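/- Let X be a smooth irreducible projective surface over an algebraically closed field of characteristic 0, let φ : X → ℙ^N (N ≥ 4) be an uncrumpled map with image Y = φ(X), let x ∈ X be a general point, and let φ̃ : X̃ → ℙ^{N−1} be the resolution to the blow-up X̃ of X at x of the inner projection from y = φ(x). Then either the ramification scheme Ram(φ̃) is finite, or Y is ruled by lines. -/

import Mathlib

/-!
Common framework: classical projective varieties over an algebraically closed
field, formalized via `Projectivization`.
-/

open MvPolynomial Module Set Filter

namespace PinchPaper

variable (k : Type) [Field k]

/-- The classical points of projective `N`-space over `k`. -/
abbrev Pr (N : ℕ) := Projectivization k (Fin (N + 1) → k)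

variable {k}

/-- A (homogeneous) polynomial vanishes at a point of projective space. -/
def Vanishes {N : ℕ} (f : MvPolynomial (Fin (N + 1)) k) (p : Pr k N) : Prop :=
  ∀ (v : Fin (N + 1) → k) (hv : v ≠ 0), Projectivization.mk k v hv = p → eval v f = 0

/-- Zariski-closed (projective algebraic) subsets of projective space: common zero
loci of families of homogeneous polynomials. -/
def IsAlgSet {N : ℕ} (Z : Set (Pr k N)) : Prop :=
  ∃ S : Set (MvPolynomial (Fin (N + 1)) k),
    (∀ f ∈ S, ∃ d, f.IsHomogeneous d) ∧ Z = {p | ∀ f ∈ S, Vanishes f p}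

/-- A projective variety: a nonempty algebraic set which is irreducible. -/
def IsVariety {N : ℕ} (Z : Set (Pr k N)) : Prop :=
  IsAlgSet Z ∧ Z.Nonempty ∧
    ∀ Z₁ Z₂ : Set (Pr k N), IsAlgSet Z₁ → IsAlgSet Z₂ → Z ⊆ Z₁ ∪ Z₂ → Z ⊆ Z₁ ∨ Z ⊆ Z₂

/-- `Z` has dimension `n`, via lengths of chains of subvarieties. -/
def HasDim {N : ℕ} (Z : Set (Pr k N)) (n : ℕ) : Prop :=
  Order.krullDim {W : Set (Pr k N) // IsVariety W ∧ W ⊆ Z} = (n : ℕ∞)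

/-- The polynomials vanishing identically on `Z` (as a `k`-submodule). -/
noncomputable def vanishingIdeal {N : ℕ} (Z : Set (Pr k N)) :
    Submodule k (MvPolynomial (Fin (N + 1)) k) :=
  ⨅ p ∈ Z, LinearMap.ker (MvPolynomial.aeval (R := k) (Projectivization.rep p)).toLinearMap

/-- The Hilbert function of the homogeneous coordinate ring of `Z`. -/
noncomputable def hilb {N : ℕ} (Z : Set (Pr k N)) (m : ℕ) : ℕ :=
  finrank k (↥(homogeneousSubmodule (Fin (N + 1)) k m) ⧸
    (Submodule.comap (homogeneousSubmodule (Fin (N + 1)) k m).subtype (vanishingIdeal Z)))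

/-- `Z` (of dimension `n`) has degree `d`: the Hilbert polynomial of `Z` has degree `n`
and leading coefficient `d / n!`. -/
def HasDegree {N : ℕ} (Z : Set (Pr k N)) (n d : ℕ) : Prop :=
  ∃ P : Polynomial ℚ, P.degree = (n : ℕ) ∧ P.leadingCoeff * (n.factorial : ℚ) = (d : ℚ) ∧
    ∀ᶠ m : ℕ in atTop, (hilb Z m : ℚ) = P.eval (m : ℚ)

/-- A curve `B` has (arithmetic, hence for smooth curves geometric) genus `g`:
its Hilbert polynomial is `P(m) = d·m + (1 - g)`. -/
def HasGenus {N : ℕ} (B : Set (Pr k N)) (g : ℕ) : Prop :=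
  ∃ d : ℕ, ∀ᶠ m : ℕ in atTop, (hilb B m : ℤ) = d * m + 1 - g

/-- A line in projective space: the set of points lying in a 2-dimensional linear subspace. -/
def IsLine {N : ℕ} (L : Set (Pr k N)) : Prop :=
  ∃ W : Submodule k (Fin (N + 1) → k), finrank k W = 2 ∧
    L = {p | Projectivization.submodule p ≤ W}

/-- A 2-plane in projective space. -/
def Is2Plane {N : ℕ} (L : Set (Pr k N)) : Prop :=
  ∃ W : Submodule k (Fin (N + 1) → k), finrank k W = 3 ∧
    L = {p | Projectivization.submodule p ≤ W}

/-- `Y` is non-degenerate: no nonzero linear form vanishes on it. -/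
def Nondegenerate {N : ℕ} (Y : Set (Pr k N)) : Prop :=
  ∀ f : MvPolynomial (Fin (N + 1)) k, f.IsHomogeneous 1 → (∀ p ∈ Y, Vanishes f p) → f = 0

/-- `Y` is ruled by lines: it contains infinitely many lines (equivalently, its Fano
scheme of lines is positive-dimensional). -/
def RuledByLines {N : ℕ} (Y : Set (Pr k N)) : Prop :=
  {L : Set (Pr k N) | IsLine L ∧ L ⊆ Y}.Infinite

/-- The differential of `f` at `v`, as a linear functional. -/
noncomputable def diffAt {N : ℕ} (f : MvPolynomial (Fin (N + 1)) k) (v : Fin (N + 1) → k) :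
    (Fin (N + 1) → k) →ₗ[k] k :=
  ∑ j, eval v (pderiv j f) • (LinearMap.proj j : (Fin (N + 1) → k) →ₗ[k] k)

/-- The affine cone over the embedded Zariski tangent space of `Z` at `p`. -/
noncomputable def embTangent {N : ℕ} (Z : Set (Pr k N)) (p : Pr k N) :
    Submodule k (Fin (N + 1) → k) :=
  ⨅ f ∈ {f : MvPolynomial (Fin (N + 1)) k |
      (∃ d, f.IsHomogeneous d) ∧ ∀ q ∈ Z, Vanishes f q},
    LinearMap.ker (diffAt f (Projectivization.rep p))

/-- A smooth projective surface (embedded in some projective space). -/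
def IsSmoothSurface {N : ℕ} (Z : Set (Pr k N)) : Prop :=
  IsVariety Z ∧ HasDim Z 2 ∧ ∀ p ∈ Z, finrank k (embTangent Z p) = 3

/-- A smooth projective curve. -/
def IsSmoothCurve {N : ℕ} (Z : Set (Pr k N)) : Prop :=
  IsVariety Z ∧ HasDim Z 1 ∧ ∀ p ∈ Z, finrank k (embTangent Z p) = 2

/-- `F` is a local homogeneous representation of `φ` near `p ∈ X`. -/
def LocalRep {M N : ℕ} (X : Set (Pr k M)) (φ : Pr k M → Pr k N) (p : Pr k M)
    (F : Fin (N + 1) → MvPolynomial (Fin (M + 1)) k) : Prop :=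
  (∃ d, ∀ i, (F i).IsHomogeneous d) ∧
  (fun i => eval (Projectivization.rep p) (F i)) ≠ 0 ∧
  ∀ q ∈ X, ∀ (v : Fin (M + 1) → k) (hv : v ≠ 0), Projectivization.mk k v hv = q →
    ∀ hFv : (fun i => eval v (F i)) ≠ 0,
      φ q = Projectivization.mk k (fun i => eval v (F i)) hFv

/-- `φ` is a morphism on the projective set `X`: locally given by homogeneous polynomials. -/
def IsMorphismOn {M N : ℕ} (X : Set (Pr k M)) (φ : Pr k M → Pr k N) : Prop :=
  ∀ p ∈ X, ∃ F, LocalRep X φ p F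

/-- The Jacobian of a tuple of polynomials at `v`, as a linear map. -/
noncomputable def jacobian {M N : ℕ} (F : Fin (N + 1) → MvPolynomial (Fin (M + 1)) k)
    (v : Fin (M + 1) → k) : (Fin (M + 1) → k) →ₗ[k] (Fin (N + 1) → k) :=
  Matrix.mulVecLin (Matrix.of fun i j => eval v (pderiv j (F i)))

/-- `φ` (defined on the surface `X`) is ramified at `p`: its differential has rank ≤ 1,
i.e. the image of the affine tangent cone has rank ≤ 2. -/
def RamifiedAt {M N : ℕ} (X : Set (Pr k M)) (φ : Pr k M → Pr k N) (p : Pr k M) : Prop :=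
  ∀ F, LocalRep X φ p F →
    finrank k ((embTangent X p).map (jacobian F (Projectivization.rep p))) ≤ 2

/-- The ramification locus of `φ` on `X`. -/
def RamLocus {M N : ℕ} (X : Set (Pr k M)) (φ : Pr k M → Pr k N) : Set (Pr k M) :=
  {p | p ∈ X ∧ RamifiedAt X φ p}

/-- `φ` is unramified at `p` (injective differential on Zariski tangent spaces). -/
def UnramifiedAt {M N : ℕ} (X : Set (Pr k M)) (φ : Pr k M → Pr k N) (p : Pr k M) : Prop :=
  ∀ F, LocalRep X φ p F → ∀ w ∈ embTangent X p,
    jacobian F (Projectivization.rep p) w ∈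
      Submodule.span k {(fun i => eval (Projectivization.rep p) (F i))} →
    w ∈ Submodule.span k {Projectivization.rep p}

/-- `φ` is a closed embedding on `X`: injective, closed image, unramified, and the
embedded tangent spaces of the image match those of `X`. -/
def IsClosedEmbeddingOn {M N : ℕ} (X : Set (Pr k M)) (φ : Pr k M → Pr k N) : Prop :=
  InjOn φ X ∧ IsAlgSet (φ '' X) ∧ (∀ p ∈ X, UnramifiedAt X φ p) ∧
    ∀ p ∈ X, finrank k (embTangent (φ '' X) (φ p)) = finrank k (embTangent X p)

/-- `φ` is generically injective on `X` (i.e. birational onto its image). -/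
def GenericallyInjectiveOn {M N : ℕ} (X : Set (Pr k M)) (φ : Pr k M → Pr k N) : Prop :=
  ∃ Z : Set (Pr k M), IsAlgSet Z ∧ ¬ X ⊆ Z ∧ InjOn φ (X \ Z)

/-- An uncrumpled map: a morphism with non-degenerate image, birational onto its
image, with finite ramification locus. -/
def Uncrumpled {M N : ℕ} (X : Set (Pr k M)) (φ : Pr k M → Pr k N) : Prop :=
  IsMorphismOn X φ ∧ Nondegenerate (φ '' X) ∧ GenericallyInjectiveOn X φ ∧
    (RamLocus X φ).Finite

/-- The ramification locus of the composite of `φ` with the linear projection given by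
the matrix `L`; ramification means the image of the affine tangent cone has rank ≤ `r`. -/
def ProjRamLocus {M N T : ℕ} (X : Set (Pr k M)) (φ : Pr k M → Pr k N)
    (L : Matrix (Fin T) (Fin (N + 1)) k) (r : ℕ) : Set (Pr k M) :=
  {p | p ∈ X ∧ ∀ F, LocalRep X φ p F →
    finrank k ((embTangent X p).map
      ((Matrix.mulVecLin L).comp (jacobian F (Projectivization.rep p)))) ≤ r}

/-- A property holds for a general matrix: it holds on a nonempty Zariski-open set. -/
def ForGenericMatrix {a b : ℕ} (P : Matrix (Fin a) (Fin b) k → Prop) : Prop :=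
  ∃ G : MvPolynomial (Fin a × Fin b) k, G ≠ 0 ∧
    ∀ L : Matrix (Fin a) (Fin b) k, eval (fun ij => L ij.1 ij.2) G ≠ 0 → P L

/-- A property holds for a general vector. -/
def ForGenericVector {b : ℕ} (P : (Fin b → k) → Prop) : Prop :=
  ∃ G : MvPolynomial (Fin b) k, G ≠ 0 ∧ ∀ a : Fin b → k, eval a G ≠ 0 → P a

/-- A property holds for a general point of `X`: it holds away from a proper closed subset. -/
def ForGeneralPointOn {M : ℕ} (X : Set (Pr k M)) (P : Pr k M → Prop) : Prop :=
  ∃ Z : Set (Pr k M), IsAlgSet Z ∧ ¬ X ⊆ Z ∧ ∀ x ∈ X \ Z, P x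

/-- The pinch point scheme length: `𝔓(φ) = n` iff the composition of `φ` with a general
linear projection to `ℙ³` has exactly `n` pinch (ramification) points.  (By
[Eisenbud–Harris, 12.6] this equals `deg (6ζ² + 4ζK + K² − c₂)`.) -/
def HasPinch {M N : ℕ} (X : Set (Pr k M)) (φ : Pr k M → Pr k N) (n : ℕ) : Prop :=
  ForGenericMatrix (fun L : Matrix (Fin 4) (Fin (N + 1)) k =>
    (∀ p ∈ X, L.mulVec (Projectivization.rep (φ p)) ≠ 0) ∧
    (ProjRamLocus X φ L 2).ncard = n ∧ (ProjRamLocus X φ L 2).Finite)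

/-- A rational normal scroll in `ℙ^N`: a smooth non-degenerate surface of minimal
degree `N − 1` which is ruled by lines. -/
def IsRationalNormalScroll {N : ℕ} (Y : Set (Pr k N)) : Prop :=
  IsSmoothSurface Y ∧ Nondegenerate Y ∧ RuledByLines Y ∧ HasDegree Y 2 (N - 1)

/-- The exceptional fiber of `β` over `x`. -/
def ExcFiber {M' M : ℕ} (Xt : Set (Pr k M')) (β : Pr k M' → Pr k M) (x : Pr k M) :
    Set (Pr k M') := {q | q ∈ Xt ∧ β q = x}

/-- `β : X̃ → X` is the blow-up of the surface `X` at the (smooth) point `x`: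
a birational morphism which is an isomorphism away from `x`, whose fiber over `x`
is an irreducible curve, smooth along that fiber. -/
def IsBlowupAt {M' M : ℕ} (Xt : Set (Pr k M')) (X : Set (Pr k M))
    (β : Pr k M' → Pr k M) (x : Pr k M) : Prop :=
  x ∈ X ∧ IsVariety Xt ∧ HasDim Xt 2 ∧ IsMorphismOn Xt β ∧ β '' Xt = X ∧
    InjOn β {q | q ∈ Xt ∧ β q ≠ x} ∧
    IsVariety (ExcFiber Xt β x) ∧ HasDim (ExcFiber Xt β x) 1 ∧
    ∀ q ∈ ExcFiber Xt β x, finrank k (embTangent Xt q) = 3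

/-- `φ̃ : X̃ → ℙ^{N'}` resolves the inner projection of `φ : X → ℙ^N` from `y = φ x`
(via the blow-up `β : X̃ → X` and with projection given by a linear map `L` whose
kernel is the line of `y`). -/
def ResolvesInnerProj {M M' N N' : ℕ} (X : Set (Pr k M)) (φ : Pr k M → Pr k N)
    (x : Pr k M) (Xt : Set (Pr k M')) (β : Pr k M' → Pr k M)
    (φt : Pr k M' → Pr k N') (L : (Fin (N + 1) → k) →ₗ[k] (Fin (N' + 1) → k)) : Prop :=
  IsMorphismOn Xt φt ∧ LinearMap.ker L = Projectivization.submodule (φ x) ∧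
    ∀ q ∈ Xt, β q ≠ x → ∀ (v : Fin (N + 1) → k) (hv : v ≠ 0),
      Projectivization.mk k v hv = φ (β q) → ∀ hLv : L v ≠ 0,
        φt q = Projectivization.mk k (L v) hLv

/-- The standard quadratic (Veronese) monomials. -/
def veroneseVec (v : Fin 3 → k) : Fin 6 → k :=
  ![v 0 * v 0, v 0 * v 1, v 0 * v 2, v 1 * v 1, v 1 * v 2, v 2 * v 2]

/-- The image of the Veronese embedding `ℙ² → ℙ⁵`. -/
def veroneseImage (k : Type) [Field k] : Set (Pr k 5) :=
  {p | ∃ (v : Fin 3 → k) (hv : veroneseVec v ≠ 0), p = Projectivization.mk k (veroneseVec v) hv}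

/-- `Y` is (projectively equivalent to) the Veronese surface in `ℙ⁵`
(the existence of the linear isomorphism forces `N = 5`). -/
def IsVeroneseSurface {N : ℕ} (Y : Set (Pr k N)) : Prop :=
  ∃ σ : (Fin 6 → k) ≃ₗ[k] (Fin (N + 1) → k),
    Y = Projectivization.map σ.toLinearMap σ.injective '' veroneseImage k

/-- `Y ⊂ ℙ^N` is linearly normal: it is not an isomorphic linear projection of a
non-degenerate variety in `ℙ^{N+1}`. -/
def LinearlyNormal {N : ℕ} (Y : Set (Pr k N)) : Prop :=
  ¬ ∃ (Y' : Set (Pr k (N + 1))) (π : Pr k (N + 1) → Pr k N)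
      (L : (Fin (N + 1 + 1) → k) →ₗ[k] (Fin (N + 1) → k)),
      IsVariety Y' ∧ Nondegenerate Y' ∧
      (∀ q ∈ Y', ∀ (v : Fin (N + 1 + 1) → k) (hv : v ≠ 0),
        Projectivization.mk k v hv = q →
          ∃ hLv : L v ≠ 0, π q = Projectivization.mk k (L v) hLv) ∧
      π '' Y' = Y ∧ InjOn π Y' ∧
      ∀ q ∈ Y', Disjoint (LinearMap.ker L) (embTangent Y' q)

/-- A del Pezzo surface of degree `d` in `ℙ^N`: a smooth non-degenerate linearly normal
surface of degree `d` (for `d = N` this characterizes anticanonically embedded del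
Pezzo surfaces). -/
def IsDelPezzoOfDegree {N : ℕ} (Y : Set (Pr k N)) (d : ℕ) : Prop :=
  IsSmoothSurface Y ∧ Nondegenerate Y ∧ LinearlyNormal Y ∧ HasDegree Y 2 d

/-- `F` is isomorphic to `ℙ¹` (as a projective variety). -/
def IsIsoToP1 {M : ℕ} (F : Set (Pr k M)) : Prop :=
  ∃ ψ : Pr k 1 → Pr k M, IsMorphismOn Set.univ ψ ∧ Set.BijOn ψ Set.univ F ∧
    ∃ ψ' : Pr k M → Pr k 1, IsMorphismOn F ψ' ∧ ∀ t, ψ' (ψ t) = t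

/-- `ρ : X → B` exhibits `X` as a `ℙ¹`-bundle over the curve `B`
(all fibers are isomorphic to `ℙ¹`). -/
def IsP1Bundle {M m : ℕ} (X : Set (Pr k M)) (B : Set (Pr k m))
    (ρ : Pr k M → Pr k m) : Prop :=
  IsMorphismOn X ρ ∧ ρ '' X = B ∧ ∀ b ∈ B, IsIsoToP1 {p | p ∈ X ∧ ρ p = b}

/-- The hyperplane cut out by the linear form with coefficients `a`. -/
def hyperplaneOf {N : ℕ} (a : Fin (N + 1) → k) : Set (Pr k N) :=
  {p | Vanishes (∑ i, MvPolynomial.C (a i) * MvPolynomial.X i) p}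

/-- A rational normal curve of degree `N` in `ℙ^N`: a non-degenerate curve of degree `N`. -/
def IsRationalNormalCurve {N : ℕ} (C : Set (Pr k N)) : Prop :=
  IsVariety C ∧ HasDim C 1 ∧ Nondegenerate C ∧ HasDegree C 1 N

/-- The Gauss degree `γ₁` of an embedded curve `X ⊂ ℙ^N`: the number of ramification
points of a general linear projection `X → ℙ¹`. -/
def HasGaussDegree {N : ℕ} (X : Set (Pr k N)) (γ : ℕ) : Prop :=
  ForGenericMatrix (fun L : Matrix (Fin 2) (Fin (N + 1)) k =>
    (∀ p ∈ X, L.mulVec (Projectivization.rep p) ≠ 0) ∧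
    (ProjRamLocus X id L 1).ncard = γ ∧ (ProjRamLocus X id L 1).Finite)

end PinchPaper

namespace PinchPaper

section

theorem exists_point_of_field_point {k : Type} [Field k] [IsAlgClosed k] {K : Type*} [Field K]
    [Algebra k K] {σ : Type*} [Finite σ] (a : σ → K) (g : MvPolynomial σ k)
    (hg : aeval a g ≠ 0) :
    ∃ e : σ → k, eval e g ≠ 0 ∧ ∀ f : MvPolynomial σ k, aeval a f = 0 → eval e f = 0 := by
  let I : Ideal (MvPolynomial σ k) := RingHom.ker (aeval (R := k) a)
  have hI : I.IsPrime := RingHom.ker_isPrime _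
  have h1 : g ∉ MvPolynomial.vanishingIdeal k (zeroLocus k I) := by
    rw [IsPrime.vanishingIdeal_zeroLocus]
    exact hg
  rw [mem_vanishingIdeal_iff] at h1
  push Not at h1
  obtain ⟨e, he, hge⟩ := h1
  refine ⟨e, by simpa [aeval_eq_eval] using hge, fun f hf => ?_⟩
  simpa [aeval_eq_eval] using he f hf

open TrivSqZeroExt in
theorem exists_derivation_ne_zero {F L : Type*} [Field F] [Field L] [CharZero F] [Algebra F L]
    {c : L} (hc : Transcendental F c) : ∃ D : Derivation F L L, D c ≠ 0 := by
  let _ : Algebra (Polynomial F) L := (Polynomial.aeval (R := F) c).toAlgebra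
  have hAL : ∀ p : Polynomial F, algebraMap (Polynomial F) L p = Polynomial.aeval c p :=
    fun _ => rfl
  have hinj : Function.Injective (algebraMap (Polynomial F) L) :=
    (transcendental_iff_injective.mp hc)
  have : FaithfulSMul (Polynomial F) L := (faithfulSMul_iff_algebraMap_injective _ _).mpr hinj
  let _ : Algebra (FractionRing (Polynomial F)) L := FractionRing.liftAlgebra _ _
  have : IsScalarTower (Polynomial F) (FractionRing (Polynomial F)) L :=
    FractionRing.isScalarTower_liftAlgebra _ _
  have : CharZero (Polynomial F) := inferInstance
  have : CharZero (FractionRing (Polynomial F)) :=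
    charZero_of_injective_algebraMap
      (FaithfulSMul.algebraMap_injective (Polynomial F) (FractionRing (Polynomial F)))
  have : Algebra.FormallySmooth (Polynomial F) (FractionRing (Polynomial F)) :=
    .of_isLocalization (nonZeroDivisors _)
  obtain ⟨s, hs⟩ := exists_isTranscendenceBasis (FractionRing (Polynomial F)) L
  have : Algebra.IsAlgebraic (IntermediateField.adjoin (FractionRing (Polynomial F))
    (Set.range ((↑) : s → L))) L := hs.isAlgebraic_field
  have : Algebra.FormallySmooth (FractionRing (Polynomial F)) L :=
    .of_algebraicIndependent_of_isSeparable hs.1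
  have : Algebra.FormallySmooth (Polynomial F) L := .comp _ (FractionRing (Polynomial F)) _
  let ψ : Polynomial F →ₐ[F] TrivSqZeroExt L L := Polynomial.aeval (inl c + inr 1)
  let _ : Algebra (Polynomial F) (TrivSqZeroExt L L) := ψ.toRingHom.toAlgebra
  have hψ : ∀ p : Polynomial F, algebraMap (Polynomial F) (TrivSqZeroExt L L) p = ψ p :=
    fun _ => rfl
  let g : TrivSqZeroExt L L →ₐ[Polynomial F] L :=
    { (fstHom F L L).toRingHom with
      commutes' := by
        intro p
        change fstHom F L L (ψ p) = Polynomial.aeval c p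
        have : (fstHom F L L).comp ψ = Polynomial.aeval c := by
          ext; simp [ψ]
        exact DFunLike.congr_fun this p }
  have hg : Function.Surjective g := fst_surjective
  have hker : IsNilpotent (RingHom.ker (g : TrivSqZeroExt L L →+* L)) := by
    refine ⟨2, ?_⟩
    have h : RingHom.ker (g : TrivSqZeroExt L L →+* L) *
        RingHom.ker (g : TrivSqZeroExt L L →+* L) ≤ ⊥ := by
      refine Ideal.mul_le.mpr fun x hx y hy => ?_
      have hx' : x.fst = 0 := hx
      have hy' : y.fst = 0 := hy
      rw [Ideal.mem_bot]
      ext <;> simp [hx', hy']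
    have h' := le_bot_iff.mp h
    rw [← Submodule.zero_eq_bot] at h'
    rw [← h']
    exact pow_two (RingHom.ker (g : TrivSqZeroExt L L →+* L))
  let l := Algebra.FormallySmooth.liftOfSurjective (AlgHom.id (Polynomial F) L) g hg hker
  have hl : ∀ x, (l x).fst = x := fun x =>
    Algebra.FormallySmooth.liftOfSurjective_apply (AlgHom.id (Polynomial F) L) g hg hker x
  have hF : ∀ r : F, l (algebraMap F L r) = inl (algebraMap F L r) := by
    intro r
    have h1 : algebraMap F L r = algebraMap (Polynomial F) L (Polynomial.C r) := by
      simp [hAL]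
    rw [h1, l.commutes, hψ, ← h1]
    simp [ψ]; rfl
  refine ⟨Derivation.mk' (D := { toFun := fun x => (l x).snd
                                 map_add' := fun x y => by simp
                                 map_smul' := fun r x => by
                                    simp [Algebra.smul_def, hF] }) ?_, ?_⟩
  · intro a b
    simp [hl, mul_comm]
  · have h1 : c = algebraMap (Polynomial F) L Polynomial.X := by simp [hAL]
    have : l c = inl c + inr 1 := by
      conv_lhs => rw [h1]
      rw [l.commutes, hψ]
      simp [ψ]
    simp [this]

end

section

theorem eq_zero_of_eval_eq_zero_of_const {k L : Type*} [Field k] [Field L] [CharZero L]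
    [Algebra k L] (δ : Derivation k L L) {s : L} (hs : δ s ≠ 0) (h : Polynomial L)
    (hc : ∀ m, δ (h.coeff m) = 0) (h0 : h.eval s = 0) : h = 0 := by
  have key : ∀ h : Polynomial L, (∀ m, δ (h.coeff m) = 0) →
      δ (h.eval s) = (Polynomial.derivative h).eval s * δ s := by
    intro h hc
    rw [Polynomial.eval_eq_sum_range, map_sum, Polynomial.derivative_eval,
      Polynomial.sum_over_range _ (by simp), Finset.sum_mul]
    refine Finset.sum_congr rfl fun i _ => ?_
    rw [Derivation.leibniz, hc, Derivation.leibniz_pow]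
    simp [mul_assoc]
  induction hd : h.natDegree using Nat.strong_induction_on generalizing h with
  | _ d ih =>
    have h1 : (Polynomial.derivative h).eval s = 0 := by
      have := key h hc
      rw [h0, map_zero] at this
      exact (mul_eq_zero.mp this.symm).resolve_right hs
    have h2 : Polynomial.derivative h = 0 := by
      by_contra hne
      have hlt : (Polynomial.derivative h).natDegree < h.natDegree := by
        refine Polynomial.natDegree_derivative_lt fun h0 => hne ?_
        exact Polynomial.derivative_of_natDegree_zero h0
      refine hne (ih _ (hd ▸ hlt) _ (fun m => ?_) h1 rfl)
      rw [Polynomial.coeff_derivative, Derivation.leibniz, hc]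
      have : δ ((m : L) + 1) = 0 := by
        have := δ.map_natCast (m + 1)
        push_cast at this
        exact this
      simp [this]
    have h3 := Polynomial.eq_C_of_derivative_eq_zero h2
    rw [h3] at h0 ⊢
    simp at h0
    simp [h0]

/-- A dual basis of derivations of a field of transcendence degree two. -/
structure DiffBasis (k K : Type) [Field k] [Field K] [Algebra k K] where
  z : Fin 2 → K
  D : Fin 2 → Derivation k K K
  D_z : ∀ i j, D i (z j) = if i = j then 1 else 0
  uniq : ∀ (L : Type) [Field L] [Algebra k L] [Algebra K L] [IsScalarTower k K L]
    (δ : Derivation k K L), (∀ i, δ (z i) = 0) → δ = 0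

namespace DiffBasis
variable {k K : Type} [Field k] [Field K] [Algebra k K] (B : DiffBasis k K)

theorem expand {L : Type} [Field L] [Algebra k L] [Algebra K L] [IsScalarTower k K L]
    (δ : Derivation k K L) (x : K) :
    δ x = δ (B.z 0) * algebraMap K L (B.D 0 x) + δ (B.z 1) * algebraMap K L (B.D 1 x) := by
  have := B.uniq L (δ - (δ (B.z 0) • (Algebra.linearMap K L).compDer (B.D 0) +
    δ (B.z 1) • (Algebra.linearMap K L).compDer (B.D 1))) (by
      intro i; fin_cases i <;> simp [B.D_z])
  have h := DFunLike.congr_fun this x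
  simp at h
  linear_combination h

theorem comm (x : K) (i j : Fin 2) : B.D i (B.D j x) = B.D j (B.D i x) := by
  have h := B.uniq K ⁅B.D i, B.D j⁆ (by
    intro l
    rw [Derivation.commutator_apply, B.D_z, B.D_z]
    split_ifs <;> simp)
  have := DFunLike.congr_fun h x
  rw [Derivation.commutator_apply] at this
  exact sub_eq_zero.mp this

theorem const [IsAlgClosed k] [CharZero k] {c : K} (h : ∀ i, B.D i c = 0) :
    ∃ r : k, algebraMap k K r = c := by
  by_contra hne
  have ht : Transcendental k c := by
    intro halg
    refine hne ?_
    have : Algebra.IsAlgebraic k (IntermediateField.adjoin k {c}) :=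
      IntermediateField.isAlgebraic_adjoin_simple halg.isIntegral
    have h1 := IntermediateField.eq_bot_of_isAlgClosed_of_isAlgebraic
      (IntermediateField.adjoin k {c})
    have h2 := IntermediateField.mem_adjoin_simple_self k c
    rw [h1, IntermediateField.mem_bot] at h2
    exact h2
  obtain ⟨D, hD⟩ := exists_derivation_ne_zero ht
  refine hD ?_
  rw [B.expand D c, h, h]; simp

end DiffBasis

/-- A proper subspace stable under the derivations is contained in a hyperplane defined
over the constants. -/
theorem exists_const_annihilator {k K : Type} [Field k] [IsAlgClosed k] [CharZero k] [Field K]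
    [Algebra k K] (B : DiffBasis k K) {n : ℕ} (W : Submodule K (Fin n → K)) (hW : W ≠ ⊤)
    (hst : ∀ w ∈ W, ∀ i, (fun l => B.D i (w l)) ∈ W) :
    ∃ μ : Fin n → k, μ ≠ 0 ∧ ∀ w ∈ W, ∑ l, algebraMap k K (μ l) * w l = 0 := by
  classical
  let P : (Fin n → K) → Prop := fun μ => μ ≠ 0 ∧ ∀ w ∈ W, ∑ l, μ l * w l = 0
  have hex : ∃ m, ∃ μ, P μ ∧ (Finset.univ.filter fun l => μ l ≠ 0).card = m := by
    obtain ⟨f, hf, hfW⟩ := Submodule.exists_le_ker_of_lt_top W (lt_top_iff_ne_top.mpr hW)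
    refine ⟨_, fun l => f (Pi.single l 1), ⟨?_, fun w hw => ?_⟩, rfl⟩
    · intro h0
      refine hf (LinearMap.pi_ext' fun l => ?_)
      exact LinearMap.ext_ring (by simpa using congr_fun h0 l)
    · have := hfW hw
      rw [LinearMap.mem_ker, LinearMap.pi_apply_eq_sum_univ f w] at this
      rw [← this]
      exact Finset.sum_congr rfl fun l _ => by
        have : (fun j => if l = j then (1 : K) else 0) = Pi.single l 1 := by
          funext j; simp [Pi.single_apply, eq_comm]
        rw [smul_eq_mul, mul_comm, this]
  obtain ⟨μ0, ⟨hμ0, hμ0W⟩, hcard⟩ := Nat.find_spec hex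
  have hmin := fun m => Nat.find_min hex (m := m)
  obtain ⟨l0, hl0⟩ := Function.ne_iff.mp hμ0
  simp only [Pi.zero_apply] at hl0
  let μ : Fin n → K := fun l => (μ0 l0)⁻¹ * μ0 l
  have hμ1 : μ l0 = 1 := inv_mul_cancel₀ hl0
  have hμW : ∀ w ∈ W, ∑ l, μ l * w l = 0 := by
    intro w hw
    simp only [μ, mul_assoc, ← Finset.mul_sum, hμ0W w hw, mul_zero]
  have hD : ∀ i l, B.D i (μ l) = 0 := by
    intro i
    by_contra hne
    push Not at hne
    obtain ⟨l1, hl1⟩ := hne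
    refine hmin _ ?_ ⟨fun l => B.D i (μ l), ⟨fun h => hl1 (congr_fun h l1), fun w hw => ?_⟩, rfl⟩
    · rw [← hcard]
      refine Finset.card_lt_card (Finset.ssubset_iff_of_subset ?_ |>.mpr ⟨l0, ?_, ?_⟩)
      · intro l hl
        simp only [Finset.mem_filter, Finset.mem_univ, true_and] at hl ⊢
        intro h0; apply hl; simp [μ, h0]
      · simpa using hl0
      · simp [hμ1]
    · have h1 := congr_arg (B.D i) (hμW w hw)
      have h2 := hμW _ (hst w hw i)
      simp only [map_sum, Derivation.leibniz, smul_eq_mul, map_zero, Finset.sum_add_distrib] at h1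
      rw [h2, zero_add] at h1
      rw [← h1]
      exact Finset.sum_congr rfl fun l _ => mul_comm _ _
  choose r hr using fun l => B.const (fun i => hD i l)
  refine ⟨r, fun h0 => ?_, fun w hw => by simpa [hr] using hμW w hw⟩
  have := hr l0
  rw [h0, hμ1] at this
  simp at this

end

section

/-- A one-parameter family of lines satisfying the equations in `S`. -/
def HasLineFamily (k : Type) [Field k] {n : ℕ} (S : Set (MvPolynomial (Fin n) k)) : Prop :=
  ∃ (L : Type) (_ : Field L) (_ : Algebra k L) (w₀ w₁ : Fin n → L) (i j : Fin n),
    w₀ i = 1 ∧ w₀ j = 0 ∧ w₁ i = 0 ∧ w₁ j = 1 ∧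
    (∃ l, w₀ l ∉ range (algebraMap k L) ∨ w₁ l ∉ range (algebraMap k L)) ∧
    ∀ f ∈ S, aeval (fun l => Polynomial.C (w₀ l) + Polynomial.X * Polynomial.C (w₁ l)) f = 0

/-- The coordinates of `η` are linearly independent over the constants. -/
def ConstIndep (k : Type) [Field k] {L : Type} [Field L] [Algebra k L] {n : ℕ}
    (η : Fin n → L) : Prop :=
  ∀ μ : Fin n → k, ∑ l, algebraMap k L (μ l) * η l = 0 → μ = 0

theorem algHom_aeval {k : Type*} [CommSemiring k] {A B : Type*} [CommSemiring A]
    [CommSemiring B] [Algebra k A] [Algebra k B] {σ : Type*} (φ : A →ₐ[k] B) (v : σ → A)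
    (f : MvPolynomial σ k) : φ (aeval v f) = aeval (fun i => φ (v i)) f :=
  DFunLike.congr_fun (MvPolynomial.comp_aeval v φ) f

theorem aeval_smul_of_isHomogeneous {k : Type} [CommSemiring k] {R : Type*} [CommSemiring R]
    [Algebra k R] {σ : Type*} {f : MvPolynomial σ k} {d : ℕ} (hf : f.IsHomogeneous d) (c : R)
    (v : σ → R) : aeval (fun l => c * v l) f = c ^ d * aeval v f := by
  rw [aeval_def, aeval_def, eval₂_eq, eval₂_eq, Finset.mul_sum]
  refine Finset.sum_congr rfl fun m hm => ?_
  have hd : m.degree = d := by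
    by_contra h
    exact (mem_support_iff.mp hm) (hf.coeff_eq_zero h)
  simp only [mul_pow, Finset.prod_mul_distrib]
  rw [Finset.prod_pow_eq_pow_sum]
  have : ∑ i ∈ m.support, m i = d := hd
  rw [this]; ring

theorem hasLineFamily_of_derivation {k L : Type} [Field k] [Field L] [CharZero L] [Algebra k L]
    {n : ℕ} (hn : 3 ≤ n) (δ : Derivation k L L) (P : Fin n → L) (hP : ConstIndep k P)
    (hind : ∀ ρ : L, (fun l => δ (P l)) ≠ fun l => ρ * P l) (a b : L)
    (hab : ∀ l, δ (δ (P l)) = a * P l + b * δ (P l))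
    (S : Set (MvPolynomial (Fin n) k))
    (hS : ∀ f ∈ S, (∃ d, f.IsHomogeneous d) ∧ aeval P f = 0) : HasLineFamily k S := by
  classical
  have hP0 : ∀ i, P i ≠ 0 := by
    intro i h0
    have := hP (Pi.single i 1) (by
      rw [Finset.sum_eq_single i] <;> simp +contextual [h0])
    have := congr_fun this i
    simp at this
  let i : Fin n := ⟨0, by omega⟩
  obtain ⟨j, hj⟩ : ∃ j, P i * δ (P j) - P j * δ (P i) ≠ 0 := by
    by_contra hne
    push Not at hne
    refine hind (δ (P i) / P i) (funext fun l => ?_)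
    have h := hne l
    have := hP0 i
    field_simp
    linear_combination h
  set Δ := P i * δ (P j) - P j * δ (P i) with hΔ
  let w₀ : Fin n → L := fun l => (δ (P j) * P l - P j * δ (P l)) / Δ
  let w₁ : Fin n → L := fun l => (P i * δ (P l) - δ (P i) * P l) / Δ
  have hsum : ∀ l, P l = P i * w₀ l + P j * w₁ l := by
    intro l
    simp only [w₀, w₁]
    field_simp
    rw [hΔ]; ring
  have hsum' : ∀ l, δ (P l) = δ (P i) * w₀ l + δ (P j) * w₁ l := by
    intro l
    simp only [w₀, w₁]
    field_simp
    rw [hΔ]; ring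
  have hw0i : w₀ i = 1 := by
    simp only [w₀]; rw [div_eq_one_iff_eq hj, hΔ]; ring
  have hw0j : w₀ j = 0 := by
    simp only [w₀]; rw [div_eq_zero_iff]; left; ring
  have hw1i : w₁ i = 0 := by
    simp only [w₁]; rw [div_eq_zero_iff]; left; ring
  have hw1j : w₁ j = 1 := by
    simp only [w₁]; rw [div_eq_one_iff_eq hj, hΔ]; ring
  have e1 : ∀ l, P i * δ (w₀ l) + P j * δ (w₁ l) = 0 := by
    intro l
    have h := congr_arg δ (hsum l)
    rw [hsum' l] at h
    simp only [map_add, Derivation.leibniz, smul_eq_mul] at h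
    linear_combination -h
  have e2 : ∀ l, δ (P i) * δ (w₀ l) + δ (P j) * δ (w₁ l) = 0 := by
    intro l
    have h := congr_arg δ (hsum' l)
    simp only [map_add, Derivation.leibniz, smul_eq_mul, hab] at h
    linear_combination -h + a * hsum l + b * hsum' l
  have hδ1 : ∀ l, δ (w₁ l) = 0 := by
    intro l
    have : Δ * δ (w₁ l) = 0 := by rw [hΔ]; linear_combination P i * e2 l - δ (P i) * e1 l
    exact (mul_eq_zero.mp this).resolve_left hj
  have hδ0 : ∀ l, δ (w₀ l) = 0 := by
    intro l
    have h := e1 l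
    rw [hδ1, mul_zero, add_zero] at h
    exact (mul_eq_zero.mp h).resolve_left (hP0 i)
  let s := P j / P i
  have hs : δ s ≠ 0 := by
    intro h0
    have h1 : s * P i = P j := div_mul_cancel₀ _ (hP0 i)
    have h2 := congr_arg δ h1
    rw [Derivation.leibniz, h0] at h2
    apply hj
    rw [hΔ, ← h2, ← h1]
    simp; ring
  refine ⟨L, inferInstance, inferInstance, w₀, w₁, i, j, hw0i, hw0j, hw1i, hw1j, ?_, ?_⟩
  · by_contra hne
    push Not at hne
    choose r0 hr0 using fun l => (hne l).1
    choose r1 hr1 using fun l => (hne l).2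
    obtain ⟨l, hli, hlj⟩ : ∃ l : Fin n, l ≠ i ∧ l ≠ j := by
      have : ({i, j} : Finset (Fin n)).card < (Finset.univ : Finset (Fin n)).card := by
        refine lt_of_le_of_lt Finset.card_le_two ?_
        simp; omega
      obtain ⟨l, -, hl⟩ := Finset.exists_mem_notMem_of_card_lt_card this
      simp at hl
      exact ⟨l, hl.1, hl.2⟩
    have hij : i ≠ j := by
      rintro h; rw [← h, hw0i] at hw0j; exact one_ne_zero hw0j
    have := hP (Pi.single l 1 - Pi.single i (r0 l) - Pi.single j (r1 l)) (by
      simp only [Pi.sub_apply, map_sub, sub_mul, Finset.sum_sub_distrib]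
      rw [Finset.sum_eq_single l, Finset.sum_eq_single i, Finset.sum_eq_single j]
      · simp only [Pi.single_eq_same, map_one, hr0, hr1, one_mul]
        rw [hsum l]; ring
      all_goals simp +contextual)
    have := congr_fun this l
    simp [hli, hlj] at this
  · intro f hf
    obtain ⟨⟨d, hd⟩, hf0⟩ := hS f hf
    refine eq_zero_of_eval_eq_zero_of_const δ hs _ (fun m => ?_) ?_
    · let R : Subalgebra k L :=
        { carrier := {x | δ x = 0}
          mul_mem' := fun {x y} hx hy => by
            simp only [mem_ofPred_eq] at hx hy ⊢; simp [hx, hy]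
          add_mem' := fun {x y} hx hy => by
            simp only [mem_ofPred_eq] at hx hy ⊢; simp [hx, hy]
          algebraMap_mem' := fun r => by simp }
      let w : Fin n → Polynomial R := fun l => Polynomial.C ⟨w₀ l, hδ0 l⟩ +
        Polynomial.X * Polynomial.C ⟨w₁ l, hδ1 l⟩
      have : aeval (fun l => Polynomial.C (w₀ l) + Polynomial.X * Polynomial.C (w₁ l)) f =
          Polynomial.mapAlgHom R.val (aeval w f) := by
        rw [algHom_aeval]
        congr 2
        funext l
        simp [w]
      rw [this]
      change δ (Polynomial.coeff (Polynomial.map R.val.toRingHom (aeval w f)) m) = 0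
      have h := ((aeval w f).coeff m).2
      rw [Polynomial.coeff_map]
      exact h
    · have h1 : Polynomial.eval s
          (aeval (fun l => Polynomial.C (w₀ l) + Polynomial.X * Polynomial.C (w₁ l)) f) =
          aeval (fun l => w₀ l + s * w₁ l) f := by
        have h := algHom_aeval ((Polynomial.aeval (R := L) s).restrictScalars k)
          (fun l => Polynomial.C (w₀ l) + Polynomial.X * Polynomial.C (w₁ l)) f
        simpa [Polynomial.coe_aeval_eq_eval, mul_comm s] using h
      rw [h1]
      have h2 : P = fun l => P i * (w₀ l + s * w₁ l) := by
        funext l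
        rw [hsum l]
        simp only [s]
        have := hP0 i
        field_simp
      rw [h2, aeval_smul_of_isHomogeneous hd] at hf0
      exact (mul_eq_zero.mp hf0).resolve_left (pow_ne_zero _ (hP0 i))

end

section

theorem exists_dual_family {K : Type*} [Field K] {n m : ℕ} (v : Fin m → Fin n → K)
    (hv : LinearIndependent K v) :
    ∃ μ : Fin m → Fin n → K, ∀ i j, ∑ l, μ i l * v j l = if i = j then 1 else 0 := by
  classical
  obtain ⟨g, hg⟩ := (Fintype.linearCombination K v).exists_leftInverse_of_injective
    (LinearMap.ker_eq_bot.mpr hv.fintypeLinearCombination_injective)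
  refine ⟨fun i l => g (Pi.single l 1) i, fun i j => ?_⟩
  have h1 : g (v j) = Pi.single j 1 := by
    have := DFunLike.congr_fun hg (Pi.single j 1)
    simpa using this
  have h2 : g (v j) = ∑ l, v j l • g (Pi.single l 1) := by
    conv_lhs => rw [pi_eq_sum_univ' (v j)]
    simp
  have h3 := congr_fun (h1.symm.trans h2) i
  rw [Finset.sum_apply] at h3
  simp only [Pi.smul_apply, smul_eq_mul] at h3
  rw [Finset.sum_congr rfl fun l _ => mul_comm _ _, ← h3]
  simp [Pi.single_apply]

/-- If every functional killing `V` kills `w` then `w ∈ V`. -/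
theorem mem_of_forall_dot {K : Type*} [Field K] {n : ℕ} (V : Submodule K (Fin n → K))
    (w : Fin n → K)
    (h : ∀ μ : Fin n → K, (∀ v ∈ V, ∑ l, μ l * v l = 0) → ∑ l, μ l * w l = 0) : w ∈ V := by
  classical
  by_contra hw
  obtain ⟨f, hf, hfV⟩ := Submodule.exists_le_ker_of_notMem hw
  have hf' : ∀ v, f v = ∑ l, f (Pi.single l 1) * v l := by
    intro v
    conv_lhs => rw [pi_eq_sum_univ' v]
    simp [mul_comm]
  refine hf ?_
  rw [hf']
  refine h _ fun v hv => ?_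
  rw [← hf']
  exact hfV hv

section Second
variable {k K : Type} [Field k] [IsAlgClosed k] [CharZero k] [Field K] [CharZero K] [Algebra k K]

/-- Apply a derivation coordinatewise. -/
def dvec {L : Type} [Field L] [Algebra k L] {n : ℕ} (δ : Derivation k L L) (w : Fin n → L) :
    Fin n → L := fun l => δ (w l)

/-- The span of a vector and its two partial derivatives. -/
def tangentSpan (B : DiffBasis k K) {n : ℕ} (η : Fin n → K) : Submodule K (Fin n → K) :=
  Submodule.span K {η, dvec (B.D 0) η, dvec (B.D 1) η}

theorem dvec_add {L : Type} [Field L] [Algebra k L] {n : ℕ} (δ : Derivation k L L)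
    (v w : Fin n → L) : dvec δ (v + w) = dvec δ v + dvec δ w := by
  funext l; simp [dvec]

theorem dvec_smul {L : Type} [Field L] [Algebra k L] {n : ℕ} (δ : Derivation k L L) (c : L)
    (w : Fin n → L) : dvec δ (c • w) = c • dvec δ w + δ c • w := by
  funext l; simp [dvec, mul_comm]

theorem dvec_mem_of_span {L : Type} [Field L] [Algebra k L] {n : ℕ} (δ : Derivation k L L)
    {s : Set (Fin n → L)} {W : Submodule L (Fin n → L)} (hs : ∀ v ∈ s, dvec δ v ∈ W)
    (hsW : s ⊆ W) {w : Fin n → L} (hw : w ∈ Submodule.span L s) : dvec δ w ∈ W := by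
  induction hw using Submodule.span_induction with
  | mem x hx => exact hs x hx
  | zero =>
    have : dvec δ (0 : Fin n → L) = 0 := by funext l; simp [dvec]
    rw [this]; exact W.zero_mem
  | add x y _ _ hx hy => rw [dvec_add]; exact W.add_mem hx hy
  | smul a x hx' hx =>
    rw [dvec_smul]
    exact W.add_mem (W.smul_mem _ hx) (W.smul_mem _ (Submodule.span_le.mpr hsW hx'))

variable (B : DiffBasis k K) {n : ℕ} (η : Fin n → K)

theorem self_mem_tangentSpan : η ∈ tangentSpan B η := Submodule.subset_span (by simp)

theorem dvec_mem_tangentSpan (i : Fin 2) : dvec (B.D i) η ∈ tangentSpan B η :=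
  Submodule.subset_span (by fin_cases i <;> simp)

theorem mem_tangentSpan_iff {w : Fin n → K} : w ∈ tangentSpan B η ↔
    ∃ a b c : K, w = a • η + b • dvec (B.D 0) η + c • dvec (B.D 1) η := by
  rw [tangentSpan, Submodule.mem_span_triple]
  constructor
  · rintro ⟨a, b, c, h⟩; exact ⟨a, b, c, h.symm⟩
  · rintro ⟨a, b, c, h⟩; exact ⟨a, b, c, h.symm⟩

/-- The second partial derivatives. -/
def second (i j : Fin 2) : Fin n → K := dvec (B.D i) (dvec (B.D j) η)

theorem second_comm (i j : Fin 2) : second B η i j = second B η j i := by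
  funext l; exact B.comm _ _ _

theorem dvec_second (i j m : Fin 2) :
    dvec (B.D m) (second B η i j) = dvec (B.D i) (second B η m j) := by
  funext l; exact B.comm _ _ _

theorem finrank_tangentSpan_le : finrank K (tangentSpan B η) ≤ 3 := by
  classical
  have := finrank_span_finset_le_card (R := K)
    ({η, dvec (B.D 0) η, dvec (B.D 1) η} : Finset (Fin n → K))
  simp only [Finset.coe_insert, Finset.coe_singleton] at this
  exact this.trans Finset.card_le_three

theorem not_stable (hη : ConstIndep k η) (W : Submodule K (Fin n → K)) (hηW : η ∈ W)
    (hW : finrank K W < n) (hst : ∀ w ∈ W, ∀ i, dvec (B.D i) w ∈ W) : False := by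
  have hne : W ≠ ⊤ := by
    rintro rfl
    simp at hW
  obtain ⟨μ, hμ, h⟩ := exists_const_annihilator B W hne hst
  exact hμ (hη μ (h η hηW))

theorem hasLineFamily_of_second_rank_le_one (hn : 5 ≤ n) (hη : ConstIndep k η)
    (hind : LinearIndependent K ![η, dvec (B.D 0) η, dvec (B.D 1) η])
    (hII : ∀ μ ν : Fin n → K, (∀ v ∈ tangentSpan B η, ∑ l, μ l * v l = 0) →
      (∀ v ∈ tangentSpan B η, ∑ l, ν l * v l = 0) → ∀ i j i' j',
      (∑ l, μ l * second B η i j l) * (∑ l, ν l * second B η i' j' l) =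
      (∑ l, ν l * second B η i j l) * (∑ l, μ l * second B η i' j' l))
    (S : Set (MvPolynomial (Fin n) k))
    (hS : ∀ f ∈ S, (∃ d, f.IsHomogeneous d) ∧ aeval η f = 0) : HasLineFamily k S := by
  set V := tangentSpan B η with hV
  have hVs : ∀ (W : Submodule K (Fin n → K)), V ≤ W → (∀ i j, second B η i j ∈ W) →
      ∀ w ∈ V, ∀ i, dvec (B.D i) w ∈ W := by
    intro W hVW hW w hw i
    refine dvec_mem_of_span (B.D i) ?_ (fun v hv => hVW (Submodule.subset_span hv)) hw
    rintro v (rfl | rfl | rfl)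
    · exact hVW (dvec_mem_tangentSpan B v i)
    · exact hW i 0
    · exact hW i 1
  by_cases hall : ∀ i j, second B η i j ∈ V
  · exfalso
    refine not_stable B η hη V (self_mem_tangentSpan B η) ?_ (hVs V le_rfl hall)
    have := finrank_tangentSpan_le B η
    rw [← hV] at this
    omega
  push Not at hall
  obtain ⟨a, b, hab⟩ := hall
  obtain ⟨μ, hμV, hμ⟩ : ∃ μ : Fin n → K, (∀ v ∈ V, ∑ l, μ l * v l = 0) ∧
      ∑ l, μ l * second B η a b l ≠ 0 := by
    by_contra hne
    push Not at hne
    exact hab (mem_of_forall_dot V _ hne)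
  let q : Fin 2 → Fin 2 → K := fun i j => ∑ l, μ l * second B η i j l
  have hqab : q a b ≠ 0 := hμ
  have hqc : ∀ i j, q i j = q j i := fun i j => by simp only [q]; rw [second_comm]
  let u : Fin n → K := (q a b)⁻¹ • second B η a b
  have huV : u ∉ V := by
    intro h
    apply hab
    have := V.smul_mem (q a b) h
    simpa [u, smul_smul, hqab] using this
  have hdec : ∀ i j, second B η i j - q i j • u ∈ V := by
    intro i j
    refine mem_of_forall_dot V _ fun ν hν => ?_
    have h := hII μ ν hμV hν i j a b
    have e1 : ∑ l, ν l * (second B η i j - q i j • u) l =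
        (∑ l, ν l * second B η i j l) - q i j * (q a b)⁻¹ * ∑ l, ν l * second B η a b l := by
      rw [Finset.mul_sum, ← Finset.sum_sub_distrib]
      refine Finset.sum_congr rfl fun l _ => ?_
      simp [u]; ring
    rw [e1, sub_eq_zero]
    have h' : q i j * (∑ l, ν l * second B η a b l) = (∑ l, ν l * second B η i j l) * q a b := h
    rw [mul_right_comm, h', mul_assoc, mul_inv_cancel₀ hqab, mul_one]
  let V' := V ⊔ Submodule.span K {u}
  have hVV' : V ≤ V' := le_sup_left
  have huV' : u ∈ V' := (le_sup_right : _ ≤ V') (Submodule.mem_span_singleton_self u)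
  have hII' : ∀ i j, second B η i j ∈ V' := by
    intro i j
    have := V'.add_mem (hVV' (hdec i j)) (V'.smul_mem (q i j) huV')
    simpa using this
  have hDV : ∀ w ∈ V, ∀ i, dvec (B.D i) w ∈ V' := hVs V' hVV' hII'
  have hrel : ∀ i j m, q i j • dvec (B.D m) u - q m j • dvec (B.D i) u ∈ V' := by
    intro i j m
    have h1 : ∀ i j m, dvec (B.D m) (second B η i j) - q i j • dvec (B.D m) u ∈ V' := by
      intro i j m
      have h2 : second B η i j = (second B η i j - q i j • u) + q i j • u := by simp
      rw [h2, dvec_add, dvec_smul]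
      have := V'.add_mem (hDV _ (hdec i j) m) (V'.smul_mem (B.D m (q i j)) huV')
      convert this using 1
      abel
    have h3 := V'.sub_mem (h1 m j i) (h1 i j m)
    rw [dvec_second B η i j m] at h3
    convert h3 using 1
    abel
  by_cases hdet : q 0 0 * q 1 1 - q 0 1 * q 1 0 = 0
  · obtain ⟨α, hα0, hα⟩ : ∃ α : Fin 2 → K, α ≠ 0 ∧ ∀ j, α 0 * q 0 j + α 1 * q 1 j = 0 := by
      have hc := hqc 0 1
      by_cases h0 : q 0 0 = 0 ∧ q 0 1 = 0
      · refine ⟨![1, 0], fun h => by simpa using congr_fun h 0, fun j => ?_⟩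
        fin_cases j <;> simp [h0]
      · by_cases h1 : q 1 1 = 0 ∧ q 0 1 = 0
        · refine ⟨![0, 1], fun h => by simpa using congr_fun h 1, fun j => ?_⟩
          fin_cases j <;> simp [h1, ← hc]
        · by_cases h2 : q 0 1 = 0
          · simp only [h2, and_true, zero_mul, sub_zero] at h0 h1 hdet
            exact absurd hdet (mul_ne_zero h0 h1)
          · refine ⟨![q 1 0, - q 0 0], fun h => h2 ?_, fun j => ?_⟩
            · rw [hc]; simpa using congr_fun h 0
            · fin_cases j
              · simp; ring
              · simp; linear_combination -hdet
    let D : Derivation k K K := α 0 • B.D 0 + α 1 • B.D 1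
    have hDv : ∀ w : Fin n → K, dvec D w = α 0 • dvec (B.D 0) w + α 1 • dvec (B.D 1) w := by
      intro w; funext l; simp [dvec, D]
    have hDD : ∀ j, dvec D (dvec (B.D j) η) ∈ V := by
      intro j
      have e : dvec D (dvec (B.D j) η) = α 0 • (second B η 0 j - q 0 j • u) +
          α 1 • (second B η 1 j - q 1 j • u) := by
        have := hα j
        rw [hDv]
        have h2 : α 0 • (second B η 0 j - q 0 j • u) + α 1 • (second B η 1 j - q 1 j • u) =
          α 0 • second B η 0 j + α 1 • second B η 1 j - (α 0 * q 0 j + α 1 * q 1 j) • u := by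
          module
        rw [h2, this]; simp [second]
      rw [e]
      exact V.add_mem (V.smul_mem _ (hdec 0 j)) (V.smul_mem _ (hdec 1 j))
    have hDη : dvec D η ∈ V := by
      rw [hDv]
      exact V.add_mem (V.smul_mem _ (dvec_mem_tangentSpan B η 0))
        (V.smul_mem _ (dvec_mem_tangentSpan B η 1))
    have hDst : ∀ w ∈ V, dvec D w ∈ V := by
      intro w hw
      refine dvec_mem_of_span D ?_ (fun v hv => Submodule.subset_span hv) hw
      rintro v (rfl | rfl | rfl)
      · exact hDη
      · exact hDD 0
      · exact hDD 1
    have hcomm : ∀ (w : Fin n → K) i, dvec (B.D i) (dvec D w) = dvec D (dvec (B.D i) w) +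
        (B.D i (α 0) • dvec (B.D 0) w + B.D i (α 1) • dvec (B.D 1) w) := by
      intro w i
      funext l
      simp only [dvec, D, Derivation.add_apply, Derivation.smul_apply, smul_eq_mul, map_add,
        Derivation.leibniz, Pi.add_apply, Pi.smul_apply]
      rw [B.comm _ i 0, B.comm _ i 1]; ring
    have hkD : ∀ i, dvec (B.D i) (dvec D η) ∈ V := by
      intro i
      rw [hcomm]
      exact V.add_mem (hDD i) (V.add_mem (V.smul_mem _ (dvec_mem_tangentSpan B η 0))
        (V.smul_mem _ (dvec_mem_tangentSpan B η 1)))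
    have hkDD : ∀ i, dvec (B.D i) (dvec D (dvec D η)) ∈ V := by
      intro i
      rw [hcomm]
      exact V.add_mem (hDst _ (hkD i)) (V.add_mem (V.smul_mem _ (hkD 0)) (V.smul_mem _ (hkD 1)))
    obtain ⟨c, r0, r1, hr⟩ := (mem_tangentSpan_iff B η).mp (hDst _ hDη)
    have hrq : ∀ i, r0 * q i 0 + r1 * q i 1 = 0 := by
      intro i
      by_contra hne
      apply huV
      have h1 := hkDD i
      rw [hr] at h1
      simp only [dvec_add, dvec_smul] at h1
      have e0 := hdec i 0
      have e1 := hdec i 1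
      have m0 := self_mem_tangentSpan B η
      have m1 := dvec_mem_tangentSpan B η 0
      have m2 := dvec_mem_tangentSpan B η 1
      have m3 := dvec_mem_tangentSpan B η i
      have h2 : (r0 * q i 0 + r1 * q i 1) • u ∈ V := by
        have e : (r0 * q i 0 + r1 * q i 1) • u =
          (c • dvec (B.D i) η + (B.D i) c • η + (r0 • dvec (B.D i) (dvec (B.D 0) η) +
            (B.D i) r0 • dvec (B.D 0) η) + (r1 • dvec (B.D i) (dvec (B.D 1) η) +
            (B.D i) r1 • dvec (B.D 1) η)) - c • dvec (B.D i) η - (B.D i) c • η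
          - (B.D i) r0 • dvec (B.D 0) η - (B.D i) r1 • dvec (B.D 1) η
          - r0 • (second B η i 0 - q i 0 • u) - r1 • (second B η i 1 - q i 1 • u) := by
          simp only [second]; module
        rw [e]
        exact V.sub_mem (V.sub_mem (V.sub_mem (V.sub_mem (V.sub_mem (V.sub_mem h1
          (V.smul_mem _ m3)) (V.smul_mem _ m0)) (V.smul_mem _ m1)) (V.smul_mem _ m2))
          (V.smul_mem _ e0)) (V.smul_mem _ e1)
      have := V.smul_mem (r0 * q i 0 + r1 * q i 1)⁻¹ h2
      rwa [smul_smul, inv_mul_cancel₀ hne, one_smul] at this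
    obtain ⟨t, ht0, ht1⟩ : ∃ t, r0 = t * α 0 ∧ r1 = t * α 1 := by
      have hcross : r0 * α 1 = r1 * α 0 := by
        have key : ∀ i, (r0 * α 1 - r1 * α 0) * q i 0 = 0 ∧ (r0 * α 1 - r1 * α 0) * q i 1 = 0 := by
          intro i
          have h1 := hrq i
          have h2 : α 0 * q i 0 + α 1 * q i 1 = 0 := by
            have := hα i
            rwa [hqc 0 i, hqc 1 i] at this
          constructor
          · linear_combination α 1 * h1 - r1 * h2
          · linear_combination r0 * h2 - α 0 * h1
        have : (r0 * α 1 - r1 * α 0) * q a b = 0 := by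
          fin_cases b
          · exact (key a).1
          · exact (key a).2
        exact sub_eq_zero.mp ((mul_eq_zero.mp this).resolve_right hqab)
      by_cases h0 : α 0 = 0
      · have h1 : α 1 ≠ 0 := fun h1 => hα0 (by funext i; fin_cases i <;> simp [h0, h1])
        refine ⟨r1 / α 1, ?_, by field_simp⟩
        rw [h0, mul_zero] at hcross ⊢
        exact (mul_eq_zero.mp hcross).resolve_right h1
      · refine ⟨r0 / α 0, by field_simp, ?_⟩
        field_simp; exact hcross.symm
    refine hasLineFamily_of_derivation (by omega) D η hη ?_ c t (fun l => ?_) S hS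
    · intro ρ hρ
      have h1 : ρ • η + (-α 0) • dvec (B.D 0) η + (-α 1) • dvec (B.D 1) η = 0 := by
        have h2 : dvec D η = ρ • η := hρ
        rw [← h2, hDv]; module
      rw [Fintype.linearIndependent_iff] at hind
      have h3 := hind ![ρ, -α 0, -α 1] (by simpa [Fin.sum_univ_three] using h1)
      apply hα0
      funext i
      fin_cases i
      · simpa using h3 1
      · simpa using h3 2
    · have h1 := congr_fun hr l
      have h2 := congr_fun (hDv η) l
      simp only [dvec, Pi.add_apply, Pi.smul_apply, smul_eq_mul] at h1 h2
      rw [h1, h2, ht0, ht1]; ring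
  · exfalso
    have hDu : ∀ m, dvec (B.D m) u ∈ V' := by
      have h0 := hrel 0 0 1
      have h1 := hrel 0 1 1
      intro m
      fin_cases m
      · have h2 := V'.sub_mem (V'.smul_mem (q 0 0) h1) (V'.smul_mem (q 0 1) h0)
        have e : q 0 0 • (q 0 1 • dvec (B.D 1) u - q 1 1 • dvec (B.D 0) u) -
          q 0 1 • (q 0 0 • dvec (B.D 1) u - q 1 0 • dvec (B.D 0) u) =
          (-(q 0 0 * q 1 1 - q 0 1 * q 1 0)) • dvec (B.D 0) u := by module
        rw [e] at h2
        exact (V'.smul_mem_iff (neg_ne_zero.mpr hdet)).mp h2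
      · have h2 := V'.sub_mem (V'.smul_mem (q 1 1) h0) (V'.smul_mem (q 1 0) h1)
        have e : q 1 1 • (q 0 0 • dvec (B.D 1) u - q 1 0 • dvec (B.D 0) u) -
          q 1 0 • (q 0 1 • dvec (B.D 1) u - q 1 1 • dvec (B.D 0) u) =
          (q 0 0 * q 1 1 - q 0 1 * q 1 0) • dvec (B.D 1) u := by module
        rw [e] at h2
        exact (V'.smul_mem_iff hdet).mp h2
    refine not_stable B η hη V' (hVV' (self_mem_tangentSpan B η)) ?_ ?_
    · have h1 : finrank K V' ≤ finrank K V + finrank K (Submodule.span K {u}) :=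
        Submodule.finrank_add_le_finrank_add_finrank _ _
      have h2 := finrank_tangentSpan_le B η
      rw [← hV] at h2
      have h3 : finrank K (Submodule.span K {u}) ≤ 1 := by
        have := finrank_span_finset_le_card (R := K) ({u} : Finset (Fin n → K))
        rwa [Finset.coe_singleton, Finset.card_singleton] at this
      omega
    · intro w hw i
      obtain ⟨v, hv, w', hw', rfl⟩ := Submodule.mem_sup.mp hw
      obtain ⟨c, rfl⟩ := Submodule.mem_span_singleton.mp hw'
      rw [dvec_add, dvec_smul]
      exact V'.add_mem (hDV v hv i) (V'.add_mem (V'.smul_mem _ (hDu i)) (V'.smul_mem _ huV'))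

end Second

end

section

namespace DiffBasis
variable {k K : Type} [Field k] [Field K] [Algebra k K] (B : DiffBasis k K)

theorem expand_hom {L : Type} [Field L] [Algebra k L] (ι : K →ₐ[k] L) (δ : Derivation k L L)
    (x : K) : δ (ι x) = δ (ι (B.z 0)) * ι (B.D 0 x) + δ (ι (B.z 1)) * ι (B.D 1 x) := by
  let _ : Algebra K L := ι.toRingHom.toAlgebra
  have : IsScalarTower k K L := IsScalarTower.of_algebraMap_eq fun r => (ι.commutes r).symm
  exact B.expand (δ.compAlgebraMap K) x

end DiffBasis

theorem hasLineFamily_of_correspondence {k K L : Type} [Field k] [IsAlgClosed k] [CharZero k]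
    [Field K] [CharZero K] [Algebra k K] [Field L] [CharZero L] [Algebra k L] (B : DiffBasis k K)
    {n : ℕ} (hn : 5 ≤ n) (η : Fin n → K) (hη : ConstIndep k η)
    (hind : LinearIndependent K ![η, dvec (B.D 0) η, dvec (B.D 1) η])
    (κ ι : K →ₐ[k] L) (a : L) (b : Fin 2 → L)
    (hrel : ∀ l, ι (η l) = a * κ (η l) + b 0 * κ (B.D 0 (η l)) + b 1 * κ (B.D 1 (η l)))
    (hgen : ∀ δ : Derivation k L L, (∀ x, δ (ι x) = 0) → (∀ x, δ (κ x) = 0) → δ a = 0 →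
      (∀ i, δ (b i) = 0) → δ = 0)
    (hι : ∃ δ : Derivation k L L, δ ≠ 0 ∧ ∀ x, δ (ι x) = 0)
    (hκ : ∃ δ : Derivation k L L, δ ≠ 0 ∧ ∀ x, δ (κ x) = 0)
    (S : Set (MvPolynomial (Fin n) k))
    (hS : ∀ f ∈ S, (∃ d, f.IsHomogeneous d) ∧ aeval η f = 0) : HasLineFamily k S := by
  obtain ⟨μ, hμ⟩ := exists_dual_family _ hind
  have hindL : ∀ x y z : L, (∀ l, x * κ (η l) + y * κ (B.D 0 (η l)) + z * κ (B.D 1 (η l)) = 0) →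
      x = 0 ∧ y = 0 ∧ z = 0 := by
    intro x y z h
    have key : ∀ i, x * κ (∑ l, μ i l * η l) + y * κ (∑ l, μ i l * B.D 0 (η l)) +
        z * κ (∑ l, μ i l * B.D 1 (η l)) = 0 := by
      intro i
      simp only [map_sum, map_mul, Finset.mul_sum, ← Finset.sum_add_distrib]
      refine Finset.sum_eq_zero fun l _ => ?_
      linear_combination κ (μ i l) * h l
    have h0 : ∀ i, ∑ l, μ i l * η l = if i = 0 then 1 else 0 := fun i => hμ i 0
    have h1 : ∀ i, ∑ l, μ i l * B.D 0 (η l) = if i = 1 then 1 else 0 := fun i => hμ i 1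
    have h2 : ∀ i, ∑ l, μ i l * B.D 1 (η l) = if i = 2 then 1 else 0 := fun i => hμ i 2
    simp only [h0, h1, h2] at key
    exact ⟨by simpa using key 0, by simpa using key 1, by simpa using key 2⟩
  have hex : ∃ l, η l ≠ 0 := by
    by_contra hne
    push Not at hne
    have := hη (fun _ => 1) (by simp [hne])
    have := congr_fun this ⟨0, by omega⟩
    simp at this
  have hb : b ≠ 0 := by
    intro hb
    obtain ⟨p, hp, hpι⟩ := hι
    have hb0 : b 0 = 0 := by simp [hb]
    have hb1 : b 1 = 0 := by simp [hb]
    simp only [hb0, hb1, zero_mul, add_zero] at hrel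
    have ha : a ≠ 0 := by
      rintro rfl
      obtain ⟨l, hl⟩ := hex
      have := hrel l
      rw [zero_mul] at this
      exact hl ((map_eq_zero_iff ι ι.injective).mp this)
    have h := fun l => congr_arg p (hrel l)
    simp only [hpι, Derivation.leibniz, smul_eq_mul, B.expand_hom κ p (η _)] at h
    obtain ⟨h0, h1, h2⟩ := hindL (p a) (a * p (κ (B.z 0))) (a * p (κ (B.z 1))) (fun l => by
      rw [h l]; ring)
    have h1' := (mul_eq_zero.mp h1).resolve_left ha
    have h2' := (mul_eq_zero.mp h2).resolve_left ha
    refine hp (hgen p hpι (fun x => ?_) h0 fun i => ?_)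
    · rw [B.expand_hom κ p x, h1', h2']; ring
    · simp [hb]
  obtain ⟨c, hc0, hc⟩ : ∃ c : Fin 2 → L, c ≠ 0 ∧ ∀ ν : Fin n → K,
      (∀ v ∈ tangentSpan B η, ∑ l, ν l * v l = 0) →
      b 0 * (c 0 * κ (∑ l, ν l * second B η 0 0 l) + c 1 * κ (∑ l, ν l * second B η 1 0 l)) +
      b 1 * (c 0 * κ (∑ l, ν l * second B η 0 1 l) +
        c 1 * κ (∑ l, ν l * second B η 1 1 l)) = 0 := by
    obtain ⟨p, hp, hpι⟩ := hι
    have h := fun l => congr_arg p (hrel l)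
    simp only [hpι, Derivation.leibniz, smul_eq_mul, map_add] at h
    have hx := fun x => B.expand_hom κ p x
    refine ⟨fun i => p (κ (B.z i)), fun h0 => hp ?_, fun ν hν => ?_⟩
    · have e0 : p (κ (B.z 0)) = 0 := congr_fun h0 0
      have e1 : p (κ (B.z 1)) = 0 := congr_fun h0 1
      obtain ⟨h1, h2, h3⟩ := hindL (p a) (p (b 0)) (p (b 1)) (fun l => by
        rw [h l, hx (η l), hx (B.D 0 (η l)), hx (B.D 1 (η l)), e0, e1]; ring)
      refine hgen p hpι (fun x => ?_) h1 fun i => by fin_cases i <;> assumption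
      rw [B.expand_hom κ p x, e0, e1]; ring
    · have t0 := hν _ (self_mem_tangentSpan B η)
      have t1 := hν _ (dvec_mem_tangentSpan B η 0)
      have t2 := hν _ (dvec_mem_tangentSpan B η 1)
      simp only [dvec] at t1 t2
      have key : ∑ l, κ (ν l) * (0 : L) = _ := Finset.sum_congr rfl fun l _ => by rw [h l]
      simp only [mul_zero, Finset.sum_const_zero] at key
      have e : ∀ x : Fin n → K, κ (∑ l, ν l * x l) = ∑ l, κ (ν l) * κ (x l) := by
        intro x; simp
      have t0' := congr_arg κ t0
      have t1' := congr_arg κ t1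
      have t2' := congr_arg κ t2
      simp only [map_zero] at t0' t1' t2'
      have : b 0 * (p (κ (B.z 0)) * κ (∑ l, ν l * second B η 0 0 l) +
            p (κ (B.z 1)) * κ (∑ l, ν l * second B η 1 0 l)) +
          b 1 * (p (κ (B.z 0)) * κ (∑ l, ν l * second B η 0 1 l) +
            p (κ (B.z 1)) * κ (∑ l, ν l * second B η 1 1 l)) =
          b 0 * (p (κ (B.z 0)) * κ (∑ l, ν l * second B η 0 0 l) +
            p (κ (B.z 1)) * κ (∑ l, ν l * second B η 1 0 l)) +
          b 1 * (p (κ (B.z 0)) * κ (∑ l, ν l * second B η 0 1 l) +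
            p (κ (B.z 1)) * κ (∑ l, ν l * second B η 1 1 l)) +
          p a * κ (∑ l, ν l * η l) + (p (b 0) + a * p (κ (B.z 0))) *
            κ (∑ l, ν l * B.D 0 (η l)) + (p (b 1) + a * p (κ (B.z 1))) *
            κ (∑ l, ν l * B.D 1 (η l)) := by rw [t0', t1', t2']; ring
      rw [this]
      simp only [e, Finset.mul_sum, ← Finset.sum_add_distrib]
      rw [key]
      refine Finset.sum_congr rfl fun l _ => ?_
      rw [hx (η l), hx (B.D 0 (η l)), hx (B.D 1 (η l))]
      simp only [second, dvec]
      ring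
  obtain ⟨δ, hδ, hδκ⟩ := hκ
  by_cases hA : b 0 * δ (b 1) = b 1 * δ (b 0)
  · obtain ⟨ρ, hρ⟩ : ∃ ρ, ∀ i, δ (b i) = ρ * b i := by
      by_cases h0 : b 0 = 0
      · have h1 : b 1 ≠ 0 := fun h1 => hb (by funext i; fin_cases i <;> simp [h0, h1])
        refine ⟨δ (b 1) / b 1, fun i => ?_⟩
        fin_cases i
        · simp [h0]
        · field_simp; simp
      · refine ⟨δ (b 0) / b 0, fun i => ?_⟩
        fin_cases i
        · field_simp; simp
        · field_simp; simp only [Fin.mk_one]; linear_combination hA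
    have hP : ∀ l, δ (ι (η l)) = δ a * κ (η l) + ρ * (b 0 * κ (B.D 0 (η l)) +
        b 1 * κ (B.D 1 (η l))) := by
      intro l
      rw [hrel l]
      simp only [map_add, Derivation.leibniz, hδκ, smul_eq_mul, hρ]
      ring
    have hnp : ∀ r : L, (fun l => δ (ι (η l))) ≠ fun l => r * ι (η l) := by
      intro r hr
      have h1 : ∀ l, r * ι (η l) = δ (ι (B.z 0)) * ι (B.D 0 (η l)) +
          δ (ι (B.z 1)) * ι (B.D 1 (η l)) := fun l => by
        rw [← B.expand_hom ι δ]; exact (congr_fun hr l).symm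
      have h2 : ∀ i, -r * ι (∑ l, μ i l * η l) + δ (ι (B.z 0)) * ι (∑ l, μ i l * B.D 0 (η l)) +
          δ (ι (B.z 1)) * ι (∑ l, μ i l * B.D 1 (η l)) = 0 := by
        intro i
        simp only [map_sum, map_mul, Finset.mul_sum, ← Finset.sum_add_distrib]
        refine Finset.sum_eq_zero fun l _ => ?_
        linear_combination -ι (μ i l) * h1 l
      have h3 : ∀ i, ∑ l, μ i l * η l = if i = 0 then 1 else 0 := fun i => hμ i 0
      have h4 : ∀ i, ∑ l, μ i l * B.D 0 (η l) = if i = 1 then 1 else 0 := fun i => hμ i 1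
      have h5 : ∀ i, ∑ l, μ i l * B.D 1 (η l) = if i = 2 then 1 else 0 := fun i => hμ i 2
      simp only [h3, h4, h5] at h2
      have r0 : r = 0 := by simpa using h2 0
      have d0 : δ (ι (B.z 0)) = 0 := by simpa using h2 1
      have d1 : δ (ι (B.z 1)) = 0 := by simpa using h2 2
      have hδι : ∀ x, δ (ι x) = 0 := fun x => by rw [B.expand_hom ι δ x, d0, d1]; ring
      obtain ⟨e0, e1, e2⟩ := hindL (δ a) (ρ * b 0) (ρ * b 1) (fun l => by
        have := hP l
        rw [hδι] at this
        rw [this]; ring)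
      refine hδ (hgen δ hδι hδκ e0 fun i => ?_)
      rw [hρ]
      fin_cases i <;> assumption
    have hPη : ConstIndep k (fun l => ι (η l)) := by
      intro ν hν
      refine hη ν (ι.injective ?_)
      rw [map_zero, ← hν, map_sum]
      refine Finset.sum_congr rfl fun l _ => ?_
      change ι (algebraMap k K (ν l) * η l) = algebraMap k L (ν l) * ι (η l)
      rw [map_mul, ι.commutes]
    have hdet : a * ρ - δ a ≠ 0 := by
      intro h0
      refine hnp ρ (funext fun l => ?_)
      rw [hP l, hrel l]
      linear_combination (-κ (η l)) * h0
    refine hasLineFamily_of_derivation (by omega) δ (fun l => ι (η l)) hPη hnp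
      ((δ (δ a) * ρ - δ a * (δ ρ + ρ ^ 2)) / (a * ρ - δ a))
      ((a * (δ ρ + ρ ^ 2) - δ (δ a)) / (a * ρ - δ a)) (fun l => ?_) S (fun f hf => ?_)
    · have e : δ (δ (ι (η l))) = δ (δ a) * κ (η l) + (δ ρ + ρ ^ 2) * (b 0 * κ (B.D 0 (η l)) +
          b 1 * κ (B.D 1 (η l))) := by
        rw [hP l]
        simp only [map_add, Derivation.leibniz, hδκ, smul_eq_mul, hρ]
        ring
      rw [e, hP l, hrel l]
      rw [div_mul_eq_mul_div, div_mul_eq_mul_div, ← add_div, eq_div_iff hdet]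
      ring
    · refine ⟨(hS f hf).1, ?_⟩
      rw [← algHom_aeval, (hS f hf).2, map_zero]
  · refine hasLineFamily_of_second_rank_le_one B η hn hη hind ?_ S hS
    intro μ ν hμ hν
    have hb1 : b 1 ≠ 0 := by
      intro h1
      apply hA
      simp [h1]
    set s := b 0 / b 1 with hsdef
    have hs1 : s * b 1 = b 0 := div_mul_cancel₀ _ hb1
    have hs : δ s ≠ 0 := by
      intro h0
      have h2 := congr_arg δ hs1
      rw [Derivation.leibniz, h0] at h2
      apply hA
      rw [← h2, ← hs1]
      simp; ring
    set P : (Fin n → K) → Fin 2 → Fin 2 → K := fun μ i j => ∑ l, μ l * second B η i j l with hPdef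
    have hPc : ∀ μ, P μ 1 0 = P μ 0 1 := fun μ => by simp only [P]; rw [second_comm]
    have lin : ∀ μ, (∀ v ∈ tangentSpan B η, ∑ l, μ l * v l = 0) →
        c 0 * (s * κ (P μ 0 0) + κ (P μ 0 1)) + c 1 * (s * κ (P μ 0 1) + κ (P μ 1 1)) = 0 := by
      intro μ hμ
      have h := hc μ hμ
      change b 0 * (c 0 * κ (P μ 0 0) + c 1 * κ (P μ 1 0)) +
        b 1 * (c 0 * κ (P μ 0 1) + c 1 * κ (P μ 1 1)) = 0 at h
      rw [hPc, ← hs1] at h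
      have : b 1 * (c 0 * (s * κ (P μ 0 0) + κ (P μ 0 1)) +
        c 1 * (s * κ (P μ 0 1) + κ (P μ 1 1))) = 0 := by linear_combination h
      exact (mul_eq_zero.mp this).resolve_left hb1
    have hdet : (s * κ (P μ 0 0) + κ (P μ 0 1)) * (s * κ (P ν 0 1) + κ (P ν 1 1)) -
        (s * κ (P ν 0 0) + κ (P ν 0 1)) * (s * κ (P μ 0 1) + κ (P μ 1 1)) = 0 := by
      have l1 := lin μ hμ
      have l2 := lin ν hν
      by_contra hne
      refine hc0 (funext fun i => ?_)
      fin_cases i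
      · change c 0 = 0
        refine (mul_eq_zero.mp ?_).resolve_right hne
        linear_combination (s * κ (P ν 0 1) + κ (P ν 1 1)) * l1 -
          (s * κ (P μ 0 1) + κ (P μ 1 1)) * l2
      · change c 1 = 0
        refine (mul_eq_zero.mp ?_).resolve_right hne
        linear_combination (s * κ (P μ 0 0) + κ (P μ 0 1)) * l2 -
          (s * κ (P ν 0 0) + κ (P ν 0 1)) * l1
    have hpoly := eq_zero_of_eval_eq_zero_of_const δ hs
      (Polynomial.C (κ (P μ 0 0 * P ν 0 1 - P ν 0 0 * P μ 0 1)) * Polynomial.X ^ 2 +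
        Polynomial.C (κ (P μ 0 0 * P ν 1 1 - P ν 0 0 * P μ 1 1)) * Polynomial.X +
        Polynomial.C (κ (P μ 0 1 * P ν 1 1 - P ν 0 1 * P μ 1 1)))
      (fun m => by
        rcases m with _ | _ | _ | m <;>
        simp [Polynomial.coeff_X, Polynomial.coeff_C, Polynomial.coeff_X_pow, -map_sub, -map_mul,
          hδκ])
      (by
        simp only [Polynomial.eval_add, Polynomial.eval_mul, Polynomial.eval_C,
          Polynomial.eval_pow, Polynomial.eval_X]
        simp only [map_sub, map_mul]
        linear_combination hdet)
    have inj : ∀ x, κ x = 0 → x = 0 := fun x hx => (map_eq_zero_iff κ κ.injective).mp hx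
    have q2 : P μ 0 0 * P ν 0 1 - P ν 0 0 * P μ 0 1 = 0 := inj _ (by
      have := congr_arg (fun p => Polynomial.coeff p 2) hpoly
      simpa [Polynomial.coeff_X, Polynomial.coeff_C, -map_sub, -map_mul] using this)
    have q1 : P μ 0 0 * P ν 1 1 - P ν 0 0 * P μ 1 1 = 0 := inj _ (by
      have := congr_arg (fun p => Polynomial.coeff p 1) hpoly
      simpa [Polynomial.coeff_X, Polynomial.coeff_C, -map_sub, -map_mul] using this)
    have q0 : P μ 0 1 * P ν 1 1 - P ν 0 1 * P μ 1 1 = 0 := inj _ (by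
      have := congr_arg (fun p => Polynomial.coeff p 0) hpoly
      simpa [Polynomial.coeff_X, Polynomial.coeff_C, -map_sub, -map_mul] using this)
    intro i j i' j'
    change P μ i j * P ν i' j' = P ν i j * P μ i' j'
    have c1 := hPc μ
    have c2 := hPc ν
    fin_cases i <;> fin_cases j <;> fin_cases i' <;> fin_cases j' <;>
      simp only [Fin.zero_eta, Fin.mk_one, c1, c2] <;>
      first
        | ring1
        | linear_combination q2
        | linear_combination q1
        | linear_combination q0
        | linear_combination -q2
        | linear_combination -q1
        | linear_combination -q0

end

section

/-- A `k`-point of the spectrum of `A`, with two parameters generating the cotangent space and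
dual derivations. -/
structure LocalParam (k A : Type) [Field k] [CommRing A] [Algebra k A] where
  ev : A →ₐ[k] k
  t : Fin 2 → A
  D : Fin 2 → Derivation k A A
  ev_t : ∀ i, ev (t i) = 0
  ker_le : RingHom.ker ev ≤ Ideal.span (range t) ⊔ (RingHom.ker ev) ^ 2
  ev_D : ∀ i j, ev (D i (t j)) = if i = j then 1 else 0

theorem derivation_mem_pow {k A : Type} [Field k] [CommRing A] [Algebra k A]
    (D : Derivation k A A) (m : Ideal A) (n : ℕ) {a : A} (ha : a ∈ m ^ (n + 1)) :
    D a ∈ m ^ n := by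
  induction n generalizing a with
  | zero => simp
  | succ n ih =>
    rw [pow_succ] at ha
    refine Submodule.mul_induction_on ha (fun x hx y hy => ?_) fun x y hx hy => ?_
    · rw [Derivation.leibniz]
      refine add_mem (Ideal.mul_mem_right _ _ hx) ?_
      rw [pow_succ, smul_eq_mul, mul_comm y]
      exact Ideal.mul_mem_mul (ih hx) hy
    · rw [map_add]; exact add_mem hx hy

namespace LocalParam
variable {k A : Type} [Field k] [CommRing A] [Algebra k A] (T : LocalParam k A)

/-- The maximal ideal of the point. -/
noncomputable def m : Ideal A := RingHom.ker T.ev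

theorem mem_m {a : A} : a ∈ T.m ↔ T.ev a = 0 := RingHom.mem_ker

theorem t_mem (i : Fin 2) : T.t i ∈ T.m := T.mem_m.2 (T.ev_t i)

theorem m_ne_top : T.m ≠ ⊤ := by
  intro h
  have : (1 : A) ∈ T.m := h ▸ Submodule.mem_top
  rw [mem_m, map_one] at this
  exact one_ne_zero this

theorem sub_C_mem (a : A) : a - algebraMap k A (T.ev a) ∈ T.m := by
  rw [mem_m]; simp

theorem aeval_mem_pow {P : MvPolynomial (Fin 2) k} {n : ℕ} (hP : P.IsHomogeneous n) :
    aeval T.t P ∈ T.m ^ n := by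
  rw [aeval_def, eval₂_eq]
  refine Ideal.sum_mem _ fun d hd => Ideal.mul_mem_left _ _ ?_
  have hdeg := hP (mem_support_iff.mp hd)
  rw [Finsupp.weight_apply, Finsupp.sum_fintype _ _ (by simp)] at hdeg
  rw [← hdeg]
  simp only [Fin.sum_univ_two, Pi.one_apply, smul_eq_mul, mul_one, pow_add]
  have hi : ∏ j ∈ d.support, T.t j ^ d j = T.t 0 ^ d 0 * T.t 1 ^ d 1 := by
    rw [Finset.prod_subset (Finset.subset_univ _), Fin.prod_univ_two]
    intro x _ hx
    simp [Finsupp.notMem_support_iff.mp hx]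
  rw [hi]
  exact Ideal.mul_mem_mul (Ideal.pow_mem_pow (T.t_mem 0) _) (Ideal.pow_mem_pow (T.t_mem 1) _)

theorem derivation_aeval (i : Fin 2) (P : MvPolynomial (Fin 2) k) :
    T.D i (aeval T.t P) = ∑ j, aeval T.t (pderiv j P) * T.D i (T.t j) := by
  induction P using MvPolynomial.induction_on with
  | C a => simp
  | add p q hp hq => simp [hp, hq, add_mul, Finset.sum_add_distrib]
  | mul_X p l hp =>
    simp only [map_mul, aeval_X, Derivation.leibniz, hp, smul_eq_mul, pderiv_X, map_add]
    fin_cases l <;> simp <;> ring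

theorem eq_zero_of_aeval_mem [CharZero k] {P : MvPolynomial (Fin 2) k} {n : ℕ}
    (hP : P.IsHomogeneous n) (h : aeval T.t P ∈ T.m ^ (n + 1)) : P = 0 := by
  induction n generalizing P with
  | zero =>
    obtain ⟨c, rfl⟩ : ∃ c, P = C c :=
      ⟨_, totalDegree_eq_zero_iff_eq_C.mp (Nat.le_zero.mp hP.totalDegree_le)⟩
    have := T.mem_m.mp (by simpa using h)
    rw [show T.ev (algebraMap k A c) = c by simp] at this
    rw [this, map_zero]
  | succ n ih =>
    have hd : ∀ i, pderiv i P = 0 := by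
      intro i
      refine ih (by simpa using hP.pderiv (i := i)) ?_
      have h1 := derivation_mem_pow (T.D i) T.m (n + 1) h
      rw [derivation_aeval] at h1
      have h2 : ∑ j, aeval T.t (pderiv j P) * (T.D i (T.t j) -
          algebraMap k A (if i = j then 1 else 0)) ∈ T.m ^ (n + 1) := by
        refine Ideal.sum_mem _ fun j _ => ?_
        rw [pow_succ]
        refine Ideal.mul_mem_mul (T.aeval_mem_pow (by simpa using hP.pderiv (i := j))) ?_
        rw [← T.ev_D]
        exact T.sub_C_mem _
      have h3 := sub_mem h1 h2
      rw [← Finset.sum_sub_distrib] at h3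
      convert h3 using 1
      simp [mul_sub]
    have := hP.sum_X_mul_pderiv
    simp only [hd, mul_zero, Finset.sum_const_zero] at this
    exact (smul_eq_zero.mp this.symm).resolve_left (by simp)

theorem exists_form {n : ℕ} {a : A} (ha : a ∈ T.m ^ n) :
    ∃ P : MvPolynomial (Fin 2) k, P.IsHomogeneous n ∧ a - aeval T.t P ∈ T.m ^ (n + 1) := by
  induction n generalizing a with
  | zero =>
    exact ⟨C (T.ev a), isHomogeneous_C _ _, by simpa using T.sub_C_mem a⟩
  | succ n ih =>
    rw [pow_succ] at ha
    refine Submodule.mul_induction_on ha (fun x hx y hy => ?_) fun x y hx hy => ?_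
    · obtain ⟨P, hP, hxP⟩ := ih hx
      obtain ⟨u, hu, v, hv, rfl⟩ := Submodule.mem_sup.mp (T.ker_le hy)
      obtain ⟨c, rfl⟩ := (Ideal.mem_span_range_iff_exists_fun).mp hu
      refine ⟨P * ∑ i, C (T.ev (c i)) * X i, hP.mul ?_, ?_⟩
      · exact IsHomogeneous.sum _ _ _ fun i _ => isHomogeneous_C_mul_X _ _
      have e : x * (∑ i, c i * T.t i + v) - aeval T.t (P * ∑ i, C (T.ev (c i)) * X i) =
          (x - aeval T.t P) * (∑ i, algebraMap k A (T.ev (c i)) * T.t i) +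
          x * (∑ i, (c i - algebraMap k A (T.ev (c i))) * T.t i + v) := by
        simp [Fin.sum_univ_two]
        ring
      rw [e]
      refine add_mem ?_ ?_
      · rw [pow_succ]
        exact Ideal.mul_mem_mul hxP (Ideal.sum_mem _ fun i _ => Ideal.mul_mem_left _ _ (T.t_mem i))
      · rw [add_assoc, pow_add]
        refine Ideal.mul_mem_mul hx (add_mem (Ideal.sum_mem _ fun i _ => ?_) hv)
        rw [show (1 + 1) = 2 from rfl, pow_two]
        exact Ideal.mul_mem_mul (T.sub_C_mem _) (T.t_mem i)
    · obtain ⟨P, hP, hx'⟩ := hx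
      obtain ⟨Q, hQ, hy'⟩ := hy
      refine ⟨P + Q, hP.add hQ, ?_⟩
      convert add_mem hx' hy' using 1
      rw [map_add]; ring

/-- `P` is the leading form, of degree `n`, of `a` at the point. -/
def HasLead (a : A) (n : ℕ) (P : MvPolynomial (Fin 2) k) : Prop :=
  P.IsHomogeneous n ∧ P ≠ 0 ∧ a - aeval T.t P ∈ T.m ^ (n + 1)

variable {T}

theorem HasLead.mem {a : A} {n : ℕ} {P : MvPolynomial (Fin 2) k} (h : T.HasLead a n P) :
    a ∈ T.m ^ n := by
  have := add_mem (Ideal.pow_le_pow_right (Nat.le_succ n) h.2.2) (T.aeval_mem_pow h.1)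
  simpa using this

theorem HasLead.notMem [CharZero k] {a : A} {n : ℕ} {P : MvPolynomial (Fin 2) k}
    (h : T.HasLead a n P) : a ∉ T.m ^ (n + 1) := by
  intro ha
  refine h.2.1 (T.eq_zero_of_aeval_mem h.1 ?_)
  have := sub_mem ha h.2.2
  simpa using this

theorem HasLead.unique [CharZero k] {a : A} {n n' : ℕ} {P P' : MvPolynomial (Fin 2) k}
    (h : T.HasLead a n P) (h' : T.HasLead a n' P') : n = n' ∧ P = P' := by
  have hn : n = n' := by
    by_contra hne
    rcases lt_or_gt_of_ne hne with hlt | hlt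
    · exact h.notMem (Ideal.pow_le_pow_right hlt h'.mem)
    · exact h'.notMem (Ideal.pow_le_pow_right hlt h.mem)
  subst hn
  refine ⟨rfl, sub_eq_zero.mp (T.eq_zero_of_aeval_mem (h.1.sub h'.1) ?_)⟩
  have := sub_mem h'.2.2 h.2.2
  simpa using this

theorem exists_lead (T : LocalParam k A) [IsDomain A] [IsNoetherianRing A] {a : A} (ha : a ≠ 0) :
    ∃ n P, T.HasLead a n P := by
  have h : ∃ n, a ∉ T.m ^ (n + 1) := by
    by_contra hne
    push Not at hne
    have : a ∈ (⨅ i : ℕ, T.m ^ i : Ideal A) := by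
      rw [Ideal.mem_iInf]
      intro i
      exact Ideal.pow_le_pow_right (Nat.le_succ i) (hne i)
    rw [Ideal.iInf_pow_eq_bot_of_isDomain _ T.m_ne_top] at this
    exact ha (by simpa using this)
  classical
  let n := Nat.find h
  have hn : a ∉ T.m ^ (n + 1) := Nat.find_spec h
  have hn' : a ∈ T.m ^ n := by
    rcases hn0 : n with _ | j
    · simp
    · by_contra hc
      exact Nat.find_min h (m := j) (by change j < n; omega) hc
  obtain ⟨P, hP, hP'⟩ := T.exists_form hn'
  refine ⟨n, P, hP, ?_, hP'⟩
  rintro rfl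
  exact hn (by simpa using hP')

theorem lead_of_mem (T : LocalParam k A) [IsDomain A] [IsNoetherianRing A] [CharZero k] {a : A} (ha : a ≠ 0) {n : ℕ}
    (h : a ∈ T.m ^ n) : ∃ j P, n ≤ j ∧ T.HasLead a j P := by
  obtain ⟨j, P, hP⟩ := T.exists_lead ha
  refine ⟨j, P, ?_, hP⟩
  by_contra hlt
  exact hP.notMem (Ideal.pow_le_pow_right (by omega) h)

theorem HasLead.mul {a b : A} {n n' : ℕ} {P Q : MvPolynomial (Fin 2) k}
    (h : T.HasLead a n P) (h' : T.HasLead b n' Q) : T.HasLead (a * b) (n + n') (P * Q) := by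
  refine ⟨h.1.mul h'.1, mul_ne_zero h.2.1 h'.2.1, ?_⟩
  have e : a * b - aeval T.t (P * Q) = (a - aeval T.t P) * b + aeval T.t P * (b - aeval T.t Q) := by
    rw [map_mul]; ring
  rw [e]
  refine add_mem ?_ ?_
  · rw [show n + n' + 1 = (n + 1) + n' by ring, pow_add]
    exact Ideal.mul_mem_mul h.2.2 h'.mem
  · rw [add_assoc, pow_add]
    exact Ideal.mul_mem_mul (T.aeval_mem_pow h.1) h'.2.2

theorem HasLead.pow {a : A} {n : ℕ} {P : MvPolynomial (Fin 2) k}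
    (h : T.HasLead a n P) (r : ℕ) : T.HasLead (a ^ r) (r * n) (P ^ r) := by
  induction r with
  | zero =>
    refine ⟨by simpa using isHomogeneous_one _ _, by simp, by simp⟩
  | succ r ih =>
    rw [pow_succ, pow_succ, add_mul, one_mul]
    exact ih.mul h

end LocalParam

/-- A factor of a form by a form can be chosen to be a form. -/
theorem exists_homogeneous_factor {k : Type} [Field k] {P Q : MvPolynomial (Fin 2) k} {n d : ℕ}
    (hP : P.IsHomogeneous n) (hP0 : P ≠ 0) (hQ : Q.IsHomogeneous d) (h : Q ∣ P) :
    d ≤ n ∧ ∃ H : MvPolynomial (Fin 2) k, H.IsHomogeneous (n - d) ∧ P = Q * H := by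
  obtain ⟨H, hH⟩ := h
  let _ := MvPolynomial.gradedAlgebra (σ := Fin 2) (R := k)
  have hPn : (DirectSum.decompose (homogeneousSubmodule (Fin 2) k) P n : MvPolynomial (Fin 2) k) =
      P := DirectSum.decompose_of_mem_same _ hP
  by_cases hle : d ≤ n
  · refine ⟨hle, _, (DirectSum.decompose (homogeneousSubmodule (Fin 2) k) H (n - d)).2, ?_⟩
    rw [← DirectSum.coe_decompose_mul_of_left_mem_of_le _ hQ hle, ← hH, hPn]
  · refine absurd ?_ hP0
    rw [← hPn, hH]
    exact DirectSum.coe_decompose_mul_of_left_mem_of_not_le _ hQ hle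

/-- An element of the fraction field integral over the ring is regular at a point with local
parameters. -/
theorem LocalParam.exists_mul_mem_of_isIntegral {k A K : Type} [Field k] [CharZero k] [CommRing A]
    [IsDomain A] [IsNoetherianRing A] [Algebra k A] [Field K] [Algebra A K] [IsFractionRing A K]
    (T : LocalParam k A) {f : K} (hf : IsIntegral A f) :
    ∃ c g : A, T.ev c ≠ 0 ∧ algebraMap A K c * f = algebraMap A K g := by
  obtain ⟨a, b, hb, rfl⟩ := IsFractionRing.div_surjective (A := A) f
  have hb0 : b ≠ 0 := nonZeroDivisors.ne_zero hb
  have hbK : algebraMap A K b ≠ 0 := by simpa using hb0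
  have inj := IsFractionRing.injective A K
  obtain ⟨d, Q, hQ⟩ := T.exists_lead hb0
  have step : ∀ n, ∃ h : A, a - h * b ∈ T.m ^ n := by
    intro n
    induction n with
    | zero => exact ⟨0, by simp⟩
    | succ n ih =>
      obtain ⟨h, hh⟩ := ih
      by_cases hin : a - h * b ∈ T.m ^ (n + 1)
      · exact ⟨h, hin⟩
      obtain ⟨P, hPh, hP'⟩ := T.exists_form hh
      have hP : T.HasLead (a - h * b) n P := by
        refine ⟨hPh, ?_, hP'⟩
        rintro rfl
        exact hin (by simpa using hP')
      have hint : IsIntegral A (algebraMap A K (a - h * b) / algebraMap A K b) := by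
        have : algebraMap A K (a - h * b) / algebraMap A K b =
            algebraMap A K a / algebraMap A K b - algebraMap A K h := by
          rw [map_sub, map_mul]; field_simp
        rw [this]
        exact hf.sub isIntegral_algebraMap
      obtain ⟨r, hr, hr'⟩ := hint.isAlmostIntegral
      obtain ⟨e, R, hR⟩ := T.exists_lead (nonZeroDivisors.ne_zero hr)
      have hdvd : ∀ i, Q ^ i ∣ R * P ^ i := by
        intro i
        obtain ⟨s, hs⟩ := hr' i
        have hs' : r * (a - h * b) ^ i = b ^ i * s := by
          apply inj
          rw [Algebra.smul_def, div_pow] at hs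
          rw [map_mul, map_mul, map_pow, map_pow, hs]
          field_simp
        by_cases hs0 : s = 0
        · have := (hR.mul (hP.pow i)).notMem
          rw [hs', hs0] at this
          simp at this
        obtain ⟨j, S, hS⟩ := T.exists_lead hs0
        have h1 := hR.mul (hP.pow i)
        rw [hs'] at h1
        exact ⟨S, (h1.unique ((hQ.pow i).mul hS)).2⟩
      have hQP : Q ∣ P := by
        let F := FractionRing (MvPolynomial (Fin 2) k)
        have hQF : algebraMap _ F Q ≠ 0 := by simpa using hQ.2.1
        have hal : IsAlmostIntegral (MvPolynomial (Fin 2) k)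
            (algebraMap _ F P / algebraMap _ F Q) := by
          refine ⟨R, mem_nonZeroDivisors_of_ne_zero hR.2.1, fun i => ?_⟩
          obtain ⟨S, hS⟩ := hdvd i
          refine ⟨S, ?_⟩
          rw [Algebra.smul_def, div_pow, ← mul_div_assoc, eq_div_iff (pow_ne_zero _ hQF),
            ← map_pow, ← map_pow, ← map_mul, ← map_mul, hS, mul_comm]
        obtain ⟨H, hH⟩ := IsIntegrallyClosed.isIntegral_iff.mp hal.isIntegral
        refine ⟨H, IsFractionRing.injective _ F ?_⟩
        rw [map_mul, hH, mul_div_cancel₀ _ hQF]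
      obtain ⟨hdn, H, hH, hPQ⟩ := exists_homogeneous_factor hP.1 hP.2.1 hQ.1 hQP
      refine ⟨h + aeval T.t H, ?_⟩
      have e1 : a - (h + aeval T.t H) * b = (a - h * b - aeval T.t P) -
          aeval T.t H * (b - aeval T.t Q) := by
        rw [hPQ, map_mul]; ring
      rw [e1]
      refine sub_mem hP' ?_
      rw [show n + 1 = (n - d) + (d + 1) by omega, pow_add]
      exact Ideal.mul_mem_mul (T.aeval_mem_pow hH) hQ.2.2
  have key : Ideal.Quotient.mk (Ideal.span {b}) a ∈
      (⨅ i : ℕ, T.m ^ i • ⊤ : Submodule A (A ⧸ Ideal.span {b})) := by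
    rw [Submodule.mem_iInf]
    intro n
    obtain ⟨h, hh⟩ := step n
    have e : Ideal.Quotient.mk (Ideal.span {b}) a =
        (a - h * b) • (1 : A ⧸ Ideal.span {b}) := by
      rw [← map_one (Ideal.Quotient.mk (Ideal.span {b})), ← Ideal.Quotient.mk_eq_mk,
        ← Ideal.Quotient.mk_eq_mk, ← Submodule.Quotient.mk_smul, Submodule.Quotient.eq]
      rw [smul_eq_mul, mul_one, sub_sub_cancel]
      exact Ideal.mul_mem_left _ _ (Ideal.mem_span_singleton_self b)
    rw [e]
    exact Submodule.smul_mem_smul hh Submodule.mem_top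
  rw [Ideal.mem_iInf_smul_pow_eq_bot_iff] at key
  obtain ⟨⟨r, hr⟩, hra⟩ := key
  rw [← Ideal.Quotient.mk_eq_mk, ← Submodule.Quotient.mk_smul, Submodule.Quotient.eq] at hra
  obtain ⟨g, hg⟩ := Ideal.mem_span_singleton'.mp hra
  have hr0 : T.ev r = 0 := hr
  refine ⟨1 - r, -g, by simp [hr0], ?_⟩
  rw [mul_div_assoc', div_eq_iff hbK, ← map_mul, ← map_mul]
  congr 1
  rw [smul_eq_mul] at hg
  linear_combination hg

end

section

theorem exists_derivation_extension {k A K : Type} [Field k] [CommRing A] [Algebra k A]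
    [Field K] [Algebra A K] [Algebra k K] [IsScalarTower k A K] [IsDomain A] [IsFractionRing A K]
    (D : Derivation k A A) :
    ∃ D' : Derivation k K K, ∀ a, D' (algebraMap A K a) = algebraMap A K (D a) := by
  have := Algebra.FormallyEtale.of_isLocalization (Rₘ := K) (nonZeroDivisors A)
  let d : Derivation k A K := (Algebra.linearMap A K).compDer D
  let f : TensorProduct A K (KaehlerDifferential k A) →ₗ[K] K :=
    LinearMap.liftBaseChange K d.liftKaehlerDifferential
  let e := (KaehlerDifferential.tensorKaehlerEquivOfFormallyEtale k A K).symm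
  refine ⟨(f ∘ₗ e.toLinearMap).compDer (KaehlerDifferential.D k K), fun a => ?_⟩
  change f (e (KaehlerDifferential.D k K (algebraMap A K a))) = _
  rw [KaehlerDifferential.tensorKaehlerEquivOfFormallyEtale_symm_D_algebraMap]
  simp [f, d]

theorem derivation_aeval_pderiv {k L : Type} {B : Type} [Field k] [CommRing B] [Algebra k B]
    [AddCommGroup L] [Module k L] [Module B L] [IsScalarTower k B L] {n : ℕ}
    (D : Derivation k B L) (v : Fin n → B) (f : MvPolynomial (Fin n) k) :
    D (aeval v f) = ∑ l, aeval v (pderiv l f) • D (v l) := by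
  induction f using MvPolynomial.induction_on with
  | C a => simp
  | add p q hp hq => simp [hp, hq, add_smul, Finset.sum_add_distrib]
  | mul_X p l hp =>
    simp only [map_mul, aeval_X, Derivation.leibniz, hp, smul_eq_mul, pderiv_X, map_add, add_smul,
      Finset.sum_add_distrib, Finset.smul_sum, smul_smul]
    congr 1
    rw [Finset.sum_eq_single l]
    · simp
    · intro j _ hj; simp [hj]
    · simp

variable {k : Type} [Field k] {n : ℕ}

/-- The differential of a polynomial at a point, as a vector of coefficients. -/
noncomputable def gradAt (p : Fin n → k) : MvPolynomial (Fin n) k →ₗ[k] (Fin n → k) :=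
  LinearMap.pi fun l => (aeval p).toLinearMap ∘ₗ (pderiv l).toLinearMap

theorem gradAt_apply (p : Fin n → k) (f : MvPolynomial (Fin n) k) (l : Fin n) :
    gradAt p f l = eval p (pderiv l f) := by
  simp [gradAt, aeval_eq_eval]

/-- The Zariski tangent space of the scheme defined by an ideal. -/
noncomputable def affTangent (I : Ideal (MvPolynomial (Fin n) k)) (p : Fin n → k) :
    Submodule k (Fin n → k) where
  carrier := {w | ∀ f ∈ I, ∑ l, eval p (pderiv l f) * w l = 0}
  zero_mem' := by simp
  add_mem' := by
    intro a b ha hb f hf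
    simp [mul_add, Finset.sum_add_distrib, ha f hf, hb f hf]
  smul_mem' := by
    intro c a ha f hf
    have := ha f hf
    simp only [Pi.smul_apply, smul_eq_mul]
    calc _ = c * ∑ l, eval p (pderiv l f) * a l := by
          rw [Finset.mul_sum]; exact Finset.sum_congr rfl fun _ _ => by ring
      _ = 0 := by rw [this, mul_zero]

theorem mem_affTangent {I : Ideal (MvPolynomial (Fin n) k)} {p w : Fin n → k} :
    w ∈ affTangent I p ↔ ∀ f ∈ I, ∑ l, eval p (pderiv l f) * w l = 0 := Iff.rfl

/-- The ideal of a smooth irreducible affine surface. -/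
def IsSurf (I : Ideal (MvPolynomial (Fin n) k)) : Prop :=
  I.IsPrime ∧ ∀ p, (∀ f ∈ I, eval p f = 0) → finrank k (affTangent I p) = 2

/-- A system of functions, all but two of them in the ideal. -/
structure Chart (I : Ideal (MvPolynomial (Fin n) k)) where
  g : Fin n → MvPolynomial (Fin n) k
  i : Fin 2 → Fin n
  inj : Function.Injective i
  mem : ∀ l, (∀ j, l ≠ i j) → g l ∈ I

namespace Chart
variable {I : Ideal (MvPolynomial (Fin n) k)} (c : Chart I)

noncomputable def mat : Matrix (Fin n) (Fin n) (MvPolynomial (Fin n) k) :=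
  Matrix.of fun l m => pderiv m (c.g l)

noncomputable def det : MvPolynomial (Fin n) k := c.mat.det

noncomputable def der (j : Fin 2) :
    Derivation k (MvPolynomial (Fin n) k) (MvPolynomial (Fin n) k) :=
  mkDerivation k fun m => c.mat.adjugate m (c.i j)

theorem der_apply (j : Fin 2) (f : MvPolynomial (Fin n) k) :
    c.der j f = ∑ m, pderiv m f * c.mat.adjugate m (c.i j) := by
  have := derivation_aeval_pderiv (c.der j) X f
  simpa [aeval_X_left, der] using this

theorem der_g (j : Fin 2) (l : Fin n) : c.der j (c.g l) = if l = c.i j then c.det else 0 := by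
  rw [der_apply]
  have := congr_fun (congr_fun (Matrix.mul_adjugate c.mat) l) (c.i j)
  rw [Matrix.mul_apply] at this
  rw [det, show (∑ m, pderiv m (c.g l) * c.mat.adjugate m (c.i j)) = _ from this]
  simp [Matrix.one_apply]

/-- Vectors killed by the equations of the chart are determined by their two coordinates. -/
theorem eq_zero_of_dot {L : Type} [Field L] [Algebra k L] (ξ v : Fin n → L)
    (hdet : aeval ξ c.det ≠ 0) (hv : ∀ l, ∑ m, aeval ξ (pderiv m (c.g l)) * v m = 0) : v = 0 := by
  have hd : (c.mat.map (aeval ξ)).det ≠ 0 := by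
    rwa [← AlgHom.mapMatrix_apply, ← AlgHom.map_det]
  refine Matrix.eq_zero_of_mulVec_eq_zero hd ?_
  funext l
  simpa [Matrix.mulVec, dotProduct, mat] using hv l

theorem der_mem [IsAlgClosed k] (hI : IsSurf I) {p : Fin n → k} (hp : ∀ f ∈ I, eval p f = 0)
    (hdet : eval p c.det ≠ 0) (j : Fin 2) {f : MvPolynomial (Fin n) k} (hf : f ∈ I) :
    c.der j f ∈ I := by
  have hprime := hI.1
  have key : ∀ q : Fin n → k, (∀ f ∈ I, eval q f = 0) → eval q c.det ≠ 0 →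
      (fun m => eval q (c.mat.adjugate m (c.i j))) ∈ affTangent I q := by
    intro q hq hqd
    let φ : affTangent I q →ₗ[k] (Fin 2 → k) :=
      { toFun := fun w j => ∑ m, eval q (pderiv m (c.g (c.i j))) * w.1 m
        map_add' := by intro a b; ext; simp [mul_add, Finset.sum_add_distrib]
        map_smul' := by
          intro r a; ext; simp [Finset.mul_sum, mul_left_comm] }
    have hφ : Function.Injective φ := by
      rw [injective_iff_map_eq_zero]
      intro w hw
      refine Subtype.ext (c.eq_zero_of_dot q w.1 (by simpa [aeval_eq_eval] using hqd) fun l => ?_)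
      simp only [aeval_eq_eval]
      by_cases h : ∃ j, l = c.i j
      · obtain ⟨j, rfl⟩ := h
        exact congr_fun hw j
      · push Not at h
        exact w.2 _ (c.mem l h)
    have hsurj : Function.Surjective φ := by
      have := hI.2 q hq
      exact (LinearMap.injective_iff_surjective_of_finrank_eq_finrank (by simp [this])).mp hφ
    obtain ⟨w, hw⟩ := hsurj (Pi.single j (eval q c.det))
    have : w.1 - (fun m => eval q (c.mat.adjugate m (c.i j))) = 0 := by
      refine c.eq_zero_of_dot q _ (by simpa [aeval_eq_eval] using hqd) fun l => ?_
      simp only [aeval_eq_eval, Pi.sub_apply, mul_sub, Finset.sum_sub_distrib]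
      have h1 := congr_arg (eval q) (c.der_g j l)
      rw [der_apply] at h1
      simp only [map_sum, map_mul] at h1
      change _ - ∑ m, eval q (pderiv m (c.g l)) * eval q (c.mat.adjugate m (c.i j)) = 0
      rw [h1]
      by_cases h : ∃ j, l = c.i j
      · obtain ⟨j', rfl⟩ := h
        have h2 : ∑ m, eval q (pderiv m (c.g (c.i j'))) * w.1 m = _ := congr_fun hw j'
        rw [h2]
        by_cases hj : j' = j
        · subst hj; simp
        · simp [hj, c.inj.eq_iff]
      · push Not at h
        have := w.2 _ (c.mem l h)
        rw [this, if_neg (h j)]; simp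
    rw [← sub_eq_zero.mp this]
    exact w.2
  have hmul : c.det * c.der j f ∈ I := by
    refine (IsPrime.vanishingIdeal_zeroLocus (K := k) I).le (mem_vanishingIdeal_iff.mpr ?_)
    intro q hq
    have hq' : ∀ f ∈ I, eval q f = 0 := fun f hf => by simpa [aeval_eq_eval] using hq f hf
    rw [map_mul]
    by_cases hqd : eval q c.det = 0
    · simp [aeval_eq_eval, hqd]
    · have := key q hq' hqd f hf
      rw [der_apply]
      simp only [aeval_eq_eval, map_sum, map_mul]
      rw [this, mul_zero]
  refine (hI.1.mem_or_mem hmul).resolve_left fun h => hdet (hp _ h)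

end Chart

theorem exists_chart {I : Ideal (MvPolynomial (Fin n) k)} {p : Fin n → k}
    (hp : finrank k (affTangent I p) = 2) : ∃ c : Chart I, eval p c.det ≠ 0 := by
  classical
  let W : Submodule k (Fin n → k) := (I.restrictScalars k).map (gradAt p)
  let u := finBasisOfFinrankEq k (affTangent I p) hp
  have hu : LinearIndependent k fun i => (u i : Fin n → k) :=
    u.linearIndependent.map' (affTangent I p).subtype (Submodule.ker_subtype _)
  obtain ⟨lam, hlam⟩ := exists_dual_family _ hu
  have hdual : ∀ w, (∀ i, ∑ l, (u i : Fin n → k) l * w l = 0) → w ∈ W := by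
    intro w hw
    refine mem_of_forall_dot W w fun μ hμ => ?_
    have hμT : μ ∈ affTangent I p := by
      intro f hf
      have := hμ _ (Submodule.mem_map_of_mem hf)
      rw [← this]
      exact Finset.sum_congr rfl fun l _ => by rw [gradAt_apply, mul_comm]
    have h2 := u.sum_repr ⟨μ, hμT⟩
    have h3 := congr_arg Subtype.val h2
    simp only [Submodule.coe_sum, Submodule.coe_smul] at h3
    rw [← h3]
    simp only [Finset.sum_apply, Pi.smul_apply, smul_eq_mul, Fin.sum_univ_two, add_mul, mul_assoc,
      Finset.sum_add_distrib, ← Finset.mul_sum, hw, mul_zero, add_zero]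
  have hWu : ∀ w ∈ W, ∀ i, ∑ l, (u i : Fin n → k) l * w l = 0 := by
    rintro _ ⟨f, hf, rfl⟩ i
    rw [← (u i).2 f hf]
    exact Finset.sum_congr rfl fun l _ => by rw [gradAt_apply, mul_comm]
  let w := finBasis k W
  have hsum : LinearIndependent k (Sum.elim (fun i => (w i : Fin n → k)) lam) := by
    have hl : ∀ c : Fin 2 → k, (∀ i, ∑ l, (u i : Fin n → k) l * (∑ j, c j • lam j) l = 0) →
        c = 0 := by
      intro c hc
      funext i
      have := hc i
      simp only [Fin.sum_univ_two, Pi.add_apply, Pi.smul_apply, smul_eq_mul, mul_add,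
        Finset.sum_add_distrib] at this
      have e : ∀ j, ∑ l, (u i : Fin n → k) l * (c j * lam j l) = c j * if j = i then 1 else 0 := by
        intro j
        rw [← hlam, Finset.mul_sum]
        exact Finset.sum_congr rfl fun _ _ => by ring
      rw [e, e] at this
      fin_cases i <;> simpa using this
    refine LinearIndependent.sum_type
      (w.linearIndependent.map' W.subtype (Submodule.ker_subtype _)) ?_ ?_
    · rw [Fintype.linearIndependent_iff]
      intro c hc
      exact congr_fun (hl c fun i => by rw [hc]; simp)
    · rw [Submodule.disjoint_def]
      intro x hx hx'
      have hxW : x ∈ W := by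
        refine Submodule.span_le.mpr ?_ hx
        rintro _ ⟨i, rfl⟩
        exact (w i).2
      obtain ⟨c, rfl⟩ := (Submodule.mem_span_range_iff_exists_fun k).mp hx'
      have := hl c (hWu _ hxW)
      simp [this]
  have hspan : ⊤ ≤ Submodule.span k (range (Sum.elim (fun i => (w i : Fin n → k)) lam)) := by
    intro x _
    have hx : x - ∑ j, (∑ l, (u j : Fin n → k) l * x l) • lam j ∈ W := by
      refine hdual _ fun i => ?_
      have e : ∀ j, ∑ l, (u i : Fin n → k) l * lam j l = if j = i then 1 else 0 := by
        intro j
        rw [← hlam]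
        exact Finset.sum_congr rfl fun _ _ => by ring
      simp only [Pi.sub_apply, Finset.sum_apply, Pi.smul_apply, smul_eq_mul, mul_sub,
        Finset.sum_sub_distrib, Finset.mul_sum]
      rw [Finset.sum_comm, sub_eq_zero]
      have e2 : ∀ j, ∑ l, (u i : Fin n → k) l * ((∑ l', (u j : Fin n → k) l' * x l') * lam j l) =
          (∑ l', (u j : Fin n → k) l' * x l') * if j = i then 1 else 0 := by
        intro j
        rw [← e, Finset.mul_sum]
        exact Finset.sum_congr rfl fun _ _ => by ring
      simp only [e2]
      simp
    rw [← sub_add_cancel x (∑ j, (∑ l, (u j : Fin n → k) l * x l) • lam j)]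
    refine add_mem ?_ (Submodule.sum_mem _ fun j _ => Submodule.smul_mem _ _
      (Submodule.subset_span ⟨Sum.inr j, rfl⟩))
    have h2 := congr_arg Subtype.val (w.sum_repr ⟨_, hx⟩)
    simp only [Submodule.coe_sum, Submodule.coe_smul] at h2
    rw [← h2]
    exact Submodule.sum_mem _ fun i _ => Submodule.smul_mem _ _
      (Submodule.subset_span ⟨Sum.inl i, rfl⟩)
  let b := Basis.mk hsum hspan
  let e := b.indexEquiv (Pi.basisFun k (Fin n))
  have hw : ∀ i, ∃ f ∈ I, gradAt p f = w i := fun i => (w i).2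
  choose f hfI hf using hw
  let G := Sum.elim f fun j => ∑ l, C (lam j l) * X l
  have hG : ∀ s, gradAt p (G s) = b s := by
    rintro (i | j)
    · simp [G, hf, b]
    · simp only [G, Sum.elim_inr, b, Basis.mk_apply]
      funext m
      rw [gradAt_apply]
      simp [pderiv_X, Pi.single_apply]
  refine ⟨⟨fun l => G (e.symm l), fun j => e (Sum.inr j), fun i j h => by simpa using h, ?_⟩, ?_⟩
  · intro l hl
    rcases hs : e.symm l with i | j
    · exact hfI i
    · exact absurd (by rw [← hs]; simp) (hl j)
  · have : LinearIndependent k (fun l => gradAt p (G (e.symm l))) := by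
      simp only [hG]
      exact b.linearIndependent.comp _ e.symm.injective
    have h2 := Matrix.linearIndependent_rows_iff_isUnit.mp
      (show LinearIndependent k (Matrix.of fun l => gradAt p (G (e.symm l))).row from this)
    rw [Matrix.isUnit_iff_isUnit_det, isUnit_iff_ne_zero] at h2
    convert h2
    rw [Chart.det, RingHom.map_det]
    congr 1

end

section

variable {k : Type} [Field k] {n : ℕ}

theorem sub_C_mem_span (p : Fin n → k) (f : MvPolynomial (Fin n) k) :
    f - C (eval p f) ∈ Ideal.span (range fun l => (X l - C (p l) : MvPolynomial (Fin n) k)) := by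
  induction f using MvPolynomial.induction_on with
  | C a => simp
  | add f g hf hg =>
    convert add_mem hf hg using 1
    simp only [map_add]; ring
  | mul_X f l hf =>
    have e : f * X l - C (eval p (f * X l)) =
        (f - C (eval p f)) * X l + C (eval p f) * (X l - C (p l)) := by
      simp only [map_mul, eval_X]; ring
    rw [e]
    exact add_mem (Ideal.mul_mem_right _ _ hf)
      (Ideal.mul_mem_left _ _ (Ideal.subset_span ⟨l, rfl⟩))

theorem mem_sq_of_gradAt_eq_zero (p : Fin n → k) (f : MvPolynomial (Fin n) k)
    (hf : eval p f = 0) (hg : gradAt p f = 0) :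
    f ∈ (RingHom.ker (aeval p : MvPolynomial (Fin n) k →ₐ[k] k)) ^ 2 := by
  have h := sub_C_mem_span p f
  rw [hf, map_zero, sub_zero, Ideal.mem_span_range_iff_exists_fun] at h
  obtain ⟨c, rfl⟩ := h
  rw [pow_two]
  refine Ideal.sum_mem _ fun l _ => Ideal.mul_mem_mul ?_ ?_
  · rw [RingHom.mem_ker, aeval_eq_eval]
    have := congr_fun hg l
    rw [gradAt_apply] at this
    simpa [Derivation.leibniz, pderiv_X, Pi.single_apply, mul_comm, apply_ite (eval p)] using this
  · rw [RingHom.mem_ker, aeval_eq_eval]; simp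

namespace Chart
variable {I : Ideal (MvPolynomial (Fin n) k)} (c : Chart I)

/-- The derivations of the coordinate ring defined by a chart. -/
theorem exists_lift_der [IsAlgClosed k] (hI : IsSurf I) {p : Fin n → k}
    (hp : ∀ f ∈ I, eval p f = 0) (hdet : eval p c.det ≠ 0) (j : Fin 2) :
    ∃ D : Derivation k (MvPolynomial (Fin n) k ⧸ I) (MvPolynomial (Fin n) k ⧸ I),
      ∀ f, D (Ideal.Quotient.mk I f) = Ideal.Quotient.mk I (c.der j f) := by
  have hd : ∀ x, Ideal.Quotient.mkₐ k I x = 0 → Ideal.Quotient.mkₐ k I (c.der j x) = 0 := by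
    intro x hx
    exact Ideal.Quotient.eq_zero_iff_mem.mpr
      (c.der_mem hI hp hdet j (Ideal.Quotient.eq_zero_iff_mem.mp hx))
  exact ⟨Derivation.liftOfSurjective (Ideal.Quotient.mkₐ_surjective k I) hd,
    fun f => Derivation.liftOfSurjective_apply (Ideal.Quotient.mkₐ_surjective k I) hd f⟩

/-- Evaluation of the coordinate ring at a point. -/
noncomputable def _root_.PinchPaper.quotEval (I : Ideal (MvPolynomial (Fin n) k)) (p : Fin n → k)
    (hp : ∀ f ∈ I, eval p f = 0) : (MvPolynomial (Fin n) k ⧸ I) →ₐ[k] k :=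
  Ideal.Quotient.liftₐ I (aeval p) fun f hf => by rw [aeval_eq_eval]; exact hp f hf

theorem _root_.PinchPaper.quotEval_mk (I : Ideal (MvPolynomial (Fin n) k)) (p : Fin n → k)
    (hp : ∀ f ∈ I, eval p f = 0) (f : MvPolynomial (Fin n) k) :
    quotEval I p hp (Ideal.Quotient.mk I f) = eval p f := by
  rw [← coe_aeval_eq_eval]
  rfl

theorem exists_localParam [IsAlgClosed k] (hI : IsSurf I) {p : Fin n → k}
    (hp : ∀ f ∈ I, eval p f = 0) (hdet : eval p c.det ≠ 0) :
    ∃ T : LocalParam k (MvPolynomial (Fin n) k ⧸ I), T.ev = quotEval I p hp ∧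
      (∀ j, T.t j = Ideal.Quotient.mk I (c.g (c.i j) - C (eval p (c.g (c.i j))))) ∧
      ∀ j f, eval p c.det * T.ev (T.D j (Ideal.Quotient.mk I f)) = eval p (c.der j f) := by
  choose D hD using c.exists_lift_der hI hp hdet
  refine ⟨⟨quotEval I p hp, fun j => Ideal.Quotient.mk I (c.g (c.i j) - C (eval p (c.g (c.i j)))),
    fun j => (eval p c.det)⁻¹ • D j, fun j => ?_, ?_, fun i j => ?_⟩, rfl, fun _ => rfl,
    fun j f => ?_⟩
  · rw [quotEval_mk]; simp
  · intro a ha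
    obtain ⟨f, rfl⟩ := Ideal.Quotient.mk_surjective a
    have hf : eval p f = 0 := by
      have := RingHom.mem_ker.mp ha
      rwa [quotEval_mk] at this
    have hd : (c.mat.map (eval p)).det ≠ 0 := by
      rwa [← RingHom.mapMatrix_apply, ← RingHom.map_det]
    let r := Matrix.vecMul (gradAt p f) (c.mat.map (eval p))⁻¹
    have hr : ∀ m, ∑ l, r l * eval p (pderiv m (c.g l)) = gradAt p f m := by
      intro m
      have : Matrix.vecMul r (c.mat.map (eval p)) = gradAt p f := by
        rw [Matrix.vecMul_vecMul, Matrix.nonsing_inv_mul _ (isUnit_iff_ne_zero.mpr hd),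
          Matrix.vecMul_one]
      exact congr_fun this m
    let h := f - ∑ l, C (r l) * (c.g l - C (eval p (c.g l)))
    have hh : h ∈ (RingHom.ker (aeval p : MvPolynomial (Fin n) k →ₐ[k] k)) ^ 2 := by
      refine mem_sq_of_gradAt_eq_zero p h (by simp [h, hf]) ?_
      funext m
      rw [gradAt_apply]
      have := hr m
      rw [gradAt_apply] at this
      simp [h, Derivation.leibniz, this]
    have e : Ideal.Quotient.mk I f = Ideal.Quotient.mk I (∑ l, C (r l) *
        (c.g l - C (eval p (c.g l)))) + Ideal.Quotient.mk I h := by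
      rw [← map_add]; congr 1; simp only [h]; ring
    rw [e]
    refine add_mem (Ideal.mem_sup_left ?_) (Ideal.mem_sup_right ?_)
    · rw [map_sum]
      refine Ideal.sum_mem _ fun l _ => ?_
      rw [map_mul]
      refine Ideal.mul_mem_left _ _ ?_
      by_cases hl : ∃ j, l = c.i j
      · obtain ⟨j, rfl⟩ := hl
        exact Ideal.subset_span ⟨j, rfl⟩
      · push Not at hl
        have h1 := c.mem l hl
        rw [hp _ h1, map_zero, sub_zero, Ideal.Quotient.eq_zero_iff_mem.mpr h1]
        exact zero_mem _
    · have := Ideal.mem_map_of_mem (Ideal.Quotient.mk I) hh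
      rw [Ideal.map_pow] at this
      refine Ideal.pow_right_mono ?_ 2 this
      rw [Ideal.map_le_iff_le_comap]
      intro x hx
      rw [Ideal.mem_comap, RingHom.mem_ker, quotEval_mk]
      have := RingHom.mem_ker.mp hx
      rwa [aeval_eq_eval] at this
  · change quotEval I p hp ((eval p c.det)⁻¹ • D i _) = _
    rw [hD, map_smul, quotEval_mk, map_sub, ← algebraMap_eq, Derivation.map_algebraMap, sub_zero,
      c.der_g]
    by_cases hij : i = j
    · subst hij; simp [hdet]
    · have : j ≠ i := fun h => hij h.symm
      simp [c.inj.eq_iff, hij, this]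
  · change _ * quotEval I p hp ((eval p c.det)⁻¹ • D j _) = _
    rw [hD, map_smul, quotEval_mk, smul_eq_mul, mul_inv_cancel_left₀ hdet]

theorem exists_diffBasis [IsAlgClosed k] (hI : IsSurf I) {p : Fin n → k}
    (hp : ∀ f ∈ I, eval p f = 0) (hdet : eval p c.det ≠ 0)
    (K : Type) [Field K] [Algebra k K] [Algebra (MvPolynomial (Fin n) k ⧸ I) K]
    [IsScalarTower k (MvPolynomial (Fin n) k ⧸ I) K]
    [IsFractionRing (MvPolynomial (Fin n) k ⧸ I) K] :
    ∃ B : DiffBasis k K,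
      (∀ j, B.z j = algebraMap _ K (Ideal.Quotient.mk I (c.g (c.i j)))) ∧
      ∀ j f, algebraMap _ K (Ideal.Quotient.mk I c.det) *
        B.D j (algebraMap _ K (Ideal.Quotient.mk I f)) =
        algebraMap _ K (Ideal.Quotient.mk I (c.der j f)) := by
  have hprime := hI.1
  choose D hD using c.exists_lift_der hI hp hdet
  choose D' hD' using fun j => exists_derivation_extension (K := K) (D j)
  have hdI : Ideal.Quotient.mk I c.det ≠ 0 := fun h =>
    hdet (hp _ (Ideal.Quotient.eq_zero_iff_mem.mp h))
  have hdK : algebraMap _ K (Ideal.Quotient.mk I c.det) ≠ 0 := by simpa using hdI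
  refine ⟨⟨fun j => algebraMap _ K (Ideal.Quotient.mk I (c.g (c.i j))),
    fun j => (algebraMap _ K (Ideal.Quotient.mk I c.det))⁻¹ • D' j, fun i j => ?_,
    fun L _ _ _ _ δ hδ => ?_⟩, fun _ => rfl, fun j f => ?_⟩
  · rw [Derivation.smul_apply, hD', hD, c.der_g]
    by_cases hij : i = j
    · subst hij; simp [hdK]
    · have : j ≠ i := fun h => hij h.symm
      simp [c.inj.eq_iff, hij, this]
  · let ξ : Fin n → K := fun l => algebraMap _ K (Ideal.Quotient.mk I (X l))
    have hξ : ∀ f, aeval ξ f = algebraMap _ K (Ideal.Quotient.mk I f) := by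
      intro f
      have : (aeval ξ : MvPolynomial (Fin n) k →ₐ[k] K) =
          (IsScalarTower.toAlgHom k (MvPolynomial (Fin n) k ⧸ I) K).comp
            (Ideal.Quotient.mkₐ k I) := by
        ext l; simp [ξ]
      rw [this]; rfl
    have hall : ∀ f : MvPolynomial (Fin n) k, algebraMap K L (aeval ξ f) = aeval (fun l => algebraMap K L (ξ l)) f :=
      fun f => (aeval_algebraMap_apply L ξ f).symm
    have hv : (fun l => δ (ξ l)) = 0 := by
      refine c.eq_zero_of_dot (fun l => algebraMap K L (ξ l)) (fun l => δ (ξ l)) ?_ fun l => ?_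
      · rw [← hall, hξ]; simpa using hdI
      · have h1 := derivation_aeval_pderiv δ ξ (c.g l)
        simp only [Algebra.smul_def, hall] at h1
        rw [← h1]
        by_cases hl : ∃ j, l = c.i j
        · obtain ⟨j, rfl⟩ := hl
          rw [hξ]; exact hδ j
        · push Not at hl
          rw [hξ, Ideal.Quotient.eq_zero_iff_mem.mpr (c.mem l hl), map_zero, map_zero]
    have hA : ∀ a, δ (algebraMap (MvPolynomial (Fin n) k ⧸ I) K a) = 0 := by
      intro a
      obtain ⟨f, rfl⟩ := Ideal.Quotient.mk_surjective a
      rw [← hξ, derivation_aeval_pderiv δ ξ f]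
      refine Finset.sum_eq_zero fun l _ => ?_
      rw [show δ (ξ l) = 0 from congr_fun hv l, smul_zero]
    ext x
    obtain ⟨a, b, hb, rfl⟩ := IsFractionRing.div_surjective (A := MvPolynomial (Fin n) k ⧸ I) x
    rw [Derivation.leibniz_div, hA, hA]
    simp
  · rw [Derivation.smul_apply, hD', hD, smul_eq_mul, mul_inv_cancel_left₀ hdK]

end Chart

end

section

variable {k : Type} [Field k] {N : ℕ}

/-- The homogeneous forms vanishing on `Z`. -/
def forms (Z : Set (Pr k N)) : Set (MvPolynomial (Fin (N + 1)) k) :=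
  {f | (∃ d, f.IsHomogeneous d) ∧ ∀ q ∈ Z, Vanishes f q}

theorem eval_smul_of_isHomogeneous {σ : Type*} {f : MvPolynomial σ k} {d : ℕ}
    (hf : f.IsHomogeneous d) (c : k) (v : σ → k) : eval (c • v) f = c ^ d * eval v f := by
  have := aeval_smul_of_isHomogeneous hf c v
  rwa [aeval_eq_eval] at this

theorem vanishes_mk {f : MvPolynomial (Fin (N + 1)) k} {d : ℕ} (hf : f.IsHomogeneous d)
    {v : Fin (N + 1) → k} (hv : v ≠ 0) :
    Vanishes f (Projectivization.mk k v hv) ↔ eval v f = 0 := by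
  constructor
  · intro h; exact h v hv rfl
  · intro h w hw e
    obtain ⟨a, ha⟩ := (Projectivization.mk_eq_mk_iff' k w v hw hv).mp e
    rw [← ha, eval_smul_of_isHomogeneous hf, h, mul_zero]

theorem vanishes_iff_rep {f : MvPolynomial (Fin (N + 1)) k} {d : ℕ} (hf : f.IsHomogeneous d)
    (p : Pr k N) : Vanishes f p ↔ eval p.rep f = 0 := by
  conv_lhs => rw [← p.mk_rep]
  exact vanishes_mk hf _

theorem vanishes_mul {f g : MvPolynomial (Fin (N + 1)) k} (hf : ∃ d, f.IsHomogeneous d)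
    (hg : ∃ d, g.IsHomogeneous d) (p : Pr k N) :
    Vanishes (f * g) p ↔ Vanishes f p ∨ Vanishes g p := by
  obtain ⟨d, hf⟩ := hf
  obtain ⟨e, hg⟩ := hg
  rw [vanishes_iff_rep (hf.mul hg), vanishes_iff_rep hf, vanishes_iff_rep hg, map_mul, mul_eq_zero]

theorem IsAlgSet.mem_iff {Z : Set (Pr k N)} (h : IsAlgSet Z) {p : Pr k N} :
    p ∈ Z ↔ ∀ f ∈ forms Z, Vanishes f p := by
  obtain ⟨S, hS, rfl⟩ := h
  exact ⟨fun hp f hf => hf.2 p hp, fun hp f hf => hp f ⟨hS f hf, fun q hq => hq f hf⟩⟩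

theorem isAlgSet_vanishes {f : MvPolynomial (Fin (N + 1)) k} (hf : ∃ d, f.IsHomogeneous d) :
    IsAlgSet {p | Vanishes f p} :=
  ⟨{f}, by simpa using hf, by simp⟩

theorem isAlgSet_empty : IsAlgSet (∅ : Set (Pr k N)) := by
  refine ⟨{1}, by simpa using ⟨0, isHomogeneous_one _ _⟩, ?_⟩
  ext p
  simpa using fun h : Vanishes 1 p => by
    rw [vanishes_iff_rep (isHomogeneous_one _ _)] at h; simp at h

theorem IsAlgSet.inter {Z W : Set (Pr k N)} (hZ : IsAlgSet Z) (hW : IsAlgSet W) :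
    IsAlgSet (Z ∩ W) := by
  refine ⟨forms Z ∪ forms W, fun f hf => hf.elim And.left And.left, ?_⟩
  ext p
  rw [mem_inter_iff, hZ.mem_iff, hW.mem_iff]
  simp only [mem_union, mem_ofPred_eq]
  exact ⟨fun h f hf => hf.elim (h.1 f) (h.2 f), fun h => ⟨fun f hf => h f (.inl hf),
    fun f hf => h f (.inr hf)⟩⟩

theorem IsAlgSet.union {Z W : Set (Pr k N)} (hZ : IsAlgSet Z) (hW : IsAlgSet W) :
    IsAlgSet (Z ∪ W) := by
  refine ⟨{h | ∃ f ∈ forms Z, ∃ g ∈ forms W, h = f * g}, ?_, ?_⟩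
  · rintro _ ⟨f, ⟨⟨d, hf⟩, _⟩, g, ⟨⟨e, hg⟩, _⟩, rfl⟩
    exact ⟨_, hf.mul hg⟩
  · ext p
    rw [mem_union, hZ.mem_iff, hW.mem_iff]
    constructor
    · rintro h _ ⟨f, hf, g, hg, rfl⟩
      rw [vanishes_mul hf.1 hg.1]
      exact h.imp (fun h => h f hf) (fun h => h g hg)
    · intro h
      by_contra! hc
      obtain ⟨⟨f, hf, hfp⟩, g, hg, hgp⟩ := hc
      rcases (vanishes_mul hf.1 hg.1 p).mp (h _ ⟨f, hf, g, hg, rfl⟩) with h | h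
      exacts [hfp h, hgp h]

theorem IsVariety.or_of_mul {Z : Set (Pr k N)} (hZ : IsVariety Z)
    {f g : MvPolynomial (Fin (N + 1)) k} (hf : ∃ d, f.IsHomogeneous d)
    (hg : ∃ d, g.IsHomogeneous d) (h : ∀ q ∈ Z, Vanishes (f * g) q) :
    (∀ q ∈ Z, Vanishes f q) ∨ (∀ q ∈ Z, Vanishes g q) :=
  hZ.2.2 _ _ (isAlgSet_vanishes hf) (isAlgSet_vanishes hg)
    fun q hq => (vanishes_mul hf hg q).mp (h q hq)

/-- The property `P` holds on a nonempty principal open subset of `X`. -/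
def Gen (X : Set (Pr k N)) (P : Pr k N → Prop) : Prop :=
  ∃ g : MvPolynomial (Fin (N + 1)) k, (∃ d, g.IsHomogeneous d) ∧ (∃ q ∈ X, ¬ Vanishes g q) ∧
    ∀ x ∈ X, ¬ Vanishes g x → P x

theorem Gen.mono {X : Set (Pr k N)} {P Q : Pr k N → Prop} (h : Gen X P)
    (hPQ : ∀ x ∈ X, P x → Q x) : Gen X Q := by
  obtain ⟨g, h1, h2, h3⟩ := h
  exact ⟨g, h1, h2, fun x hx hg => hPQ x hx (h3 x hx hg)⟩

theorem Gen.and {X : Set (Pr k N)} (hX : IsVariety X) {P Q : Pr k N → Prop} (h : Gen X P)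
    (h' : Gen X Q) : Gen X fun x => P x ∧ Q x := by
  obtain ⟨f, h1, h2, h3⟩ := h
  obtain ⟨g, h1', h2', h3'⟩ := h'
  refine ⟨f * g, ?_, ?_, fun x hx hfg => ?_⟩
  · obtain ⟨d, h1⟩ := h1
    obtain ⟨e, h1'⟩ := h1'
    exact ⟨_, h1.mul h1'⟩
  · by_contra! hc
    rcases hX.or_of_mul h1 h1' hc with h | h
    · obtain ⟨q, hq, hn⟩ := h2
      exact hn (h q hq)
    · obtain ⟨q, hq, hn⟩ := h2'
      exact hn (h q hq)
  · rw [vanishes_mul h1 h1', not_or] at hfg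
    exact ⟨h3 x hx hfg.1, h3' x hx hfg.2⟩

theorem Gen.of_forall {X : Set (Pr k N)} (hX : X.Nonempty) {P : Pr k N → Prop}
    (h : ∀ x ∈ X, P x) : Gen X P := by
  obtain ⟨q, hq⟩ := hX
  refine ⟨1, ⟨0, isHomogeneous_one _ _⟩, ⟨q, hq, fun h => ?_⟩, fun x hx _ => h x hx⟩
  rw [vanishes_iff_rep (isHomogeneous_one _ _)] at h; simp at h

theorem Gen.forall_finite {X : Set (Pr k N)} (hX : IsVariety X) {α : Type*} {s : Set α}
    (hs : s.Finite) {P : α → Pr k N → Prop} (h : ∀ a ∈ s, Gen X (P a)) :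
    Gen X fun x => ∀ a ∈ s, P a x := by
  induction s, hs using Set.Finite.induction_on with
  | empty => exact Gen.of_forall hX.2.1 (by simp)
  | insert _ _ ih =>
    refine ((h _ (mem_insert _ _)).and hX (ih fun a ha => h a (mem_insert_of_mem _ ha))).mono ?_
    rintro x _ ⟨h1, h2⟩ a (rfl | ha)
    exacts [h1, h2 a ha]

theorem Gen.forGeneralPointOn {X : Set (Pr k N)} {P : Pr k N → Prop} (h : Gen X P) :
    ForGeneralPointOn X P := by
  obtain ⟨g, h1, ⟨q, hq, hn⟩, h3⟩ := h
  exact ⟨{p | Vanishes g p}, isAlgSet_vanishes h1, fun h => hn (h hq), fun x hx => h3 x hx.1 hx.2⟩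

/-! ### Noetherian decomposition -/

theorem IsAlgSet.induction {P : Set (Pr k N) → Prop}
    (ih : ∀ Z, IsAlgSet Z → (∀ W, IsAlgSet W → W ⊂ Z → P W) → P Z)
    {Z : Set (Pr k N)} (hZ : IsAlgSet Z) : P Z := by
  have key : ∀ J : Ideal (MvPolynomial (Fin (N + 1)) k), ∀ Z : Set (Pr k N), IsAlgSet Z →
      Ideal.span (forms Z) = J → P Z := by
    intro J
    induction J using WellFoundedGT.induction with
    | ind J hJ =>
      rintro Z hZ rfl
      refine ih Z hZ fun W hW hWZ => hJ _ ?_ W hW rfl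
      refine lt_of_le_of_ne (Ideal.span_mono fun f hf => ⟨hf.1, fun q hq => hf.2 q (hWZ.1 hq)⟩) ?_
      intro e
      refine hWZ.2 fun p hp => hW.mem_iff.mpr fun f hf => ?_
      have hf' : f ∈ Ideal.span (forms Z) := e ▸ Ideal.subset_span hf
      obtain ⟨d, hd⟩ := hf.1
      rw [vanishes_iff_rep hd]
      have : Ideal.span (forms Z) ≤ RingHom.ker (eval p.rep) := by
        rw [Ideal.span_le]
        rintro g ⟨⟨e, hg⟩, h⟩
        exact (vanishes_iff_rep hg p).mp (h p hp)
      exact this hf'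
  exact key _ Z hZ rfl

theorem IsAlgSet.exists_decomposition {Z : Set (Pr k N)} (hZ : IsAlgSet Z) :
    ∃ s : Set (Set (Pr k N)), s.Finite ∧ (∀ W ∈ s, IsVariety W ∧ W ⊆ Z) ∧ Z ⊆ ⋃₀ s := by
  refine IsAlgSet.induction (P := fun Z => ∃ s : Set (Set (Pr k N)), s.Finite ∧
    (∀ W ∈ s, IsVariety W ∧ W ⊆ Z) ∧ Z ⊆ ⋃₀ s) (fun Z hZ ih => ?_) hZ
  · by_cases hV : IsVariety Z
    · exact ⟨{Z}, finite_singleton _, by simpa using hV, by simp⟩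
    · rcases Z.eq_empty_or_nonempty with rfl | hne
      · exact ⟨∅, finite_empty, by simp, by simp⟩
      · have : ∃ Z₁ Z₂ : Set (Pr k N), IsAlgSet Z₁ ∧ IsAlgSet Z₂ ∧ Z ⊆ Z₁ ∪ Z₂ ∧ ¬ Z ⊆ Z₁ ∧
            ¬ Z ⊆ Z₂ := by
          by_contra! hc
          refine hV ⟨hZ, hne, fun Z₁ Z₂ h1 h2 h => ?_⟩
          by_contra! h'
          exact h'.2 (hc Z₁ Z₂ h1 h2 h h'.1)
        obtain ⟨Z₁, Z₂, h1, h2, h, hn1, hn2⟩ := this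
        obtain ⟨s, hs, hs1, hs2⟩ := ih (Z ∩ Z₁) (hZ.inter h1)
          ⟨inter_subset_left, fun h => hn1 fun x hx => (h hx).2⟩
        obtain ⟨t, ht, ht1, ht2⟩ := ih (Z ∩ Z₂) (hZ.inter h2)
          ⟨inter_subset_left, fun h => hn2 fun x hx => (h hx).2⟩
        refine ⟨s ∪ t, hs.union ht, ?_, ?_⟩
        · rintro W (hW | hW)
          · exact ⟨(hs1 W hW).1, (hs1 W hW).2.trans inter_subset_left⟩
          · exact ⟨(ht1 W hW).1, (ht1 W hW).2.trans inter_subset_left⟩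
        · intro x hx
          rw [sUnion_union]
          rcases h hx with h | h
          · exact .inl (hs2 ⟨hx, h⟩)
          · exact .inr (ht2 ⟨hx, h⟩)

/-! ### Curves -/

/-- An irreducible closed set of dimension at most one. -/
def IsCurveLike (B : Set (Pr k N)) : Prop :=
  IsVariety B ∧ ∀ W₁ W₂, IsVariety W₁ → IsVariety W₂ → W₁ ⊂ W₂ → ¬ W₂ ⊂ B

theorem isAlgSet_singleton (p : Pr k N) : IsAlgSet ({p} : Set (Pr k N)) := by
  refine ⟨{f | ∃ i j, f = C (p.rep j) * X i - C (p.rep i) * X j}, ?_, ?_⟩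
  · rintro _ ⟨i, j, rfl⟩
    exact ⟨1, (isHomogeneous_C_mul_X _ _).sub (isHomogeneous_C_mul_X _ _)⟩
  · ext q
    simp only [mem_singleton_iff, mem_ofPred_eq]
    have key : ∀ i j, Vanishes (C (p.rep j) * X i - C (p.rep i) * X j) q ↔
        p.rep j * q.rep i = p.rep i * q.rep j := by
      intro i j
      rw [vanishes_iff_rep ((isHomogeneous_C_mul_X _ _).sub (isHomogeneous_C_mul_X _ _))]
      simp [sub_eq_zero]
    constructor
    · rintro rfl _ ⟨i, j, rfl⟩
      rw [key, mul_comm]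
    · intro h
      have h' : ∀ i j, p.rep j * q.rep i = p.rep i * q.rep j :=
        fun i j => (key i j).mp (h _ ⟨i, j, rfl⟩)
      obtain ⟨j, hj⟩ := Function.ne_iff.mp p.rep_nonzero
      rw [← p.mk_rep, ← q.mk_rep, Projectivization.mk_eq_mk_iff']
      refine ⟨q.rep j / p.rep j, ?_⟩
      funext i
      have := h' i j
      simp only [Pi.smul_apply, smul_eq_mul, Pi.zero_apply] at hj ⊢
      field_simp
      linear_combination -this

theorem isVariety_singleton (p : Pr k N) : IsVariety ({p} : Set (Pr k N)) :=
  ⟨isAlgSet_singleton p, singleton_nonempty p, fun Z₁ Z₂ _ _ h => by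
    simpa using h⟩

theorem IsCurveLike.finite {B : Set (Pr k N)} (hB : IsCurveLike B) {Z : Set (Pr k N)}
    (hZ : IsAlgSet Z) (h : ¬ B ⊆ Z) : (B ∩ Z).Finite := by
  obtain ⟨s, hs, h1, h2⟩ := (hB.1.1.inter hZ).exists_decomposition
  refine (hs.sUnion fun W hW => ?_).subset h2
  obtain ⟨hV, hWZ⟩ := h1 W hW
  have hWB : W ⊂ B := ⟨fun x hx => (hWZ hx).1, fun hc => h fun x hx => (hWZ (hc hx)).2⟩
  obtain ⟨p, hp⟩ := hV.2.1
  have : W = {p} := by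
    by_contra hne
    exact hB.2 {p} W (isVariety_singleton p) hV
      (ssubset_of_subset_of_ne (by simpa using hp) (Ne.symm hne)) hWB
  rw [this]; exact finite_singleton p

theorem chain_le_of_hasDim {Z : Set (Pr k N)} {n : ℕ} (hZ : HasDim Z n)
    (s : LTSeries {W : Set (Pr k N) // IsVariety W ∧ W ⊆ Z}) : s.length ≤ n := by
  have := Order.LTSeries.length_le_krullDim s
  rw [hZ] at this
  exact_mod_cast this

theorem not_chain_of_hasDim {Z : Set (Pr k N)} {n : ℕ} (hZ : HasDim Z n)
    (W : Fin (n + 2) → Set (Pr k N)) (hW : ∀ i, IsVariety (W i) ∧ W i ⊆ Z) : ¬ StrictMono W := by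
  intro h
  have := chain_le_of_hasDim hZ (LTSeries.mk (n + 1) (fun i => ⟨W i, hW i⟩) fun i j hij => h hij)
  change n + 1 ≤ n at this
  omega

theorem isCurveLike_of_hasDim_one {Z : Set (Pr k N)} (hV : IsVariety Z) (hZ : HasDim Z 1) :
    IsCurveLike Z := by
  refine ⟨hV, fun W₁ W₂ h1 h2 h12 h2Z => not_chain_of_hasDim hZ ![W₁, W₂, Z] ?_ ?_⟩
  · simp [Fin.forall_fin_succ, h1, h2, hV, h2Z.1, h12.1.trans h2Z.1]
  · rw [Fin.strictMono_iff_lt_succ]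
    simp [Fin.forall_fin_succ, h12, h2Z]

theorem isCurveLike_of_ssubset {Z B : Set (Pr k N)} (hV : IsVariety Z) (hZ : HasDim Z 2)
    (hB : IsVariety B) (hBZ : B ⊂ Z) : IsCurveLike B := by
  refine ⟨hB, fun W₁ W₂ h1 h2 h12 h2B => not_chain_of_hasDim hZ ![W₁, W₂, B, Z] ?_ ?_⟩
  · simp [Fin.forall_fin_succ, h1, h2, hB, hV, hBZ.1, h2B.1.trans hBZ.1,
      h12.1.trans (h2B.1.trans hBZ.1)]
  · rw [Fin.strictMono_iff_lt_succ]
    simp [Fin.forall_fin_succ, h12, h2B, hBZ]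

theorem isAlgSet_finite {s : Set (Pr k N)} (hs : s.Finite) : IsAlgSet s := by
  induction s, hs using Set.Finite.induction_on with
  | empty => exact isAlgSet_empty
  | insert _ _ ih => exact (isAlgSet_singleton _).union ih

theorem IsVariety.eq_singleton_of_finite {W : Set (Pr k N)} (hW : IsVariety W) (hf : W.Finite) :
    ∃ p, W = {p} := by
  obtain ⟨p, hp⟩ := hW.2.1
  refine ⟨p, ?_⟩
  rcases hW.2.2 {p} (W \ {p}) (isAlgSet_singleton p) (isAlgSet_finite hf.diff)
    (by intro x hx; by_cases h : x = p <;> simp [h, hx]) with h | h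
  · exact h.antisymm (by simpa using hp)
  · exact absurd rfl (h hp).2

theorem infinite_of_hasDim {Z : Set (Pr k N)} {n : ℕ} (hZ : HasDim Z (n + 1)) :
    Z.Infinite := by
  intro hf
  have h1 : ((n + 1 : ℕ) : WithBot ℕ∞) ≤ Order.krullDim {W : Set (Pr k N) // IsVariety W ∧ W ⊆ Z} := by
    rw [hZ]; rfl
  obtain ⟨s, hs⟩ := Order.le_krullDim_iff.mp h1
  have h01 : (s 0).1 ⊂ (s ⟨1, by omega⟩).1 := s.strictMono (by simp [Fin.lt_def])
  obtain ⟨p, hp⟩ := (s ⟨1, by omega⟩).2.1.eq_singleton_of_finite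
    (hf.subset (s ⟨1, by omega⟩).2.2)
  rw [hp, ssubset_singleton_iff] at h01
  exact (s 0).2.1.2.1.ne_empty h01

end

section

variable {k : Type} [Field k] {N : ℕ}

/-- The nonzero vectors representing points of `Z`. -/
def cone (Z : Set (Pr k N)) : Set (Fin (N + 1) → k) :=
  {v | ∃ hv : v ≠ 0, Projectivization.mk k v hv ∈ Z}

theorem rep_mem_cone {Z : Set (Pr k N)} {p : Pr k N} (hp : p ∈ Z) : p.rep ∈ cone Z :=
  ⟨p.rep_nonzero, by rwa [p.mk_rep]⟩

theorem smul_mem_cone {Z : Set (Pr k N)} {v : Fin (N + 1) → k} (hv : v ∈ cone Z) {c : k}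
    (hc : c ≠ 0) : c • v ∈ cone Z := by
  obtain ⟨h0, h⟩ := hv
  refine ⟨smul_ne_zero hc h0, ?_⟩
  convert h using 1
  rw [Projectivization.mk_eq_mk_iff']
  exact ⟨c, rfl⟩

theorem mem_forms_iff {Z : Set (Pr k N)} {f : MvPolynomial (Fin (N + 1)) k}
    (hf : ∃ d, f.IsHomogeneous d) : f ∈ forms Z ↔ ∀ v ∈ cone Z, eval v f = 0 := by
  constructor
  · rintro h v ⟨hv, hZ⟩
    exact h.2 _ hZ v hv rfl
  · intro h
    refine ⟨hf, fun q hq => ?_⟩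
    obtain ⟨d, hd⟩ := hf
    rw [vanishes_iff_rep hd]
    exact h _ (rep_mem_cone hq)

theorem mem_cone_iff {Z : Set (Pr k N)} (hZ : IsAlgSet Z) {v : Fin (N + 1) → k} (hv : v ≠ 0) :
    v ∈ cone Z ↔ ∀ f ∈ forms Z, eval v f = 0 := by
  constructor
  · intro h f hf
    exact (mem_forms_iff hf.1).mp hf v h
  · intro h
    refine ⟨hv, hZ.mem_iff.mpr fun f hf => ?_⟩
    obtain ⟨d, hd⟩ := hf.1
    exact (vanishes_mk hd hv).mpr (h f hf)

theorem exists_homogenization (j : Fin (N + 1)) (f : MvPolynomial (Fin (N + 1)) k) :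
    ∃ D, ∃ F h : MvPolynomial (Fin (N + 1)) k, F.IsHomogeneous D ∧ F = f + (X j - 1) * h := by
  have key : ∀ m : ℕ, ∃ h : MvPolynomial (Fin (N + 1)) k, X j ^ m = 1 + (X j - 1) * h := by
    intro m
    obtain ⟨h, hh⟩ := sub_one_dvd_pow_sub_one (X j : MvPolynomial (Fin (N + 1)) k) m
    exact ⟨h, by rw [← hh]; ring⟩
  choose h hh using key
  refine ⟨f.totalDegree, ∑ d ∈ Finset.range (f.totalDegree + 1),
    X j ^ (f.totalDegree - d) * homogeneousComponent d f,
    ∑ d ∈ Finset.range (f.totalDegree + 1), h (f.totalDegree - d) * homogeneousComponent d f,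
    ?_, ?_⟩
  · refine IsHomogeneous.sum _ _ _ fun d hd => ?_
    have := (isHomogeneous_X_pow (R := k) j (f.totalDegree - d)).mul
      (homogeneousComponent_isHomogeneous d f)
    rwa [Nat.sub_add_cancel (by simpa [Nat.lt_succ_iff] using hd)] at this
  · conv_rhs => enter [1]; rw [← sum_homogeneousComponent f]
    rw [Finset.mul_sum, ← Finset.sum_add_distrib]
    refine Finset.sum_congr rfl fun d _ => ?_
    conv_lhs => rw [hh]
    ring

/-- The representatives of points of `Z` with `j`-th coordinate one. -/
def patch (Z : Set (Pr k N)) (j : Fin (N + 1)) : Set (Fin (N + 1) → k) := {v ∈ cone Z | v j = 1}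

/-- The ideal of `patch Z j`. -/
noncomputable def patchIdeal (Z : Set (Pr k N)) (j : Fin (N + 1)) :
    Ideal (MvPolynomial (Fin (N + 1)) k) :=
  ⨅ v ∈ patch Z j, RingHom.ker (eval v)

theorem mem_patchIdeal {Z : Set (Pr k N)} {j : Fin (N + 1)} {f : MvPolynomial (Fin (N + 1)) k} :
    f ∈ patchIdeal Z j ↔ ∀ v ∈ patch Z j, eval v f = 0 := by
  simp [patchIdeal, Submodule.mem_iInf, RingHom.mem_ker]

theorem X_sub_one_mem (Z : Set (Pr k N)) (j : Fin (N + 1)) : X j - 1 ∈ patchIdeal Z j := by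
  rw [mem_patchIdeal]
  intro v hv
  simp [hv.2]

theorem forms_subset_patchIdeal {Z : Set (Pr k N)} (j : Fin (N + 1)) {f} (hf : f ∈ forms Z) :
    f ∈ patchIdeal Z j :=
  mem_patchIdeal.mpr fun v hv => (mem_forms_iff hf.1).mp hf v hv.1

theorem exists_patch {Z : Set (Pr k N)} {v : Fin (N + 1) → k} (hv : v ∈ cone Z) {j : Fin (N + 1)}
    (hj : v j ≠ 0) : (v j)⁻¹ • v ∈ patch Z j :=
  ⟨smul_mem_cone hv (inv_ne_zero hj), by simp [hj]⟩

theorem X_mul_mem_forms {Z : Set (Pr k N)} {j : Fin (N + 1)} {F} (hF : ∃ d, F.IsHomogeneous d)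
    (h : F ∈ patchIdeal Z j) : X j * F ∈ forms Z := by
  obtain ⟨d, hd⟩ := hF
  rw [mem_forms_iff ⟨_, (isHomogeneous_X k j).mul hd⟩]
  intro v hv
  by_cases hj : v j = 0
  · simp [hj]
  · have := mem_patchIdeal.mp h _ (exists_patch hv hj)
    rw [eval_smul_of_isHomogeneous hd] at this
    have := (mul_eq_zero.mp this).resolve_left (pow_ne_zero _ (inv_ne_zero hj))
    simp [this]

theorem mem_forms_of_mem_patchIdeal {Z : Set (Pr k N)} (hZ : IsVariety Z) {j : Fin (N + 1)}
    (hne : (patch Z j).Nonempty) {F} (hF : ∃ d, F.IsHomogeneous d) :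
    F ∈ patchIdeal Z j ↔ F ∈ forms Z := by
  refine ⟨fun h => ?_, forms_subset_patchIdeal j⟩
  rcases hZ.or_of_mul ⟨1, isHomogeneous_X k j⟩ hF (X_mul_mem_forms hF h).2 with h | h
  · obtain ⟨v, ⟨hv, hvZ⟩, hj⟩ := hne
    have := (vanishes_mk (isHomogeneous_X k j) hv).mp (h _ hvZ)
    simp [hj] at this
  · exact ⟨hF, h⟩

theorem homogenization_mem_patchIdeal {Z : Set (Pr k N)} {j : Fin (N + 1)}
    {f h : MvPolynomial (Fin (N + 1)) k} :
    f + (X j - 1) * h ∈ patchIdeal Z j ↔ f ∈ patchIdeal Z j :=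
  Submodule.add_mem_iff_left _ (Ideal.mul_mem_right _ _ (X_sub_one_mem Z j))

theorem patchIdeal_isPrime {Z : Set (Pr k N)} (hZ : IsVariety Z) {j : Fin (N + 1)}
    (hne : (patch Z j).Nonempty) : (patchIdeal Z j).IsPrime := by
  constructor
  · rw [Ne, Ideal.eq_top_iff_one, mem_patchIdeal]
    obtain ⟨v, hv⟩ := hne
    intro h
    simpa using h v hv
  · intro f g hfg
    obtain ⟨d, F, a, hF, hFe⟩ := exists_homogenization j f
    obtain ⟨e, G, b, hG, hGe⟩ := exists_homogenization j g
    rw [← homogenization_mem_patchIdeal (h := a), ← hFe,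
      ← homogenization_mem_patchIdeal (f := g) (h := b), ← hGe,
      mem_forms_of_mem_patchIdeal hZ hne ⟨_, hF⟩, mem_forms_of_mem_patchIdeal hZ hne ⟨_, hG⟩]
    have : F * G ∈ forms Z := by
      rw [← mem_forms_of_mem_patchIdeal hZ hne ⟨_, hF.mul hG⟩, mem_patchIdeal]
      intro v hv
      have := mem_patchIdeal.mp hfg v hv
      rw [hFe, hGe]
      simpa [hv.2] using this
    exact (hZ.or_of_mul ⟨_, hF⟩ ⟨_, hG⟩ this.2).imp (fun h => ⟨⟨_, hF⟩, h⟩) fun h => ⟨⟨_, hG⟩, h⟩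

theorem mem_patch_iff {Z : Set (Pr k N)} (hZ : IsAlgSet Z) {j : Fin (N + 1)}
    {v : Fin (N + 1) → k} : v ∈ patch Z j ↔ ∀ f ∈ patchIdeal Z j, eval v f = 0 := by
  constructor
  · intro h f hf
    exact mem_patchIdeal.mp hf v h
  · intro h
    have hj : v j = 1 := by simpa [sub_eq_zero] using h _ (X_sub_one_mem Z j)
    have hv : v ≠ 0 := by rintro rfl; simp at hj
    exact ⟨(mem_cone_iff hZ hv).mpr fun f hf => h f (forms_subset_patchIdeal j hf), hj⟩

theorem Gen.of_notMem {Z : Set (Pr k N)} {j : Fin (N + 1)}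
    {g : MvPolynomial (Fin (N + 1)) k} (hg : g ∉ patchIdeal Z j) :
    Gen Z fun x => ∃ v ∈ patch Z j, eval v g ≠ 0 ∧ ∃ hv, x = Projectivization.mk k v hv := by
  obtain ⟨d, G, h, hG, e⟩ := exists_homogenization j g
  have hX := isHomogeneous_X k j
  refine ⟨X j * G, ⟨_, hX.mul hG⟩, ?_, ?_⟩
  · rw [mem_patchIdeal] at hg
    push Not at hg
    obtain ⟨v, hv, hvg⟩ := hg
    obtain ⟨⟨h0, hZ⟩, hj⟩ := hv
    refine ⟨_, hZ, ?_⟩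
    rw [vanishes_mk (hX.mul hG), e]
    simpa [hj] using hvg
  · intro x hx hn
    rw [vanishes_mul ⟨_, hX⟩ ⟨_, hG⟩, not_or, vanishes_iff_rep hX, vanishes_iff_rep hG, eval_X] at hn
    have hp := exists_patch (rep_mem_cone hx) hn.1
    refine ⟨_, hp, ?_, hp.1.1, ?_⟩
    · have h1 : eval ((x.rep j)⁻¹ • x.rep) G ≠ 0 := by
        rw [eval_smul_of_isHomogeneous hG]
        exact mul_ne_zero (pow_ne_zero _ (inv_ne_zero hn.1)) hn.2
      rw [e] at h1
      simpa [hn.1] using h1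
    · conv_lhs => rw [← x.mk_rep]
      rw [eq_comm, Projectivization.mk_eq_mk_iff']
      exact ⟨_, rfl⟩

/-! ### Tangent spaces -/

/-- The affine tangent space to the cone over `Z` at a vector. -/
noncomputable def tan (Z : Set (Pr k N)) (v : Fin (N + 1) → k) :
    Submodule k (Fin (N + 1) → k) :=
  ⨅ f ∈ forms Z, LinearMap.ker (diffAt f v)

theorem embTangent_eq (Z : Set (Pr k N)) (p : Pr k N) : embTangent Z p = tan Z p.rep := rfl

theorem diffAt_apply (f : MvPolynomial (Fin (N + 1)) k) (v w : Fin (N + 1) → k) :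
    diffAt f v w = ∑ l, eval v (pderiv l f) * w l := by
  simp [diffAt]

theorem mem_tan {Z : Set (Pr k N)} {v w : Fin (N + 1) → k} :
    w ∈ tan Z v ↔ ∀ f ∈ forms Z, ∑ l, eval v (pderiv l f) * w l = 0 := by
  simp [tan, Submodule.mem_iInf, diffAt_apply]

theorem sum_pderiv_smul {f : MvPolynomial (Fin (N + 1)) k} {d : ℕ} (hf : f.IsHomogeneous d) (c : k)
    (v w : Fin (N + 1) → k) : ∑ l, eval (c • v) (pderiv l f) * w l =
      c ^ (d - 1) * ∑ l, eval v (pderiv l f) * w l := by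
  rw [Finset.mul_sum]
  refine Finset.sum_congr rfl fun l _ => ?_
  rw [eval_smul_of_isHomogeneous hf.pderiv, mul_assoc]

theorem tan_smul (Z : Set (Pr k N)) {c : k} (hc : c ≠ 0) (v : Fin (N + 1) → k) :
    tan Z (c • v) = tan Z v := by
  ext w
  rw [mem_tan, mem_tan]
  refine forall₂_congr fun f hf => ?_
  obtain ⟨d, hd⟩ := hf.1
  rw [sum_pderiv_smul hd, mul_eq_zero, or_iff_right (pow_ne_zero _ hc)]

theorem sum_pderiv_self {f : MvPolynomial (Fin (N + 1)) k} {d : ℕ} (hf : f.IsHomogeneous d)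
    (v : Fin (N + 1) → k) : ∑ l, eval v (pderiv l f) * v l = d * eval v f := by
  have := congr_arg (eval v) hf.sum_X_mul_pderiv
  simpa [mul_comm] using this

theorem self_mem_tan {Z : Set (Pr k N)} {v : Fin (N + 1) → k} (hv : v ∈ cone Z) : v ∈ tan Z v := by
  rw [mem_tan]
  intro f hf
  obtain ⟨d, hd⟩ := hf.1
  rw [sum_pderiv_self hd, (mem_forms_iff hf.1).mp hf v hv, mul_zero]

theorem affTangent_patchIdeal {Z : Set (Pr k N)} {j : Fin (N + 1)} {v : Fin (N + 1) → k}
    (hv : v ∈ patch Z j) :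
    affTangent (patchIdeal Z j) v = tan Z v ⊓ LinearMap.ker (LinearMap.proj j) := by
  ext w
  rw [mem_affTangent, Submodule.mem_inf, mem_tan, LinearMap.mem_ker, LinearMap.proj_apply]
  constructor
  · intro h
    refine ⟨fun f hf => h f (forms_subset_patchIdeal j hf), ?_⟩
    have := h _ (X_sub_one_mem Z j)
    simpa [pderiv_X, Pi.single_apply, apply_ite (eval v)] using this
  · rintro ⟨h, hw⟩ f hf
    obtain ⟨d, F, g, hF, e⟩ := exists_homogenization j f
    have hFI : F ∈ patchIdeal Z j := by rwa [e, homogenization_mem_patchIdeal]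
    have h1 := h _ (X_mul_mem_forms ⟨_, hF⟩ hFI)
    have hFv := mem_patchIdeal.mp hFI v hv
    simp only [Derivation.leibniz, map_add, smul_eq_mul, map_mul, eval_X, hFv, zero_mul, add_zero,
      hv.2, one_mul] at h1
    rw [e] at h1
    simp only [Derivation.leibniz, map_add, smul_eq_mul, map_mul, eval_X, map_sub, map_one, sub_self,
      hv.2, zero_mul, zero_add, pderiv_X, Pi.single_apply, add_mul, Finset.sum_add_distrib] at h1
    simpa [apply_ite (eval v), hw] using h1

theorem finrank_tan {Z : Set (Pr k N)} (hZ : IsSmoothSurface Z) {v : Fin (N + 1) → k}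
    (hv : v ∈ cone Z) : finrank k (tan Z v) = 3 := by
  obtain ⟨h0, hv⟩ := hv
  have := hZ.2.2 _ hv
  rw [embTangent_eq] at this
  obtain ⟨a, ha⟩ := Projectivization.exists_smul_eq_mk_rep k v h0
  rw [← ha, Units.smul_def, tan_smul _ a.ne_zero] at this
  exact this

theorem IsSmoothSurface.isSurf {Z : Set (Pr k N)} (hZ : IsSmoothSurface Z) {j : Fin (N + 1)}
    (hne : (patch Z j).Nonempty) : IsSurf (patchIdeal Z j) := by
  refine ⟨patchIdeal_isPrime hZ.1 hne, fun p hp => ?_⟩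
  have hp' := (mem_patch_iff hZ.1.1).mpr hp
  rw [affTangent_patchIdeal hp']
  have h3 := finrank_tan hZ hp'.1
  let φ : tan Z p →ₗ[k] k := (LinearMap.proj j : (Fin (N + 1) → k) →ₗ[k] k).comp (tan Z p).subtype
  have hφ : Function.Surjective φ := by
    intro c
    refine ⟨c • ⟨p, self_mem_tan hp'.1⟩, ?_⟩
    simp [φ, hp'.2]
  have h1 := LinearMap.finrank_range_add_finrank_ker φ
  rw [LinearMap.range_eq_top.mpr hφ, finrank_top, finrank_self, h3] at h1
  have h2 : finrank k (LinearMap.ker φ) =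
      finrank k (tan Z p ⊓ LinearMap.ker (LinearMap.proj j) : Submodule k (Fin (N + 1) → k)) := by
    rw [← Submodule.map_comap_subtype, LinearMap.ker_comp]
    exact (Submodule.equivMapOfInjective _ (Submodule.injective_subtype _) _).finrank_eq
  omega

end

section

theorem exists_center {k K : Type} [Field k] [IsAlgClosed k] [Field K] [Algebra k K]
    (V : ValuationSubring K) (hV : ∀ a : k, algebraMap k K a ∈ V) {σ : Type} [Finite σ]
    (c : σ → K) (hc : ∀ i, c i ∈ V) (g : MvPolynomial σ k) (hg : V.valuation (aeval c g) = 1) :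
    ∃ e : σ → k, eval e g ≠ 0 ∧
      ∀ f : MvPolynomial σ k, V.valuation (aeval c f) < 1 → eval e f = 0 := by
  let φ : k →+* V := (algebraMap k K).codRestrict V.toSubring hV
  let _ : Algebra k V := φ.toAlgebra
  let ι : V →ₐ[k] K := { V.subtype with commutes' := fun _ => rfl }
  let π : V →ₐ[k] IsLocalRing.ResidueField V :=
    { IsLocalRing.residue V with commutes' := fun _ => rfl }
  let c' : σ → V := fun i => ⟨c i, hc i⟩
  have h1 : ∀ f, ((aeval c' f : V) : K) = aeval c f := fun f => algHom_aeval ι c' f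
  have h2 : ∀ f, aeval (fun i => π (c' i)) f = π (aeval c' f) :=
    fun f => (algHom_aeval π c' f).symm
  have h3 : ∀ f : MvPolynomial σ k, aeval (fun i => π (c' i)) f = 0 ↔ V.valuation (aeval c f) < 1 := by
    intro f
    rw [h2, ← h1, ← V.valuation_lt_one_iff]
    exact IsLocalRing.residue_eq_zero_iff _
  obtain ⟨e, he, h⟩ := exists_point_of_field_point (fun i => π (c' i)) g
    (by rw [Ne, h3, hg]; exact lt_irrefl _)
  exact ⟨e, he, fun f hf => h f ((h3 f).mpr hf)⟩

theorem exists_valuation_of_specialization {k K : Type} [Field k] [Field K] [Algebra k K]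
    {σ : Type} (c : σ → K) (y : σ → k)
    (h : ∀ f : MvPolynomial σ k, aeval c f = 0 → eval y f = 0) :
    ∃ V : ValuationSubring K, (∀ f : MvPolynomial σ k, aeval c f ∈ V) ∧
      ∀ f : MvPolynomial σ k, eval y f = 0 → V.valuation (aeval c f) < 1 := by
  let A : Subring K := (aeval (R := k) c).toRingHom.range
  let I : Ideal (MvPolynomial σ k) := RingHom.ker (eval y)
  let ρ : MvPolynomial σ k →+* A := (aeval (R := k) c).toRingHom.rangeRestrict
  have hρ : Function.Surjective ρ := RingHom.rangeRestrict_surjective _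
  have hI : I.map ρ ≠ ⊤ := by
    intro e
    have := (Ideal.eq_top_iff_one _).mp e
    obtain ⟨f, hf, h1⟩ := (Ideal.mem_map_iff_of_surjective ρ hρ).mp this
    have h2 : aeval c f = 1 := congr_arg Subtype.val h1
    have h3 := h (f - 1) (by rw [map_sub, h2, map_one, sub_self])
    rw [map_sub, map_one, sub_eq_zero] at h3
    exact one_ne_zero (h3.symm.trans hf)
  obtain ⟨V, hV1, hV2⟩ := Ideal.image_subset_nonunits_valuationSubring _ hI
  refine ⟨V, fun f => hV1 ⟨f, rfl⟩, fun f hf => ?_⟩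
  exact V.mem_nonunits_iff.mp (hV2 ⟨ρ f, Ideal.mem_map_of_mem _ hf, rfl⟩)

open Polynomial Algebra in
theorem exists_valuation_of_not_isIntegral {A K : Type} [CommRing A] [Field K] [Algebra A K]
    (m : Ideal A) (hm : m ≠ ⊤) (x : K) (hx : ∀ s ∉ m, ¬ IsIntegral A (s • x)) :
    ∃ V : ValuationSubring K, (∀ a, algebraMap A K a ∈ V) ∧
      (∀ a ∈ m, V.valuation (algebraMap A K a) < 1) ∧ x ∉ V := by
  have h1 : (1 : A) ∉ m := fun h => hm ((Ideal.eq_top_iff_one _).mpr h)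
  have hx0 : x ≠ 0 := by
    rintro rfl
    exact hx 1 h1 (by rw [smul_zero]; exact isIntegral_zero)
  let _ := invertibleOfNonzero (inv_ne_zero hx0)
  let B := Algebra.adjoin A {x⁻¹}
  let xinv : B.toSubring := ⟨x⁻¹, Algebra.subset_adjoin rfl⟩
  have : m.map (algebraMap A B) + .span {xinv} ≠ ⊤ := by
    intro eq
    obtain ⟨p, hp, hpx⟩ := exists_aeval_invOf_eq_zero_of_idealMap_adjoin_sup_span_eq_top x⁻¹ m hm eq
    refine hx p.leadingCoeff (fun h => h1 ?_) (isIntegral_leadingCoeff_smul p x (by simpa using hpx))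
    simpa using sub_mem h hp
  obtain ⟨V, hV1, hV2⟩ := Ideal.image_subset_nonunits_valuationSubring (A := B.toSubring) _ this
  refine ⟨V, fun a => hV1 (B.algebraMap_mem a), fun a ha => ?_, ?_⟩
  · exact V.mem_nonunits_iff.mp (hV2 ⟨_, le_self_add (α := Ideal B) (Ideal.mem_map_of_mem _ ha), rfl⟩)
  · exact (V.inv_mem_nonunits_iff.mp <|
      hV2 ⟨_, le_add_self (α := Ideal B) (Ideal.subset_span rfl), rfl⟩).resolve_left hx0

end

section

variable {k : Type} [Field k] {M N : ℕ}

/-- The value of a tuple of polynomials. -/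
noncomputable def evalV (F : Fin (N + 1) → MvPolynomial (Fin (M + 1)) k) (v : Fin (M + 1) → k) :
    Fin (N + 1) → k := fun i => eval v (F i)

/-- A tuple of forms of the same degree which represents `φ` wherever it does not vanish. -/
def IsRep (X : Set (Pr k M)) (φ : Pr k M → Pr k N)
    (F : Fin (N + 1) → MvPolynomial (Fin (M + 1)) k) : Prop :=
  (∃ d, ∀ i, (F i).IsHomogeneous d) ∧ ∀ v ∈ cone X, ∀ (hv : v ≠ 0) (hF : evalV F v ≠ 0),
    φ (Projectivization.mk k v hv) = Projectivization.mk k (evalV F v) hF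

theorem localRep_iff {X : Set (Pr k M)} {φ : Pr k M → Pr k N} {p : Pr k M}
    {F : Fin (N + 1) → MvPolynomial (Fin (M + 1)) k} :
    LocalRep X φ p F ↔ IsRep X φ F ∧ evalV F p.rep ≠ 0 := by
  constructor
  · rintro ⟨h1, h2, h3⟩
    exact ⟨⟨h1, fun v ⟨_, hX⟩ hv hF => h3 _ hX v hv rfl hF⟩, h2⟩
  · rintro ⟨⟨h1, h3⟩, h2⟩
    refine ⟨h1, h2, ?_⟩
    rintro q hq v hv rfl hF
    exact h3 v ⟨hv, hq⟩ hv hF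

theorem evalV_smul {F : Fin (N + 1) → MvPolynomial (Fin (M + 1)) k} {d : ℕ}
    (hF : ∀ i, (F i).IsHomogeneous d) (c : k) (v : Fin (M + 1) → k) :
    evalV F (c • v) = c ^ d • evalV F v := by
  funext i
  exact eval_smul_of_isHomogeneous (hF i) c v

theorem exists_rep {X : Set (Pr k M)} {φ : Pr k M → Pr k N} (hφ : IsMorphismOn X φ)
    {v : Fin (M + 1) → k} (hv : v ∈ cone X) : ∃ F, IsRep X φ F ∧ evalV F v ≠ 0 := by
  obtain ⟨h0, hX⟩ := hv
  obtain ⟨F, hF⟩ := hφ _ hX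
  obtain ⟨h1, h2⟩ := localRep_iff.mp hF
  obtain ⟨d, hd⟩ := h1.1
  refine ⟨F, h1, fun h => h2 ?_⟩
  obtain ⟨a, ha⟩ := Projectivization.exists_smul_eq_mk_rep k v h0
  rw [← ha, Units.smul_def, evalV_smul hd, h, smul_zero]

theorem IsRep.mem_image {X Z : Set (Pr k M)} (hZX : Z ⊆ X) {φ : Pr k M → Pr k N} {F}
    (hF : IsRep X φ F) {v : Fin (M + 1) → k} (hv : v ∈ cone Z) (h0 : evalV F v ≠ 0) :
    evalV F v ∈ cone (φ '' Z) := by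
  obtain ⟨hv0, hvZ⟩ := hv
  exact ⟨h0, _, hvZ, hF.2 v ⟨hv0, hZX hvZ⟩ hv0 h0⟩

theorem IsRep.cross {X : Set (Pr k M)} {φ : Pr k M → Pr k N} {F F'}
    (hF : IsRep X φ F) (hF' : IsRep X φ F') {v : Fin (M + 1) → k} (hv : v ∈ cone X)
    (a b : Fin (N + 1)) : eval v (F a) * eval v (F' b) = eval v (F b) * eval v (F' a) := by
  by_cases h : evalV F v = 0
  · have h1 : ∀ i, eval v (F i) = 0 := fun i => congr_fun h i
    simp [h1]
  by_cases h' : evalV F' v = 0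
  · have h1 : ∀ i, eval v (F' i) = 0 := fun i => congr_fun h' i
    simp [h1]
  obtain ⟨c, hc⟩ := (Projectivization.mk_eq_mk_iff' k _ _ h h').mp
    ((hF.2 v hv hv.1 h).symm.trans (hF'.2 v hv hv.1 h'))
  have h1 : ∀ i, eval v (F i) = c * eval v (F' i) := fun i => (congr_fun hc i).symm
  rw [h1, h1]; ring

theorem eval_aeval_tuple (F : Fin (N + 1) → MvPolynomial (Fin (M + 1)) k) (v : Fin (M + 1) → k)
    (f : MvPolynomial (Fin (N + 1)) k) : eval v (aeval F f) = eval (evalV F v) f := by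
  have := algHom_aeval (aeval v : MvPolynomial (Fin (M + 1)) k →ₐ[k] k) F f
  change _ = eval (fun i => eval v (F i)) f
  simpa [aeval_eq_eval] using this

theorem isHomogeneous_aeval {F : Fin (N + 1) → MvPolynomial (Fin (M + 1)) k} {d : ℕ}
    (hF : ∀ i, (F i).IsHomogeneous d) {f : MvPolynomial (Fin (N + 1)) k}
    (hf : ∃ e, f.IsHomogeneous e) : ∃ e, (aeval F f).IsHomogeneous e := by
  obtain ⟨e, he⟩ := hf
  exact ⟨_, he.aeval _ hF⟩

theorem IsRep.mem_forms_iff {X Z : Set (Pr k M)} (hZX : Z ⊆ X) (hZ : IsVariety Z)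
    {φ : Pr k M → Pr k N} (hφ : IsMorphismOn X φ) {F} (hF : IsRep X φ F) {v₀ : Fin (M + 1) → k}
    (hv₀ : v₀ ∈ cone Z) (h0 : evalV F v₀ ≠ 0) {f} (hf : ∃ e, f.IsHomogeneous e) :
    f ∈ forms (φ '' Z) ↔ aeval F f ∈ forms Z := by
  obtain ⟨d, hd⟩ := hF.1
  obtain ⟨e, he⟩ := hf
  rw [PinchPaper.mem_forms_iff (isHomogeneous_aeval hd ⟨e, he⟩),
    PinchPaper.mem_forms_iff ⟨e, he⟩]
  constructor
  · intro h v hv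
    rw [eval_aeval_tuple]
    by_cases hv0 : evalV F v = 0
    · have h1 := h _ (hF.mem_image hZX hv₀ h0)
      have h2 := eval_smul_of_isHomogeneous he 0 (evalV F v₀)
      rwa [zero_smul, h1, mul_zero, ← hv0] at h2
    · exact h _ (hF.mem_image hZX hv hv0)
  · rintro h y ⟨hy0, q, hq, hqy⟩
    obtain ⟨F', hF', hF'q⟩ := exists_rep hφ (rep_mem_cone (hZX hq))
    obtain ⟨d', hd'⟩ := hF'.1
    obtain ⟨a, ha⟩ := Function.ne_iff.mp h0
    have key : ∀ q ∈ Z, Vanishes (F a ^ e * aeval F' f) q := by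
      have hom : ∃ m, (F a ^ e * aeval F' f).IsHomogeneous m := by
        obtain ⟨m, hm⟩ := isHomogeneous_aeval hd' ⟨e, he⟩
        exact ⟨_, ((hd a).pow e).mul hm⟩
      refine ((PinchPaper.mem_forms_iff (Z := Z) hom).mpr fun u hu => ?_).2
      rw [map_mul, map_pow, eval_aeval_tuple, ← eval_smul_of_isHomogeneous he]
      have : eval u (F a) • evalV F' u = eval u (F' a) • evalV F u := by
        funext b
        have := hF.cross hF' ⟨hu.1, hZX hu.2⟩ a b
        simp only [Pi.smul_apply, smul_eq_mul, evalV]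
        rw [this, mul_comm]
      rw [this, eval_smul_of_isHomogeneous he, ← eval_aeval_tuple, h u hu, mul_zero]
    rcases hZ.or_of_mul ⟨_, (hd a).pow e⟩ (isHomogeneous_aeval hd' ⟨e, he⟩) key with h1 | h1
    · obtain ⟨hv, hvZ⟩ := hv₀
      have := (vanishes_mk ((hd a).pow e) hv).mp (h1 _ hvZ)
      rw [map_pow] at this
      exact absurd (eq_zero_of_pow_eq_zero this) ha
    · obtain ⟨m, hm⟩ := isHomogeneous_aeval hd' ⟨e, he⟩
      have h2 := (vanishes_iff_rep hm q).mp (h1 q hq)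
      rw [eval_aeval_tuple] at h2
      have h3 := hF'.2 q.rep (rep_mem_cone (hZX hq)) q.rep_nonzero hF'q
      rw [q.mk_rep, hqy] at h3
      obtain ⟨c, hc⟩ := (Projectivization.mk_eq_mk_iff' k _ _ _ _).mp h3
      rw [← hc, eval_smul_of_isHomogeneous he, h2, mul_zero]

/-! ### Jacobians -/

theorem jacobian_apply (F : Fin (N + 1) → MvPolynomial (Fin (M + 1)) k)
    (v w : Fin (M + 1) → k) (i : Fin (N + 1)) :
    jacobian F v w i = ∑ l, eval v (pderiv l (F i)) * w l := by
  simp [jacobian, Matrix.mulVec, dotProduct]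

theorem jacobian_self {F : Fin (N + 1) → MvPolynomial (Fin (M + 1)) k} {d : ℕ}
    (hF : ∀ i, (F i).IsHomogeneous d) (v : Fin (M + 1) → k) :
    jacobian F v v = (d : k) • evalV F v := by
  funext i
  rw [jacobian_apply, sum_pderiv_self (hF i)]
  rfl

theorem jacobian_smul {F : Fin (N + 1) → MvPolynomial (Fin (M + 1)) k} {d : ℕ}
    (hF : ∀ i, (F i).IsHomogeneous d) (c : k) (v w : Fin (M + 1) → k) :
    jacobian F (c • v) w = c ^ (d - 1) • jacobian F v w := by
  funext i
  rw [jacobian_apply, sum_pderiv_smul (hF i)]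
  simp [jacobian_apply]

variable {V : Type} [AddCommGroup V] [Module k V]

/-- The differential of `L ∘ φ` is injective at the point of `v`. -/
def GoodAt (X : Set (Pr k M)) (φ : Pr k M → Pr k N) (L : (Fin (N + 1) → k) →ₗ[k] V)
    (v : Fin (M + 1) → k) : Prop :=
  ∃ F, IsRep X φ F ∧ evalV F v ≠ 0 ∧ ∀ w ∈ tan X v, L (jacobian F v w) = 0 → w = 0

theorem GoodAt.smul {X : Set (Pr k M)} {φ : Pr k M → Pr k N} {L : (Fin (N + 1) → k) →ₗ[k] V}
    {v : Fin (M + 1) → k} (h : GoodAt X φ L v) {c : k} (hc : c ≠ 0) : GoodAt X φ L (c • v) := by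
  obtain ⟨F, hF, h0, h⟩ := h
  obtain ⟨d, hd⟩ := hF.1
  refine ⟨F, hF, ?_, fun w hw hL => ?_⟩
  · rw [evalV_smul hd]; exact smul_ne_zero (pow_ne_zero _ hc) h0
  · rw [tan_smul X hc] at hw
    rw [jacobian_smul hd, map_smul, smul_eq_zero, or_iff_right (pow_ne_zero _ hc)] at hL
    exact h w hw hL

theorem not_ramifiedAt_iff {X : Set (Pr k M)} (hX : IsSmoothSurface X) {φ : Pr k M → Pr k N}
    {p : Pr k M} (hp : p ∈ X) : ¬ RamifiedAt X φ p ↔ GoodAt X φ LinearMap.id p.rep := by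
  have h3 : finrank k (tan X p.rep) = 3 := finrank_tan hX (rep_mem_cone hp)
  have hmap : ∀ F : Fin (N + 1) → MvPolynomial (Fin (M + 1)) k,
      finrank k ((tan X p.rep).map (jacobian F p.rep)) =
        finrank k (LinearMap.range ((jacobian F p.rep).domRestrict (tan X p.rep))) := fun F =>
    (LinearEquiv.ofEq _ _ (LinearMap.range_domRestrict _ _).symm).finrank_eq
  simp only [RamifiedAt, embTangent_eq, not_forall, not_le, localRep_iff, GoodAt,
    LinearMap.id_apply]
  constructor
  · rintro ⟨F, ⟨h1, h2⟩, h⟩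
    refine ⟨F, h1, h2, fun w hw hJ => ?_⟩
    have h : 2 < finrank k ((tan X p.rep).map (jacobian F p.rep)) := h
    rw [hmap] at h
    have hr := LinearMap.finrank_range_add_finrank_ker ((jacobian F p.rep).domRestrict (tan X p.rep))
    rw [h3] at hr
    have hk : LinearMap.ker ((jacobian F p.rep).domRestrict (tan X p.rep)) = ⊥ :=
      Submodule.finrank_eq_zero.mp (by omega)
    have : (⟨w, hw⟩ : tan X p.rep) ∈ LinearMap.ker ((jacobian F p.rep).domRestrict (tan X p.rep)) :=
      hJ
    rw [hk, Submodule.mem_bot] at this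
    exact congr_arg Subtype.val this
  · rintro ⟨F, h1, h2, h⟩
    refine ⟨F, ⟨h1, h2⟩, ?_⟩
    change 2 < finrank k ((tan X p.rep).map (jacobian F p.rep))
    rw [hmap, LinearMap.finrank_range_of_inj, h3]
    · norm_num
    · rw [← LinearMap.ker_eq_bot, LinearMap.ker_eq_bot']
      rintro ⟨w, hw⟩ hJ
      exact Subtype.ext (h w hw hJ)

end

section

namespace Chart
variable {k : Type} [Field k] {n : ℕ} {I : Ideal (MvPolynomial (Fin n) k)} (c : Chart I)

/-- The tangent vectors defined by a chart. -/
noncomputable def vec (j : Fin 2) (v : Fin n → k) : Fin n → k :=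
  fun m => eval v (c.mat.adjugate m (c.i j))

theorem eval_der (j : Fin 2) (v : Fin n → k) (f : MvPolynomial (Fin n) k) :
    eval v (c.der j f) = ∑ m, eval v (pderiv m f) * c.vec j v m := by
  rw [der_apply]; simp [vec]

theorem vec_mem [IsAlgClosed k] (hI : IsSurf I) {v : Fin n → k} (hv : ∀ f ∈ I, eval v f = 0)
    (hdet : eval v c.det ≠ 0) (j : Fin 2) : c.vec j v ∈ affTangent I v := by
  rw [mem_affTangent]
  intro f hf
  rw [← eval_der]
  exact hv _ (c.der_mem hI hv hdet j hf)

theorem dot_vec (j j' : Fin 2) (v : Fin n → k) :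
    ∑ m, eval v (pderiv m (c.g (c.i j'))) * c.vec j v m = if j' = j then eval v c.det else 0 := by
  rw [← eval_der, der_g]
  by_cases h : j' = j
  · simp [h]
  · simp [h, c.inj.eq_iff]

theorem vec_indep {v : Fin n → k} (hdet : eval v c.det ≠ 0) {b : Fin 2 → k}
    (hb : b 0 • c.vec 0 v + b 1 • c.vec 1 v = 0) : b = 0 := by
  have key : ∀ j, ∑ m, eval v (pderiv m (c.g (c.i j))) *
      (b 0 • c.vec 0 v + b 1 • c.vec 1 v) m = b j * eval v c.det := by
    intro j
    have h0 := c.dot_vec 0 j v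
    have h1 := c.dot_vec 1 j v
    simp only [Pi.add_apply, Pi.smul_apply, smul_eq_mul, mul_add, Finset.sum_add_distrib,
      mul_left_comm _ (b _), ← Finset.mul_sum, h0, h1]
    fin_cases j <;> simp
  rw [hb] at key
  funext j
  simpa [hdet] using key j

theorem exists_combination {v : Fin n → k} (hdet : eval v c.det ≠ 0) {w : Fin n → k}
    (hw : w ∈ affTangent I v) (hvec : ∀ j, c.vec j v ∈ affTangent I v) :
    ∃ b : Fin 2 → k, w = b 0 • c.vec 0 v + b 1 • c.vec 1 v := by
  let b : Fin 2 → k := fun j => (∑ m, eval v (pderiv m (c.g (c.i j))) * w m) / eval v c.det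
  refine ⟨b, sub_eq_zero.mp (c.eq_zero_of_dot v _ (by simpa [aeval_eq_eval] using hdet) fun l => ?_)⟩
  simp only [aeval_eq_eval]
  by_cases h : ∃ j, l = c.i j
  · obtain ⟨j, rfl⟩ := h
    have h0 := c.dot_vec 0 j v
    have h1 := c.dot_vec 1 j v
    have hb : ∑ m, eval v (pderiv m (c.g (c.i j))) * w m = b j * eval v c.det := by
      simp only [b]; field_simp
    simp only [Pi.sub_apply, Pi.add_apply, Pi.smul_apply, smul_eq_mul, mul_sub, mul_add,
      Finset.sum_add_distrib, Finset.sum_sub_distrib,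
      mul_left_comm _ (b _), ← Finset.mul_sum, h0, h1, hb]
    fin_cases j <;> simp
  · push Not at h
    exact mem_affTangent.mp (sub_mem hw (add_mem (Submodule.smul_mem _ _ (hvec 0))
      (Submodule.smul_mem _ _ (hvec 1)))) _ (c.mem l h)

end Chart

variable {k : Type} [Field k] {M N : ℕ}

theorem jacobian_vec {I : Ideal (MvPolynomial (Fin (M + 1)) k)} (c : Chart I)
    (F : Fin (N + 1) → MvPolynomial (Fin (M + 1)) k) (v : Fin (M + 1) → k) (j : Fin 2) :
    jacobian F v (c.vec j v) = fun l => eval v (c.der j (F l)) := by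
  funext l
  rw [jacobian_apply, c.eval_der]

theorem eval_patchIdeal {X : Set (Pr k M)} {j : Fin (M + 1)} {v : Fin (M + 1) → k}
    (hv : v ∈ patch X j) : ∀ f ∈ patchIdeal X j, eval v f = 0 :=
  fun _ hf => mem_patchIdeal.mp hf v hv

theorem mem_tan_of_mem_affTangent {X : Set (Pr k M)} {j : Fin (M + 1)} {v w : Fin (M + 1) → k}
    (hv : v ∈ patch X j) (hw : w ∈ affTangent (patchIdeal X j) v) : w ∈ tan X v ∧ w j = 0 := by
  rw [affTangent_patchIdeal hv] at hw
  exact hw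

theorem exists_combination_tan [IsAlgClosed k] {X : Set (Pr k M)} {j : Fin (M + 1)}
    {v : Fin (M + 1) → k}
    (hv : v ∈ patch X j) (c : Chart (patchIdeal X j)) (hI : IsSurf (patchIdeal X j))
    (hdet : eval v c.det ≠ 0) {w : Fin (M + 1) → k} (hw : w ∈ tan X v) :
    ∃ (a : k) (b : Fin 2 → k), w = a • v + (b 0 • c.vec 0 v + b 1 • c.vec 1 v) := by
  have h : w - w j • v ∈ affTangent (patchIdeal X j) v := by
    rw [affTangent_patchIdeal hv]
    refine ⟨sub_mem hw (Submodule.smul_mem _ _ (self_mem_tan hv.1)), ?_⟩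
    simp [hv.2]
  obtain ⟨b, hb⟩ := c.exists_combination hdet h (c.vec_mem hI (eval_patchIdeal hv) hdet)
  exact ⟨w j, b, by rw [← hb]; abel⟩

theorem tan_combination_indep [IsAlgClosed k] {X : Set (Pr k M)} {j : Fin (M + 1)}
    {v : Fin (M + 1) → k}
    (hv : v ∈ patch X j) (c : Chart (patchIdeal X j)) (hI : IsSurf (patchIdeal X j))
    (hdet : eval v c.det ≠ 0) {a : k} {b : Fin 2 → k}
    (h : a • v + (b 0 • c.vec 0 v + b 1 • c.vec 1 v) = 0) : a = 0 ∧ b = 0 := by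
  have hm := fun i => (mem_tan_of_mem_affTangent hv (c.vec_mem hI (eval_patchIdeal hv) hdet i)).2
  have ha : a = 0 := by
    have := congr_fun h j
    simpa [hm, hv.2] using this
  refine ⟨ha, c.vec_indep hdet ?_⟩
  rwa [ha, zero_smul, zero_add] at h

variable {m : ℕ}

/-- A linear map applied to a tuple of polynomials. -/
noncomputable def linTuple (L : (Fin (N + 1) → k) →ₗ[k] (Fin m → k))
    (F : Fin (N + 1) → MvPolynomial (Fin (M + 1)) k) : Fin m → MvPolynomial (Fin (M + 1)) k :=
  fun i => ∑ l, C (L (Pi.single l 1) i) * F l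

theorem linear_apply_eq_sum (L : (Fin (N + 1) → k) →ₗ[k] (Fin m → k)) (w : Fin (N + 1) → k)
    (i : Fin m) : L w i = ∑ l, L (Pi.single l 1) i * w l := by
  have : w = ∑ l, w l • (Pi.single l 1 : Fin (N + 1) → k) := by
    funext j; simp [Pi.single_apply]
  conv_lhs => rw [this]
  simp [mul_comm]

theorem eval_linTuple (L : (Fin (N + 1) → k) →ₗ[k] (Fin m → k))
    (F : Fin (N + 1) → MvPolynomial (Fin (M + 1)) k) (v : Fin (M + 1) → k) (i : Fin m) :
    eval v (linTuple L F i) = L (evalV F v) i := by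
  rw [linear_apply_eq_sum]
  simp [linTuple, evalV]

theorem isHomogeneous_linTuple (L : (Fin (N + 1) → k) →ₗ[k] (Fin m → k))
    {F : Fin (N + 1) → MvPolynomial (Fin (M + 1)) k} {d : ℕ} (hF : ∀ i, (F i).IsHomogeneous d)
    (i : Fin m) : (linTuple L F i).IsHomogeneous d :=
  IsHomogeneous.sum _ _ _ fun l _ => (hF l).C_mul _

/-- The polynomial rows spanning the tangent space of the image. -/
noncomputable def Chart.rows {I : Ideal (MvPolynomial (Fin (M + 1)) k)} (c : Chart I)
    (F : Fin (N + 1) → MvPolynomial (Fin (M + 1)) k) :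
    Fin 3 → Fin (N + 1) → MvPolynomial (Fin (M + 1)) k :=
  ![F, fun l => c.der 0 (F l), fun l => c.der 1 (F l)]

theorem linear_jacobian_combination {I : Ideal (MvPolynomial (Fin (M + 1)) k)} (c : Chart I)
    {F : Fin (N + 1) → MvPolynomial (Fin (M + 1)) k} {d : ℕ} (hF : ∀ i, (F i).IsHomogeneous d)
    (L : (Fin (N + 1) → k) →ₗ[k] (Fin m → k)) (v : Fin (M + 1) → k) (a : k) (b : Fin 2 → k) :
    L (jacobian F v (a • v + (b 0 • c.vec 0 v + b 1 • c.vec 1 v))) =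
      ∑ i, ![a * d, b 0, b 1] i • L (evalV (c.rows F i) v) := by
  simp only [map_add, map_smul, jacobian_self hF, jacobian_vec, Fin.sum_univ_three, smul_smul,
    add_assoc]
  rfl

/-- Injectivity of the differential in terms of rows. -/
theorem goodAt_of_linearIndependent [IsAlgClosed k] {X : Set (Pr k M)} {j : Fin (M + 1)}
    {φ : Pr k M → Pr k N}
    {v : Fin (M + 1) → k} (hv : v ∈ patch X j) (c : Chart (patchIdeal X j))
    (hI : IsSurf (patchIdeal X j)) (hdet : eval v c.det ≠ 0)
    (L : (Fin (N + 1) → k) →ₗ[k] (Fin m → k)) {F} (hF : IsRep X φ F) {d : ℕ}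
    (hd : ∀ i, (F i).IsHomogeneous d) (hd0 : (d : k) ≠ 0)
    (h : LinearIndependent k fun i => L (evalV (c.rows F i) v)) : GoodAt X φ L v := by
  refine ⟨F, hF, fun h0 => ?_, fun w hw hL => ?_⟩
  · exact h.ne_zero 0 (by change L (evalV F v) = 0; rw [h0, map_zero])
  · obtain ⟨a, b, rfl⟩ := exists_combination_tan hv c hI hdet hw
    rw [linear_jacobian_combination c hd] at hL
    have := Fintype.linearIndependent_iff.mp h _ hL
    have h0 : a * d = 0 := this 0
    have h1 : b 0 = 0 := this 1
    have h2 : b 1 = 0 := this 2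
    rw [(mul_eq_zero.mp h0).resolve_right hd0, h1, h2]; simp

theorem GoodAt.exists_rows [IsAlgClosed k] {X : Set (Pr k M)} {j : Fin (M + 1)}
    {φ : Pr k M → Pr k N}
    {v : Fin (M + 1) → k} (hv : v ∈ patch X j) (c : Chart (patchIdeal X j))
    (hI : IsSurf (patchIdeal X j)) (hdet : eval v c.det ≠ 0)
    (L : (Fin (N + 1) → k) →ₗ[k] (Fin m → k)) (h : GoodAt X φ L v) :
    ∃ F d, IsRep X φ F ∧ (∀ i, (F i).IsHomogeneous d) ∧ (d : k) ≠ 0 ∧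
      LinearIndependent k fun i => L (evalV (c.rows F i) v) := by
  obtain ⟨F, hF, h0, h⟩ := h
  obtain ⟨d, hd⟩ := hF.1
  have hd0 : (d : k) ≠ 0 := by
    intro h
    have := h ▸ jacobian_self hd v
    rename_i h'
    have := h' v (self_mem_tan hv.1) (by rw [jacobian_self hd, h]; simp)
    exact hv.1.1 this
  refine ⟨F, d, hF, hd, hd0, Fintype.linearIndependent_iff.mpr fun r hr => ?_⟩
  have hm := fun i => (mem_tan_of_mem_affTangent hv (c.vec_mem hI (eval_patchIdeal hv) hdet i)).1
  have e := linear_jacobian_combination c hd L v (r 0 / d) ![r 1, r 2]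
  have e' : ![r 0 / d * d, ![r 1, r 2] 0, ![r 1, r 2] 1] = r := by
    funext i
    fin_cases i <;> simp [hd0]
  rw [e', hr] at e
  have := h _ (add_mem (Submodule.smul_mem _ _ (self_mem_tan hv.1))
    (add_mem (Submodule.smul_mem _ _ (hm 0)) (Submodule.smul_mem _ _ (hm 1)))) e
  obtain ⟨ha, hb⟩ := tan_combination_indep hv c hI hdet this
  have hb0 := congr_fun hb 0
  have hb1 := congr_fun hb 1
  intro i
  fin_cases i
  · simpa [hd0] using ha
  · exact hb0
  · exact hb1

/-- Linear independence of polynomial vectors is witnessed by a polynomial. -/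
theorem exists_det_poly {σ : Type} {s m : ℕ} (r : Fin s → Fin m → MvPolynomial σ k) (v : σ → k)
    (h : LinearIndependent k fun i l => eval v (r i l)) :
    ∃ P : MvPolynomial σ k, eval v P ≠ 0 ∧ ∀ (L : Type) [Field L] [Algebra k L] (x : σ → L),
      aeval x P ≠ 0 → LinearIndependent L fun i l => aeval x (r i l) := by
  obtain ⟨μ, hμ⟩ := exists_dual_family _ h
  refine ⟨(Matrix.of fun i j => ∑ l, C (μ i l) * r j l).det, ?_, fun L _ _ x hx => ?_⟩
  · rw [RingHom.map_det]
    have : (eval v).mapMatrix (Matrix.of fun i j => ∑ l, C (μ i l) * r j l) = 1 := by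
      ext i j
      simp [Matrix.one_apply, hμ]
    rw [this]; simp
  · rw [AlgHom.map_det] at hx
    rw [Fintype.linearIndependent_iff]
    intro g hg
    have := Matrix.eq_zero_of_mulVec_eq_zero hx (v := g) (by
      funext i
      have hg' : ∀ l, ∑ j, g j * aeval x (r j l) = 0 := fun l => by
        simpa using congr_fun hg l
      simp only [Matrix.mulVec, dotProduct, AlgHom.mapMatrix_apply, Matrix.map_apply, Matrix.of_apply,
        map_sum, map_mul, Pi.zero_apply, Finset.sum_mul]
      rw [Finset.sum_comm]
      refine Finset.sum_eq_zero fun l _ => ?_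
      calc _ = aeval x (C (μ i l)) * ∑ j, g j * aeval x (r j l) := by
            rw [Finset.mul_sum]; exact Finset.sum_congr rfl fun j _ => by ring
        _ = 0 := by rw [hg', mul_zero])
    exact fun i => congr_fun this i

theorem GoodAt.open [IsAlgClosed k] {X : Set (Pr k M)} (hX : IsSmoothSurface X)
    {φ : Pr k M → Pr k N} {v : Fin (M + 1) → k} (hv : v ∈ cone X)
    (L : (Fin (N + 1) → k) →ₗ[k] (Fin m → k)) (h : GoodAt X φ L v) :
    ∃ g, (∃ d, g.IsHomogeneous d) ∧ eval v g ≠ 0 ∧ ∀ v' ∈ cone X, eval v' g ≠ 0 →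
      GoodAt X φ L v' := by
  obtain ⟨j, hj⟩ := Function.ne_iff.mp hv.1
  have hj : v j ≠ 0 := hj
  have hu := exists_patch hv hj
  have hI := hX.isSurf ⟨_, hu⟩
  have hu' := eval_patchIdeal hu
  obtain ⟨c, hc⟩ := exists_chart (hI.2 _ hu')
  obtain ⟨F, d, hF, hd, hd0, hr⟩ := (h.smul (inv_ne_zero hj)).exists_rows hu c hI hc L
  have e : ∀ u : Fin (M + 1) → k, (fun i => L (evalV (c.rows F i) u)) =
      fun i l => eval u (linTuple L (c.rows F i) l) := by
    intro u; funext i l; rw [eval_linTuple]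
  rw [e] at hr
  obtain ⟨P, hP, hP'⟩ := exists_det_poly _ _ hr
  obtain ⟨D, H, q, hH, hHe⟩ := exists_homogenization j (P * c.det)
  have hH1 : ∀ u ∈ patch X j, eval u H = eval u P * eval u c.det := by
    intro u hu
    rw [hHe]; simp [hu.2]
  refine ⟨MvPolynomial.X j * H, ⟨_, (isHomogeneous_X k j).mul hH⟩, ?_, fun v' hv' h' => ?_⟩
  · rw [map_mul, eval_X]
    refine mul_ne_zero hj fun h0 => ?_
    have := hH1 _ hu
    rw [eval_smul_of_isHomogeneous hH, h0, mul_zero] at this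
    exact mul_ne_zero hP hc this.symm
  · rw [map_mul, eval_X] at h'
    have hj' := left_ne_zero_of_mul h'
    have hu2 := exists_patch hv' hj'
    have h2 : eval ((v' j)⁻¹ • v') H ≠ 0 := by
      rw [eval_smul_of_isHomogeneous hH]
      exact mul_ne_zero (pow_ne_zero _ (inv_ne_zero hj')) (right_ne_zero_of_mul h')
    rw [hH1 _ hu2] at h2
    have hli := hP' k ((v' j)⁻¹ • v') (by rw [aeval_eq_eval]; exact left_ne_zero_of_mul h2)
    simp only [aeval_eq_eval] at hli
    have := (goodAt_of_linearIndependent hu2 c hI (right_ne_zero_of_mul h2) L hF hd hd0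
      (by rw [e]; exact hli)).smul hj'
    rwa [smul_inv_smul₀ hj'] at this

end

section

section GenericPoint
variable {k : Type} [Field k] {σ : Type} (I : Ideal (MvPolynomial σ k))
  (K : Type) [Field K] [Algebra k K] [Algebra (MvPolynomial σ k ⧸ I) K]
  [IsScalarTower k (MvPolynomial σ k ⧸ I) K]

/-- The coordinates of the generic point. -/
noncomputable def genPt (l : σ) : K := algebraMap _ K (Ideal.Quotient.mk I (X l))

theorem aeval_genPt (f : MvPolynomial σ k) :
    aeval (genPt I K) f = algebraMap _ K (Ideal.Quotient.mk I f) := by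
  have h1 := algHom_aeval (IsScalarTower.toAlgHom k (MvPolynomial σ k ⧸ I) K)
    (fun l => Ideal.Quotient.mk I (X l)) f
  have h2 := algHom_aeval (Ideal.Quotient.mkₐ k I) X f
  rw [aeval_X_left, AlgHom.id_apply] at h2
  have h3 : aeval (fun l => (Ideal.Quotient.mk I (X l))) f = Ideal.Quotient.mk I f := h2.symm
  rw [h3] at h1
  exact h1.symm

theorem aeval_genPt_eq_zero [IsFractionRing (MvPolynomial σ k ⧸ I) K]
    (f : MvPolynomial σ k) : aeval (genPt I K) f = 0 ↔ f ∈ I := by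
  rw [aeval_genPt, ← Ideal.Quotient.eq_zero_iff_mem,
    map_eq_zero_iff _ (IsFractionRing.injective (MvPolynomial σ k ⧸ I) K)]

theorem exists_aeval_genPt_div [IsFractionRing (MvPolynomial σ k ⧸ I) K] (x : K) :
    ∃ f g : MvPolynomial σ k, g ∉ I ∧ x = aeval (genPt I K) f / aeval (genPt I K) g := by
  obtain ⟨a, b, hb, rfl⟩ := IsFractionRing.div_surjective (A := MvPolynomial σ k ⧸ I) x
  obtain ⟨f, rfl⟩ := Ideal.Quotient.mk_surjective a
  obtain ⟨g, rfl⟩ := Ideal.Quotient.mk_surjective b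
  by_cases hg : g ∈ I
  · have := (IsFractionRing.injective (MvPolynomial σ k ⧸ I) K)
    rw [Ideal.Quotient.eq_zero_iff_mem.mpr hg] at hb
    have : (0 : MvPolynomial σ k ⧸ I) = 1 := by
      have h0 := (mem_nonZeroDivisors_iff.mp hb).1 1 (by simp)
      exact h0.symm
    have h1 := congr_arg (algebraMap _ K) this
    simp at h1
  · exact ⟨f, g, hg, by rw [aeval_genPt, aeval_genPt]⟩

theorem derivation_eq_zero_of_genPt [IsFractionRing (MvPolynomial σ k ⧸ I) K]
    {W : Type} [AddCommGroup W] [Module K W] [Module k W] [IsScalarTower k K W]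
    (δ : Derivation k K W) (h : ∀ l, δ (genPt I K l) = 0) : δ = 0 := by
  have h1 : ∀ f : MvPolynomial σ k, δ (aeval (genPt I K) f) = 0 := by
    intro f
    induction f using MvPolynomial.induction_on with
    | C a => simp
    | add f g hf hg => rw [map_add, map_add, hf, hg, add_zero]
    | mul_X f l hf => rw [map_mul, δ.leibniz, hf, aeval_X, h, smul_zero, smul_zero, add_zero]
  ext x
  obtain ⟨f, g, hg, rfl⟩ := exists_aeval_genPt_div I K x
  have hg' : aeval (genPt I K) g ≠ 0 := fun h => hg ((aeval_genPt_eq_zero I K g).mp h)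
  have := h1 f
  rw [← div_mul_cancel₀ (aeval (genPt I K) f) hg', δ.leibniz, h1 g, smul_zero, zero_add,
    smul_eq_zero] at this
  simpa using this.resolve_left hg'

end GenericPoint

variable {k : Type} [Field k] {M N : ℕ}

theorem genPt_self {Z : Set (Pr k M)} {j : Fin (M + 1)} (K : Type) [Field K] [Algebra k K]
    [Algebra (MvPolynomial (Fin (M + 1)) k ⧸ patchIdeal Z j) K]
    [IsScalarTower k (MvPolynomial (Fin (M + 1)) k ⧸ patchIdeal Z j) K] :
    genPt (patchIdeal Z j) K j = 1 := by
  have : Ideal.Quotient.mk (patchIdeal Z j) (X j) = Ideal.Quotient.mk (patchIdeal Z j) 1 :=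
    Ideal.Quotient.eq.mpr (X_sub_one_mem Z j)
  rw [genPt, this, map_one, map_one]

theorem IsVariety.exists_patch_nonempty {Z : Set (Pr k M)} (hZ : IsVariety Z) :
    ∃ j, (patch Z j).Nonempty := by
  obtain ⟨p, hp⟩ := hZ.2.1
  obtain ⟨j, hj⟩ := Function.ne_iff.mp p.rep_nonzero
  exact ⟨j, _, exists_patch (rep_mem_cone hp) hj⟩

theorem IsMorphismOn.isAlgSet_image [IsAlgClosed k] {X : Set (Pr k M)} (hX : IsVariety X)
    {φ : Pr k M → Pr k N} (hφ : IsMorphismOn X φ) : IsAlgSet (φ '' X) := by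
  refine ⟨forms (φ '' X), fun f hf => hf.1, subset_antisymm (fun p hp f hf => hf.2 p hp) ?_⟩
  intro y hy
  obtain ⟨j, hne⟩ := hX.exists_patch_nonempty
  obtain ⟨v₀, hv₀⟩ := hne
  have hprime := patchIdeal_isPrime hX ⟨v₀, hv₀⟩
  let K := FractionRing (MvPolynomial (Fin (M + 1)) k ⧸ patchIdeal X j)
  let ξ : Fin (M + 1) → K := genPt (patchIdeal X j) K
  have hξ : ∀ f : MvPolynomial (Fin (M + 1)) k, (∃ d, f.IsHomogeneous d) →
      (aeval ξ f = 0 ↔ f ∈ forms X) := fun f hf => by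
    rw [aeval_genPt_eq_zero, mem_forms_of_mem_patchIdeal hX ⟨v₀, hv₀⟩ hf]
  obtain ⟨F, hF, hF0⟩ := exists_rep hφ hv₀.1
  obtain ⟨d, hd⟩ := hF.1
  obtain ⟨a, ha⟩ := Function.ne_iff.mp y.rep_nonzero
  have ha : y.rep a ≠ 0 := ha
  let z : Fin (N + 1) → k := (y.rep a)⁻¹ • y.rep
  have hza : z a = 1 := by simp [z, ha]
  have hz : ∀ f ∈ forms (φ '' X), eval z f = 0 := by
    intro f hf
    obtain ⟨e, he⟩ := hf.1
    rw [eval_smul_of_isHomogeneous he, (vanishes_iff_rep he y).mp (hy f hf), mul_zero]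
  let η : Fin (N + 1) → K := fun l => aeval ξ (F l)
  have hη : ∀ f : MvPolynomial (Fin (N + 1)) k, aeval η f = aeval ξ (aeval F f) := fun f =>
    (algHom_aeval (aeval ξ) F f).symm
  have hηa : η a ≠ 0 := by
    intro h
    have h1 : aeval η (MvPolynomial.X a : MvPolynomial (Fin (N + 1)) k) = 0 := by rw [aeval_X, h]
    have hX1 := isHomogeneous_X k a
    rw [hη, hξ _ (isHomogeneous_aeval hd ⟨1, hX1⟩),
      ← hF.mem_forms_iff subset_rfl hX hφ hv₀.1 hF0 ⟨1, hX1⟩] at h1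
    have := hz _ h1
    rw [eval_X, hza] at this
    exact one_ne_zero this
  let c : Fin (N + 1) → K := fun l => (η a)⁻¹ * η l
  have hca : c a = 1 := inv_mul_cancel₀ hηa
  obtain ⟨V, hV1, hV2⟩ := exists_valuation_of_specialization c z (by
    intro f hf
    obtain ⟨D, H, h, hH, hHe⟩ := exists_homogenization a f
    have h1 : aeval c H = 0 := by rw [hHe]; simp [hf, hca]
    have h2 : eval z H = eval z f := by rw [hHe]; simp [hza]
    rw [aeval_smul_of_isHomogeneous hH, mul_eq_zero, or_iff_right (pow_ne_zero _ (inv_ne_zero hηa)),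
      hη, hξ _ (isHomogeneous_aeval hd ⟨D, hH⟩),
      ← hF.mem_forms_iff subset_rfl hX hφ hv₀.1 hF0 ⟨D, hH⟩] at h1
    rw [← h2]
    exact hz _ h1)
  have hVk : ∀ t : k, algebraMap k K t ∈ V := fun t => by simpa using hV1 (C t)
  obtain ⟨l₀, hl₀⟩ := Finite.exists_max fun l => V.valuation (ξ l)
  have hξj : ξ j = 1 := genPt_self K
  have hξ0 : ξ l₀ ≠ 0 := by
    intro h
    have := hl₀ j
    rw [h, hξj, map_one, map_zero] at this
    exact absurd this (by simp)
  let c' : Fin (M + 1) → K := fun l => (ξ l₀)⁻¹ * ξ l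
  have hc' : ∀ l, c' l ∈ V := by
    intro l
    rw [← V.valuation_le_one_iff, map_mul, map_inv₀, mul_comm]
    exact mul_inv_le_one_of_le₀ (hl₀ l) zero_le
  have hhom : ∀ f : MvPolynomial (Fin (M + 1)) k, f ∈ forms X → aeval c' f = 0 := by
    intro f hf
    obtain ⟨e, he⟩ := hf.1
    rw [aeval_smul_of_isHomogeneous he, (hξ f hf.1).mpr hf, mul_zero]
  have hcl : c' l₀ = 1 := inv_mul_cancel₀ hξ0
  obtain ⟨e, he0, he⟩ := exists_center V hVk c' hc' (MvPolynomial.X l₀) (by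
    rw [aeval_X, hcl, map_one])
  rw [eval_X] at he0
  have heX : e ∈ cone X := by
    refine (mem_cone_iff hX.1 fun h => he0 (by rw [h]; rfl)).mpr fun f hf => he f ?_
    rw [hhom f hf, map_zero]; exact zero_lt_one
  obtain ⟨F', hF', hF'0⟩ := exists_rep hφ heX
  obtain ⟨d', hd'⟩ := hF'.1
  have hF'e : evalV F' e = eval e (F' a) • z := by
    funext i
    have h1 : F i * F' a - F a * F' i ∈ forms X := by
      have hom : (F i * F' a - F a * F' i).IsHomogeneous (d + d') :=
        ((hd i).mul (hd' a)).sub ((hd a).mul (hd' i))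
      refine (mem_forms_iff ⟨_, hom⟩).mpr fun v hv => ?_
      rw [map_sub, map_mul, map_mul, hF.cross hF' hv i a, sub_self]
    have h2 : aeval c' (F' i) = c i * aeval c' (F' a) := by
      have := (hξ _ h1.1).mpr h1
      rw [map_sub, map_mul, map_mul] at this
      simp only [c']
      rw [aeval_smul_of_isHomogeneous (hd' i), aeval_smul_of_isHomogeneous (hd' a)]
      have e1 : η a * c i = η i := mul_inv_cancel_left₀ hηa _
      replace this : η i * aeval ξ (F' a) - η a * aeval ξ (F' i) = 0 := this
      refine mul_left_cancel₀ hηa ?_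
      linear_combination (-(ξ l₀)⁻¹ ^ d') * this - ((ξ l₀)⁻¹ ^ d' * aeval ξ (F' a)) * e1
    have h3 : V.valuation (aeval c' (F' i - C (z i) * F' a)) < 1 := by
      have h4 := hV2 (MvPolynomial.X i - C (z i)) (by simp)
      rw [map_sub, aeval_X, aeval_C] at h4
      have h5 : aeval c' (F' i - C (z i) * F' a) = (c i - algebraMap k K (z i)) * aeval c' (F' a) := by
        rw [map_sub, map_mul, h2, aeval_C]; ring
      have h6 : V.valuation (aeval c' (F' a)) ≤ 1 := by
        rw [V.valuation_le_one_iff]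
        have : ∀ f : MvPolynomial (Fin (M + 1)) k, aeval c' f ∈ V := by
          intro f
          induction f using MvPolynomial.induction_on with
          | C t => simpa using hVk t
          | add f g hf hg => rw [map_add]; exact add_mem hf hg
          | mul_X f l hf => rw [map_mul, aeval_X]; exact mul_mem hf (hc' l)
        exact this _
      rw [h5, map_mul]
      exact mul_lt_one_of_lt_of_le h4 h6
    have := he _ h3
    rw [map_sub, map_mul, eval_C, sub_eq_zero] at this
    simp only [evalV, Pi.smul_apply, smul_eq_mul]
    rw [this, mul_comm]
  obtain ⟨hee, heX'⟩ := heX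
  refine ⟨_, heX', ?_⟩
  rw [hF'.2 e ⟨hee, heX'⟩ hee hF'0]
  conv_rhs => rw [← y.mk_rep]
  rw [Projectivization.mk_eq_mk_iff']
  refine ⟨eval e (F' a) * (y.rep a)⁻¹, ?_⟩
  rw [hF'e, mul_smul]

theorem HasLineFamily.ruledByLines [IsAlgClosed k] {Y : Set (Pr k N)} (hY : IsAlgSet Y)
    (h : HasLineFamily k (forms Y)) : RuledByLines Y := by
  obtain ⟨L, _, _, w₀, w₁, i, j, h0i, h0j, h1i, h1j, ⟨l, hl⟩, hS⟩ := h
  intro hfin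
  let σ := Fin (N + 1) ⊕ Fin (N + 1)
  let a : σ → L := Sum.elim w₀ w₁
  let Sp : Set (σ → k) := {e | ∀ f : MvPolynomial σ k, aeval a f = 0 → eval e f = 0}
  have hco : ∀ e ∈ Sp, ∀ s (t : k), a s = algebraMap k L t → e s = t := by
    intro e he s t hst
    have := he (X s - C t) (by simp [hst])
    simpa [sub_eq_zero] using this
  let W : (σ → k) → Submodule k (Fin (N + 1) → k) := fun e =>
    Submodule.span k {(fun l => e (.inl l)), (fun l => e (.inr l))}
  have hnorm : ∀ e ∈ Sp, e (.inl i) = 1 ∧ e (.inl j) = 0 ∧ e (.inr i) = 0 ∧ e (.inr j) = 1 := by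
    intro e he
    refine ⟨hco e he _ _ ?_, hco e he _ _ ?_, hco e he _ _ ?_, hco e he _ _ ?_⟩ <;>
      simp [a, h0i, h0j, h1i, h1j]
  have hmemW : ∀ e ∈ Sp, ∀ v ∈ W e, v = v i • (fun l => e (.inl l)) + v j • fun l => e (.inr l) := by
    intro e he v hv
    obtain ⟨r, s, rfl⟩ := Submodule.mem_span_pair.mp hv
    obtain ⟨h1, h2, h3, h4⟩ := hnorm e he
    simp [h1, h2, h3, h4]
  let ℓ : (σ → k) → Set (Pr k N) := fun e => {p | Projectivization.submodule p ≤ W e}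
  have hline : MapsTo ℓ Sp {L : Set (Pr k N) | IsLine L ∧ L ⊆ Y} := by
    intro e he
    obtain ⟨h1, h2, h3, h4⟩ := hnorm e he
    refine ⟨⟨W e, ?_, rfl⟩, fun p hp => ?_⟩
    · have hli : LinearIndependent k ![(fun l => e (.inl l)), (fun l => e (.inr l))] := by
        rw [LinearIndependent.pair_iff]
        intro s t hst
        have e1 := congr_fun hst i
        have e2 := congr_fun hst j
        simp [h1, h2, h3, h4] at e1 e2
        exact ⟨e1, e2⟩
      have := finrank_span_eq_card hli
      rw [Matrix.range_cons, Matrix.range_cons, Matrix.range_empty, union_empty] at this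
      exact this
    · refine hY.mem_iff.mpr fun f hf => ?_
      obtain ⟨d, hd⟩ := hf.1
      rw [vanishes_iff_rep hd]
      have hp' : p.rep ∈ W e := hp (by rw [Projectivization.submodule_eq]; exact Submodule.mem_span_singleton_self _)
      have hpt : ∀ t : k, eval ((fun l => e (.inl l)) + t • fun l => e (.inr l)) f = 0 := by
        intro t
        have h5 := congr_arg (Polynomial.aeval (algebraMap k L t)) (hS f hf)
        rw [map_zero] at h5
        have h6 := algHom_aeval ((Polynomial.aeval (R := L) (algebraMap k L t)).restrictScalars k)
          (fun l => Polynomial.C (w₀ l) + Polynomial.X * Polynomial.C (w₁ l)) f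
        have h7 := (h6.symm.trans h5)
        have h8 := he (aeval (fun l => X (.inl l) + C t * X (.inr l)) f) (by
          rw [algHom_aeval, ← h7]
          congr 2; funext l; simp [a]; ring)
        have h9 := algHom_aeval (aeval e : MvPolynomial σ k →ₐ[k] k)
          (fun l => X (.inl l) + C t * X (.inr l)) f
        rw [aeval_eq_eval] at h9
        rw [h8] at h9
        rw [aeval_eq_eval] at h9
        rw [h9]
        congr 2; funext l; simp [mul_comm]
      have hpt' : ∀ s t : k, s ≠ 0 →
          eval (s • (fun l => e (.inl l)) + t • fun l => e (.inr l)) f = 0 := by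
        intro s t hs
        have := eval_smul_of_isHomogeneous hd s ((fun l => e (.inl l)) + (s⁻¹ * t) • fun l => e (.inr l))
        rw [hpt, mul_zero] at this
        rw [← this, smul_add, smul_smul, mul_inv_cancel_left₀ hs]
      rw [hmemW e he _ hp']
      by_cases hs : p.rep i = 0
      · let q : Polynomial k := aeval (fun l => Polynomial.X * Polynomial.C (e (.inl l)) +
          Polynomial.C (p.rep j * e (.inr l))) f
        have hq : ∀ s : k, q.eval s = eval (s • (fun l => e (.inl l)) + p.rep j • fun l => e (.inr l)) f := by
          intro s
          have := algHom_aeval (Polynomial.aeval (R := k) s) (fun l => Polynomial.X * Polynomial.C (e (.inl l)) +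
            Polynomial.C (p.rep j * e (.inr l))) f
          rw [Polynomial.coe_aeval_eq_eval] at this
          rw [this, aeval_eq_eval]
          congr 2; funext l; simp; ring
        have hq0 : Polynomial.X * q = 0 := by
          refine Polynomial.funext fun s => ?_
          by_cases hs : s = 0
          · simp [hs]
          · simp [hq, hpt' s _ hs]
        have hq1 : q = 0 := (mul_eq_zero.mp hq0).resolve_left Polynomial.X_ne_zero
        rw [hs, ← hq, hq1, Polynomial.eval_zero]
      · exact hpt' _ _ hs
  have hinj : InjOn ℓ Sp := by
    intro e he e' he' hee
    have hW : ∀ v, v ≠ 0 → (v ∈ W e → v ∈ W e') := by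
      intro v hv hvW
      have : Projectivization.mk k v hv ∈ ℓ e := by
        change Projectivization.submodule _ ≤ _
        rw [Projectivization.submodule_mk, Submodule.span_singleton_le_iff_mem]; exact hvW
      rw [hee] at this
      change Projectivization.submodule _ ≤ _ at this
      rwa [Projectivization.submodule_mk, Submodule.span_singleton_le_iff_mem] at this
    obtain ⟨h1, h2, h3, h4⟩ := hnorm e he
    have hl := hmemW e' he' _ (hW (fun l => e (.inl l)) (fun h => by
      have := congr_fun h i; simp [h1] at this) (Submodule.subset_span (by simp)))
    have hr := hmemW e' he' _ (hW (fun l => e (.inr l)) (fun h => by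
      have := congr_fun h j; simp [h4] at this) (Submodule.subset_span (by simp)))
    funext s
    rcases s with s | s
    · have := congr_fun hl s; simpa [h1, h2] using this
    · have := congr_fun hr s; simpa [h3, h4] using this
  have hSp : Sp.Finite := Set.Finite.of_injOn hline hinj hfin
  have hs : ∃ s, a s ∉ range (algebraMap k L) := hl.elim (fun h => ⟨.inl l, h⟩) fun h => ⟨.inr l, h⟩
  obtain ⟨s, hs⟩ := hs
  obtain ⟨e, he, he'⟩ := exists_point_of_field_point a
    (∏ e ∈ hSp.toFinset, (X s - C (e s)) : MvPolynomial σ k) (by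
      rw [map_prod, Finset.prod_ne_zero_iff]
      intro e _ h0
      rw [map_sub, aeval_X, aeval_C, sub_eq_zero] at h0
      exact hs ⟨_, h0.symm⟩)
  refine he ?_
  rw [map_prod]
  exact Finset.prod_eq_zero (hSp.mem_toFinset.mpr he') (by simp)

end

section

theorem exists_section {K L T : Type} [Field K] [Field L] [CharZero K] [CommRing T]
    [Algebra K L] (ψ : K →+* T) (π : T →+* L) (hπ : Function.Surjective π)
    (hker : ∀ x y, π x = 0 → π y = 0 → x * y = 0) (hψ : ∀ x, π (ψ x) = algebraMap K L x) :
    ∃ l : L →+* T, (∀ x, π (l x) = x) ∧ ∀ x, l (algebraMap K L x) = ψ x := by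
  let _ : Algebra K T := ψ.toAlgebra
  let g : T →ₐ[K] L := { π with commutes' := hψ }
  have hnil : IsNilpotent (RingHom.ker (g : T →+* L)) := by
    refine ⟨2, ?_⟩
    have h : RingHom.ker (g : T →+* L) * RingHom.ker (g : T →+* L) ≤ ⊥ :=
      Ideal.mul_le.mpr fun x hx y hy => by
        rw [Ideal.mem_bot]; exact hker x y hx hy
    have h' := le_bot_iff.mp h
    rw [← Submodule.zero_eq_bot] at h'
    rw [← h']
    exact pow_two (RingHom.ker (g : T →+* L))
  obtain ⟨s, hs⟩ := exists_isTranscendenceBasis K L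
  have : Algebra.IsAlgebraic (IntermediateField.adjoin K
    (Set.range ((↑) : s → L))) L := hs.isAlgebraic_field
  have : Algebra.FormallySmooth K L :=
    .of_algebraicIndependent_of_isSeparable hs.1
  let l := Algebra.FormallySmooth.liftOfSurjective (AlgHom.id K L) g hπ hnil
  exact ⟨l, fun x => Algebra.FormallySmooth.liftOfSurjective_apply (AlgHom.id K L) g hπ hnil x,
    fun x => l.commutes x⟩

open TrivSqZeroExt in
theorem exists_derivation_lift {k K L : Type} [Field k] [Field K] [Field L] [CharZero K]
    [Algebra k K] [Algebra k L] [Algebra K L] [IsScalarTower k K L] (D : Derivation k K L) :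
    ∃ D' : Derivation k L L, ∀ x, D' (algebraMap K L x) = D x := by
  let ψ : K →+* TrivSqZeroExt L L :=
    { toFun := fun x => inl (algebraMap K L x) + inr (D x)
      map_one' := by ext <;> simp
      map_zero' := by ext <;> simp
      map_add' := by intro x y; ext <;> simp
      map_mul' := by
        intro x y
        ext
        · simp
        · simp [Algebra.smul_def]
          change algebraMap K L x * D y + algebraMap K L y * D x =
            algebraMap K L x * D y + D x * algebraMap K L y
          ring }
  have hψ : ∀ p : K, ψ p = inl (algebraMap K L p) + inr (D p) := fun _ => rfl
  obtain ⟨l, hl, hK⟩ := exists_section ψ (fstHom L L L).toRingHom fst_surjective (by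
    intro x y hx hy
    have hx' : x.fst = 0 := hx
    have hy' : y.fst = 0 := hy
    ext <;> simp [hx', hy']) (by
    intro x
    change (ψ x).fst = _
    simp [hψ])
  replace hl : ∀ x, (l x).fst = x := hl
  have hF : ∀ r : k, l (algebraMap k L r) = inl (algebraMap k L r) := by
    intro r
    rw [IsScalarTower.algebraMap_apply k K L, hK, hψ, D.map_algebraMap, inr_zero, add_zero]
  refine ⟨Derivation.mk' (D := { toFun := fun x => (l x).snd
                                 map_add' := fun x y => by simp
                                 map_smul' := fun r x => by
                                    simp [Algebra.smul_def, hF] }) ?_, ?_⟩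
  · intro a b
    simp [hl, mul_comm]
  · intro x
    simp [hK, hψ]

/-- Over a field with two independent derivations, `L` is algebraic over one copy of `K` as soon
as it is so over the other. -/
theorem exists_derivation_of_ne_zero {k K K' L : Type} [Field k] [Field K] [Field L] [Field K']
    [CharZero K] [Algebra k K] [Algebra k K'] [Algebra k L] (B : DiffBasis k K)
    (B' : DiffBasis k K') (ι : K →ₐ[k] L)
    (κ : K' →ₐ[k] L) (δ : Derivation k L L) (hδ : δ ≠ 0) (hι : ∀ x, δ (ι x) = 0) :
    ∃ δ' : Derivation k L L, δ' ≠ 0 ∧ ∀ x, δ' (κ x) = 0 := by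
  let _ : Algebra K L := ι.toRingHom.toAlgebra
  have hal : ∀ x, algebraMap K L x = ι x := fun _ => rfl
  have : IsScalarTower k K L := .of_algebraMap_eq fun r => (ι.commutes r).symm
  choose E hE using fun j => exists_derivation_lift
    ((Algebra.linearMap K L).compDer (B.D j))
  let Δ : Fin 3 → Derivation k L L := ![E 0, E 1, δ]
  have hdep : ¬ LinearIndependent L fun i : Fin 3 => fun j : Fin 2 => Δ i (κ (B'.z j)) := by
    intro h
    have := h.fintype_card_le_finrank
    simp at this
  rw [Fintype.not_linearIndependent_iff] at hdep
  obtain ⟨c, hc, i₀, hi₀⟩ := hdep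
  rw [Fin.sum_univ_three] at hc
  refine ⟨c 0 • E 0 + c 1 • E 1 + c 2 • δ, ?_, ?_⟩
  · intro h
    have h1 := fun j => DFunLike.congr_fun h (ι (B.z j))
    have h2 : ∀ i j, E i (ι (B.z j)) = if i = j then 1 else 0 := by
      intro i j
      rw [← hal, hE]
      simp [B.D_z]
    have h3 := h1 0
    have h4 := h1 1
    simp [h2, hι] at h3 h4
    rw [h3, h4, zero_smul, zero_smul, zero_add, zero_add] at h
    have h5 := (smul_eq_zero.mp h).resolve_right hδ
    fin_cases i₀
    exacts [hi₀ h3, hi₀ h4, hi₀ h5]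
  · intro x
    have h0 := congr_fun hc 0
    have h1 := congr_fun hc 1
    simp [Δ] at h0 h1
    rw [B'.expand_hom κ]
    simp [h0, h1]

theorem exists_hom_of_genPt {k : Type} [Field k] {σ : Type} (I : Ideal (MvPolynomial σ k))
    (K : Type) [Field K] [Algebra k K] [Algebra (MvPolynomial σ k ⧸ I) K]
    [IsScalarTower k (MvPolynomial σ k ⧸ I) K] [IsFractionRing (MvPolynomial σ k ⧸ I) K]
    {L : Type} [Field L] [Algebra k L] (x : σ → L) (hx : ∀ f : MvPolynomial σ k, aeval x f = 0 ↔ f ∈ I) :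
    ∃ ι : K →ₐ[k] L, ∀ f : MvPolynomial σ k, ι (aeval (genPt I K) f) = aeval x f := by
  let ψ : (MvPolynomial σ k ⧸ I) →ₐ[k] L :=
    Ideal.Quotient.liftₐ I (aeval x) fun a ha => (hx a).mpr ha
  have hψ : Function.Injective ψ := by
    rw [injective_iff_map_eq_zero]
    intro a ha
    obtain ⟨f, rfl⟩ := Ideal.Quotient.mk_surjective a
    exact Ideal.Quotient.eq_zero_iff_mem.mpr ((hx f).mp ha)
  refine ⟨IsFractionRing.liftAlgHom (g := ψ) hψ, fun f => ?_⟩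
  rw [aeval_genPt]
  change IsFractionRing.lift hψ _ = _
  rw [IsFractionRing.lift_algebraMap]
  rfl

theorem Chart.exists_diffBasis_genPt
    {k : Type} [Field k] [IsAlgClosed k] [CharZero k] {n m : ℕ}
    {I : Ideal (MvPolynomial (Fin n) k)} (hI : IsSurf I) (c : Chart I) {p₀ : Fin n → k}
    (hp₀ : ∀ f ∈ I, eval p₀ f = 0) (hdet : eval p₀ c.det ≠ 0)
    (K : Type) [Field K] [Algebra k K] [Algebra (MvPolynomial (Fin n) k ⧸ I) K]
    [IsScalarTower k (MvPolynomial (Fin n) k ⧸ I) K] [IsFractionRing (MvPolynomial (Fin n) k ⧸ I) K] :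
    ∃ B : DiffBasis k K, (∀ j f, aeval (genPt I K) c.det * B.D j (aeval (genPt I K) f) =
        aeval (genPt I K) (c.der j f)) ∧
      ∀ (F : Fin m → MvPolynomial (Fin n) k),
      (LinearIndependent K ![fun l => aeval (genPt I K) (F l),
        fun l => aeval (genPt I K) (c.der 0 (F l)), fun l => aeval (genPt I K) (c.der 1 (F l))]) →
      LinearIndependent K ![fun l => aeval (genPt I K) (F l),
        dvec (B.D 0) fun l => aeval (genPt I K) (F l),
        dvec (B.D 1) fun l => aeval (genPt I K) (F l)] := by
  obtain ⟨B, -, hB⟩ := c.exists_diffBasis hI hp₀ hdet K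
  simp only [← aeval_genPt] at hB
  have hd : aeval (genPt I K) c.det ≠ 0 := fun h =>
    hdet (hp₀ _ ((aeval_genPt_eq_zero I K _).mp h))
  refine ⟨B, hB, fun F h => ?_⟩
  have h1 := h.units_smul ![1, (Units.mk0 _ hd)⁻¹, (Units.mk0 _ hd)⁻¹]
  convert h1 using 1
  funext i l
  fin_cases i
  · simp
  all_goals
    simp only [Pi.smul_apply', Pi.smul_apply]
    rw [eq_comm]
    simp [Units.smul_def, ← hB, inv_mul_cancel_left₀ hd]
    rfl

theorem exists_poly_of_correspondence
    {k : Type} [Field k] [IsAlgClosed k] [CharZero k] {n m : ℕ}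
    {I : Ideal (MvPolynomial (Fin n) k)} (hI : IsSurf I) (c : Chart I) {p₀ : Fin n → k}
    (hp₀ : ∀ f ∈ I, eval p₀ f = 0) (hdet : eval p₀ c.det ≠ 0)
    (K : Type) [Field K] [Algebra k K] [Algebra (MvPolynomial (Fin n) k ⧸ I) K]
    [IsScalarTower k (MvPolynomial (Fin n) k ⧸ I) K] [IsFractionRing (MvPolynomial (Fin n) k ⧸ I) K]
    (hm : 5 ≤ m) (F : Fin m → MvPolynomial (Fin n) k)
    (hη : ConstIndep k fun l => aeval (genPt I K) (F l))
    (hind : LinearIndependent K ![fun l => aeval (genPt I K) (F l),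
      fun l => aeval (genPt I K) (c.der 0 (F l)), fun l => aeval (genPt I K) (c.der 1 (F l))])
    (S : Set (MvPolynomial (Fin m) k))
    (hS : ∀ f ∈ S, (∃ d, f.IsHomogeneous d) ∧ aeval F f ∈ I) (hnl : ¬ HasLineFamily k S)
    {L : Type} [Field L] [Algebra k L] (u : Fin n ⊕ Fin n ⊕ Fin 3 → L)
    (hgen : ∀ δ : Derivation k L L, (∀ s, δ (u s) = 0) → δ = 0)
    (hx : ∀ f ∈ I, aeval (fun l => u (.inl l)) f = 0)
    (hp : ∀ f ∈ I, aeval (fun l => u (.inr (.inl l))) f = 0)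
    (hrel : ∀ l, aeval (fun l => u (.inl l)) (F l) =
      u (.inr (.inr 0)) * aeval (fun l => u (.inr (.inl l))) (F l) +
      u (.inr (.inr 1)) * aeval (fun l => u (.inr (.inl l))) (c.der 0 (F l)) +
      u (.inr (.inr 2)) * aeval (fun l => u (.inr (.inl l))) (c.der 1 (F l))) :
    ∃ g ∉ I, aeval (fun l => u (.inl l)) g = 0 ∨ aeval (fun l => u (.inr (.inl l))) g = 0 ∨
      ∀ l, ∃ Q : Polynomial (MvPolynomial (Fin n) k), Q.leadingCoeff ∣ g ∧
        Q.eval₂ (aeval fun l => u (.inl l)).toRingHom (u (.inr (.inl l))) = 0 := by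
  have hprime := hI.1
  by_cases h1 : ∃ g ∉ I, aeval (fun l => u (.inl l)) g = 0
  · obtain ⟨g, hg, h⟩ := h1
    exact ⟨g, hg, .inl h⟩
  by_cases h2 : ∃ g ∉ I, aeval (fun l => u (.inr (.inl l))) g = 0
  · obtain ⟨g, hg, h⟩ := h2
    exact ⟨g, hg, .inr (.inl h)⟩
  push Not at h1 h2
  have hx' : ∀ f : MvPolynomial (Fin n) k, aeval (fun l => u (.inl l)) f = 0 ↔ f ∈ I :=
    fun f => ⟨fun h => by_contra fun hf => h1 f hf h, hx f⟩
  have hp' : ∀ f : MvPolynomial (Fin n) k, aeval (fun l => u (.inr (.inl l))) f = 0 ↔ f ∈ I :=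
    fun f => ⟨fun h => by_contra fun hf => h2 f hf h, hp f⟩
  obtain ⟨ι, hι⟩ := exists_hom_of_genPt I K _ hx'
  obtain ⟨κ, hκ⟩ := exists_hom_of_genPt I K _ hp'
  have : CharZero K := charZero_of_injective_algebraMap (algebraMap k K).injective
  have : CharZero L := charZero_of_injective_algebraMap (algebraMap k L).injective
  let _ : Algebra K L := ι.toRingHom.toAlgebra
  have hal : ∀ x, algebraMap K L x = ι x := fun _ => rfl
  have : IsScalarTower k K L := .of_algebraMap_eq fun r => (ι.commutes r).symm
  by_cases halg : ∀ l, IsAlgebraic K (u (.inr (.inl l)))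
  · let _ : Algebra (MvPolynomial (Fin n) k ⧸ I) L :=
      ((algebraMap K L).comp (algebraMap (MvPolynomial (Fin n) k ⧸ I) K)).toAlgebra
    have : IsScalarTower (MvPolynomial (Fin n) k ⧸ I) K L := .of_algebraMap_eq fun r => rfl
    have hQ : ∀ l, ∃ Q : Polynomial (MvPolynomial (Fin n) k), Q.leadingCoeff ∉ I ∧
        Q.eval₂ (aeval fun l => u (.inl l)).toRingHom (u (.inr (.inl l))) = 0 := by
      intro l
      obtain ⟨q, hq0, hq⟩ :=
        (IsFractionRing.isAlgebraic_iff (MvPolynomial (Fin n) k ⧸ I) K L).mpr (halg l)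
      obtain ⟨Q, hQ, hdeg⟩ := Polynomial.exists_degree_eq_of_mem_lifts (f := Ideal.Quotient.mk I)
        (p := q) (Polynomial.map_surjective _ Ideal.Quotient.mk_surjective q)
      refine ⟨Q, fun h => ?_, ?_⟩
      · have h3 : q.leadingCoeff = 0 := by
          rw [← Ideal.Quotient.eq_zero_iff_mem, ← Polynomial.coeff_natDegree,
            ← Polynomial.coeff_map, hQ, Polynomial.natDegree_eq_of_degree_eq hdeg] at h
          exact h
        exact hq0 (Polynomial.leadingCoeff_eq_zero.mp h3)
      · rw [← hQ, Polynomial.aeval_def, Polynomial.eval₂_map] at hq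
        have he : (aeval fun l => u (.inl l)).toRingHom =
            (algebraMap (MvPolynomial (Fin n) k ⧸ I) L).comp (Ideal.Quotient.mk I) := by
          refine RingHom.ext fun f => ?_
          change aeval _ f = ι (algebraMap _ K (Ideal.Quotient.mk I f))
          rw [← aeval_genPt, hι]
        rw [he]
        exact hq
    choose Q hQ1 hQ2 using hQ
    refine ⟨∏ l, (Q l).leadingCoeff, fun h => ?_, .inr (.inr fun l =>
      ⟨Q l, Finset.dvd_prod_of_mem _ (Finset.mem_univ l), hQ2 l⟩)⟩
    obtain ⟨l, -, hl⟩ := (hprime.prod_mem_iff).mp h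
    exact hQ1 l hl
  · push Not at halg
    obtain ⟨l, hl⟩ := halg
    obtain ⟨D, hD⟩ := exists_derivation_ne_zero (F := K) (L := L) (c := u (.inr (.inl l))) hl
    let δ : Derivation k L L := D.restrictScalars k
    have hδ0 : δ ≠ 0 := fun h => hD (DFunLike.congr_fun h _)
    have hδι : ∀ x, δ (ι x) = 0 := fun x => D.map_algebraMap x
    obtain ⟨B, hB, hBF⟩ := c.exists_diffBasis_genPt (m := m) hI hp₀ hdet K
    have hd : aeval (genPt I K) c.det ≠ 0 := fun h =>
      hdet (hp₀ _ ((aeval_genPt_eq_zero I K _).mp h))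
    have hκd : κ (aeval (genPt I K) c.det) ≠ 0 := by
      rwa [Ne, map_eq_zero]
    refine absurd (hasLineFamily_of_correspondence B hm _ hη (hBF F hind) κ ι (u (.inr (.inr 0)))
      ![κ (aeval (genPt I K) c.det) * u (.inr (.inr 1)),
        κ (aeval (genPt I K) c.det) * u (.inr (.inr 2))] ?_ ?_ ⟨δ, hδ0, hδι⟩
        (exists_derivation_of_ne_zero B B ι κ δ hδ0 hδι) S ?_) hnl
    · intro l
      rw [hι, hrel l, ← hκ, ← hκ, ← hκ, ← hB, ← hB, map_mul, map_mul]
      simp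
      ring
    · intro E h1 h2 h3 h4
      refine hgen E ?_
      rintro (l | l | l)
      · have := h1 (aeval (genPt I K) (X l : MvPolynomial (Fin n) k))
        rwa [hι, aeval_X] at this
      · have := h2 (aeval (genPt I K) (X l : MvPolynomial (Fin n) k))
        rwa [hκ, aeval_X] at this
      · have h5 := h4 0
        have h6 := h4 1
        simp [h2, hd] at h5 h6
        fin_cases l
        exacts [h3, h5, h6]
    · intro f hf
      refine ⟨(hS f hf).1, ?_⟩
      have := algHom_aeval (aeval (genPt I K) : MvPolynomial (Fin n) k →ₐ[k] K) F f
      rw [← this, aeval_genPt_eq_zero]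
      exact (hS f hf).2

end

section

theorem exists_finite_correspondence
    {k : Type} [Field k] [IsAlgClosed k] [CharZero k] {n m : ℕ}
    {I : Ideal (MvPolynomial (Fin n) k)} (hI : IsSurf I) (c : Chart I) {p₀ : Fin n → k}
    (hp₀ : ∀ f ∈ I, eval p₀ f = 0) (hdet : eval p₀ c.det ≠ 0)
    (K : Type) [Field K] [Algebra k K] [Algebra (MvPolynomial (Fin n) k ⧸ I) K]
    [IsScalarTower k (MvPolynomial (Fin n) k ⧸ I) K] [IsFractionRing (MvPolynomial (Fin n) k ⧸ I) K]
    (hm : 5 ≤ m) (F : Fin m → MvPolynomial (Fin n) k)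
    (hη : ConstIndep k fun l => aeval (genPt I K) (F l))
    (hind : LinearIndependent K ![fun l => aeval (genPt I K) (F l),
      fun l => aeval (genPt I K) (c.der 0 (F l)), fun l => aeval (genPt I K) (c.der 1 (F l))])
    (S : Set (MvPolynomial (Fin m) k))
    (hS : ∀ f ∈ S, (∃ d, f.IsHomogeneous d) ∧ aeval F f ∈ I) (hnl : ¬ HasLineFamily k S) :
    ∃ g ∉ I, ∀ x, (∀ f ∈ I, eval x f = 0) → eval x g ≠ 0 →
      {p | (∀ f ∈ I, eval p f = 0) ∧ eval p g ≠ 0 ∧ ∃ t : Fin 3 → k, ∀ l, eval x (F l) =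
        t 0 * eval p (F l) + t 1 * eval p (c.der 0 (F l)) + t 2 * eval p (c.der 1 (F l))}.Finite := by
  classical
  have hprime := hI.1
  let σ := Fin n ⊕ Fin n ⊕ Fin 3
  let rx : MvPolynomial (Fin n) k →ₐ[k] MvPolynomial σ k := rename Sum.inl
  let rp : MvPolynomial (Fin n) k →ₐ[k] MvPolynomial σ k := rename fun l => Sum.inr (Sum.inl l)
  let T : Fin 3 → MvPolynomial σ k := fun i => X (.inr (.inr i))
  let R : Fin m → MvPolynomial σ k := fun l => rx (F l) - (T 0 * rp (F l) +
    T 1 * rp (c.der 0 (F l)) + T 2 * rp (c.der 1 (F l)))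
  let J : Ideal (MvPolynomial σ k) := Ideal.span (rx '' I ∪ rp '' I ∪ range R)
  have key : ∀ P ∈ J.minimalPrimes, ∃ g ∉ I, ∀ x : Fin n → k, eval x g ≠ 0 →
      {p : Fin n → k | eval p g ≠ 0 ∧ ∃ t : Fin 3 → k, ∀ f ∈ P,
        eval (Sum.elim x (Sum.elim p t)) f = 0}.Finite := by
    intro P hP
    have hPp : P.IsPrime := hP.1.1
    have hJP : J ≤ P := hP.1.2
    let L := FractionRing (MvPolynomial σ k ⧸ P)
    have h0 : ∀ f ∈ P, aeval (genPt P L) f = 0 := fun f hf => (aeval_genPt_eq_zero P L f).mpr hf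
    have hrx : ∀ f : MvPolynomial (Fin n) k, aeval (fun l => genPt P L (.inl l)) f =
        aeval (genPt P L) (rx f) := fun f => by
      rw [aeval_rename]; rfl
    have hrp : ∀ f : MvPolynomial (Fin n) k, aeval (fun l => genPt P L (.inr (.inl l))) f =
        aeval (genPt P L) (rp f) := fun f => by
      rw [aeval_rename]; rfl
    have hT : ∀ i, genPt P L (.inr (.inr i)) = aeval (genPt P L) (T i) := fun i => by
      rw [aeval_X]
    obtain ⟨g, hgI, hg⟩ := exists_poly_of_correspondence hI c hp₀ hdet K hm F hη hind S hS hnl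
      (genPt P L) (fun δ h => derivation_eq_zero_of_genPt P L δ h)
      (fun f hf => by
        rw [hrx]; exact h0 _ (hJP (Ideal.subset_span (.inl (.inl ⟨f, hf, rfl⟩)))))
      (fun f hf => by
        rw [hrp]; exact h0 _ (hJP (Ideal.subset_span (.inl (.inr ⟨f, hf, rfl⟩)))))
      (fun l => by
        have := h0 _ (hJP (Ideal.subset_span (.inr ⟨l, rfl⟩)))
        rw [map_sub, sub_eq_zero] at this
        rw [hrx, this, hT, hT, hT, hrp, hrp, hrp]
        simp only [map_add, map_mul])
    refine ⟨g, hgI, fun x hx => ?_⟩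
    rcases hg with hg | hg | hg
    · refine Set.Finite.subset Set.finite_empty ?_
      rintro p ⟨-, t, ht⟩
      rw [hrx, aeval_genPt_eq_zero] at hg
      have := ht _ hg
      rw [eval_rename] at this
      exact hx this
    · refine Set.Finite.subset Set.finite_empty ?_
      rintro p ⟨hp, t, ht⟩
      rw [hrp, aeval_genPt_eq_zero] at hg
      have := ht _ hg
      rw [eval_rename] at this
      exact hp this
    · choose Q hQ1 hQ2 using hg
      refine Set.Finite.subset (Set.Finite.pi' (ι := Fin n) (t := fun l =>
        {s | s ∈ ((Q l).map (eval x)).roots.toFinset}) fun l => Finset.finite_toSet _) ?_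
      rintro p ⟨hp, t, ht⟩ l
      have hne : (Q l).map (eval x) ≠ 0 := by
        intro h
        have h1 : ((Q l).map (eval x)).coeff (Q l).natDegree = 0 := by rw [h, Polynomial.coeff_zero]
        rw [Polynomial.coeff_map] at h1
        obtain ⟨r, hr⟩ := hQ1 l
        rw [hr, map_mul] at hx
        exact hx (by rw [Polynomial.leadingCoeff, h1, zero_mul])
      change p l ∈ ((Q l).map (eval x)).roots.toFinset
      rw [Multiset.mem_toFinset, Polynomial.mem_roots hne, Polynomial.IsRoot, Polynomial.eval_map]
      have h2 : (Q l).eval₂ rx.toRingHom (X (.inr (.inl l))) ∈ P := by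
        rw [← aeval_genPt_eq_zero P L, ← AlgHom.coe_toRingHom, Polynomial.hom_eval₂]
        have he : ((aeval (genPt P L) : MvPolynomial σ k →ₐ[k] L) : MvPolynomial σ k →+* L).comp
            rx.toRingHom = (aeval fun l => genPt P L (.inl l)).toRingHom :=
          RingHom.ext fun f => (hrx f).symm
        have hX : aeval (genPt P L) (X (.inr (.inl l)) : MvPolynomial σ k) =
          genPt P L (.inr (.inl l)) := aeval_X _ _
        have h3 := hQ2 l
        rw [← he, ← hX] at h3
        exact h3
      have h3 := ht _ h2
      rw [Polynomial.hom_eval₂] at h3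
      have he : (eval (Sum.elim x (Sum.elim p t))).comp rx.toRingHom = eval x :=
        RingHom.ext fun f => by
          change eval _ (rename Sum.inl f) = _
          rw [eval_rename]
          rfl
      rw [he, eval_X] at h3
      exact h3
  have hfin := J.finite_minimalPrimes_of_isNoetherianRing
  choose! g hg hgf using key
  refine ⟨∏ P ∈ hfin.toFinset, g P, fun h => ?_, fun x hx hgx => ?_⟩
  · obtain ⟨P, hP, h⟩ := hprime.prod_mem_iff.mp h
    exact hg P (hfin.mem_toFinset.mp hP) h
  have hprod : ∀ q : Fin n → k, eval q (∏ P ∈ hfin.toFinset, g P) ≠ 0 →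
      ∀ P ∈ J.minimalPrimes, eval q (g P) ≠ 0 := by
    intro q hq P hP
    rw [map_prod, Finset.prod_ne_zero_iff] at hq
    exact hq P (hfin.mem_toFinset.mpr hP)
  refine Set.Finite.subset (hfin.biUnion fun P hP => hgf P hP x (hprod x hgx P hP)) ?_
  rintro p ⟨hp, hgp, t, ht⟩
  let e : σ → k := Sum.elim x (Sum.elim p t)
  have hJe : J ≤ RingHom.ker (eval e) := by
    refine Ideal.span_le.mpr ?_
    rintro _ ((⟨f, hf, rfl⟩ | ⟨f, hf, rfl⟩) | ⟨l, rfl⟩)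
    · change eval e (rename _ f) = 0
      rw [eval_rename]; exact hx f hf
    · change eval e (rename _ f) = 0
      rw [eval_rename]; exact hp f hf
    · change eval e (R l) = 0
      simp only [R, map_sub, map_add, map_mul, rx, rp, eval_rename, T, eval_X]
      exact sub_eq_zero.mpr (ht l)
  have hker : (RingHom.ker (eval e)).IsPrime := RingHom.ker_isPrime _
  obtain ⟨P, hP, hPe⟩ := Ideal.exists_minimalPrimes_le hJe
  exact Set.mem_biUnion hP ⟨hprod p hgp P hP, t, fun f hf => hPe hf⟩

end

section

section Bad
variable {k : Type} [Field k] [IsAlgClosed k] {M N : ℕ} {X : Set (Pr k M)} {φ : Pr k M → Pr k N}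

theorem constIndep_of_nondegenerate (hX : IsVariety X) (hφ : IsMorphismOn X φ)
    (hnd : Nondegenerate (φ '' X)) {F} (hF : IsRep X φ F) {j : Fin (M + 1)} {v₀ : Fin (M + 1) → k}
    (hv₀ : v₀ ∈ patch X j) (h0 : evalV F v₀ ≠ 0) {μ : Fin (N + 1) → k}
    (h : ∑ l, C (μ l) * F l ∈ patchIdeal X j) : μ = 0 := by
  obtain ⟨d, hd⟩ := hF.1
  have hom : (∑ l, C (μ l) * F l).IsHomogeneous d :=
    IsHomogeneous.sum _ _ _ fun l _ => by
      simpa using (isHomogeneous_C (Fin (M + 1)) (μ l)).mul (hd l)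
  rw [mem_forms_of_mem_patchIdeal hX ⟨v₀, hv₀⟩ ⟨d, hom⟩] at h
  have hl : (∑ l, C (μ l) * MvPolynomial.X l : MvPolynomial (Fin (N + 1)) k).IsHomogeneous 1 :=
    IsHomogeneous.sum _ _ _ fun l _ => isHomogeneous_C_mul_X _ _
  have h1 := (hF.mem_forms_iff subset_rfl hX hφ hv₀.1 h0 ⟨1, hl⟩).mpr (by simpa using h)
  have h2 := hnd _ hl h1.2
  funext l
  have h3 := congrArg (eval (Pi.single l (1 : k))) h2
  simpa [Pi.single_apply] using h3

theorem ker_eq_span {x : Pr k M} {F} (hF : IsRep X φ F) {v : Fin (M + 1) → k} (hv : v ∈ cone X)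
    {hv0 : v ≠ 0} (hx : x = Projectivization.mk k v hv0) (h0 : evalV F v ≠ 0) :
    Projectivization.submodule (φ x) = Submodule.span k {evalV F v} := by
  rw [hx, hF.2 v hv hv0 h0, Projectivization.submodule_mk]

theorem GoodAt.gen (hX : IsSmoothSurface X) (hφ : IsMorphismOn X φ) (hnd : Nondegenerate (φ '' X))
    (hN : 4 ≤ N) {u : Fin (M + 1) → k} (hu : u ∈ cone X)
    (h : GoodAt X φ (LinearMap.id : (Fin (N + 1) → k) →ₗ[k] _) u) :
    Gen X fun x => ∀ m (L : (Fin (N + 1) → k) →ₗ[k] (Fin m → k)),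
      LinearMap.ker L = Projectivization.submodule (φ x) → GoodAt X φ L u := by
  obtain ⟨F, hF, h0, hJ⟩ := h
  obtain ⟨j, hj⟩ := Function.ne_iff.mp hu.1
  have hj : u j ≠ 0 := hj
  have hv₀ := exists_patch hu hj
  have h0' : evalV F ((u j)⁻¹ • u) ≠ 0 := by
    obtain ⟨d, hd⟩ := hF.1
    rw [evalV_smul hd]
    exact smul_ne_zero (pow_ne_zero _ (inv_ne_zero hj)) h0
  have hlt : (tan X u).map (jacobian F u) < ⊤ := by
    refine lt_top_iff_ne_top.mpr fun h => ?_
    have h1 := Submodule.finrank_map_le (jacobian F u) (tan X u)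
    rw [h, finrank_top, finrank_tan hX hu, finrank_fin_fun] at h1
    omega
  obtain ⟨ℓ, hℓ, hle⟩ := Submodule.exists_le_ker_of_lt_top _ hlt
  have hℓs : ∀ w, ℓ w = ∑ l, ℓ (Pi.single l 1) * w l := by
    intro w
    rw [LinearMap.pi_apply_eq_sum_univ ℓ w]
    simp only [smul_eq_mul, mul_comm]
    congr! 3 with l
    funext a
    simp [Pi.single_apply, eq_comm]
  have hg : ∑ l, C (ℓ (Pi.single l 1)) * F l ∉ patchIdeal X j := fun hmem => by
    have h1 := constIndep_of_nondegenerate hX.1 hφ hnd hF hv₀ h0' hmem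
    refine hℓ (LinearMap.ext fun w => ?_)
    rw [hℓs]
    exact Finset.sum_eq_zero fun l _ => by rw [congr_fun h1 l]; simp
  refine (Gen.of_notMem hg).mono ?_
  rintro x hx ⟨v, hv, hgv, hv0, hxv⟩ m L hL
  have hgv' : ℓ (evalV F v) ≠ 0 := by
    rw [hℓs]; simpa [evalV] using hgv
  have hFv : evalV F v ≠ 0 := fun h => hgv' (by rw [h, map_zero])
  refine ⟨F, hF, h0, fun w hw hLw => hJ w hw ?_⟩
  rw [← LinearMap.mem_ker, hL, ker_eq_span hF hv.1 hxv hFv, Submodule.mem_span_singleton] at hLw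
  obtain ⟨c, hc⟩ := hLw
  have h1 : ℓ (jacobian F u w) = 0 := hle (Submodule.mem_map_of_mem hw)
  rw [← hc, map_smul, smul_eq_mul] at h1
  rw [LinearMap.id_apply, ← hc, (mul_eq_zero.mp h1).resolve_right hgv', zero_smul]

theorem GoodAt.finite_bad_curve (hX : IsSmoothSurface X) {m : ℕ}
    {L : (Fin (N + 1) → k) →ₗ[k] (Fin m → k)} {B : Set (Pr k M)} (hB : IsCurveLike B)
    {p : Pr k M} (hp : p ∈ B) (hpX : p ∈ X) (h : GoodAt X φ L p.rep) :
    {q | q ∈ X ∧ q ∈ B ∧ ¬ GoodAt X φ L q.rep}.Finite := by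
  obtain ⟨g, hg, hgp, H⟩ := h.open hX (rep_mem_cone hpX)
  refine (hB.finite (isAlgSet_vanishes hg) fun hsub => hgp ?_).subset ?_
  · obtain ⟨d, hd⟩ := hg
    exact (vanishes_iff_rep hd p).mp (hsub hp)
  · rintro q ⟨hqX, hqB, hq⟩
    refine ⟨hqB, ?_⟩
    by_contra hv
    obtain ⟨d, hd⟩ := hg
    exact hq (H _ (rep_mem_cone hqX) fun h0 => hv ((vanishes_iff_rep hd q).mpr h0))

variable [CharZero k]

theorem GoodAt.gen_finite_patch (hX : IsSmoothSurface X) (hφ : IsMorphismOn X φ)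
    (hnd : Nondegenerate (φ '' X)) (hN : 4 ≤ N) (hnl : ¬ HasLineFamily k (forms (φ '' X)))
    {j : Fin (M + 1)} {v₀ : Fin (M + 1) → k} (hv₀ : v₀ ∈ patch X j)
    (h : GoodAt X φ (LinearMap.id : (Fin (N + 1) → k) →ₗ[k] _) v₀) :
    ∃ h ∉ patchIdeal X j, Gen X fun x => ∀ m (L : (Fin (N + 1) → k) →ₗ[k] (Fin m → k)),
      LinearMap.ker L = Projectivization.submodule (φ x) →
        {v | v ∈ patch X j ∧ eval v h ≠ 0 ∧ ¬ GoodAt X φ L v}.Finite := by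
  set I := patchIdeal X j with hIdef
  have hI : IsSurf I := hX.isSurf ⟨v₀, hv₀⟩
  have hprime : I.IsPrime := hI.1
  have hp₀ := eval_patchIdeal hv₀
  obtain ⟨c, hdet⟩ := exists_chart (hI.2 v₀ hp₀)
  obtain ⟨F, d, hF, hd, hd0, hrows⟩ := h.exists_rows hv₀ c hI hdet
  have hFv₀ : evalV F v₀ ≠ 0 := fun h => hrows.ne_zero 0 h
  obtain ⟨P, hP, hPi⟩ := exists_det_poly (c.rows F) v₀ hrows
  let K := FractionRing (MvPolynomial (Fin (M + 1)) k ⧸ I)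
  have notMem : ∀ f, eval v₀ f ≠ 0 → f ∉ I := fun f hf hfI => hf (hp₀ f hfI)
  have hη : ConstIndep k fun l => aeval (genPt I K) (F l) := by
    intro μ hμ
    refine constIndep_of_nondegenerate hX.1 hφ hnd hF hv₀ hFv₀ (j := j) ?_
    rw [← hIdef, ← aeval_genPt_eq_zero I K, map_sum, ← hμ]
    exact Finset.sum_congr rfl fun l _ => by rw [map_mul, aeval_C]
  have h1 := hPi K (genPt I K) fun h => notMem P hP ((aeval_genPt_eq_zero I K P).mp h)
  have hS : ∀ f ∈ forms (φ '' X), (∃ d, f.IsHomogeneous d) ∧ aeval F f ∈ I := fun f hf =>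
    ⟨hf.1, forms_subset_patchIdeal j ((hF.mem_forms_iff subset_rfl hX.1 hφ hv₀.1 hFv₀ hf.1).mp hf)⟩
  obtain ⟨g, hg, hfin⟩ := exists_finite_correspondence hI c hp₀ hdet K (by omega) F hη
    (by convert h1 using 1; funext i; fin_cases i <;> rfl) _ hS hnl
  obtain ⟨l₀, hl₀⟩ := Function.ne_iff.mp hFv₀
  refine ⟨g * (P * c.det), ?_, ?_⟩
  · rw [hprime.mul_mem_iff_mem_or_mem, hprime.mul_mem_iff_mem_or_mem]
    rintro (h | h | h)
    exacts [hg h, notMem _ hP h, notMem _ hdet h]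
  · have hgF : g * F l₀ ∉ I := by
      rw [hprime.mul_mem_iff_mem_or_mem]
      rintro (h | h)
      exacts [hg h, notMem _ hl₀ h]
    refine (Gen.of_notMem hgF).mono ?_
    rintro x hx ⟨v, hv, hgv, hv0, hxv⟩ m L hL
    rw [map_mul] at hgv
    have hFv : evalV F v ≠ 0 := fun h => right_ne_zero_of_mul hgv (congr_fun h l₀)
    rw [ker_eq_span hF hv.1 hxv hFv] at hL
    refine (hfin v (eval_patchIdeal hv) (left_ne_zero_of_mul hgv)).subset ?_
    rintro p ⟨hp, hpg, hbad⟩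
    rw [map_mul, map_mul] at hpg
    refine ⟨eval_patchIdeal hp, left_ne_zero_of_mul hpg, ?_⟩
    have hpPd := right_ne_zero_of_mul hpg
    have hrp : LinearIndependent k fun i => evalV (c.rows F i) p := by
      have h1 := hPi k p (left_ne_zero_of_mul hpPd)
      exact h1
    have hnot := fun h => hbad (goodAt_of_linearIndependent hp c hI (right_ne_zero_of_mul hpPd) L hF
      hd hd0 h)
    replace hnot := Fintype.not_linearIndependent_iff.mp hnot
    obtain ⟨t, ht, i₀, hi₀⟩ := hnot
    simp only [← map_smul, ← map_sum] at ht
    rw [← LinearMap.mem_ker, hL, Submodule.mem_span_singleton] at ht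
    obtain ⟨a, ha⟩ := ht
    have ha0 : a ≠ 0 := by
      rintro rfl
      rw [zero_smul] at ha
      exact hi₀ (Fintype.linearIndependent_iff.mp hrp t ha.symm i₀)
    refine ⟨fun i => a⁻¹ * t i, fun l => ?_⟩
    have h1 := congr_fun ha l
    have h2 : a * eval v (F l) = t 0 * eval p (F l) + t 1 * eval p (c.der 0 (F l)) +
        t 2 * eval p (c.der 1 (F l)) := by
      rw [Fin.sum_univ_three] at h1
      exact h1
    have h3 : eval v (F l) = a⁻¹ * (a * eval v (F l)) := by rw [← mul_assoc, inv_mul_cancel₀ ha0, one_mul]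
    rw [h3, h2]; ring

theorem gen_finite_bad (hX : IsSmoothSurface X) (hφ : Uncrumpled X φ) (hN : 4 ≤ N)
    (hnl : ¬ HasLineFamily k (forms (φ '' X))) :
    Gen X fun x => ∀ m (L : (Fin (N + 1) → k) →ₗ[k] (Fin m → k)),
      LinearMap.ker L = Projectivization.submodule (φ x) →
        {p | p ∈ X ∧ ¬ GoodAt X φ L p.rep}.Finite := by
  classical
  obtain ⟨hφm, hnd, -, hram⟩ := hφ
  have hgood : ∀ p ∈ X, p ∉ RamLocus X φ →
      GoodAt X φ (LinearMap.id : (Fin (N + 1) → k) →ₗ[k] _) p.rep := fun p hp h =>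
    (not_ramifiedAt_iff hX hp).mp fun h' => h ⟨hp, h'⟩
  obtain ⟨p₀, hp₀, hnr⟩ := (infinite_of_hasDim (n := 1) hX.2.1).exists_notMem_finite hram
  have hu := rep_mem_cone hp₀
  obtain ⟨j, hj⟩ := Function.ne_iff.mp hu.1
  have hj : p₀.rep j ≠ 0 := hj
  obtain ⟨h, hh, hgen⟩ := ((hgood p₀ hp₀ hnr).smul (inv_ne_zero hj)).gen_finite_patch hX hφm hnd hN
    hnl (exists_patch hu hj)
  obtain ⟨D, H, h', hH, hHh⟩ := exists_homogenization j h
  have hXH : (MvPolynomial.X j * H : MvPolynomial (Fin (M + 1)) k).IsHomogeneous (1 + D) :=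
    (isHomogeneous_X k j).mul hH
  have hprime : (patchIdeal X j).IsPrime := patchIdeal_isPrime hX.1 ⟨_, exists_patch hu hj⟩
  have hXHn : MvPolynomial.X j * H ∉ forms X := by
    intro hmem
    rcases hprime.mem_or_mem (forms_subset_patchIdeal j hmem) with h1 | h1
    · have := eval_patchIdeal (exists_patch hu hj) _ h1
      simp [hj] at this
    · rw [hHh, homogenization_mem_patchIdeal] at h1
      exact hh h1
  obtain ⟨s, hs, hsB, hsW⟩ := (hX.1.1.inter (isAlgSet_vanishes ⟨_, hXH⟩)).exists_decomposition
  have hcurve : ∀ B ∈ s, IsCurveLike B := fun B hB => by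
    refine isCurveLike_of_ssubset hX.1 hX.2.1 (hsB B hB).1
      ⟨(hsB B hB).2.trans inter_subset_left, fun hsub => hXHn ⟨⟨_, hXH⟩, fun q hq => ?_⟩⟩
    exact ((hsB B hB).2 (hsub hq)).2
  have hB : ∀ B ∈ s, Gen X fun x => ∀ m (L : (Fin (N + 1) → k) →ₗ[k] (Fin m → k)),
      LinearMap.ker L = Projectivization.submodule (φ x) →
        {q | q ∈ X ∧ q ∈ B ∧ ¬ GoodAt X φ L q.rep}.Finite := by
    intro B hB
    by_cases hfin : B.Finite
    · exact Gen.of_forall hX.1.2.1 fun x _ m L _ => hfin.subset fun q hq => hq.2.1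
    · obtain ⟨p, hp, hpr⟩ := Set.Infinite.exists_notMem_finite hfin hram
      have hpX := ((hsB B hB).2 hp).1
      exact ((hgood p hpX hpr).gen hX hφm hnd hN (rep_mem_cone hpX)).mono fun x _ hx m L hL =>
        (hx m L hL).finite_bad_curve hX (hcurve B hB) hp hpX
  refine (hgen.and hX.1 (Gen.forall_finite hX.1 hs hB)).mono ?_
  rintro x hx ⟨h1, h2⟩ m L hL
  have hfin1 := h1 m L hL
  refine ((hs.biUnion fun B hB => h2 B hB m L hL).union
    (hfin1.image fun v => if hv : v ≠ 0 then Projectivization.mk k v hv else x)).subset ?_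
  rintro p ⟨hp, hbad⟩
  by_cases hv : Vanishes (MvPolynomial.X j * H) p
  · obtain ⟨B, hBs, hpB⟩ := hsW ⟨hp, hv⟩
    exact .inl (Set.mem_biUnion hBs ⟨hp, hpB, hbad⟩)
  · right
    rw [vanishes_iff_rep hXH, map_mul, eval_X, mul_eq_zero, not_or] at hv
    have hmem := exists_patch (rep_mem_cone hp) hv.1
    refine ⟨(p.rep j)⁻¹ • p.rep, ⟨hmem, ?_, fun hG => hbad ?_⟩, ?_⟩
    · have h3 : eval ((p.rep j)⁻¹ • p.rep) H ≠ 0 := by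
        rw [eval_smul_of_isHomogeneous hH]
        exact mul_ne_zero (pow_ne_zero _ (inv_ne_zero hv.1)) hv.2
      rwa [hHh, map_add, map_mul, map_sub, eval_X, hmem.2, map_one, sub_self, zero_mul,
        add_zero] at h3
    · have := hG.smul hv.1
      rwa [smul_inv_smul₀ hv.1] at this
    · have h0 := hmem.1.1
      simp only [dif_pos h0]
      refine Eq.trans ?_ p.mk_rep
      rw [Projectivization.mk_eq_mk_iff']
      exact ⟨(p.rep j)⁻¹, rfl⟩

end Bad

end

section

section Pullback
variable {k : Type} [Field k] {M M' N N' : ℕ}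

theorem sum_pderiv_aeval (G : Fin (M + 1) → MvPolynomial (Fin (M' + 1)) k)
    (f : MvPolynomial (Fin (M + 1)) k) (v w : Fin (M' + 1) → k) :
    ∑ l, eval v (pderiv l (aeval G f)) * w l =
      ∑ a, eval (evalV G v) (pderiv a f) * jacobian G v w a := by
  simp only [jacobian_apply, Finset.mul_sum, derivation_aeval_pderiv, map_sum, smul_eq_mul,
    map_mul, Finset.sum_mul, eval_aeval_tuple]
  rw [Finset.sum_comm]
  exact Finset.sum_congr rfl fun a _ => Finset.sum_congr rfl fun l _ => by ring

theorem IsRep.jacobian_mem_tan {Xt : Set (Pr k M')} {β : Pr k M' → Pr k M} (hXt : IsVariety Xt)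
    (hβ : IsMorphismOn Xt β) {G} (hG : IsRep Xt β G) {v : Fin (M' + 1) → k} (hv : v ∈ cone Xt)
    (h0 : evalV G v ≠ 0) {w} (hw : w ∈ tan Xt v) :
    jacobian G v w ∈ tan (β '' Xt) (evalV G v) := by
  rw [mem_tan] at hw ⊢
  intro f hf
  rw [← sum_pderiv_aeval]
  exact hw _ ((hG.mem_forms_iff subset_rfl hXt hβ hv h0 hf.1).mp hf)

theorem GoodAt.of_smul {X : Set (Pr k M)} {φ : Pr k M → Pr k N} {m : ℕ}
    {L : (Fin (N + 1) → k) →ₗ[k] (Fin m → k)} {v u : Fin (M + 1) → k} {hv : v ≠ 0} {hu : u ≠ 0}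
    (h : GoodAt X φ L v) (he : Projectivization.mk k u hu = Projectivization.mk k v hv) :
    GoodAt X φ L u := by
  obtain ⟨a, ha⟩ := (Projectivization.mk_eq_mk_iff' _ _ _ hu hv).mp he
  have ha0 : a ≠ 0 := by rintro rfl; exact hu (by rw [← ha, zero_smul])
  rw [← ha]
  exact h.smul ha0

/-- Off the exceptional fiber, the resolved projection is unramified wherever `β` is unramified and
`L ∘ φ` is unramified at the image point. -/
theorem GoodAt.pullback [IsAlgClosed k] {X : Set (Pr k M)} {φ : Pr k M → Pr k N} {Xt : Set (Pr k M')}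
    {β : Pr k M' → Pr k M} {x : Pr k M} {φt : Pr k M' → Pr k N'}
    {L : (Fin (N + 1) → k) →ₗ[k] (Fin (N' + 1) → k)} (hXt : IsVariety Xt)
    (hβ : IsMorphismOn Xt β) (hβX : β '' Xt = X)
    (hres : ResolvesInnerProj X φ x Xt β φt L) {v : Fin (M' + 1) → k} (hv : v ∈ cone Xt)
    (hgβ : GoodAt Xt β (LinearMap.id : (Fin (M + 1) → k) →ₗ[k] _) v)
    (hgL : GoodAt X φ L (β (Projectivization.mk k v hv.1)).rep) :
    GoodAt Xt φt (LinearMap.id : (Fin (N' + 1) → k) →ₗ[k] _) v := by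
  obtain ⟨-, hker, hres⟩ := hres
  obtain ⟨G, hG, hG0, hGJ⟩ := hgβ
  have hβv := hG.2 v hv hv.1 hG0
  have hpX : evalV G v ∈ cone X := hβX ▸ hG.mem_image subset_rfl hv hG0
  have hgL' : GoodAt X φ L (evalV G v) :=
    hgL.of_smul (hu := hG0) (hv := Projectivization.rep_nonzero _) (by
      rw [Projectivization.mk_rep, ← hβv])
  obtain ⟨F, hF, hF0, hFJ⟩ := hgL'
  obtain ⟨dG, hdG⟩ := hG.1
  obtain ⟨d, hd⟩ := hF.1
  have hFzero : evalV F 0 = 0 := by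
    have hd0 : d ≠ 0 := by
      rintro rfl
      have h1 := hFJ _ (self_mem_tan hpX)
      rw [jacobian_self hd] at h1
      exact hG0 (h1 (by simp))
    have := evalV_smul hd 0 0
    rwa [zero_smul, zero_pow hd0, zero_smul] at this
  let H : Fin (N' + 1) → MvPolynomial (Fin (M' + 1)) k := fun i => aeval G (linTuple L F i)
  have hHe : ∀ u, evalV H u = L (evalV F (evalV G u)) := fun u => by
    funext i
    change eval u (aeval G (linTuple L F i)) = _
    rw [eval_aeval_tuple, eval_linTuple]
  have hHhom : ∀ i, (H i).IsHomogeneous (dG * d) := fun i => by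
    have := (isHomogeneous_linTuple L hd i).aeval G hdG
    exact this
  have hJ : ∀ w, jacobian H v w = L (jacobian F (evalV G v) (jacobian G v w)) := fun w => by
    funext i
    rw [jacobian_apply]
    simp only [H]
    rw [sum_pderiv_aeval, linear_apply_eq_sum]
    simp only [linTuple, jacobian_apply, map_sum, Derivation.leibniz, pderiv_C,
      smul_eq_mul, mul_zero, add_zero, map_mul, eval_C, Finset.sum_mul, Finset.mul_sum, mul_assoc]
    exact Eq.trans (Finset.sum_congr rfl fun _ _ => Finset.sum_comm) Finset.sum_comm
  have hinj : ∀ w ∈ tan Xt v, jacobian H v w = 0 → w = 0 := fun w hw h => by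
    rw [hJ] at h
    exact hGJ w hw (hFJ _ (hβX ▸ hG.jacobian_mem_tan hXt hβ hv hG0 hw) h)
  refine ⟨H, ⟨⟨_, hHhom⟩, fun u hu hu0 hHu => ?_⟩, fun h => hv.1 (hinj v (self_mem_tan hv) ?_), hinj⟩
  · have hFGu : evalV F (evalV G u) ≠ 0 := fun h => hHu (by rw [hHe, h, map_zero])
    have hGu : evalV G u ≠ 0 := fun h => hFGu (by rw [h, hFzero])
    have hGuX : evalV G u ∈ cone X := hβX ▸ hG.mem_image subset_rfl hu hGu
    have h1 := hG.2 u hu hu0 hGu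
    have h2 := hF.2 _ hGuX hGu hFGu
    have hne : β (Projectivization.mk k u hu0) ≠ x := by
      intro he
      rw [ker_eq_span hF hGuX (he.symm.trans h1) hFGu] at hker
      refine hHu ?_
      rw [hHe, ← LinearMap.mem_ker, hker]
      exact Submodule.mem_span_singleton_self _
    have h3 := hres _ hu.2 hne _ hFGu (by rw [h1, h2]) (by rw [← hHe]; exact hHu)
    rw [h3]
    exact (Projectivization.mk_eq_mk_iff' _ _ _ _ _).mpr ⟨1, by rw [one_smul, hHe]⟩
  · rw [jacobian_self hHhom, h, smul_zero]

end Pullback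

end

section

theorem exists_algHom_ne_of_not_surjective {K L : Type} [Field K] [CharZero K] [Field L]
    [Algebra K L] [Algebra.IsAlgebraic K L] (h : ¬ Function.Surjective (algebraMap K L)) :
    ∃ σ : L →ₐ[K] AlgebraicClosure L, σ ≠ IsScalarTower.toAlgHom K L (AlgebraicClosure L) := by
  by_contra! hall
  have hsub : Subsingleton (Field.Emb K L) := ⟨fun σ τ => (hall σ).trans (hall τ).symm⟩
  have h1 : Field.finSepDegree K L = 1 := by
    rw [Field.finSepDegree, Nat.card_eq_one_iff_unique]
    exact ⟨hsub, ⟨IsScalarTower.toAlgHom K L (AlgebraicClosure L)⟩⟩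
  have := isPurelyInseparable_of_finSepDegree_eq_one h1
  exact h (IsPurelyInseparable.surjective_algebraMap_of_isSeparable K L)

section Birational
variable {k : Type} [Field k] [IsAlgClosed k] {M M' : ℕ}
  {X : Set (Pr k M)} {Xt : Set (Pr k M')} {β : Pr k M' → Pr k M} {j : Fin (M + 1)}
  {l : Fin (M' + 1)}
  {K : Type} [Field K] [Algebra k K] [Algebra (MvPolynomial (Fin (M + 1)) k ⧸ patchIdeal X j) K]
  [IsScalarTower k (MvPolynomial (Fin (M + 1)) k ⧸ patchIdeal X j) K]
  [IsFractionRing (MvPolynomial (Fin (M + 1)) k ⧸ patchIdeal X j) K]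
  {L : Type} [Field L] [Algebra k L]
  [Algebra (MvPolynomial (Fin (M' + 1)) k ⧸ patchIdeal Xt l) L]
  [IsScalarTower k (MvPolynomial (Fin (M' + 1)) k ⧸ patchIdeal Xt l) L]
  [IsFractionRing (MvPolynomial (Fin (M' + 1)) k ⧸ patchIdeal Xt l) L]

theorem aeval_genPt_ne_zero {v : Fin (M' + 1) → k} (hv : v ∈ patch Xt l) {f} (hf : eval v f ≠ 0) :
    aeval (genPt (patchIdeal Xt l) L) f ≠ 0 := fun h =>
  hf (eval_patchIdeal hv _ ((aeval_genPt_eq_zero _ L f).mp h))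

variable (K L) in
theorem exists_generic_hom (hX : IsVariety X) (hXt : IsVariety Xt)
    (hβ : IsMorphismOn Xt β) (hβX : β '' Xt = X) {G} (hG : IsRep Xt β G) {v : Fin (M' + 1) → k}
    (hv : v ∈ patch Xt l) (hGj : eval v (G j) ≠ 0) :
    ∃ ι : K →ₐ[k] L, ∀ a, ι (genPt (patchIdeal X j) K a) *
      aeval (genPt (patchIdeal Xt l) L) (G j) = aeval (genPt (patchIdeal Xt l) L) (G a) := by
  set ζ := genPt (patchIdeal Xt l) L with hζ
  have hj0 : aeval ζ (G j) ≠ 0 := aeval_genPt_ne_zero hv hGj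
  have h0 : evalV G v ≠ 0 := fun h => hGj (congr_fun h j)
  have hne : (patch X j).Nonempty :=
    ⟨_, exists_patch (hβX ▸ hG.mem_image subset_rfl hv.1 h0) (j := j) hGj⟩
  have key : ∀ f : MvPolynomial (Fin (M + 1)) k,
      aeval (fun a => aeval ζ (G a) / aeval ζ (G j)) f = 0 ↔ f ∈ patchIdeal X j := by
    intro f
    obtain ⟨D, F, h, hF, hFh⟩ := exists_homogenization j f
    have h1 : aeval (fun a => aeval ζ (G a) / aeval ζ (G j)) f =
        aeval (fun a => aeval ζ (G a) / aeval ζ (G j)) F := by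
      rw [hFh, map_add, map_mul, map_sub, aeval_X, div_self hj0, map_one, sub_self, zero_mul,
        add_zero]
    have h2 : (fun a => aeval ζ (G a) / aeval ζ (G j)) =
        fun a => (aeval ζ (G j))⁻¹ * aeval ζ (G a) := by funext a; rw [div_eq_inv_mul]
    have h3 : aeval (fun a => aeval ζ (G a)) F = aeval ζ (aeval G F) :=
      (algHom_aeval (aeval ζ) G F).symm
    rw [h1, h2, aeval_smul_of_isHomogeneous hF, mul_eq_zero,
      or_iff_right (pow_ne_zero _ (inv_ne_zero hj0)), h3, aeval_genPt_eq_zero,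
      mem_forms_of_mem_patchIdeal hXt ⟨v, hv⟩ (isHomogeneous_aeval hG.1.choose_spec ⟨D, hF⟩),
      ← hG.mem_forms_iff subset_rfl hXt hβ hv.1 h0 ⟨D, hF⟩, hβX,
      ← mem_forms_of_mem_patchIdeal hX hne ⟨D, hF⟩, hFh, homogenization_mem_patchIdeal]
  obtain ⟨ι, hι⟩ := exists_hom_of_genPt (patchIdeal X j) K _ key
  refine ⟨ι, fun a => ?_⟩
  have := hι (MvPolynomial.X a)
  rw [aeval_X, aeval_X] at this
  rw [this, div_mul_cancel₀ _ hj0]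

theorem generic_hom_surjective [CharZero k] (hX : IsVariety X) (hXt : IsVariety Xt)
    (hβ : IsMorphismOn Xt β) (hβX : β '' Xt = X) {x : Pr k M} (hinf : X.Infinite)
    (hinj : InjOn β {q | q ∈ Xt ∧ β q ≠ x})
    (hI : IsSurf (patchIdeal X j)) (hIt : IsSurf (patchIdeal Xt l))
    {G} (hG : IsRep Xt β G) {v : Fin (M' + 1) → k}
    (hv : v ∈ patch Xt l) (hGj : eval v (G j) ≠ 0) (ι : K →ₐ[k] L)
    (hι : ∀ a, ι (genPt (patchIdeal X j) K a) *
      aeval (genPt (patchIdeal Xt l) L) (G j) = aeval (genPt (patchIdeal Xt l) L) (G a)) :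
    Function.Surjective ι := by
  set ζ := genPt (patchIdeal Xt l) L with hζ
  have hGζ : aeval ζ (G j) ≠ 0 := aeval_genPt_ne_zero hv hGj
  have h0 : evalV G v ≠ 0 := fun h => hGj (congr_fun h j)
  have hpatch := exists_patch (hβX ▸ hG.mem_image subset_rfl hv.1 h0) (j := j) hGj
  obtain ⟨dG, hdG⟩ := hG.1
  have hcz : CharZero K := charZero_of_injective_algebraMap (algebraMap k K).injective
  have hczL : CharZero L := charZero_of_injective_algebraMap (algebraMap k L).injective
  obtain ⟨c, hc⟩ := exists_chart (hI.2 _ (eval_patchIdeal hpatch))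
  obtain ⟨c', hc'⟩ := exists_chart (hIt.2 _ (eval_patchIdeal hv))
  obtain ⟨B, -⟩ := c.exists_diffBasis hI (eval_patchIdeal hpatch) hc K
  obtain ⟨B', -⟩ := c'.exists_diffBasis hIt (eval_patchIdeal hv) hc' L
  let _ : Algebra K L := ι.toRingHom.toAlgebra
  have hal : ∀ y, algebraMap K L y = ι y := fun _ => rfl
  have htow : IsScalarTower k K L := .of_algebraMap_eq fun r => (ι.commutes r).symm
  have halg : Algebra.IsAlgebraic K L := by
    refine ⟨fun y => ?_⟩
    by_contra hy
    obtain ⟨D, hD⟩ := exists_derivation_ne_zero (F := K) hy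
    obtain ⟨δ, hδ, h⟩ := exists_derivation_of_ne_zero B B' ι (AlgHom.id k L) (D.restrictScalars k)
      (fun h => hD (by simpa using DFunLike.congr_fun h y)) fun y => D.map_algebraMap y
    exact hδ (Derivation.ext h)
  by_contra hsurj
  obtain ⟨σ, hσ⟩ := exists_algHom_ne_of_not_surjective (K := K) (L := L) hsurj
  let Ω := AlgebraicClosure L
  let τ : L →ₐ[k] Ω := IsScalarTower.toAlgHom k L Ω
  let σ' : L →ₐ[k] Ω := σ.restrictScalars k
  have hτι : ∀ y, τ (ι y) = σ' (ι y) := fun y => (σ.commutes y).symm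
  obtain ⟨a, ha⟩ : ∃ a, τ (ζ a) ≠ σ' (ζ a) := by
    by_contra! hall
    refine hσ (AlgHom.ext fun y => ?_)
    obtain ⟨f, g, -, rfl⟩ := exists_aeval_genPt_div (patchIdeal Xt l) L y
    have h1 : ∀ f, σ' (aeval ζ f) = τ (aeval ζ f) := fun f => by
      rw [algHom_aeval, algHom_aeval]; simp only [hall]
    change σ' _ = τ _
    rw [map_div₀, map_div₀, h1, h1]
  obtain ⟨b, b', hb⟩ : ∃ b b', G b * C (x.rep b') - G b' * C (x.rep b) ∉ patchIdeal Xt l := by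
    by_contra! hall
    have h1 : ∀ b b' : Fin (M + 1), MvPolynomial.X b * C (x.rep b') - MvPolynomial.X b' *
        C (x.rep b) ∈ forms X := by
      intro b b'
      have hom : (MvPolynomial.X b * C (x.rep b') - MvPolynomial.X b' *
          C (x.rep b) : MvPolynomial (Fin (M + 1)) k).IsHomogeneous 1 := by
        simpa [mul_comm] using (isHomogeneous_C_mul_X (x.rep b') b).sub
          (isHomogeneous_C_mul_X (x.rep b) b')
      rw [← hβX, hG.mem_forms_iff subset_rfl hXt hβ hv.1 h0 ⟨1, hom⟩,
        ← mem_forms_of_mem_patchIdeal hXt ⟨v, hv⟩ (isHomogeneous_aeval hdG ⟨1, hom⟩)]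
      simpa using hall b b'
    refine hinf ((Set.finite_singleton x).subset fun p hp => ?_)
    have h2 : ∀ b b', p.rep b * x.rep b' = p.rep b' * x.rep b := fun b b' => by
      have := (mem_forms_iff (h1 b b').1).mp (h1 b b') _ (rep_mem_cone hp)
      simpa [sub_eq_zero] using this
    obtain ⟨b', hb'⟩ := Function.ne_iff.mp x.rep_nonzero
    have hb' : x.rep b' ≠ 0 := hb'
    rw [Set.mem_singleton_iff, ← p.mk_rep, ← x.mk_rep, Projectivization.mk_eq_mk_iff']
    refine ⟨p.rep b' / x.rep b', funext fun b => ?_⟩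
    rw [Pi.smul_apply, smul_eq_mul, div_mul_eq_mul_div, ← h2, mul_div_cancel_right₀ _ hb']
  set h := G b * C (x.rep b') - G b' * C (x.rep b) with hh
  have hhζ : aeval ζ h ≠ 0 := fun h1 => hb ((aeval_genPt_eq_zero _ L _).mp h1)
  let e₀ : Fin (M' + 1) ⊕ Fin (M' + 1) → Ω := Sum.elim (fun a => τ (ζ a)) fun a => σ' (ζ a)
  have hl : ∀ f : MvPolynomial (Fin (M' + 1)) k, aeval e₀ (rename Sum.inl f) = τ (aeval ζ f) :=
    fun f => by rw [aeval_rename, algHom_aeval]; rfl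
  have hr : ∀ f : MvPolynomial (Fin (M' + 1)) k, aeval e₀ (rename Sum.inr f) = σ' (aeval ζ f) :=
    fun f => by rw [aeval_rename, algHom_aeval]; rfl
  obtain ⟨e, hge, he⟩ := exists_point_of_field_point (k := k) e₀
    ((MvPolynomial.X (.inl a) - MvPolynomial.X (.inr a)) * rename Sum.inl (G j * h) *
      rename Sum.inr (G j * h)) (by
    rw [map_mul, map_mul, map_sub, aeval_X, aeval_X, hl, hr, map_mul, map_mul, map_mul]
    exact mul_ne_zero (mul_ne_zero (sub_ne_zero.mpr ha) (mul_ne_zero ((map_ne_zero _).mpr hGζ)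
      ((map_ne_zero _).mpr hhζ))) (mul_ne_zero ((map_ne_zero _).mpr hGζ) ((map_ne_zero _).mpr hhζ)))
  let e₁ := e ∘ Sum.inl
  let e₂ := e ∘ Sum.inr
  simp only [map_mul, map_sub, eval_X, eval_rename] at hge
  have hne := left_ne_zero_of_mul (left_ne_zero_of_mul hge)
  have hj1 : eval e₁ (G j) ≠ 0 := left_ne_zero_of_mul (right_ne_zero_of_mul (left_ne_zero_of_mul hge))
  have hh1 : eval e₁ h ≠ 0 := right_ne_zero_of_mul (right_ne_zero_of_mul (left_ne_zero_of_mul hge))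
  have hj2 : eval e₂ (G j) ≠ 0 := left_ne_zero_of_mul (right_ne_zero_of_mul hge)
  have hp1 : e₁ ∈ patch Xt l := by
    rw [mem_patch_iff hXt.1]
    intro f hf
    have := he (rename Sum.inl f) (by rw [hl, (aeval_genPt_eq_zero _ L f).mpr hf, map_zero])
    rwa [eval_rename] at this
  have hp2 : e₂ ∈ patch Xt l := by
    rw [mem_patch_iff hXt.1]
    intro f hf
    have := he (rename Sum.inr f) (by rw [hr, (aeval_genPt_eq_zero _ L f).mpr hf, map_zero])
    rwa [eval_rename] at this
  have hcross : ∀ b, eval e₁ (G b) * eval e₂ (G j) = eval e₁ (G j) * eval e₂ (G b) := by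
    intro b
    have := he (rename Sum.inl (G b) * rename Sum.inr (G j) - rename Sum.inl (G j) *
      rename Sum.inr (G b)) (by
        rw [map_sub, map_mul, map_mul, hl, hl, hr, hr, ← hι b, map_mul, map_mul, hτι]
        ring)
    rw [map_sub, map_mul, map_mul, eval_rename, eval_rename, eval_rename, eval_rename,
      sub_eq_zero] at this
    exact this
  have h01 : evalV G e₁ ≠ 0 := fun h => hj1 (congr_fun h j)
  have h02 : evalV G e₂ ≠ 0 := fun h => hj2 (congr_fun h j)
  have hβ12 : β (Projectivization.mk k e₁ hp1.1.1) = β (Projectivization.mk k e₂ hp2.1.1) := by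
    rw [hG.2 _ hp1.1 _ h01, hG.2 _ hp2.1 _ h02, Projectivization.mk_eq_mk_iff']
    refine ⟨eval e₁ (G j) / eval e₂ (G j), funext fun b => ?_⟩
    change _ / _ * eval e₂ (G b) = eval e₁ (G b)
    rw [div_mul_eq_mul_div, ← hcross, mul_div_cancel_right₀ _ hj2]
  have hx1 : β (Projectivization.mk k e₁ hp1.1.1) ≠ x := by
    intro h1
    rw [hG.2 _ hp1.1 _ h01, ← x.mk_rep, Projectivization.mk_eq_mk_iff'] at h1
    obtain ⟨r, hr⟩ := h1
    refine hh1 ?_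
    have h2 : ∀ b, eval e₁ (G b) = r * x.rep b := fun b => (congr_fun hr b).symm
    rw [hh, map_sub, map_mul, map_mul, eval_C, eval_C, h2, h2]
    ring
  have := hinj ⟨hp1.1.2, hx1⟩ ⟨hp2.1.2, hβ12 ▸ hx1⟩ hβ12
  rw [Projectivization.mk_eq_mk_iff'] at this
  obtain ⟨r, hr⟩ := this
  have hr1 : r = 1 := by
    have h1 := congr_fun hr l
    rw [Pi.smul_apply, hp1.2, hp2.2] at h1
    simpa using h1
  rw [hr1, one_smul] at hr
  exact hne (sub_eq_zero.mpr (congr_fun hr.symm a))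

end Birational

end

section

theorem exists_center_over {k K : Type} [Field k] [IsAlgClosed k] [Field K] [Algebra k K]
    {M M' : ℕ} {Xt : Set (Pr k M')} {β : Pr k M' → Pr k M} (hXt : IsVariety Xt)
    (hβ : IsMorphismOn Xt β) {G : Fin (M + 1) → MvPolynomial (Fin (M' + 1)) k}
    (hG : IsRep Xt β G) {y : Fin (M' + 1) → K} (hy : ∀ f ∈ forms Xt, aeval y f = 0)
    {j : Fin (M + 1)} (hy0 : aeval y (G j) ≠ 0) (hyn : y ≠ 0) {z : Fin (M + 1) → K}
    (hz : ∀ a, z a * aeval y (G j) = aeval y (G a)) {p : Fin (M + 1) → k} (hp : p ≠ 0)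
    (V : ValuationSubring K) (hV : ∀ a, algebraMap k K a ∈ V)
    (hzp : ∀ a, V.valuation (z a - algebraMap k K (p a)) < 1)
    {τ : Type} [Finite τ] (w : τ → K) (hw : ∀ i, w i ∈ V) (g : MvPolynomial τ k)
    (hg : V.valuation (aeval w g) = 1) :
    ∃ s e, ∃ ω : τ → k, ∃ he : e ∈ cone Xt, e s = 1 ∧ y s ≠ 0 ∧ (∀ a, y a / y s ∈ V) ∧
      eval ω g ≠ 0 ∧ β (Projectivization.mk k e he.1) = Projectivization.mk k p hp ∧
      ∀ f, V.valuation (aeval (Sum.elim (fun a => y a / y s) w) f) < 1 →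
        eval (Sum.elim e ω) f = 0 := by
  obtain ⟨s, -, hs⟩ := Finset.exists_max_image Finset.univ (fun a => V.valuation (y a))
    ⟨0, Finset.mem_univ _⟩
  have hys : y s ≠ 0 := by
    obtain ⟨a, ha⟩ := Function.ne_iff.mp hyn
    intro h
    have := hs a (Finset.mem_univ _)
    rw [h, map_zero, le_zero_iff, map_eq_zero] at this
    exact ha this
  have hyV : ∀ a, y a / y s ∈ V := fun a => by
    rw [← V.valuation_le_one_iff, map_div₀]
    exact div_le_one_of_le₀ (hs a (Finset.mem_univ _)) zero_le
  obtain ⟨E, hgE, hE⟩ := exists_center V hV (Sum.elim (fun a => y a / y s) w)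
    (by rintro (a | i); exacts [hyV a, hw i]) (rename Sum.inr g) (by
      rw [aeval_rename, Sum.elim_comp_inr, hg])
  have hEe : E = Sum.elim (E ∘ Sum.inl) (E ∘ Sum.inr) := (Sum.elim_comp_inl_inr E).symm
  set e := E ∘ Sum.inl with he_def
  have hE' : ∀ f, V.valuation (aeval (fun a => y a / y s) f) < 1 → eval e f = 0 := by
    intro f hf
    have := hE (rename Sum.inl f) (by rwa [aeval_rename, Sum.elim_comp_inl])
    rwa [eval_rename] at this
  have hy' : (fun a => y a / y s) = fun a => (y s)⁻¹ * y a := by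
    funext a; rw [div_eq_inv_mul]
  have hform : ∀ f ∈ forms Xt, aeval (fun a => y a / y s) f = 0 := by
    intro f hf
    obtain ⟨d, hd⟩ := hf.1
    rw [hy', aeval_smul_of_isHomogeneous hd, hy f hf, mul_zero]
  have hes : e s = 1 := by
    have := hE' (MvPolynomial.X s - 1) (by
      rw [map_sub, aeval_X, map_one, div_self hys, sub_self, map_zero]; exact zero_lt_one)
    rwa [map_sub, eval_X, map_one, sub_eq_zero] at this
  have he : e ∈ cone Xt := by
    rw [mem_cone_iff hXt.1 (fun h => one_ne_zero (hes.symm.trans (congr_fun h s)))]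
    exact fun f hf => hE' f (by rw [hform f hf, map_zero]; exact zero_lt_one)
  refine ⟨s, e, E ∘ Sum.inr, he, hes, hys, hyV, by rwa [eval_rename] at hgE, ?_, hEe ▸ hE⟩
  obtain ⟨G', hG', hG'e⟩ := exists_rep hβ he
  obtain ⟨d, hd⟩ := hG.1
  obtain ⟨d', hd'⟩ := hG'.1
  have hz' : ∀ a, z a * aeval (fun a => y a / y s) (G j) = aeval (fun a => y a / y s) (G a) := by
    intro a
    rw [hy', aeval_smul_of_isHomogeneous (hd _), aeval_smul_of_isHomogeneous (hd _), ← hz a]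
    ring
  have hj' : aeval (fun a => y a / y s) (G j) ≠ 0 := by
    rw [hy', aeval_smul_of_isHomogeneous (hd _)]
    exact mul_ne_zero (pow_ne_zero _ (inv_ne_zero hys)) hy0
  have hpoly : ∀ f : MvPolynomial (Fin (M' + 1)) k, aeval (fun a => y a / y s) f ∈ V := by
    intro f
    induction f using MvPolynomial.induction_on with
    | C a => rw [aeval_C]; exact hV a
    | add f g hf hg => rw [map_add]; exact add_mem hf hg
    | mul_X f a hf => rw [map_mul, aeval_X]; exact mul_mem hf (hyV a)
  have hcr : ∀ a b, aeval (fun a => y a / y s) (G' a) * z b =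
      aeval (fun a => y a / y s) (G' b) * z a := by
    intro a b
    have h1 : G' a * G b - G' b * G a ∈ forms Xt := by
      rw [mem_forms_iff ⟨d' + d, ((hd' a).mul (hd b)).sub ((hd' b).mul (hd a))⟩]
      intro v hv
      rw [map_sub, map_mul, map_mul, hG'.cross hG hv a b, sub_self]
    have h2 := hform _ h1
    rw [map_sub, map_mul, map_mul, ← hz' a, ← hz' b, ← mul_assoc, ← mul_assoc, ← sub_mul,
      mul_eq_zero, or_iff_left hj', sub_eq_zero] at h2
    exact h2
  have hep : ∀ a b, eval e (G' a) * p b = eval e (G' b) * p a := by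
    intro a b
    have := hE' (G' a * C (p b) - G' b * C (p a)) (by
      have h3 : aeval (fun a => y a / y s) (G' a * C (p b) - G' b * C (p a)) =
          aeval (fun a => y a / y s) (G' b) * (z a - algebraMap k K (p a)) -
          aeval (fun a => y a / y s) (G' a) * (z b - algebraMap k K (p b)) := by
        rw [map_sub, map_mul, map_mul, aeval_C, aeval_C]
        linear_combination hcr a b
      rw [h3]
      refine Valuation.map_sub_lt _ ?_ ?_ <;>
      · rw [map_mul]
        exact mul_lt_one_of_nonneg_of_lt_one_right ((V.valuation_le_one_iff _).mpr (hpoly _))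
          zero_le (hzp _))
    rwa [map_sub, map_mul, map_mul, eval_C, eval_C, sub_eq_zero] at this
  rw [hG'.2 _ he _ hG'e, Projectivization.mk_eq_mk_iff']
  obtain ⟨b, hb⟩ := Function.ne_iff.mp hp
  have hb : p b ≠ 0 := hb
  refine ⟨eval e (G' b) / p b, funext fun a => ?_⟩
  change _ / _ * p a = eval e (G' a)
  rw [div_mul_eq_mul_div, ← hep, mul_div_cancel_right₀ _ hb]

end

section

section Isomorphism
variable {k : Type} [Field k] {M M' : ℕ} {X : Set (Pr k M)} {Xt : Set (Pr k M')}
  {β : Pr k M' → Pr k M}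

theorem sum_pderiv_mul {n : ℕ} (f g : MvPolynomial (Fin n) k) (v w : Fin n → k) :
    ∑ l, eval v (pderiv l (f * g)) * w l =
      eval v f * ∑ l, eval v (pderiv l g) * w l + eval v g * ∑ l, eval v (pderiv l f) * w l := by
  rw [Finset.mul_sum, Finset.mul_sum, ← Finset.sum_add_distrib]
  refine Finset.sum_congr rfl fun l _ => ?_
  rw [Derivation.leibniz, smul_eq_mul, smul_eq_mul, map_add, map_mul, map_mul]
  ring

theorem sum_pderiv_X {n : ℕ} (a : Fin n) (v w : Fin n → k) :
    ∑ l, eval v (pderiv l (MvPolynomial.X a : MvPolynomial (Fin n) k)) * w l = w a := by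
  rw [Finset.sum_eq_single a]
  · simp
  · intro b _ hb
    rw [pderiv_X_of_ne hb.symm, map_zero, zero_mul]
  · simp

theorem exists_homogenization_pair {K : Type} [Field K] [Algebra k K] (j : Fin (M + 1))
    (f g : MvPolynomial (Fin (M + 1)) k) : ∃ D F G, F.IsHomogeneous D ∧ G.IsHomogeneous D ∧
      (∀ p : Fin (M + 1) → k, p j = 1 → eval p F = eval p f ∧ eval p G = eval p g) ∧
      ∀ p : Fin (M + 1) → K, p j = 1 → aeval p F = aeval p f ∧ aeval p G = aeval p g := by
  obtain ⟨D₁, F, h₁, hF, hFh⟩ := exists_homogenization j f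
  obtain ⟨D₂, G, h₂, hG, hGh⟩ := exists_homogenization j g
  refine ⟨D₁ + D₂, F * MvPolynomial.X j ^ D₂, G * MvPolynomial.X j ^ D₁,
    hF.mul (isHomogeneous_X_pow j D₂), add_comm D₁ D₂ ▸ hG.mul (isHomogeneous_X_pow j D₁), ?_, ?_⟩
  · intro p hp
    simp [hFh, hGh, hp]
  · intro p hp
    simp [hFh, hGh, hp]

theorem IsRep.degree_ne_zero (hβX : β '' Xt = X) (hinf : X.Infinite)
    {G : Fin (M + 1) → MvPolynomial (Fin (M' + 1)) k} (hG : IsRep Xt β G) {d : ℕ}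
    (hd : ∀ a, (G a).IsHomogeneous d) {v : Fin (M' + 1) → k} (h0 : evalV G v ≠ 0) : d ≠ 0 := by
  rintro rfl
  refine hinf ((Set.finite_singleton (Projectivization.mk k _ h0)).subset ?_)
  rw [← hβX]
  rintro _ ⟨q, hq, rfl⟩
  have hc : evalV G q.rep = evalV G v := funext fun a => by
    obtain ⟨c, hc⟩ : ∃ c, G a = C c :=
      ⟨_, totalDegree_eq_zero_iff_eq_C.mp (Nat.le_zero.mp (hd a).totalDegree_le)⟩
    change eval _ (G a) = eval _ (G a)
    rw [hc, eval_C, eval_C]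
  have := hG.2 _ (rep_mem_cone hq) q.rep_nonzero (hc ▸ h0)
  rw [q.mk_rep] at this
  rw [Set.mem_singleton_iff, this]
  congr 1

variable [IsAlgClosed k] [CharZero k]

theorem exists_local_fraction {j : Fin (M + 1)} {l : Fin (M' + 1)}
    (hXt : IsVariety Xt) (hβ : IsMorphismOn Xt β) {x : Pr k M}
    (hinj : InjOn β {q | q ∈ Xt ∧ β q ≠ x})
    (hI : IsSurf (patchIdeal X j))
    {K : Type} [Field K] [Algebra k K] [Algebra (MvPolynomial (Fin (M + 1)) k ⧸ patchIdeal X j) K]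
    [IsScalarTower k (MvPolynomial (Fin (M + 1)) k ⧸ patchIdeal X j) K]
    [IsFractionRing (MvPolynomial (Fin (M + 1)) k ⧸ patchIdeal X j) K]
    {G : Fin (M + 1) → MvPolynomial (Fin (M' + 1)) k} (hG : IsRep Xt β G)
    {v : Fin (M' + 1) → k} (hv : v ∈ cone Xt) (hvl : v l = 1)
    (hvx : β (Projectivization.mk k v hv.1) ≠ x) {p : Fin (M + 1) → k} (hp : p ∈ patch X j)
    (hpv : β (Projectivization.mk k v hv.1) = Projectivization.mk k p hp.1.1)
    {y : Fin (M' + 1) → K} (hyl : y l = 1) (hy : ∀ f ∈ forms Xt, aeval y f = 0)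
    (hy0 : aeval y (G j) ≠ 0)
    (hz : ∀ a, genPt (patchIdeal X j) K a * aeval y (G j) = aeval y (G a)) (a : Fin (M' + 1)) :
    ∃ f g : MvPolynomial (Fin (M + 1)) k, eval p f ≠ 0 ∧
      aeval (genPt (patchIdeal X j) K) f * y a = aeval (genPt (patchIdeal X j) K) g := by
  obtain ⟨c, hc⟩ := exists_chart (hI.2 _ (eval_patchIdeal hp))
  obtain ⟨T, hT, -⟩ := c.exists_localParam hI (eval_patchIdeal hp) hc
  have hprime := hI.1
  by_cases hint : ∀ s ∉ RingHom.ker T.ev, ¬ IsIntegral (MvPolynomial (Fin (M + 1)) k ⧸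
      patchIdeal X j) (s • y a)
  · exfalso
    obtain ⟨V, hVA, hVm, hVy⟩ := exists_valuation_of_not_isIntegral (RingHom.ker T.ev)
      (RingHom.ker_ne_top _) (y a) hint
    have hVk : ∀ a, algebraMap k K a ∈ V := fun a => by
      rw [IsScalarTower.algebraMap_apply k (MvPolynomial (Fin (M + 1)) k ⧸ patchIdeal X j) K]
      exact hVA _
    obtain ⟨s, e, ω, he, hes, hys, hyV, -, hβe, hsp⟩ := exists_center_over hXt hβ hG hy hy0
      (fun h => one_ne_zero (hyl.symm.trans (congr_fun h l))) hz hp.1.1 V hVk (fun b => by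
        have h1 := hVm (Ideal.Quotient.mk _ (MvPolynomial.X b - C (p b))) (by
          rw [RingHom.mem_ker, hT, quotEval_mk, map_sub, eval_X, eval_C, sub_self])
        rwa [← aeval_genPt, map_sub, aeval_X, aeval_C] at h1)
      (PEmpty.elim : PEmpty → K) (fun i => i.elim) 1 (by rw [map_one, map_one])
    have hmk := hinj ⟨he.2, hβe ▸ hpv ▸ hvx⟩ ⟨hv.2, hvx⟩ (hβe.trans hpv.symm)
    have hel : e l = 0 := by
      have h1 := hsp (MvPolynomial.X (.inl l)) (by
        rw [aeval_X, Sum.elim_inl]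
        refine lt_of_le_of_ne ((V.valuation_le_one_iff _).mpr (hyV l)) fun h => hVy ?_
        rw [hyl, one_div, map_inv₀, inv_eq_one] at h
        have h2 := mul_mem (hyV a) ((V.valuation_le_one_iff _).mp h.le)
        rwa [div_mul_cancel₀ _ hys] at h2)
      rwa [eval_X, Sum.elim_inl] at h1
    rw [Projectivization.mk_eq_mk_iff'] at hmk
    obtain ⟨r, hr⟩ := hmk
    have h1 := congr_fun hr l
    rw [Pi.smul_apply, hvl, hel, smul_eq_mul, mul_one] at h1
    rw [h1, zero_smul] at hr
    exact he.1 hr.symm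
  · push Not at hint
    obtain ⟨s, hs, hint⟩ := hint
    obtain ⟨c', g, hc', hg⟩ := T.exists_mul_mem_of_isIntegral hint
    obtain ⟨s, rfl⟩ := Ideal.Quotient.mk_surjective s
    obtain ⟨c', rfl⟩ := Ideal.Quotient.mk_surjective c'
    obtain ⟨g, rfl⟩ := Ideal.Quotient.mk_surjective g
    rw [RingHom.mem_ker, hT, quotEval_mk] at hs
    rw [hT, quotEval_mk] at hc'
    rw [← aeval_genPt, ← aeval_genPt, Algebra.smul_def, ← aeval_genPt] at hg
    exact ⟨c' * s, g, by rw [map_mul]; exact mul_ne_zero hc' hs, by rw [map_mul, mul_assoc, hg]⟩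

theorem goodAt_of_not_mem_excFiber (hX : IsSmoothSurface X) (hXt : IsSmoothSurface Xt)
    (hβ : IsMorphismOn Xt β) (hβX : β '' Xt = X) {x : Pr k M}
    (hinj : InjOn β {q | q ∈ Xt ∧ β q ≠ x}) {v : Fin (M' + 1) → k} (hv : v ∈ cone Xt)
    (hvx : β (Projectivization.mk k v hv.1) ≠ x) :
    GoodAt Xt β (LinearMap.id : (Fin (M + 1) → k) →ₗ[k] _) v := by
  obtain ⟨l, hl⟩ := Function.ne_iff.mp hv.1
  have hu := exists_patch hv hl
  have huv : Projectivization.mk k v hv.1 = Projectivization.mk k _ hu.1.1 := by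
    rw [Projectivization.mk_eq_mk_iff']
    exact ⟨v l, smul_inv_smul₀ hl v⟩
  refine GoodAt.of_smul (hv := hu.1.1) ?_ huv
  rw [huv] at hvx
  generalize (v l)⁻¹ • v = v at *
  clear huv hv
  obtain ⟨G, hG, h0⟩ := exists_rep hβ hu.1
  obtain ⟨j, hj⟩ := Function.ne_iff.mp h0
  have hp := exists_patch (hβX ▸ hG.mem_image subset_rfl hu.1 h0) (j := j) hj
  have hβv : β (Projectivization.mk k v hu.1.1) = Projectivization.mk k _ hp.1.1 := by
    rw [hG.2 _ hu.1 _ h0, Projectivization.mk_eq_mk_iff']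
    exact ⟨_, smul_inv_smul₀ hj _⟩
  set p := (evalV G v j)⁻¹ • evalV G v with hpdef
  have hGp : ∀ {D : ℕ} {F : MvPolynomial (Fin (M + 1)) k}, F.IsHomogeneous D →
      eval (evalV G v) F = (evalV G v j) ^ D * eval p F := by
    intro D F hF
    rw [← eval_smul_of_isHomogeneous hF, hpdef, smul_inv_smul₀ hj]
  have hinf : X.Infinite := infinite_of_hasDim (n := 1) hX.2.1
  have hI : IsSurf (patchIdeal X j) := hX.isSurf ⟨p, hp⟩
  have hIt : IsSurf (patchIdeal Xt l) := hXt.isSurf ⟨v, hu⟩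
  have := hI.1
  have := hIt.1
  let K := FractionRing (MvPolynomial (Fin (M + 1)) k ⧸ patchIdeal X j)
  let L := FractionRing (MvPolynomial (Fin (M' + 1)) k ⧸ patchIdeal Xt l)
  obtain ⟨ι, hι⟩ := exists_generic_hom K L hX.1 hXt.1 hβ hβX hG hu hj
  have hsurj := generic_hom_surjective hX.1 hXt.1 hβ hβX hinf hinj hI hIt hG hu hj ι hι
  have hιinj : Function.Injective ι := ι.injective
  set ζ := genPt (patchIdeal Xt l) L with hζ
  set z := genPt (patchIdeal X j) K with hzdef
  choose y hy using fun a => hsurj (ζ a)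
  have hιy : ∀ f : MvPolynomial (Fin (M' + 1)) k, ι (aeval y f) = aeval ζ f := fun f => by
    rw [algHom_aeval]; simp only [hy]
  have hGζ : aeval ζ (G j) ≠ 0 := aeval_genPt_ne_zero hu hj
  have hy0 : aeval y (G j) ≠ 0 := fun h => hGζ (by rw [← hιy, h, map_zero])
  have hyl : y l = 1 := hιinj (by rw [hy, map_one, hζ, genPt_self])
  have hyf : ∀ f ∈ forms Xt, aeval y f = 0 := fun f hf => hιinj (by
    rw [hιy, map_zero, aeval_genPt_eq_zero]
    exact forms_subset_patchIdeal l hf)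
  have hzy : ∀ a, z a * aeval y (G j) = aeval y (G a) := fun a => hιinj (by
    rw [map_mul, hιy, hιy, hι])
  have hvl : v l = 1 := hu.2
  obtain ⟨d, hd⟩ := hG.1
  have hd0 : (d : k) ≠ 0 := Nat.cast_ne_zero.mpr (hG.degree_ne_zero hβX hinf hd h0)
  refine ⟨G, hG, h0, fun w hw hJ => ?_⟩
  have hJ : jacobian G v w = 0 := hJ
  have hwv : w = w l • v := funext fun a => by
    obtain ⟨f, g, hf, hfg⟩ := exists_local_fraction hXt.1 hβ hinj hI hG hu.1 hvl hvx hp hβv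
      hyl hyf hy0 hzy a
    obtain ⟨D, F, H, hF, hH, hp1, hp2⟩ := exists_homogenization_pair (K := K) j f g
    have hz1 : z j = 1 := genPt_self K
    rw [← (hp2 z hz1).1, ← (hp2 z hz1).2] at hfg
    rw [← (hp1 p hp.2).1] at hf
    have hP : MvPolynomial.X a * aeval G F - MvPolynomial.X l * aeval G H ∈ forms Xt := by
      rw [← mem_forms_of_mem_patchIdeal hXt.1 ⟨v, hu⟩ (j := l)]
      · rw [← aeval_genPt_eq_zero _ L, ← hζ, ← hιy]
        have h1 : ∀ {F : MvPolynomial (Fin (M + 1)) k}, F.IsHomogeneous D →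
            aeval y (aeval G F) = aeval y (G j) ^ D * aeval z F := by
          intro F hF
          rw [← aeval_smul_of_isHomogeneous hF, algHom_aeval]
          congr 2
          funext b
          rw [← hzy, mul_comm]
        rw [map_sub, map_mul, map_mul, h1 hF, h1 hH, aeval_X, aeval_X, hyl, ← hfg]
        rw [show y a * (aeval y (G j) ^ D * aeval z F) - 1 * (aeval y (G j) ^ D *
          (aeval z F * y a)) = 0 by ring, map_zero]
      · exact ⟨1 + d * D, ((isHomogeneous_X k a).mul (hF.aeval G hd)).sub
          ((isHomogeneous_X k l).mul (hH.aeval G hd))⟩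
    have h1 := (mem_forms_iff hP.1).mp hP v hu.1
    have h2 := mem_tan.mp hw _ hP
    simp only [map_sub, sub_mul, Finset.sum_sub_distrib] at h2
    rw [sum_pderiv_mul, sum_pderiv_mul, sum_pderiv_aeval, sum_pderiv_aeval, hJ, sum_pderiv_X,
      sum_pderiv_X] at h2
    simp only [Pi.zero_apply, mul_zero, Finset.sum_const_zero, zero_add] at h2
    rw [map_sub, map_mul, map_mul, eval_X, eval_X, hvl] at h1
    rw [eval_aeval_tuple, eval_aeval_tuple] at h1 h2
    have hF0 : eval (evalV G v) F ≠ 0 := by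
      rw [hGp hF]
      exact mul_ne_zero (pow_ne_zero _ hj) hf
    refine mul_left_cancel₀ hF0 ?_
    rw [Pi.smul_apply, smul_eq_mul]
    linear_combination h2 - w l * h1
  rw [hwv, map_smul, jacobian_self hd, smul_eq_zero, smul_eq_zero, or_iff_right hd0,
    or_iff_left h0] at hJ
  rw [hwv, hJ, zero_smul]

end Isomorphism

end

section

theorem exists_valuation_of_ker_le {R K K' : Type} [CommRing R] [Field K] [Field K']
    (α : R →+* K) (β : R →+* K') (h : ∀ r, α r = 0 → β r = 0) :
    ∃ V : ValuationSubring K, (∀ r, α r ∈ V) ∧ (∀ r, β r = 0 → V.valuation (α r) < 1) ∧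
      ∀ r, β r ≠ 0 → V.valuation (α r) = 1 := by
  have : (RingHom.ker β).IsPrime := RingHom.ker_isPrime β
  have hα : ∀ s : (RingHom.ker β).primeCompl, IsUnit (α s) := fun s =>
    isUnit_iff_ne_zero.mpr fun h' => s.2 (h _ h')
  have hβ : ∀ s : (RingHom.ker β).primeCompl, IsUnit (β s) := fun s =>
    isUnit_iff_ne_zero.mpr s.2
  let α' : Localization.AtPrime (RingHom.ker β) →+* K := IsLocalization.lift hα
  let β' : Localization.AtPrime (RingHom.ker β) →+* K' := IsLocalization.lift hβ
  have hα' : ∀ r, α' (algebraMap R _ r) = α r := fun r => IsLocalization.lift_eq hα r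
  have hβ' : ∀ r, β' (algebraMap R _ r) = β r := fun r => IsLocalization.lift_eq hβ r
  have h' : ∀ r, α' r = 0 → β' r = 0 := by
    intro r hr
    obtain ⟨a, s, rfl⟩ := IsLocalization.exists_mk'_eq (RingHom.ker β).primeCompl r
    rw [IsLocalization.lift_mk', Units.mul_left_eq_zero] at hr ⊢
    exact h _ hr
  have hρ : Function.Surjective α'.rangeRestrict := RingHom.rangeRestrict_surjective _
  have hI : (RingHom.ker β').map α'.rangeRestrict ≠ ⊤ := by
    intro e
    obtain ⟨f, hf, h1⟩ := (Ideal.mem_map_iff_of_surjective _ hρ).mp ((Ideal.eq_top_iff_one _).mp e)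
    have h2 : α' f = 1 := congr_arg Subtype.val h1
    have h3 := h' (f - 1) (by rw [map_sub, h2, map_one, sub_self])
    rw [map_sub, map_one, sub_eq_zero] at h3
    exact one_ne_zero (h3.symm.trans hf)
  obtain ⟨V, hV1, hV2⟩ := Ideal.image_subset_nonunits_valuationSubring _ hI
  have hV : ∀ r, α' r ∈ V := fun r => hV1 ⟨r, rfl⟩
  refine ⟨V, fun r => hα' r ▸ hV _, fun r hr => ?_, fun r hr => ?_⟩
  · rw [← hα']
    exact V.mem_nonunits_iff.mp (hV2 ⟨α'.rangeRestrict (algebraMap R _ r),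
      Ideal.mem_map_of_mem _ ((hβ' r).trans hr), rfl⟩)
  · refine le_antisymm ((V.valuation_le_one_iff _).mpr (hα' r ▸ hV _)) ?_
    have h1 : (α r)⁻¹ ∈ V := by
      have h2 := hV (IsLocalization.mk' _ 1 (⟨r, hr⟩ : (RingHom.ker β).primeCompl))
      have h3 : α' (IsLocalization.mk' _ 1 (⟨r, hr⟩ : (RingHom.ker β).primeCompl)) = (α r)⁻¹ := by
        refine eq_inv_of_mul_eq_one_left ?_
        rw [← hα', ← map_mul, IsLocalization.mk'_spec, map_one, map_one]
      rwa [h3] at h2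
    have h2 := (V.valuation_le_one_iff _).mpr h1
    rw [map_inv₀] at h2
    have h0 : V.valuation (α r) ≠ 0 := (Valuation.ne_zero_iff _).mpr fun h0 => hr (h r h0)
    exact (inv_le_one₀ (zero_lt_iff.mpr h0)).mp h2

theorem eq_zero_of_aeval_one_X {k : Type} [Field k] [CharZero k] {P : MvPolynomial (Fin 2) k} {n : ℕ}
    (hP : P.IsHomogeneous n) (h : aeval ![1, (Polynomial.X : Polynomial k)] P = 0) : P = 0 := by
  have h1 : MvPolynomial.X 0 * P = 0 := by
    refine MvPolynomial.funext fun a => ?_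
    rw [map_mul, eval_X, map_zero]
    by_cases ha : a 0 = 0
    · rw [ha, zero_mul]
    · have h2 := congr_arg (Polynomial.eval (a 1 / a 0)) h
      have h3 : Polynomial.eval (a 1 / a 0) (aeval ![1, (Polynomial.X : Polynomial k)] P) =
          eval ![1, a 1 / a 0] P := by
        have := algHom_aeval (Polynomial.aeval (a 1 / a 0)) ![1, (Polynomial.X : Polynomial k)] P
        have hv : (fun i => Polynomial.aeval (a 1 / a 0) (![1, (Polynomial.X : Polynomial k)] i)) =
            ![1, a 1 / a 0] := by
          funext i
          fin_cases i <;> simp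
        rw [hv] at this
        exact this
      rw [h3, Polynomial.eval_zero] at h2
      have h4 : a = a 0 • ![1, a 1 / a 0] := by
        funext i
        fin_cases i
        · simp
        · simp [mul_div_cancel₀ _ ha]
      rw [h4, eval_smul_of_isHomogeneous hP, h2, mul_zero, mul_zero]
  exact (mul_eq_zero.mp h1).resolve_left (X_ne_zero 0)

namespace LocalParam
variable {k A K : Type} [Field k] [CommRing A] [Algebra k A] (T : LocalParam k A)

theorem t_ne_zero (i : Fin 2) : T.t i ≠ 0 := by
  intro h
  have := T.ev_D i i
  rw [h, map_zero, map_zero, if_pos rfl] at this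
  exact zero_ne_one this

theorem exists_mul_mem_span [IsNoetherianRing A] :
    ∃ c, T.ev c ≠ 0 ∧ ∀ a ∈ T.m, ∃ b : Fin 2 → A, c * a = b 0 * T.t 0 + b 1 * T.t 1 := by
  have h : (T.m : Submodule A A) ≤ Ideal.span (range T.t) ⊔ T.m • T.m := by
    have := T.ker_le
    rwa [pow_two] at this
  obtain ⟨c, hc, h⟩ := Submodule.exists_sub_one_mem_and_smul_le_of_fg_of_le_sup
    (IsNoetherian.noetherian (T.m)) le_rfl h
  refine ⟨c, fun h0 => ?_, fun a ha => ?_⟩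
  · have := T.mem_m.mp hc
    rw [map_sub, h0, map_one, zero_sub, neg_eq_zero] at this
    exact one_ne_zero this
  · have h1 : c * a ∈ Ideal.span (range T.t) := h (Submodule.smul_mem_pointwise_smul _ _ _ ha)
    obtain ⟨b, hb⟩ := (Ideal.mem_span_range_iff_exists_fun).mp h1
    exact ⟨b, by rw [← hb, Fin.sum_univ_two]⟩

variable [Field K] [Algebra A K]

theorem exists_pow_mul_eq {c : A} (hc : ∀ a ∈ T.m, ∃ b : Fin 2 → A, c * a = b 0 * T.t 0 + b 1 * T.t 1)
    (h0 : algebraMap A K (T.t 0) ≠ 0) (S : Subring K) (hS : ∀ a, algebraMap A K a ∈ S)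
    (hw : algebraMap A K (T.t 1) / algebraMap A K (T.t 0) ∈ S) {n : ℕ} {f : A} (hf : f ∈ T.m ^ n) :
    ∃ U ∈ S, algebraMap A K (c ^ n * f) = algebraMap A K (T.t 0) ^ n * U := by
  induction n generalizing f with
  | zero => exact ⟨algebraMap A K f, hS _, by simp⟩
  | succ n ih =>
    rw [pow_succ] at hf
    refine Submodule.mul_induction_on hf (fun a ha b hb => ?_) fun a b ha hb => ?_
    · obtain ⟨U, hU, hU'⟩ := ih ha
      obtain ⟨d, hd⟩ := hc b hb
      refine ⟨U * (algebraMap A K (d 0) + algebraMap A K (d 1) *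
        (algebraMap A K (T.t 1) / algebraMap A K (T.t 0))),
        mul_mem hU (add_mem (hS _) (mul_mem (hS _) hw)), ?_⟩
      rw [show c ^ (n + 1) * (a * b) = (c ^ n * a) * (c * b) by ring, map_mul, hU', hd, map_add,
        map_mul, map_mul]
      field_simp
      ring
    · obtain ⟨U, hU, hU'⟩ := ha
      obtain ⟨W, hW, hW'⟩ := hb
      exact ⟨U + W, add_mem hU hW, by rw [mul_add, map_add, hU', hW', mul_add]⟩

theorem aeval_t_eq [Algebra k K] [IsScalarTower k A K] (h0 : algebraMap A K (T.t 0) ≠ 0)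
    {P : MvPolynomial (Fin 2) k} {n : ℕ}
    (hP : P.IsHomogeneous n) : algebraMap A K (aeval T.t P) = algebraMap A K (T.t 0) ^ n *
      aeval ![1, algebraMap A K (T.t 1) / algebraMap A K (T.t 0)] P := by
  rw [← aeval_smul_of_isHomogeneous hP]
  have := algHom_aeval (IsScalarTower.toAlgHom k A K) T.t P
  rw [IsScalarTower.coe_toAlgHom'] at this
  rw [this]
  congr 2
  funext i
  fin_cases i
  · simp
  · simp [mul_div_cancel₀ _ h0]

theorem exists_valuation [CharZero k] [IsDomain A] [IsFractionRing A K] [Algebra k K]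
    [IsScalarTower k A K] :
    ∃ V : ValuationSubring K, (∀ a, algebraMap A K a ∈ V) ∧
      (∀ a, T.ev a = 0 → V.valuation (algebraMap A K a) < 1) ∧
      algebraMap A K (T.t 1) / algebraMap A K (T.t 0) ∈ V ∧
      ∀ n, ∀ P : MvPolynomial (Fin 2) k, P.IsHomogeneous n → P ≠ 0 → V.valuation
        (aeval ![1, algebraMap A K (T.t 1) / algebraMap A K (T.t 0)] P) = 1 := by
  have hinj : Function.Injective (algebraMap A K) := IsFractionRing.injective A K
  have h0 : algebraMap A K (T.t 0) ≠ 0 := (map_ne_zero_iff _ hinj).mpr (T.t_ne_zero 0)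
  set w := algebraMap A K (T.t 1) / algebraMap A K (T.t 0) with hw
  obtain ⟨V, hV1, hV2, hV3⟩ := exists_valuation_of_ker_le
    (Polynomial.eval₂RingHom (algebraMap A K) w)
    ((algebraMap (Polynomial k) (FractionRing (Polynomial k))).comp
      (Polynomial.mapRingHom (T.ev : A →+* k))) (by
    intro f hf
    rw [Polynomial.coe_eval₂RingHom, Polynomial.eval₂_eq_sum_range] at hf
    set n := f.natDegree
    have h1 : ∑ i ∈ Finset.range (n + 1), f.coeff i * (T.t 1 ^ i * T.t 0 ^ (n - i)) = 0 := by
      apply hinj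
      rw [map_zero, map_sum, ← mul_zero (algebraMap A K (T.t 0) ^ n), ← hf, Finset.mul_sum]
      refine Finset.sum_congr rfl fun i hi => ?_
      have hin : i ≤ n := Nat.lt_succ_iff.mp (Finset.mem_range.mp hi)
      rw [map_mul, map_mul, map_pow, map_pow, hw, div_pow, mul_comm, ← Nat.sub_add_cancel hin,
        pow_add, Nat.sub_add_cancel hin]
      field_simp
    let P : MvPolynomial (Fin 2) k := ∑ i ∈ Finset.range (n + 1),
      C (T.ev (f.coeff i)) * (MvPolynomial.X 1 ^ i * MvPolynomial.X 0 ^ (n - i))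
    have hP : P.IsHomogeneous n := by
      refine IsHomogeneous.sum _ _ _ fun i hi => ?_
      have hin : i ≤ n := Nat.lt_succ_iff.mp (Finset.mem_range.mp hi)
      have := (isHomogeneous_C (Fin 2) (T.ev (f.coeff i))).mul
        ((isHomogeneous_X_pow (R := k) (1 : Fin 2) i).mul
          (isHomogeneous_X_pow (0 : Fin 2) (n - i)))
      rwa [zero_add, Nat.add_sub_cancel' hin] at this
    have hP0 : P = 0 := by
      refine T.eq_zero_of_aeval_mem hP ?_
      have h2 : aeval T.t P = -∑ i ∈ Finset.range (n + 1),
          (f.coeff i - algebraMap k A (T.ev (f.coeff i))) * (T.t 1 ^ i * T.t 0 ^ (n - i)) := by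
        simp only [sub_mul, Finset.sum_sub_distrib, h1]
        simp [P]
      rw [h2, pow_succ']
      refine neg_mem (sum_mem fun i hi => Ideal.mul_mem_mul (T.sub_C_mem _) ?_)
      have hin : i ≤ n := Nat.lt_succ_iff.mp (Finset.mem_range.mp hi)
      rw [← Nat.add_sub_cancel' hin, pow_add, Nat.add_sub_cancel' hin]
      exact Ideal.mul_mem_mul (Ideal.pow_mem_pow (T.t_mem 1) _) (Ideal.pow_mem_pow (T.t_mem 0) _)
    have h3 : Polynomial.map (T.ev : A →+* k) f = aeval ![1, Polynomial.X] P := by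
      conv_lhs => rw [f.as_sum_range]
      simp [P, Polynomial.map_sum, Polynomial.C_mul_X_pow_eq_monomial, n]
    rw [RingHom.comp_apply, Polynomial.coe_mapRingHom, h3, hP0, map_zero, map_zero])
  have hC : ∀ a, Polynomial.eval₂RingHom (algebraMap A K) w (Polynomial.C a) = algebraMap A K a :=
    fun a => by simp
  refine ⟨V, fun a => hC a ▸ hV1 _, fun a ha => hC a ▸ hV2 _ (by simp [ha]), ?_, ?_⟩
  · have := hV1 Polynomial.X
    simpa using this
  · intro n P hP hP0
    have h4 := hV3 (aeval ![1, (Polynomial.X : Polynomial A)] P) (by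
      have h5 : Polynomial.mapRingHom (T.ev : A →+* k) (aeval ![1, (Polynomial.X : Polynomial A)] P) =
          aeval ![1, (Polynomial.X : Polynomial k)] P := by
        have := algHom_aeval (Polynomial.mapAlgHom T.ev) ![1, (Polynomial.X : Polynomial A)] P
        refine this.trans ?_
        congr 2
        funext i
        fin_cases i <;> simp
      rw [RingHom.comp_apply, h5]
      refine (map_ne_zero_iff _ (IsFractionRing.injective (Polynomial k) _)).mpr fun h6 => hP0 ?_
      exact eq_zero_of_aeval_one_X hP h6)
    have h7 : Polynomial.eval₂RingHom (algebraMap A K) w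
        (aeval ![1, (Polynomial.X : Polynomial A)] P) = aeval ![1, w] P := by
      have := algHom_aeval ((Polynomial.aeval (R := A) w).restrictScalars k)
        ![1, (Polynomial.X : Polynomial A)] P
      refine this.trans ?_
      congr 2
      funext i
      fin_cases i <;> simp
    rwa [h7] at h4

end LocalParam

end

section

section
variable {R K k : Type} [CommRing R] [Field K] [Field k]

/-- `f ∈ K` is a fraction of elements of `R` whose denominator is invertible under `τ`, and the
resulting value of `f` in the dual numbers is `d`. -/
def HasValue (α : R →+* K) (τ : R →+* DualNumber k) (f : K) (d : DualNumber k) : Prop :=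
  ∃ a b, TrivSqZeroExt.fst (τ b) ≠ 0 ∧ α b * f = α a ∧ τ b * d = τ a

namespace HasValue
variable {α : R →+* K} {τ : R →+* DualNumber k} {f f' g : K} {d d' e : DualNumber k}

theorem of_map (α : R →+* K) (τ : R →+* DualNumber k) (r : R) : HasValue α τ (α r) (τ r) :=
  ⟨r, 1, by simp, by simp, by simp⟩

theorem add (h : HasValue α τ f d) (h' : HasValue α τ f' d') : HasValue α τ (f + f') (d + d') := by
  obtain ⟨a, b, hb, h1, h2⟩ := h
  obtain ⟨a', b', hb', h1', h2'⟩ := h'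
  refine ⟨a * b' + b * a', b * b', ?_, ?_, ?_⟩
  · rw [map_mul, TrivSqZeroExt.fst_mul]
    exact mul_ne_zero hb hb'
  · simp only [map_mul, map_add, ← h1, ← h1']
    ring
  · simp only [map_mul, map_add, ← h2, ← h2']
    ring

theorem mul (h : HasValue α τ f d) (h' : HasValue α τ f' d') : HasValue α τ (f * f') (d * d') := by
  obtain ⟨a, b, hb, h1, h2⟩ := h
  obtain ⟨a', b', hb', h1', h2'⟩ := h'
  refine ⟨a * a', b * b', ?_, ?_, ?_⟩
  · rw [map_mul, TrivSqZeroExt.fst_mul]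
    exact mul_ne_zero hb hb'
  · simp only [map_mul, ← h1, ← h1']
    ring
  · simp only [map_mul, ← h2, ← h2']
    ring

theorem pow (h : HasValue α τ f d) (n : ℕ) : HasValue α τ (f ^ n) (d ^ n) := by
  induction n with
  | zero => simpa using of_map α τ 1
  | succ n ih =>
    rw [pow_succ, pow_succ]
    exact ih.mul h

theorem unique (hτ : ∀ r, α r = 0 → τ r = 0) (h : HasValue α τ f d) (h' : HasValue α τ f d') :
    d = d' := by
  obtain ⟨a, b, hb, h1, h2⟩ := h
  obtain ⟨a', b', hb', h1', h2'⟩ := h'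
  have h3 := hτ (b' * a - b * a') (by
    simp only [map_sub, map_mul, ← h1, ← h1']
    ring)
  have h4 : τ b * τ b' * (d - d') = 0 := by
    rw [← h3]
    simp only [map_sub, map_mul, ← h2, ← h2']
    ring
  have h5 : IsUnit (τ b * τ b') := TrivSqZeroExt.isUnit_iff_isUnit_fst.mpr (by
    rw [TrivSqZeroExt.fst_mul]
    exact (mul_ne_zero hb hb').isUnit)
  exact sub_eq_zero.mp ((h5.mul_right_eq_zero).mp h4)

theorem of_mul (h : HasValue α τ g e) (he : TrivSqZeroExt.fst e ≠ 0)
    (h' : HasValue α τ (g * f) (e * d)) : HasValue α τ f d := by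
  obtain ⟨a, b, hb, h1, h2⟩ := h
  obtain ⟨a', b', hb', h1', h2'⟩ := h'
  refine ⟨a' * b, b' * a, ?_, ?_, ?_⟩
  · rw [map_mul, TrivSqZeroExt.fst_mul, ← h2, TrivSqZeroExt.fst_mul]
    exact mul_ne_zero hb' (mul_ne_zero hb he)
  · simp only [map_mul, ← h1, ← h1']
    ring
  · simp only [map_mul, ← h2, ← h2']
    ring

theorem exists_of_mul (h : HasValue α τ g e) (he : TrivSqZeroExt.fst e ≠ 0)
    (h' : HasValue α τ (g * f) d) : HasValue α τ f (e⁻¹ * d) := by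
  refine h.of_mul he ?_
  rwa [← mul_assoc, TrivSqZeroExt.mul_inv_cancel he, one_mul]


/-- The elements that have a value in the subring `D`. -/
def subring (α : R →+* K) (τ : R →+* DualNumber k) (D : Subring (DualNumber k)) : Subring K where
  carrier := {f | ∃ d ∈ D, HasValue α τ f d}
  mul_mem' := fun ⟨d, hd, h⟩ ⟨d', hd', h'⟩ => ⟨d * d', mul_mem hd hd', h.mul h'⟩
  one_mem' := ⟨1, one_mem _, by simpa using of_map α τ 1⟩
  add_mem' := fun ⟨d, hd, h⟩ ⟨d', hd', h'⟩ => ⟨d + d', add_mem hd hd', h.add h'⟩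
  zero_mem' := ⟨0, zero_mem _, by simpa using of_map α τ 0⟩
  neg_mem' := fun ⟨d, hd, h⟩ => ⟨-d, neg_mem hd, by
    simpa using (of_map α τ (-1)).mul h⟩

end HasValue
end

section
variable {k A K R : Type} [Field k] [CommRing A] [Algebra k A] {T : LocalParam k A}
  [Field K] [Algebra A K] [CommRing R]

theorem LocalParam.HasLead.exists_eq [Algebra k K] [IsScalarTower k A K] {c : A}
    (hc : ∀ a ∈ T.m, ∃ b : Fin 2 → A, c * a = b 0 * T.t 0 + b 1 * T.t 1)
    (h0 : algebraMap A K (T.t 0) ≠ 0) (S : Subring K) (hS : ∀ a, algebraMap A K a ∈ S)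
    (hw : algebraMap A K (T.t 1) / algebraMap A K (T.t 0) ∈ S) {n : ℕ} {f : A}
    {P : MvPolynomial (Fin 2) k} (hf : T.HasLead f n P) :
    ∃ U ∈ S, algebraMap A K c ^ (n + 1) * algebraMap A K f = algebraMap A K (T.t 0) ^ n *
      (algebraMap A K c ^ (n + 1) * aeval ![1, algebraMap A K (T.t 1) / algebraMap A K (T.t 0)] P +
        algebraMap A K (T.t 0) * U) := by
  obtain ⟨U, hU, h⟩ := T.exists_pow_mul_eq hc h0 S hS hw hf.2.2
  refine ⟨U, hU, ?_⟩
  have h' := T.aeval_t_eq h0 hf.1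
  rw [mul_sub, map_sub, map_mul, map_mul, map_pow, h'] at h
  linear_combination h

theorem HasValue.aeval_inl [Algebra k K] {α : R →+* K} {τ : R →+* DualNumber k}
    (hC : ∀ c : k, HasValue α τ (algebraMap k K c) (TrivSqZeroExt.inl c)) {σ : Type} {v : σ → K}
    {x : σ → k} (h : ∀ i, HasValue α τ (v i) (TrivSqZeroExt.inl (x i))) (P : MvPolynomial σ k) :
    HasValue α τ (aeval v P) (TrivSqZeroExt.inl (eval x P)) := by
  induction P using MvPolynomial.induction_on with
  | C c => simpa using hC c
  | add p q hp hq =>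
    rw [map_add, map_add, TrivSqZeroExt.inl_add]
    exact hp.add hq
  | mul_X p i hp =>
    rw [map_mul, map_mul, TrivSqZeroExt.inl_mul, aeval_X, eval_X]
    exact hp.mul (h i)

/-- On a blow-up chart with parameters `t 0` and `w = t 1 / t 0`: a tangent vector along which
`w` and `q / t 0` are constant, for some `q` of order two whose leading form does not vanish at the
point considered, kills all functions with nonvanishing leading forms. -/
theorem LocalParam.snd_eq_zero [IsDomain A] [IsNoetherianRing A] [IsFractionRing A K]
    [Algebra k K] [IsScalarTower k A K] {α : R →+* K} {τ : R →+* DualNumber k}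
    (hτ : ∀ r, α r = 0 → τ r = 0)
    (hC : ∀ c : k, HasValue α τ (algebraMap k K c) (TrivSqZeroExt.inl c))
    (h1 : ∀ a, ∃ d, TrivSqZeroExt.fst d = T.ev a ∧ HasValue α τ (algebraMap A K a) d) {ω : k}
    (h2 : HasValue α τ (algebraMap A K (T.t 1) / algebraMap A K (T.t 0)) (TrivSqZeroExt.inl ω))
    {q : A} {Q : MvPolynomial (Fin 2) k} (hq : T.HasLead q 2 Q) (hQ : eval ![1, ω] Q ≠ 0)
    (h3 : HasValue α τ (algebraMap A K q / algebraMap A K (T.t 0)) 0)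
    {g h : A} {n n' : ℕ} {P P' : MvPolynomial (Fin 2) k} (hg : T.HasLead g n P)
    (hP : eval ![1, ω] P ≠ 0) (hh : T.HasLead h n' P') (hP' : eval ![1, ω] P' ≠ 0) {f : K}
    (hf : f * algebraMap A K g = algebraMap A K h) {d : DualNumber k} (hd : HasValue α τ f d) :
    TrivSqZeroExt.snd d = 0 := by
  have hinj : Function.Injective (algebraMap A K) := IsFractionRing.injective A K
  have h0 : algebraMap A K (T.t 0) ≠ 0 := (map_ne_zero_iff _ hinj).mpr (T.t_ne_zero 0)
  obtain ⟨c, hc0, hc⟩ := T.exists_mul_mem_span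
  obtain ⟨c', hc', hcc'⟩ := h1 c
  have hform : ∀ P : MvPolynomial (Fin 2) k, HasValue α τ
      (aeval ![1, algebraMap A K (T.t 1) / algebraMap A K (T.t 0)] P)
      (TrivSqZeroExt.inl (eval ![1, ω] P)) := by
    intro P
    refine HasValue.aeval_inl hC (fun i => ?_) P
    fin_cases i
    · simpa using hC 1
    · exact h2
  have ht0 : HasValue α τ (algebraMap A K (T.t 0)) 0 := by
    obtain ⟨U, ⟨u, -, hu⟩, hU⟩ := hq.exists_eq hc h0 (HasValue.subring α τ ⊤)
      (fun a => by
        obtain ⟨d, -, hd⟩ := h1 a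
        exact ⟨d, trivial, hd⟩) ⟨_, trivial, h2⟩
    obtain ⟨e, he, het⟩ := h1 (T.t 0)
    have h4 := ((hcc'.pow 3).mul (hform Q)).add (het.mul hu)
    refine h4.of_mul ?_ ?_
    · rw [TrivSqZeroExt.fst_add, TrivSqZeroExt.fst_mul, TrivSqZeroExt.fst_mul,
        TrivSqZeroExt.fst_pow, he, T.ev_t, zero_mul, add_zero, hc', TrivSqZeroExt.fst_inl]
      exact mul_ne_zero (pow_ne_zero _ hc0) hQ
    · have h5 := (hcc'.pow 3).mul h3
      rw [mul_zero] at h5 ⊢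
      convert h5 using 1
      rw [mul_div_assoc', hU]
      field_simp
      ring
  have ht1 : HasValue α τ (algebraMap A K (T.t 1)) 0 := by
    have h4 := ht0.mul h2
    rwa [zero_mul, mul_div_cancel₀ _ h0] at h4
  have hm : ∀ a ∈ T.m, HasValue α τ (algebraMap A K a) 0 := by
    intro a ha
    obtain ⟨b, hb⟩ := hc a ha
    obtain ⟨d0, -, hd0⟩ := h1 (b 0)
    obtain ⟨d1, -, hd1⟩ := h1 (b 1)
    refine hcc'.of_mul (by rwa [hc']) ?_
    have h4 := (hd0.mul ht0).add (hd1.mul ht1)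
    rw [← map_mul, hb, map_add, map_mul, map_mul]
    simpa using h4
  have hA : ∀ a, HasValue α τ (algebraMap A K a) (TrivSqZeroExt.inl (T.ev a)) := by
    intro a
    have h4 := (hm _ (T.sub_C_mem a)).add (hC (T.ev a))
    rw [zero_add, map_sub, ← IsScalarTower.algebraMap_apply, sub_add_cancel] at h4
    exact h4
  have hunit : ∀ {f : A} {n : ℕ} {P : MvPolynomial (Fin 2) k}, T.HasLead f n P →
      eval ![1, ω] P ≠ 0 → ∃ W r, r ≠ 0 ∧ HasValue α τ W (TrivSqZeroExt.inl r) ∧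
      algebraMap A K c ^ (n + 1) * algebraMap A K f = algebraMap A K (T.t 0) ^ n * W := by
    intro f n P hf hP
    obtain ⟨U, ⟨u, ⟨r, hr⟩, hu⟩, hU⟩ := hf.exists_eq hc h0
      (HasValue.subring α τ (TrivSqZeroExt.inlHom k k).range)
      (fun a => ⟨_, ⟨T.ev a, rfl⟩, hA a⟩) ⟨_, ⟨ω, rfl⟩, h2⟩
    refine ⟨_, T.ev c ^ (n + 1) * eval ![1, ω] P,
      mul_ne_zero (pow_ne_zero _ hc0) hP, ?_, hU⟩
    have h4 := (((hA c).pow (n + 1)).mul (hform P)).add (ht0.mul hu)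
    rw [zero_mul, add_zero] at h4
    simpa using h4
  obtain ⟨W, r, hr, hW, hgW⟩ := hunit hg hP
  obtain ⟨W', r', hr', hW', hhW⟩ := hunit hh hP'
  have hc0' : algebraMap A K c ≠ 0 := (map_ne_zero_iff _ hinj).mpr fun h => hc0 (by rw [h, map_zero])
  have key : algebraMap A K c ^ (n' + 1) * f * algebraMap A K (T.t 0) ^ n * W =
      algebraMap A K c ^ (n + 1) * algebraMap A K (T.t 0) ^ n' * W' := by
    linear_combination (-algebraMap A K c ^ (n' + 1) * f) * hgW +
      algebraMap A K c ^ (n + 1) * hhW +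
      algebraMap A K c ^ (n' + 1) * algebraMap A K c ^ (n + 1) * hf
  have hc1 := ((hA c).pow (n' + 1)).mul hW
  have hc2 := ((hA c).pow (n + 1)).mul hW'
  rcases le_or_gt n n' with hle | hlt
  · obtain ⟨j, rfl⟩ := Nat.exists_eq_add_of_le hle
    have h5 : (algebraMap A K c ^ (n + j + 1) * W) * f =
        algebraMap A K (T.t 0) ^ j * (algebraMap A K c ^ (n + 1) * W') := by
      refine mul_left_cancel₀ (pow_ne_zero n h0) ?_
      rw [pow_add (algebraMap A K (T.t 0)) n j] at key
      linear_combination key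
    have h6 : HasValue α τ (algebraMap A K (T.t 0)) (TrivSqZeroExt.inl 0) := by
      rwa [TrivSqZeroExt.inl_zero]
    have h7 := (h6.pow j).mul hc2
    rw [← h5] at h7
    rw [show (TrivSqZeroExt.inl 0 ^ j * (TrivSqZeroExt.inl (T.ev c) ^ (n + 1) *
      TrivSqZeroExt.inl r') : DualNumber k) =
      TrivSqZeroExt.inl (0 ^ j * (T.ev c ^ (n + 1) * r')) by
        rw [TrivSqZeroExt.inl_mul, TrivSqZeroExt.inl_mul, TrivSqZeroExt.inl_pow,
          TrivSqZeroExt.inl_pow]] at h7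
    rw [show (TrivSqZeroExt.inl (T.ev c) ^ (n + j + 1) * TrivSqZeroExt.inl r : DualNumber k) =
      TrivSqZeroExt.inl (T.ev c ^ (n + j + 1) * r) by simp] at hc1
    have hne : T.ev c ^ (n + j + 1) * r ≠ 0 := mul_ne_zero (pow_ne_zero _ hc0) hr
    have h9 : HasValue α τ f (TrivSqZeroExt.inl
        ((T.ev c ^ (n + j + 1) * r)⁻¹ * (0 ^ j * (T.ev c ^ (n + 1) * r')))) := by
      refine hc1.of_mul (by rwa [TrivSqZeroExt.fst_inl]) ?_
      rwa [← TrivSqZeroExt.inl_mul, mul_inv_cancel_left₀ hne]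
    rw [hd.unique hτ h9, TrivSqZeroExt.snd_inl]
  · exfalso
    obtain ⟨j, rfl⟩ := Nat.exists_eq_add_of_lt hlt
    have h5 : algebraMap A K (T.t 0) * ((algebraMap A K c ^ (n' + 1) * W) * f *
        algebraMap A K (T.t 0) ^ j) = algebraMap A K c ^ (n' + j + 1 + 1) * W' := by
      refine mul_left_cancel₀ (pow_ne_zero n' h0) ?_
      rw [pow_succ (algebraMap A K (T.t 0)) (n' + j), pow_add (algebraMap A K (T.t 0)) n' j] at key
      linear_combination key
    have h6 := ht0.mul ((hc1.mul hd).mul (ht0.pow j))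
    rw [h5, zero_mul] at h6
    have h7 := congr_arg TrivSqZeroExt.fst (h6.unique hτ hc2)
    rw [TrivSqZeroExt.fst_zero, TrivSqZeroExt.fst_mul, TrivSqZeroExt.fst_pow,
      TrivSqZeroExt.fst_inl, TrivSqZeroExt.fst_inl] at h7
    exact mul_ne_zero (pow_ne_zero _ hc0) hr' h7.symm
end

end

section

section
variable {k : Type} [Field k] {M M' N N' : ℕ} {X : Set (Pr k M)} {Xt : Set (Pr k M')}
  {β : Pr k M' → Pr k M} {φ : Pr k M → Pr k N} {φt : Pr k M' → Pr k N'}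

theorem IsRep.X_mul {H : Fin (N' + 1) → MvPolynomial (Fin (M' + 1)) k} (hH : IsRep Xt φt H)
    (s : Fin (M' + 1)) : IsRep Xt φt fun a => MvPolynomial.X s * H a := by
  obtain ⟨d, hd⟩ := hH.1
  refine ⟨⟨1 + d, fun a => (isHomogeneous_X k s).mul (hd a)⟩, fun v hv hv0 h0 => ?_⟩
  have he : evalV (fun a => MvPolynomial.X s * H a) v = v s • evalV H v := by
    funext a
    simp [evalV]
  have hs : v s ≠ 0 := fun h => h0 (by rw [he, h, zero_smul])
  have hH0 : evalV H v ≠ 0 := fun h => h0 (by rw [he, h, smul_zero])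
  rw [hH.2 v hv hv0 hH0, eq_comm, Projectivization.mk_eq_mk_iff']
  exact ⟨v s, he.symm⟩

variable [IsAlgClosed k] [CharZero k] {j : Fin (M + 1)}
  {K : Type} [Field K] [Algebra k K] [Algebra (MvPolynomial (Fin (M + 1)) k ⧸ patchIdeal X j) K]
  [IsScalarTower k (MvPolynomial (Fin (M + 1)) k ⧸ patchIdeal X j) K]
  [IsFractionRing (MvPolynomial (Fin (M + 1)) k ⧸ patchIdeal X j) K]

variable (K) in
/-- A birational morphism has an inverse at the generic point of its target. -/
theorem exists_generic_preimage (hX : IsSmoothSurface X) (hXt : IsSmoothSurface Xt)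
    (hβ : IsMorphismOn Xt β) (hβX : β '' Xt = X) {x : Pr k M}
    (hinj : InjOn β {q | q ∈ Xt ∧ β q ≠ x}) (hne : (patch X j).Nonempty) :
    ∃ (y : Fin (M' + 1) → K) (l : Fin (M' + 1)) (G : Fin (M + 1) → MvPolynomial (Fin (M' + 1)) k),
      y l = 1 ∧ IsRep Xt β G ∧ aeval y (G j) ≠ 0 ∧
      (∀ a, genPt (patchIdeal X j) K a * aeval y (G j) = aeval y (G a)) ∧
      ∀ f : MvPolynomial (Fin (M' + 1)) k, (∃ d, f.IsHomogeneous d) →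
        (f ∈ forms Xt ↔ aeval y f = 0) := by
  obtain ⟨p, hp⟩ := hne
  obtain ⟨q, hq, hqp⟩ : Projectivization.mk k p hp.1.1 ∈ β '' Xt := hβX ▸ hp.1.2
  obtain ⟨l, hl⟩ := Function.ne_iff.mp q.rep_nonzero
  have hu := exists_patch (rep_mem_cone hq) hl
  have huq : Projectivization.mk k _ hu.1.1 = q := by
    refine Eq.trans ?_ q.mk_rep
    rw [Projectivization.mk_eq_mk_iff']
    exact ⟨_, rfl⟩
  obtain ⟨G, hG, h0⟩ := exists_rep hβ hu.1
  have hGj : evalV G ((q.rep l)⁻¹ • q.rep) j ≠ 0 := by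
    have h := hG.2 _ hu.1 hu.1.1 h0
    rw [huq, hqp, Projectivization.mk_eq_mk_iff'] at h
    obtain ⟨c, hc⟩ := h
    intro h1
    have h2 := congr_fun hc j
    rw [Pi.smul_apply, h1, smul_zero, hp.2] at h2
    exact zero_ne_one h2
  generalize (q.rep l)⁻¹ • q.rep = v at *
  have hinf : X.Infinite := infinite_of_hasDim (n := 1) hX.2.1
  have hI : IsSurf (patchIdeal X j) := hX.isSurf ⟨p, hp⟩
  have hIt : IsSurf (patchIdeal Xt l) := hXt.isSurf ⟨v, hu⟩
  have := hI.1
  have := hIt.1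
  let L := FractionRing (MvPolynomial (Fin (M' + 1)) k ⧸ patchIdeal Xt l)
  obtain ⟨ι, hι⟩ := exists_generic_hom K L hX.1 hXt.1 hβ hβX hG hu hGj
  have hsurj := generic_hom_surjective hX.1 hXt.1 hβ hβX hinf hinj hI hIt hG hu hGj ι hι
  have hιinj : Function.Injective ι := ι.injective
  set ζ := genPt (patchIdeal Xt l) L with hζ
  choose y hy using fun a => hsurj (ζ a)
  have hιy : ∀ f : MvPolynomial (Fin (M' + 1)) k, ι (aeval y f) = aeval ζ f := fun f => by
    rw [algHom_aeval]; simp only [hy]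
  have hGζ : aeval ζ (G j) ≠ 0 := aeval_genPt_ne_zero hu hGj
  refine ⟨y, l, G, hιinj (by rw [hy, map_one, hζ, genPt_self]), hG,
    fun h => hGζ (by rw [← hιy, h, map_zero]), fun a => hιinj (by
      rw [map_mul, hιy, hιy, hι]), fun f hf => ?_⟩
  rw [← map_eq_zero_iff ι hιinj, hιy, aeval_genPt_eq_zero,
    mem_forms_of_mem_patchIdeal hXt.1 ⟨v, hu⟩ hf]

theorem IsRep.generic_eq {y : Fin (M' + 1) → K} {z : Fin (M + 1) → K}
    (hy : ∀ f ∈ forms Xt, aeval y f = 0) {G G' : Fin (M + 1) → MvPolynomial (Fin (M' + 1)) k}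
    (hG : IsRep Xt β G) (hG' : IsRep Xt β G') (h0 : aeval y (G j) ≠ 0)
    (hz : ∀ a, z a * aeval y (G j) = aeval y (G a)) (a : Fin (M + 1)) :
    z a * aeval y (G' j) = aeval y (G' a) := by
  obtain ⟨d, hd⟩ := hG.1
  obtain ⟨d', hd'⟩ := hG'.1
  have h1 : G a * G' j - G j * G' a ∈ forms Xt :=
    (PinchPaper.mem_forms_iff ⟨d + d', ((hd a).mul (hd' j)).sub ((hd j).mul (hd' a))⟩).mpr fun v hv => by
      rw [map_sub, map_mul, map_mul, hG.cross hG' hv, sub_self]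
  have h2 := hy _ h1
  rw [map_sub, map_mul, map_mul, ← hz a] at h2
  refine mul_left_cancel₀ h0 ?_
  linear_combination h2

/-- The resolved inner projection at the generic point. -/
theorem ResolvesInnerProj.generic_cross {x : Pr k M} {L : (Fin (N + 1) → k) →ₗ[k] (Fin (N' + 1) → k)}
    (hres : ResolvesInnerProj X φ x Xt β φt L) (hβX : β '' Xt = X)
    {y : Fin (M' + 1) → K} {z : Fin (M + 1) → K}
    (hy : ∀ f ∈ forms Xt, aeval y f = 0) {G : Fin (M + 1) → MvPolynomial (Fin (M' + 1)) k}
    (hG : IsRep Xt β G) (h0 : aeval y (G j) ≠ 0)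
    (hz : ∀ a, z a * aeval y (G j) = aeval y (G a))
    {F : Fin (N + 1) → MvPolynomial (Fin (M + 1)) k} (hF : IsRep X φ F)
    {H : Fin (N' + 1) → MvPolynomial (Fin (M' + 1)) k} (hH : IsRep Xt φt H) (a b : Fin (N' + 1)) :
    aeval z (linTuple L F a) * aeval y (H b) = aeval z (linTuple L F b) * aeval y (H a) := by
  obtain ⟨dG, hdG⟩ := hG.1
  obtain ⟨dF, hdF⟩ := hF.1
  obtain ⟨dH, hdH⟩ := hH.1
  have hl := isHomogeneous_linTuple L hdF
  have h1 : G j * (aeval G (linTuple L F a) * H b - aeval G (linTuple L F b) * H a) ∈ forms Xt := by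
    refine (mem_forms_iff ⟨_, (hdG j).mul ((((hl a).aeval G hdG).mul (hdH b)).sub
      (((hl b).aeval G hdG).mul (hdH a)))⟩).mpr fun v hv => ?_
    by_cases hGv : evalV G v = 0
    · rw [map_mul, show eval v (G j) = 0 from congr_fun hGv j, zero_mul]
    rw [map_mul, map_sub, map_mul, map_mul, eval_aeval_tuple, eval_aeval_tuple, eval_linTuple,
      eval_linTuple]
    have hc : evalV G v ∈ cone X := hβX ▸ hG.mem_image subset_rfl hv hGv
    have hβv := hG.2 v hv hv.1 hGv
    by_cases hFv : evalV F (evalV G v) = 0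
    · simp [hFv]
    have hφv := hF.2 _ hc hGv hFv
    by_cases hLv : L (evalV F (evalV G v)) = 0
    · simp [hLv]
    by_cases hHv : evalV H v = 0
    · rw [show eval v (H a) = 0 from congr_fun hHv a, show eval v (H b) = 0 from congr_fun hHv b]
      simp
    by_cases hx : β (Projectivization.mk k v hv.1) = x
    · exfalso
      apply hLv
      rw [← LinearMap.mem_ker, hres.2.1, ← hx, hβv, hφv, Projectivization.submodule_mk]
      exact Submodule.mem_span_singleton_self _
    · have h3 := hres.2.2 _ hv.2 hx _ hFv (by rw [hβv, hφv]) hLv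
      rw [hH.2 v hv hv.1 hHv, Projectivization.mk_eq_mk_iff'] at h3
      obtain ⟨c, hc⟩ := h3
      have h4 : ∀ a, eval v (H a) = c * L (evalV F (evalV G v)) a := fun a => (congr_fun hc a).symm
      rw [h4, h4]
      ring
  have h2 := hy _ h1
  have h3 : ∀ a, aeval y (aeval G (linTuple L F a)) =
      aeval y (G j) ^ dF * aeval z (linTuple L F a) := by
    intro a
    rw [← aeval_smul_of_isHomogeneous (hl a), algHom_aeval]
    congr 2
    funext b
    rw [← hz, mul_comm]
  rw [map_mul, map_sub, map_mul, map_mul, h3, h3] at h2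
  refine mul_left_cancel₀ (mul_ne_zero h0 (pow_ne_zero dF h0)) ?_
  linear_combination h2

end

end

section

namespace LocalParam
variable {k A : Type} [Field k] [CommRing A] [Algebra k A] (T : LocalParam k A)

theorem sub_mem_sq {a : A} (ha : a ∈ T.m) :
    a - ∑ i, algebraMap k A (T.ev (T.D i a)) * T.t i ∈ T.m ^ 2 := by
  obtain ⟨s, hs, r, hr, rfl⟩ := Submodule.mem_sup.mp (T.ker_le ha)
  obtain ⟨b, rfl⟩ := Ideal.mem_span_range_iff_exists_fun.mp hs
  have h1 : ∀ i, T.ev (T.D i (∑ j, b j * T.t j + r)) = T.ev (b i) := by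
    intro i
    have h2 : T.D i r ∈ T.m ^ 1 := derivation_mem_pow (T.D i) T.m 1 hr
    rw [pow_one, mem_m] at h2
    rw [map_add, map_add, h2, add_zero, map_sum, map_sum]
    simp only [Derivation.leibniz, smul_eq_mul, map_add, map_mul, T.ev_t, T.ev_D, zero_mul,
      add_zero]
    simp
  simp only [h1]
  have h3 : ∑ j, b j * T.t j + r - ∑ i, algebraMap k A (T.ev (b i)) * T.t i =
      ∑ i, (b i - algebraMap k A (T.ev (b i))) * T.t i + r := by
    simp only [sub_mul, Finset.sum_sub_distrib]
    ring
  rw [h3]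
  refine add_mem (sum_mem fun i _ => ?_) hr
  rw [pow_two]
  exact Ideal.mul_mem_mul (T.sub_C_mem _) (T.t_mem i)

/-- Parameters may be changed by elements of order two. -/
theorem exists_replace {t' : Fin 2 → A} (h : ∀ i, t' i - T.t i ∈ T.m ^ 2) :
    ∃ T' : LocalParam k A, T'.ev = T.ev ∧ T'.D = T.D ∧ T'.t = t' := by
  have hle : T.m ^ 2 ≤ T.m := Ideal.pow_le_self two_ne_zero
  refine ⟨⟨T.ev, t', T.D, fun i => ?_, ?_, fun i j => ?_⟩, rfl, rfl, rfl⟩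
  · have := T.mem_m.mp (hle (h i))
    rwa [map_sub, T.ev_t, sub_zero] at this
  · refine T.ker_le.trans (sup_le (Ideal.span_le.mpr ?_) le_sup_right)
    rintro _ ⟨i, rfl⟩
    have h1 : T.t i = t' i - (t' i - T.t i) := by ring
    rw [h1]
    exact sub_mem (Ideal.mem_sup_left (Ideal.subset_span ⟨i, rfl⟩)) (Ideal.mem_sup_right (h i))
  · have h2 : T.D i (t' j - T.t j) ∈ T.m ^ 1 := derivation_mem_pow (T.D i) T.m 1 (h j)
    rw [pow_one, mem_m, map_sub, map_sub, sub_eq_zero] at h2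
    rw [h2, T.ev_D]

end LocalParam

section
variable {k : Type} [Field k] {M N m : ℕ}

theorem derivation_linTuple (D : Derivation k (MvPolynomial (Fin (M + 1)) k)
    (MvPolynomial (Fin (M + 1)) k)) (L : (Fin (N + 1) → k) →ₗ[k] (Fin m → k))
    (F : Fin (N + 1) → MvPolynomial (Fin (M + 1)) k) (a : Fin m) :
    D (linTuple L F a) = linTuple L (fun l => D (F l)) a := by
  simp only [linTuple, map_sum, ← MvPolynomial.smul_eq_C_mul, Derivation.map_smul]

/-- The value, the first derivatives and one second derivative of `F` along a chart. -/
noncomputable def Chart.rows₂ {I : Ideal (MvPolynomial (Fin (M + 1)) k)} (c : Chart I)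
    (F : Fin (N + 1) → MvPolynomial (Fin (M + 1)) k) (i i' : Fin 2) :
    Fin 4 → Fin (N + 1) → MvPolynomial (Fin (M + 1)) k :=
  ![F, fun l => c.der 0 (F l), fun l => c.der 1 (F l), fun l => c.der i (c.der i' (F l))]

/-- Local parameters adapted to the projection from a point at which some second derivative is
not tangent. -/
theorem Chart.exists_projected_param [IsAlgClosed k] [CharZero k]
    {I : Ideal (MvPolynomial (Fin (M + 1)) k)} (c : Chart I) (hI : IsSurf I)
    {v : Fin (M + 1) → k} (hp : ∀ f ∈ I, eval v f = 0) (hdet : eval v c.det ≠ 0)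
    {F : Fin (N + 1) → MvPolynomial (Fin (M + 1)) k} {L : (Fin (N + 1) → k) →ₗ[k] (Fin m → k)}
    (hker : LinearMap.ker L = Submodule.span k {evalV F v}) {i i' : Fin 2}
    (hli : LinearIndependent k fun r => evalV (c.rows₂ F i i' r) v) :
    ∃ T : LocalParam k (MvPolynomial (Fin (M + 1)) k ⧸ I), T.ev = quotEval I v hp ∧
      ∃ (μ : Fin 3 → Fin m → k) (u : Fin 2 → Fin m → k) (Q : MvPolynomial (Fin 2) k),
        T.HasLead (Ideal.Quotient.mk I (∑ a, C (μ 2 a) * linTuple L F a)) 2 Q ∧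
        (∀ i, T.t i = Ideal.Quotient.mk I (∑ a, C (μ i.castSucc a) * linTuple L F a)) ∧
        (∀ r i, ∑ a, μ r a * u i a = if r = i.castSucc then 1 else 0) ∧
        ∀ a, Ideal.Quotient.mk I (linTuple L F a) - ∑ i, algebraMap k _ (u i a) * T.t i ∈
          T.m ^ 2 := by
  obtain ⟨T, hT, -, hTD⟩ := c.exists_localParam hI hp hdet
  choose D hD using c.exists_lift_der hI hp hdet
  have := hI.1
  have hFv : L (evalV F v) = 0 := by
    rw [← LinearMap.mem_ker, hker]
    exact Submodule.mem_span_singleton_self _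
  let R : Fin 3 → Fin m → k := fun r => L (evalV (c.rows₂ F i i' r.succ) v)
  have hR : LinearIndependent k R := by
    rw [Fintype.linearIndependent_iff] at hli ⊢
    intro g hg r
    have h1 : ∑ r, g r • evalV (c.rows₂ F i i' r.succ) v ∈ LinearMap.ker L := by
      rw [LinearMap.mem_ker, map_sum, ← hg]
      simp only [map_smul, R]
    rw [hker, Submodule.mem_span_singleton] at h1
    obtain ⟨e, he⟩ := h1
    have h2 := hli (Fin.cons (-e) g) (by
      rw [Fin.sum_univ_succ]
      simp only [Fin.cons_zero, Fin.cons_succ]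
      rw [← he]
      simp [Chart.rows₂]) r.succ
    simpa using h2
  obtain ⟨μ', hμ'⟩ := exists_dual_family R hR
  set δ := eval v c.det with hδ
  let u : Fin 2 → Fin m → k := fun i a => δ⁻¹ * R i.castSucc a
  let s : Fin 3 → k := ![δ, δ, 1]
  let μ : Fin 3 → Fin m → k := fun r a => s r * μ' r a
  have hμu : ∀ r i, ∑ a, μ r a * u i a = if r = i.castSucc then 1 else 0 := by
    intro r i
    have h1 : ∑ a, μ r a * u i a = s r * δ⁻¹ * ∑ a, μ' r a * R i.castSucc a := by
      rw [Finset.mul_sum]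
      refine Finset.sum_congr rfl fun a _ => ?_
      simp only [μ, u]
      ring
    rw [h1, hμ']
    split_ifs with h
    · subst h
      fin_cases i <;> simp [s, hdet]
    · rw [mul_zero]
  have hWm : ∀ a, Ideal.Quotient.mk I (linTuple L F a) ∈ T.m := by
    intro a
    rw [T.mem_m, hT, quotEval_mk, eval_linTuple, hFv]
    rfl
  have hWD : ∀ i a, T.ev (T.D i (Ideal.Quotient.mk I (linTuple L F a))) = u i a := by
    intro i a
    refine mul_left_cancel₀ hdet ?_
    rw [hTD, derivation_linTuple, eval_linTuple]
    simp only [u]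
    rw [mul_inv_cancel_left₀ hdet]
    fin_cases i <;> rfl
  have hW2 : ∀ a, Ideal.Quotient.mk I (linTuple L F a) - ∑ i, algebraMap k _ (u i a) * T.t i ∈
      T.m ^ 2 := by
    intro a
    have := T.sub_mem_sq (hWm a)
    simpa only [hWD] using this
  have hcomb : ∀ r, Ideal.Quotient.mk I (∑ a, C (μ r a) * linTuple L F a) -
      ∑ i : Fin 2, (if r = i.castSucc then 1 else 0) * T.t i ∈ T.m ^ 2 := by
    intro r
    have h1 : Ideal.Quotient.mk I (∑ a, C (μ r a) * linTuple L F a) -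
        ∑ i : Fin 2, (if r = i.castSucc then 1 else 0) * T.t i =
        ∑ a, algebraMap k _ (μ r a) * (Ideal.Quotient.mk I (linTuple L F a) -
          ∑ i, algebraMap k _ (u i a) * T.t i) := by
      have h2 : ∀ i : Fin 2, (if r = i.castSucc then 1 else 0 : MvPolynomial (Fin (M + 1)) k ⧸ I) =
          ∑ a, algebraMap k _ (μ r a) * algebraMap k _ (u i a) := by
        intro i
        simp only [← map_mul, ← map_sum, hμu]
        split_ifs <;> simp
      simp only [h2, mul_sub, Finset.sum_sub_distrib, Finset.mul_sum, Finset.sum_mul, map_sum,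
        map_mul]
      rw [Finset.sum_comm]
      simp only [mul_assoc]
      rfl
    rw [h1]
    exact sum_mem fun a _ => Ideal.mul_mem_left _ _ (hW2 a)
  obtain ⟨T', hT'ev, -, hT't⟩ := T.exists_replace
    (t' := fun i => Ideal.Quotient.mk I (∑ a, C (μ i.castSucc a) * linTuple L F a)) (by
      intro i
      have := hcomb i.castSucc
      simpa using this)
  have hm : T'.m = T.m := by
    ext a
    rw [T'.mem_m, T.mem_m, hT'ev]
  have hq2 : Ideal.Quotient.mk I (∑ a, C (μ 2 a) * linTuple L F a) ∈ T'.m ^ 2 := by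
    have := hcomb 2
    rw [hm]
    simpa [Fin.sum_univ_two] using this
  have hq3 : Ideal.Quotient.mk I (∑ a, C (μ 2 a) * linTuple L F a) ∉ T'.m ^ 3 := by
    intro h
    have h1 := derivation_mem_pow (D i) _ 1 (derivation_mem_pow (D i') _ 2 h)
    rw [hD, hD, pow_one, T'.mem_m, hT'ev, hT, quotEval_mk] at h1
    have h2 : eval v (c.der i (c.der i' (∑ a, C (μ 2 a) * linTuple L F a))) =
        ∑ a, μ' 2 a * R 2 a := by
      simp only [map_sum, ← MvPolynomial.smul_eq_C_mul, Derivation.map_smul, derivation_linTuple, smul_eval,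
        eval_linTuple]
      refine Finset.sum_congr rfl fun a _ => ?_
      simp [μ, s, R, Chart.rows₂]
    rw [h2, hμ', if_pos rfl] at h1
    exact one_ne_zero h1
  obtain ⟨n, Q, hn, hQ⟩ := T'.lead_of_mem (fun h => hq3 (by rw [h]; exact zero_mem _)) hq2
  obtain rfl : n = 2 := by
    refine le_antisymm ?_ hn
    by_contra hlt
    exact hq3 (Ideal.pow_le_pow_right (by omega) hQ.mem)
  refine ⟨T', hT'ev.trans hT, μ, u, Q, hQ, fun i => congr_fun hT't i, hμu, fun a => ?_⟩
  have h1 : Ideal.Quotient.mk I (linTuple L F a) - ∑ i, algebraMap k _ (u i a) * T'.t i =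
      (Ideal.Quotient.mk I (linTuple L F a) - ∑ i, algebraMap k _ (u i a) * T.t i) -
      ∑ i, algebraMap k _ (u i a) * (T'.t i - T.t i) := by
    simp only [mul_sub, Finset.sum_sub_distrib]
    ring
  rw [h1, hm]
  refine sub_mem (hW2 a) (sum_mem fun i _ => Ideal.mul_mem_left _ _ ?_)
  have := hcomb i.castSucc
  rw [hT't]
  simpa using this

end

end

section

theorem aeval_mem_valuationSubring {k K σ : Type} [Field k] [Field K] [Algebra k K]
    (V : ValuationSubring K) (hV : ∀ a, algebraMap k K a ∈ V) {c : σ → K} (hc : ∀ i, c i ∈ V)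
    (f : MvPolynomial σ k) : aeval c f ∈ V := by
  induction f using MvPolynomial.induction_on with
  | C a => simpa using hV a
  | add f g hf hg =>
    rw [map_add]
    exact add_mem hf hg
  | mul_X f i hf =>
    rw [map_mul, aeval_X]
    exact mul_mem hf (hc i)

section
variable {k : Type} [Field k] {n : ℕ}

/-- Evaluation on the dual numbers at the tangent vector `w` based at `e`. -/
noncomputable def dualEval (e w : Fin n → k) : MvPolynomial (Fin n) k →ₐ[k] DualNumber k :=
  aeval fun a => TrivSqZeroExt.inl (e a) + TrivSqZeroExt.inr (w a)

theorem fst_dualEval (e w : Fin n → k) (f : MvPolynomial (Fin n) k) :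
    TrivSqZeroExt.fst (dualEval e w f) = eval e f := by
  induction f using MvPolynomial.induction_on with
  | C a => simp [dualEval, TrivSqZeroExt.algebraMap_eq_inl]
  | add f g hf hg => rw [map_add, map_add, TrivSqZeroExt.fst_add, hf, hg]
  | mul_X f i hf =>
    rw [map_mul, map_mul, TrivSqZeroExt.fst_mul, hf, eval_X]
    simp [dualEval]

theorem snd_dualEval (e w : Fin n → k) (f : MvPolynomial (Fin n) k) :
    TrivSqZeroExt.snd (dualEval e w f) = ∑ l, eval e (pderiv l f) * w l := by
  induction f using MvPolynomial.induction_on with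
  | C a => simp [dualEval, TrivSqZeroExt.algebraMap_eq_inl]
  | add f g hf hg =>
    rw [map_add, TrivSqZeroExt.snd_add, hf, hg, ← Finset.sum_add_distrib]
    simp only [map_add, add_mul]
  | mul_X f i hf =>
    rw [map_mul, TrivSqZeroExt.snd_mul, hf, fst_dualEval, sum_pderiv_mul, sum_pderiv_X]
    simp [dualEval, mul_comm]

theorem dualEval_eq_zero {e w : Fin n → k} {f : MvPolynomial (Fin n) k} (h : eval e f = 0)
    (h' : ∑ l, eval e (pderiv l f) * w l = 0) : dualEval e w f = 0 :=
  TrivSqZeroExt.ext ((fst_dualEval e w f).trans h) ((snd_dualEval e w f).trans h')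

end
section
variable {k A K : Type} [Field k] [CommRing A] [Algebra k A] (T : LocalParam k A) [Field K]
  [Algebra A K] [Algebra k K] [IsScalarTower k A K]

theorem valuation_algebraMap_eq_one {V : ValuationSubring K} (hV : ∀ a : k, algebraMap k K a ∈ V)
    {a : k} (ha : a ≠ 0) : V.valuation (algebraMap k K a) = 1 := by
  refine le_antisymm ((V.valuation_le_one_iff _).mpr (hV a)) ?_
  have h := (V.valuation_le_one_iff _).mpr (hV a⁻¹)
  rw [map_inv₀, map_inv₀] at h
  have h0 : V.valuation (algebraMap k K a) ≠ 0 := by simpa using ha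
  exact (inv_le_one₀ (zero_lt_iff.mpr h0)).mp h

theorem LocalParam.valuation_eq_one {V : ValuationSubring K} (hV : ∀ a, algebraMap A K a ∈ V)
    (hV' : ∀ a, T.ev a = 0 → V.valuation (algebraMap A K a) < 1) {a : A} (ha : T.ev a ≠ 0) :
    V.valuation (algebraMap A K a) = 1 := by
  have h1 := valuation_algebraMap_eq_one (K := K) (V := V)
    (fun r => by rw [IsScalarTower.algebraMap_apply k A K]; exact hV _) ha
  have h2 := hV' (a - algebraMap k A (T.ev a)) (by simp)
  rw [map_sub, ← IsScalarTower.algebraMap_apply] at h2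
  have h3 := V.valuation.map_add_eq_of_lt_right (h2.trans_eq h1.symm)
  rw [sub_add_cancel, h1] at h3
  exact h3

theorem LocalParam.exists_lead_fraction [IsDomain A] [IsNoetherianRing A] [IsFractionRing A K]
    (f : K) : ∃ (g h : A) (n n' : ℕ) (P P' : MvPolynomial (Fin 2) k), T.HasLead g n P ∧
      (f ≠ 0 → T.HasLead h n' P') ∧ P'.IsHomogeneous n' ∧ P' ≠ 0 ∧
      f * algebraMap A K g = algebraMap A K h := by
  obtain ⟨h, g, hg, hf⟩ := IsFractionRing.div_surjective (A := A) f
  have hg0 : g ≠ 0 := nonZeroDivisors.ne_zero hg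
  have hgK : algebraMap A K g ≠ 0 := (map_ne_zero_iff _ (IsFractionRing.injective A K)).mpr hg0
  have hfg : f * algebraMap A K g = algebraMap A K h := by rw [← hf, div_mul_cancel₀ _ hgK]
  obtain ⟨n, P, hP⟩ := T.exists_lead hg0
  by_cases hf0 : f = 0
  · exact ⟨g, h, n, 0, P, 1, hP, fun h => absurd hf0 h, isHomogeneous_one _ _, one_ne_zero, hfg⟩
  · have hh : h ≠ 0 := by
      rintro rfl
      rw [map_zero] at hfg
      exact mul_ne_zero hf0 hgK hfg
    obtain ⟨n', P', hP'⟩ := T.exists_lead hh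
    exact ⟨g, h, n, n', P, P', hP, fun _ => hP', hP'.1, hP'.2.1, hfg⟩

/-- The value at a center of a valuation of functions proportional to functions with known linear
terms. -/
theorem LocalParam.eval_center [IsDomain A] [IsNoetherianRing A] [IsFractionRing A K]
    {V : ValuationSubring K} (hV : ∀ a, algebraMap A K a ∈ V)
    (hV' : ∀ a, T.ev a = 0 → V.valuation (algebraMap A K a) < 1)
    (hVw : algebraMap A K (T.t 1) / algebraMap A K (T.t 0) ∈ V)
    {n : ℕ} {c : Fin n → K} (hc : ∀ a, c a ∈ V) {e : Fin n → k} {ω : Unit → k}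
    (hE : ∀ f, V.valuation (aeval (Sum.elim c fun _ : Unit => algebraMap A K (T.t 1) /
      algebraMap A K (T.t 0)) f) < 1 → eval (Sum.elim e ω) f = 0)
    {H H₀ : MvPolynomial (Fin n) k} {W : A} {u : Fin 2 → k}
    (hW : W - ∑ i, algebraMap k A (u i) * T.t i ∈ T.m ^ 2)
    (hH : algebraMap A K W * aeval c H₀ = algebraMap A K (T.t 0) * aeval c H) :
    eval e H = (u 0 + u 1 * ω ()) * eval e H₀ := by
  have hinj : Function.Injective (algebraMap A K) := IsFractionRing.injective A K
  have h0 : algebraMap A K (T.t 0) ≠ 0 := (map_ne_zero_iff _ hinj).mpr (T.t_ne_zero 0)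
  obtain ⟨b, hb0, hb⟩ := T.exists_mul_mem_span
  obtain ⟨U, hU, hUW⟩ := T.exists_pow_mul_eq hb h0 V.toSubring hV hVw hW
  have hk : ∀ r : k, algebraMap k K r ∈ V := fun r => by
    rw [IsScalarTower.algebraMap_apply k A K]; exact hV _
  set w := algebraMap A K (T.t 1) / algebraMap A K (T.t 0) with hw
  have hwt : algebraMap A K (T.t 1) = w * algebraMap A K (T.t 0) := by
    rw [hw, div_mul_cancel₀ _ h0]
  have h1 := hE (rename Sum.inl H - (C (u 0) + C (u 1) * MvPolynomial.X (Sum.inr ())) *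
    rename Sum.inl H₀) (by
      set δ := aeval (Sum.elim c fun _ : Unit => w) (rename Sum.inl H -
        (C (u 0) + C (u 1) * MvPolynomial.X (Sum.inr ())) * rename Sum.inl H₀) with hδ
      have hδ' : δ = aeval c H - (algebraMap k K (u 0) + algebraMap k K (u 1) * w) *
          aeval c H₀ := by
        rw [hδ]
        simp [aeval_rename, Sum.elim_comp_inl]
      have h2 : algebraMap A K b ^ 2 * δ = algebraMap A K (T.t 0) * (U * aeval c H₀) := by
        refine mul_left_cancel₀ h0 ?_
        rw [Fin.sum_univ_two, map_mul, map_sub, map_add, map_mul, map_mul, map_pow,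
          ← IsScalarTower.algebraMap_apply, ← IsScalarTower.algebraMap_apply, hwt] at hUW
        rw [hδ']
        linear_combination aeval c H₀ * hUW - algebraMap A K b ^ 2 * hH
      have h3 := congr_arg V.valuation h2
      rw [map_mul, map_pow, T.valuation_eq_one hV hV' hb0, one_pow, one_mul, map_mul] at h3
      rw [h3]
      refine mul_lt_one_of_lt_of_le (hV' _ (T.ev_t 0)) ?_
      exact (V.valuation_le_one_iff _).mpr (mul_mem hU (aeval_mem_valuationSubring V hk hc _)))
  simp only [map_sub, map_mul, map_add, eval_C, eval_X, eval_rename, Sum.elim_comp_inl,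
    Sum.elim_inr] at h1
  exact sub_eq_zero.mp h1

end

section
variable {k : Type} [Field k] {M M' : ℕ} {Xt : Set (Pr k M')} {K : Type} [Field K] [Algebra k K]

theorem dualEval_eq_zero_of_aeval {y : Fin (M' + 1) → K}
    (hy : ∀ f : MvPolynomial (Fin (M' + 1)) k, (∃ d, f.IsHomogeneous d) →
      (f ∈ forms Xt ↔ aeval y f = 0)) {s : Fin (M' + 1)} (hs : y s ≠ 0) {e w : Fin (M' + 1) → k}
    (he : e ∈ cone Xt) (hes : e s = 1) (hw : w ∈ tan Xt e) (hws : w s = 0)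
    {f : MvPolynomial (Fin (M' + 1)) k} (hf : aeval (fun a => y a / y s) f = 0) :
    dualEval e w f = 0 := by
  obtain ⟨D, F, h, hF, hFh⟩ := exists_homogenization s f
  have h1 : aeval (fun a => y a / y s) F = 0 := by
    rw [hFh, map_add, hf, map_mul, map_sub, aeval_X, map_one, div_self hs]
    ring
  have h2 : F ∈ forms Xt := by
    rw [hy F ⟨D, hF⟩]
    have : y = fun a => y s * (y a / y s) := funext fun a => (mul_div_cancel₀ _ hs).symm
    rw [this, aeval_smul_of_isHomogeneous hF, h1, mul_zero]
  have h3 : dualEval e w F = 0 := dualEval_eq_zero ((PinchPaper.mem_forms_iff ⟨D, hF⟩).mp h2 e he)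
    (mem_tan.mp hw F h2)
  have h4 : dualEval e w (MvPolynomial.X s - 1) = 0 := dualEval_eq_zero (by simp [hes]) (by
    rw [← hws, ← sum_pderiv_X s e w]
    simp)
  rwa [hFh, map_add, map_mul, h4, zero_mul, add_zero] at h3

theorem exists_hasValue_aeval {c : Fin (M' + 1) → K} {e w : Fin (M' + 1) → k}
    {z : Fin (M + 1) → K} {v : Fin (M + 1) → k} {G : Fin (M + 1) → MvPolynomial (Fin (M' + 1)) k}
    {j : Fin (M + 1)} (hz : ∀ a, z a * aeval c (G j) = aeval c (G a)) (h0 : eval e (G j) ≠ 0)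
    (hv : ∀ a, v a * eval e (G j) = eval e (G a)) (f : MvPolynomial (Fin (M + 1)) k) :
    ∃ d : DualNumber k, TrivSqZeroExt.fst d = eval v f ∧
      HasValue ((aeval c : _ →ₐ[k] K) : MvPolynomial (Fin (M' + 1)) k →+* K)
        (dualEval e w : _ →+* DualNumber k) (aeval z f) d := by
  induction f using MvPolynomial.induction_on with
  | C r =>
    refine ⟨dualEval e w (C r), by rw [fst_dualEval, eval_C, eval_C], ?_⟩
    have := HasValue.of_map ((aeval c : _ →ₐ[k] K) : MvPolynomial (Fin (M' + 1)) k →+* K)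
      (dualEval e w : _ →+* DualNumber k) (C r)
    simpa using this
  | add f g hf hg =>
    obtain ⟨d, hd, hd'⟩ := hf
    obtain ⟨d', h, h'⟩ := hg
    exact ⟨d + d', by rw [TrivSqZeroExt.fst_add, hd, h, map_add], by
      rw [map_add]; exact hd'.add h'⟩
  | mul_X f i hf =>
    obtain ⟨d, hd, hd'⟩ := hf
    have h1 := HasValue.of_map ((aeval c : _ →ₐ[k] K) : MvPolynomial (Fin (M' + 1)) k →+* K)
        (dualEval e w : _ →+* DualNumber k) (G j)
    have h2 := HasValue.of_map ((aeval c : _ →ₐ[k] K) : MvPolynomial (Fin (M' + 1)) k →+* K)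
        (dualEval e w : _ →+* DualNumber k) (G i)
    have h3 := h1.exists_of_mul (f := z i) (d := dualEval e w (G i))
      (by simpa [fst_dualEval] using h0) (by
        rw [mul_comm]
        have := hz i
        simp only [RingHom.coe_coe] at h2 ⊢
        rwa [this])
    refine ⟨_, ?_, by rw [map_mul, aeval_X]; exact hd'.mul h3⟩
    rw [TrivSqZeroExt.fst_mul, TrivSqZeroExt.fst_mul, hd, TrivSqZeroExt.fst_inv, map_mul, eval_X]
    simp only [RingHom.coe_coe, fst_dualEval]
    rw [← hv i]
    field_simp

end

end

section

section
variable {k : Type} [Field k] {M M' N N' : ℕ} {X : Set (Pr k M)} {Xt : Set (Pr k M')}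
  {β : Pr k M' → Pr k M} {φ : Pr k M → Pr k N} {φt : Pr k M' → Pr k N'}

theorem algebraMap_sum_C_mul {K : Type} [Field K] {n m : ℕ} {I : Ideal (MvPolynomial (Fin n) k)} [Algebra (MvPolynomial (Fin n) k ⧸ I) K]
    [Algebra k K] [IsScalarTower k (MvPolynomial (Fin n) k ⧸ I) K] (μ : Fin m → k)
    (W : Fin m → MvPolynomial (Fin n) k) :
    algebraMap _ K (Ideal.Quotient.mk I (∑ a, C (μ a) * W a)) =
      ∑ a, algebraMap k K (μ a) * algebraMap _ K (Ideal.Quotient.mk I (W a)) := by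
  rw [← aeval_genPt, map_sum]
  refine Finset.sum_congr rfl fun a _ => ?_
  rw [map_mul, aeval_C, aeval_genPt]

theorem homogeneous_eval_aeval {K : Type} [Field K] [Algebra k K] (P : MvPolynomial (Fin 2) k)
    (ω : Unit → k) (w : K) :
    eval ω (aeval ![1, MvPolynomial.X ()] P : MvPolynomial Unit k) = eval ![1, ω ()] P ∧
    aeval (fun _ : Unit => w) (aeval ![1, MvPolynomial.X ()] P : MvPolynomial Unit k) =
      aeval ![1, w] P := by
  have h1 := algHom_aeval (aeval ω : MvPolynomial Unit k →ₐ[k] k) ![1, MvPolynomial.X ()] P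
  have h2 := algHom_aeval (aeval (fun _ => w) : MvPolynomial Unit k →ₐ[k] K)
    ![1, MvPolynomial.X ()] P
  constructor
  · rw [← coe_aeval_eq_eval, ← coe_aeval_eq_eval]
    simp only [RingHom.coe_coe]
    rw [h1]
    congr 2
    funext i
    fin_cases i <;> simp
  · rw [h2]
    congr 2
    funext i
    fin_cases i <;> simp

variable [IsAlgClosed k] [CharZero k]

set_option maxHeartbeats 1600000 in
/-- If some second derivative of `φ` at `x` is not tangent, then the resolved projection from
`φ x` is unramified at some point of the exceptional curve. -/
theorem exists_goodAt_excFiber (hX : IsSmoothSurface X) (hXt : IsSmoothSurface Xt)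
    (hβ : IsMorphismOn Xt β) (hβX : β '' Xt = X) {x : Pr k M}
    (hinj : InjOn β {q | q ∈ Xt ∧ β q ≠ x})
    {L : (Fin (N + 1) → k) →ₗ[k] (Fin (N' + 1) → k)}
    (hres : ResolvesInnerProj X φ x Xt β φt L) {j : Fin (M + 1)} {v : Fin (M + 1) → k}
    (hv : v ∈ patch X j) (hvx : x = Projectivization.mk k v hv.1.1) (c : Chart (patchIdeal X j))
    (hdet : eval v c.det ≠ 0) {F : Fin (N + 1) → MvPolynomial (Fin (M + 1)) k}
    (hF : IsRep X φ F) (hFv : evalV F v ≠ 0) {i i' : Fin 2}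
    (hli : LinearIndependent k fun r => evalV (c.rows₂ F i i' r) v) :
    ∃ q ∈ ExcFiber Xt β x, GoodAt Xt φt (LinearMap.id : (Fin (N' + 1) → k) →ₗ[k] _) q.rep := by
  have hI : IsSurf (patchIdeal X j) := hX.isSurf ⟨v, hv⟩
  have := hI.1
  let K := FractionRing (MvPolynomial (Fin (M + 1)) k ⧸ patchIdeal X j)
  have hinjA : Function.Injective (algebraMap (MvPolynomial (Fin (M + 1)) k ⧸ patchIdeal X j) K) :=
    IsFractionRing.injective _ K
  obtain ⟨y, l, G, hyl, hG, hy0, hz, hy⟩ := exists_generic_preimage K hX hXt hβ hβX hinj ⟨v, hv⟩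
  have hyF : ∀ f ∈ forms Xt, aeval y f = 0 := fun f hf => (hy f hf.1).mp hf
  obtain ⟨T, hTev, μ, u, Q, hQ, hTt, hμu, hW⟩ := c.exists_projected_param hI (eval_patchIdeal hv)
    hdet (hres.2.1.trans (ker_eq_span hF hv.1 hvx hFv)) hli
  obtain ⟨V, hVA, hVm, hVw, hV1⟩ := T.exists_valuation (K := K)
  have hVk : ∀ a, algebraMap k K a ∈ V := fun a => by
    rw [IsScalarTower.algebraMap_apply k (MvPolynomial (Fin (M + 1)) k ⧸ patchIdeal X j) K]
    exact hVA _
  choose g h n n' P P' hP hP' hP'h hP'0 hgh using fun a => T.exists_lead_fraction (y a)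
  set R := Q * ∏ a, (P a * P' a) with hR
  have hRh : R.IsHomogeneous (2 + ∑ a, (n a + n' a)) :=
    hQ.1.mul (IsHomogeneous.prod _ _ _ fun a _ => (hP a).1.mul (hP'h a))
  have hR0 : R ≠ 0 := mul_ne_zero hQ.2.1
    (Finset.prod_ne_zero_iff.mpr fun a _ => mul_ne_zero (hP a).2.1 (hP'0 a))
  obtain ⟨s, e, ω, he, hes, hys, hyV, hω, hβe, hsp⟩ := exists_center_over hXt.1 hβ hG hyF hy0
    (fun h => one_ne_zero (hyl.symm.trans (congr_fun h l))) hz hv.1.1 V hVk (fun b => by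
      have h1 := hVm (Ideal.Quotient.mk _ (MvPolynomial.X b - C (v b))) (by
        rw [hTev, quotEval_mk, map_sub, eval_X, eval_C, sub_self])
      rwa [← aeval_genPt, map_sub, aeval_X, aeval_C] at h1)
    (fun _ : Unit => algebraMap _ K (T.t 1) / algebraMap _ K (T.t 0)) (fun _ => hVw)
    (aeval ![1, MvPolynomial.X ()] R) (by
      rw [(homogeneous_eval_aeval R 0 _).2]
      exact hV1 _ R hRh hR0)
  rw [(homogeneous_eval_aeval R ω (0 : K)).1, hR, map_mul, map_prod, mul_ne_zero_iff,
    Finset.prod_ne_zero_iff] at hω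
  obtain ⟨hQω, hPω⟩ := hω
  replace hPω := fun a => mul_ne_zero_iff.mp (by
    simpa only [map_mul] using hPω a (Finset.mem_univ a))
  refine ⟨Projectivization.mk k e he.1, ⟨he.2, hβe.trans hvx.symm⟩,
    GoodAt.of_smul (hv := he.1) (hu := Projectivization.rep_nonzero _) ?_
      (Projectivization.mk_rep _)⟩
  set C' : Fin (M' + 1) → K := fun a => y a / y s with hC'
  obtain ⟨H₀, hH₀, hH₀e⟩ := exists_rep hres.1 he
  have hH := hH₀.X_mul s
  obtain ⟨d₀, hd₀⟩ := hH₀.1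
  have hd : ∀ a, (MvPolynomial.X s * H₀ a).IsHomogeneous (d₀ + 1) := fun a =>
    add_comm 1 d₀ ▸ (isHomogeneous_X k s).mul (hd₀ a)
  have hHe : evalV (fun a => MvPolynomial.X s * H₀ a) e ≠ 0 := by
    intro h0
    apply hH₀e
    funext a
    have := congr_fun h0 a
    simpa [evalV, hes] using this
  obtain ⟨H, hHdef⟩ : ∃ H, H = fun a => MvPolynomial.X s * H₀ a := ⟨_, rfl⟩
  rw [← hHdef] at hH hHe
  replace hd : ∀ a, (H a).IsHomogeneous (d₀ + 1) := by rw [hHdef]; exact hd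
  clear hHdef hH₀ hH₀e hd₀
  have hcy : y = fun a => y s * C' a := funext fun a => (mul_div_cancel₀ _ hys).symm
  have hcross : ∀ a b, aeval (genPt (patchIdeal X j) K) (linTuple L F a) * aeval C' (H b) =
      aeval (genPt (patchIdeal X j) K) (linTuple L F b) * aeval C' (H a) := by
    intro a b
    have h1 := hres.generic_cross hβX hyF hG hy0 hz hF hH a b
    rw [hcy, aeval_smul_of_isHomogeneous (hd a), aeval_smul_of_isHomogeneous (hd b)] at h1
    refine mul_left_cancel₀ (pow_ne_zero (d₀ + 1) hys) ?_
    linear_combination h1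
  -- linear combinations of the coordinates of the projection
  let Hs : Fin 3 → MvPolynomial (Fin (M' + 1)) k := fun r => ∑ a, C (μ r a) * H a
  have haHs : ∀ r, aeval C' (Hs r) = ∑ a, algebraMap k K (μ r a) * aeval C' (H a) := fun r => by
    simp only [Hs, map_sum, map_mul, aeval_C]
  have heHs : ∀ r, eval e (Hs r) = ∑ a, μ r a * eval e (H a) := fun r => by
    simp only [Hs, map_sum, map_mul, eval_C]
  have hT0 : ∀ a, algebraMap _ K (Ideal.Quotient.mk (patchIdeal X j) (linTuple L F a)) *
      aeval C' (Hs 0) = algebraMap _ K (T.t 0) * aeval C' (H a) := by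
    intro a
    rw [hTt 0, algebraMap_sum_C_mul, haHs, Finset.mul_sum, Finset.sum_mul]
    refine Finset.sum_congr rfl fun b _ => ?_
    have h1 := hcross a b
    rw [aeval_genPt, aeval_genPt] at h1
    rw [Fin.castSucc_zero]
    linear_combination (algebraMap k K (μ 0 b)) * h1
  have hTr : ∀ r, algebraMap _ K (Ideal.Quotient.mk (patchIdeal X j)
      (∑ a, C (μ r a) * linTuple L F a)) * aeval C' (Hs 0) =
      algebraMap _ K (T.t 0) * aeval C' (Hs r) := by
    intro r
    rw [algebraMap_sum_C_mul, haHs r, Finset.mul_sum, Finset.sum_mul]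
    refine Finset.sum_congr rfl fun a _ => ?_
    linear_combination (algebraMap k K (μ r a)) * hT0 a
  have hHa : ∀ a, eval e (H a) = (u 0 a + u 1 a * ω ()) * eval e (Hs 0) := fun a =>
    T.eval_center hVA hVm hVw hyV hsp (u := fun i => u i a) (hW a) (hT0 a)
  have hHr : ∀ r, eval e (Hs r) = (![1, ω (), 0] : Fin 3 → k) r * eval e (Hs 0) := by
    intro r
    have h1 : eval e (Hs r) = (∑ a, μ r a * u 0 a + (∑ a, μ r a * u 1 a) * ω ()) *
        eval e (Hs 0) := by
      rw [heHs r, Finset.sum_mul, ← Finset.sum_add_distrib, Finset.sum_mul]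
      refine Finset.sum_congr rfl fun a _ => ?_
      rw [hHa]
      ring
    rw [h1, hμu, hμu]
    fin_cases r <;> simp
  have hH0 : eval e (Hs 0) ≠ 0 := by
    intro h0
    apply hHe
    funext a
    change eval e (H a) = 0
    rw [hHa, h0, mul_zero]
  refine ⟨H, hH, hHe, fun w₁ hw₁ hJ => ?_⟩
  rw [LinearMap.id_apply] at hJ
  set w := w₁ - w₁ s • e with hw
  have hwt : w ∈ tan Xt e := sub_mem hw₁ (Submodule.smul_mem _ _ (self_mem_tan he))
  have hws : w s = 0 := by simp [hw, hes]
  have hJw : jacobian H e w = (-(w₁ s * (d₀ + 1 : ℕ))) • evalV H e := by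
    rw [hw, map_sub, map_smul, hJ, jacobian_self hd, zero_sub, smul_smul, neg_smul]
  set κ := -(w₁ s * ((d₀ + 1 : ℕ) : k)) with hκ
  have hτH : ∀ r, dualEval e w (Hs r) = TrivSqZeroExt.inl (eval e (Hs r)) +
      TrivSqZeroExt.inr (κ * eval e (Hs r)) := by
    intro r
    refine TrivSqZeroExt.ext (by simp [fst_dualEval]) ?_
    have h1 : ∀ a, TrivSqZeroExt.snd (dualEval e w (H a)) = κ * eval e (H a) := fun a => by
      rw [snd_dualEval, ← jacobian_apply, hJw]
      rfl
    simp only [Hs, map_sum, map_mul, TrivSqZeroExt.snd_sum, Finset.mul_sum,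
      ← algebraMap_eq, AlgHom.commutes, TrivSqZeroExt.algebraMap_eq_inl, TrivSqZeroExt.snd_add,
      TrivSqZeroExt.snd_inl, TrivSqZeroExt.snd_inr, zero_add]
    refine Finset.sum_congr rfl fun a _ => ?_
    simp only [TrivSqZeroExt.snd_mul, TrivSqZeroExt.fst_inl,
      TrivSqZeroExt.snd_inl, smul_zero, add_zero, h1, smul_eq_mul]
    rw [algebraMap_eq, eval_C]
    ring
  have hτ : ∀ f, aeval C' f = 0 → dualEval e w f = 0 := fun f hf =>
    dualEval_eq_zero_of_aeval hy hys he hes hwt hws hf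
  let α : MvPolynomial (Fin (M' + 1)) k →+* K := (aeval C' : _ →ₐ[k] K)
  let τ : MvPolynomial (Fin (M' + 1)) k →+* DualNumber k := (dualEval e w : _ →ₐ[k] DualNumber k)
  have hC : ∀ r : k, HasValue α τ (algebraMap k K r) (TrivSqZeroExt.inl r) := fun r => by
    have h1 := HasValue.of_map α τ (C r)
    simpa [α, τ, dualEval, TrivSqZeroExt.algebraMap_eq_inl] using h1
  have h1 : ∀ a, ∃ d, TrivSqZeroExt.fst d = T.ev a ∧ HasValue α τ (algebraMap _ K a) d := by
    intro a
    obtain ⟨f, rfl⟩ := Ideal.Quotient.mk_surjective a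
    obtain ⟨G', hG', hG'e⟩ := exists_rep hβ he
    have h2 := hG'.2 e he he.1 hG'e
    rw [hβe, Projectivization.mk_eq_mk_iff'] at h2
    obtain ⟨r, hr⟩ := h2
    have hr0 : r ≠ 0 := by
      rintro rfl
      rw [zero_smul] at hr
      exact hv.1.1 hr.symm
    have hrj : r * evalV G' e j = 1 := by
      rw [← hv.2, ← hr, Pi.smul_apply, smul_eq_mul]
    obtain ⟨d', hd'⟩ := hG'.1
    have h3 : ∀ a, genPt (patchIdeal X j) K a * aeval C' (G' j) = aeval C' (G' a) := by
      intro a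
      have h4 := hG.generic_eq hyF hG' hy0 hz a
      rw [hcy, aeval_smul_of_isHomogeneous (hd' a), aeval_smul_of_isHomogeneous (hd' j)] at h4
      refine mul_left_cancel₀ (pow_ne_zero d' hys) ?_
      linear_combination h4
    obtain ⟨d, hd, hd'⟩ := exists_hasValue_aeval (w := w) h3 (e := e) (v := v)
      (right_ne_zero_of_mul_eq_one hrj) (fun a => by
        change v a * evalV G' e j = evalV G' e a
        rw [← hr, Pi.smul_apply, smul_eq_mul]
        linear_combination evalV G' e a * hrj) f
    refine ⟨d, by rw [hd, hTev, quotEval_mk], ?_⟩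
    rw [← aeval_genPt]
    exact hd'
  have hinjK := (map_ne_zero_iff _ hinjA).mpr (T.t_ne_zero 0)
  have hHv : ∀ r, HasValue α τ (aeval C' (Hs 0) * (algebraMap _ K (Ideal.Quotient.mk
      (patchIdeal X j) (∑ a, C (μ r a) * linTuple L F a)) / algebraMap _ K (T.t 0)))
      (dualEval e w (Hs r)) := by
    intro r
    have h2 := HasValue.of_map α τ (Hs r)
    have h3 : aeval C' (Hs 0) * (algebraMap _ K (Ideal.Quotient.mk
      (patchIdeal X j) (∑ a, C (μ r a) * linTuple L F a)) / algebraMap _ K (T.t 0)) =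
        α (Hs r) := by
      rw [mul_div_assoc', div_eq_iff hinjK, mul_comm, hTr, mul_comm]
      rfl
    rwa [h3]
  have hfst : TrivSqZeroExt.fst (τ (Hs 0)) ≠ 0 := by
    change TrivSqZeroExt.fst (dualEval e w (Hs 0)) ≠ 0
    rwa [fst_dualEval]
  have hτr : ∀ r, dualEval e w (Hs r) = τ (Hs 0) * TrivSqZeroExt.inl (![1, ω (), 0] r) := by
    intro r
    change _ = dualEval e w (Hs 0) * _
    rw [hτH, hτH, hHr r]
    refine TrivSqZeroExt.ext ?_ ?_
    · simp [mul_comm]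
    · simp
      ring
  have hval : ∀ r, HasValue α τ (algebraMap _ K (Ideal.Quotient.mk
      (patchIdeal X j) (∑ a, C (μ r a) * linTuple L F a)) / algebraMap _ K (T.t 0))
      (TrivSqZeroExt.inl (![1, ω (), 0] r)) := fun r =>
    (HasValue.of_map α τ (Hs 0)).of_mul hfst (by rw [← hτr]; exact hHv r)
  have h2 : HasValue α τ (algebraMap _ K (T.t 1) / algebraMap _ K (T.t 0))
      (TrivSqZeroExt.inl (ω ())) := by
    rw [hTt 1]
    exact hval 1
  have h3 := hval 2
  rw [show (![1, ω (), 0] : Fin 3 → k) 2 = 0 from rfl, TrivSqZeroExt.inl_zero] at h3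
  have hwz : w = 0 := by
    funext a
    have hwa : TrivSqZeroExt.snd (τ (MvPolynomial.X a)) = w a := by
      change TrivSqZeroExt.snd (dualEval e w (MvPolynomial.X a)) = w a
      rw [snd_dualEval, sum_pderiv_X]
    rw [Pi.zero_apply, ← hwa]
    by_cases hya : y a = 0
    · have h4 : τ (MvPolynomial.X a) = 0 := hτ _ (by rw [aeval_X, hC']; simp [hya])
      rw [h4, TrivSqZeroExt.snd_zero]
    · refine T.snd_eq_zero (f := C' a) hτ hC h1 h2 hQ hQω h3 ((hP' s hys).mul (hP a))
        (by rw [map_mul]; exact mul_ne_zero (hPω s).2 (hPω a).1) ((hP' a hya).mul (hP s))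
        (by rw [map_mul]; exact mul_ne_zero (hPω a).2 (hPω s).1) ?_ ?_
      · rw [map_mul, map_mul, ← hgh s, ← hgh a, hC', div_mul_eq_mul_div, div_eq_iff hys]
        ring
      · have h4 := HasValue.of_map α τ (MvPolynomial.X a)
        rwa [show α (MvPolynomial.X a) = C' a from aeval_X _ _] at h4
  have h4 : (w₁ s * ((d₀ + 1 : ℕ) : k)) • evalV H e = 0 := by
    rw [← neg_eq_zero, ← neg_smul, ← hJw, hwz, map_zero]
  have h5 : w₁ s = 0 := by
    have := (smul_eq_zero.mp h4).resolve_right hHe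
    exact (mul_eq_zero.mp this).resolve_right (Nat.cast_ne_zero.mpr d₀.succ_ne_zero)
  rw [hw, h5, zero_smul, sub_zero] at hwz
  exact hwz

end

end

section

section
variable {k : Type} [Field k]

theorem exists_det_poly_genPt {σ : Type} (I : Ideal (MvPolynomial σ k)) (K : Type)
    [Field K] [Algebra k K] [Algebra (MvPolynomial σ k ⧸ I) K]
    [IsScalarTower k (MvPolynomial σ k ⧸ I) K] [IsFractionRing (MvPolynomial σ k ⧸ I) K]
    {s m : ℕ} (r : Fin s → Fin m → MvPolynomial σ k)
    (h : LinearIndependent K fun i l => aeval (genPt I K) (r i l)) :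
    ∃ P : MvPolynomial σ k, P ∉ I ∧ ∀ v : σ → k,
      eval v P ≠ 0 → LinearIndependent k fun i l => eval v (r i l) := by
  obtain ⟨μ, hμ⟩ := exists_dual_family _ h
  obtain ⟨b, hb⟩ := IsLocalization.exist_integer_multiples_of_finite
    (nonZeroDivisors (MvPolynomial σ k ⧸ I)) (fun p : Fin s × Fin m => μ p.1 p.2)
  have hb' : ∀ i l, ∃ f : MvPolynomial σ k, aeval (genPt I K) f =
      algebraMap _ K (b : MvPolynomial σ k ⧸ I) * μ i l := fun i l => by
    obtain ⟨a, ha⟩ := hb (i, l)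
    obtain ⟨f, rfl⟩ := Ideal.Quotient.mk_surjective a
    exact ⟨f, by rw [aeval_genPt, ha, Algebra.smul_def]⟩
  choose A hA using hb'
  have : Nontrivial (MvPolynomial σ k ⧸ I) := (algebraMap (MvPolynomial σ k ⧸ I) K).domain_nontrivial
  have hb0 : algebraMap _ K (b : MvPolynomial σ k ⧸ I) ≠ 0 :=
    IsFractionRing.to_map_ne_zero_of_mem_nonZeroDivisors b.2
  refine ⟨(Matrix.of fun i j => ∑ l, A i l * r j l).det, ?_, fun v hv => ?_⟩
  · rw [← aeval_genPt_eq_zero I K, AlgHom.map_det]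
    have : (aeval (genPt I K)).mapMatrix (Matrix.of fun i j => ∑ l, A i l * r j l) =
        algebraMap _ K (b : MvPolynomial σ k ⧸ I) • (1 : Matrix (Fin s) (Fin s) K) := by
      ext i j
      rw [AlgHom.mapMatrix_apply, Matrix.map_apply, Matrix.of_apply, map_sum, Matrix.smul_apply,
        Matrix.one_apply, ← hμ i j, smul_eq_mul, Finset.mul_sum]
      exact Finset.sum_congr rfl fun l _ => by rw [map_mul, hA, mul_assoc]
    rw [this, Matrix.det_smul, Matrix.det_one, mul_one]
    exact pow_ne_zero _ hb0
  · rw [RingHom.map_det] at hv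
    rw [Fintype.linearIndependent_iff]
    intro g hg
    have := Matrix.eq_zero_of_mulVec_eq_zero hv (v := g) (by
      funext i
      have hg' : ∀ l, ∑ j, g j * eval v (r j l) = 0 := fun l => by
        simpa using congr_fun hg l
      simp only [Matrix.mulVec, dotProduct, RingHom.mapMatrix_apply, Matrix.map_apply,
        Matrix.of_apply, map_sum, map_mul, Pi.zero_apply, Finset.sum_mul]
      rw [Finset.sum_comm]
      refine Finset.sum_eq_zero fun l _ => ?_
      calc _ = eval v (A i l) * ∑ j, g j * eval v (r j l) := by
            rw [Finset.mul_sum]; exact Finset.sum_congr rfl fun j _ => by ring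
        _ = 0 := by rw [hg', mul_zero])
    exact fun i => congr_fun this i

variable {M N : ℕ} {X : Set (Pr k M)} {φ : Pr k M → Pr k N}

/-- If the second fundamental form vanishes at the generic point then there is a line family. -/
theorem exists_second_notMem {K : Type} [Field K] [Algebra k K] [IsAlgClosed k] [CharZero k]
    [CharZero K]
    (B : DiffBasis k K) {n : ℕ} (hn : 5 ≤ n) {η : Fin n → K} (hη : ConstIndep k η)
    (hind : LinearIndependent K ![η, dvec (B.D 0) η, dvec (B.D 1) η])
    (S : Set (MvPolynomial (Fin n) k))
    (hS : ∀ f ∈ S, (∃ d, f.IsHomogeneous d) ∧ aeval η f = 0) (hnl : ¬ HasLineFamily k S) :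
    ∃ i i', second B η i i' ∉ tangentSpan B η := by
  by_contra! h
  refine hnl (hasLineFamily_of_second_rank_le_one B η hn hη hind ?_ S hS)
  intro μ ν hμ hν i j i' j'
  rw [hμ _ (h i j), hμ _ (h i' j'), zero_mul, mul_zero]

theorem Chart.linearIndependent_rows₂_genPt {I : Ideal (MvPolynomial (Fin (M + 1)) k)}
    [IsAlgClosed k] [CharZero k] (c : Chart I) (K : Type) [Field K] [CharZero K] [Algebra k K]
    [Algebra (MvPolynomial (Fin (M + 1)) k ⧸ I) K]
    [IsScalarTower k (MvPolynomial (Fin (M + 1)) k ⧸ I) K]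
    {F : Fin (N + 1) → MvPolynomial (Fin (M + 1)) k} (B : DiffBasis k K)
    (hB : ∀ j f, aeval (genPt I K) c.det * B.D j (aeval (genPt I K) f) =
      aeval (genPt I K) (c.der j f))
    (hd1 : aeval (genPt I K) c.det ≠ 0)
    (h1 : LinearIndependent K fun i l => aeval (genPt I K) (c.rows F i l)) {i i' : Fin 2}
    (hii : second B (fun l => aeval (genPt I K) (F l)) i i' ∉
      tangentSpan B fun l => aeval (genPt I K) (F l)) :
    LinearIndependent K fun r l => aeval (genPt I K) (c.rows₂ F i i' r l) := by
  rw [Fintype.linearIndependent_iff] at h1 ⊢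
  intro g hg
  have hg' : ∀ l, g 0 * aeval (genPt I K) (F l) + g 1 * aeval (genPt I K) (c.der 0 (F l)) +
      g 2 * aeval (genPt I K) (c.der 1 (F l)) +
      g 3 * aeval (genPt I K) (c.der i (c.der i' (F l))) = 0 := fun l => by
    have := congr_fun hg l
    rw [Fin.sum_univ_four] at this
    exact this
  have hg3 : g 3 = 0 := by
    by_contra h3
    apply hii
    set e := aeval (genPt I K) c.det with he
    have hsec : ∀ l, aeval (genPt I K) (c.der i (c.der i' (F l))) = e * (B.D i e *
        B.D i' (aeval (genPt I K) (F l)) + e * second B (fun l => aeval (genPt I K) (F l)) i i' l) :=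
      fun l => by
        rw [← hB, ← hB, Derivation.leibniz, smul_eq_mul, smul_eq_mul]
        simp only [second, dvec]
        ring
    have hD : dvec (B.D i') (fun l => aeval (genPt I K) (F l)) ∈
        tangentSpan B fun l => aeval (genPt I K) (F l) := dvec_mem_tangentSpan B _ i'
    have h4 : second B (fun l => aeval (genPt I K) (F l)) i i' =
        (-(g 3 * e * e)⁻¹) • (g 0 • (fun l => aeval (genPt I K) (F l)) +
          (g 1 * e) • dvec (B.D 0) (fun l => aeval (genPt I K) (F l)) +
          (g 2 * e) • dvec (B.D 1) (fun l => aeval (genPt I K) (F l)) +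
          (g 3 * e * B.D i e) • dvec (B.D i') (fun l => aeval (genPt I K) (F l))) := by
      funext l
      have h5 := hg' l
      rw [hsec, ← hB, ← hB] at h5
      simp only [Pi.smul_apply, Pi.add_apply, smul_eq_mul, dvec]
      have h6 : g 3 * e * e ≠ 0 := mul_ne_zero (mul_ne_zero h3 hd1) hd1
      have h7 : g 3 * e * e * second B (fun l => aeval (genPt I K) (F l)) i i' l =
        -(g 0 * aeval (genPt I K) (F l) + g 1 * e * (B.D 0) (aeval (genPt I K) (F l)) +
        g 2 * e * (B.D 1) (aeval (genPt I K) (F l)) +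
        g 3 * e * (B.D i) e * (B.D i') (aeval (genPt I K) (F l))) := by
        linear_combination h5
      rw [eq_comm, neg_mul, ← mul_neg, ← h7, inv_mul_cancel_left₀ h6]
    rw [h4]
    refine Submodule.smul_mem _ _ (Submodule.add_mem _ (Submodule.add_mem _ (Submodule.add_mem _
      (Submodule.smul_mem _ _ (Submodule.subset_span (by simp))) (Submodule.smul_mem _ _
      (dvec_mem_tangentSpan B _ 0)))
      (Submodule.smul_mem _ _ (dvec_mem_tangentSpan B _ 1))) (Submodule.smul_mem _ _ hD))
  have h2 := h1 ![g 0, g 1, g 2] (by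
    rw [Fin.sum_univ_three]
    funext l
    have := hg' l
    rw [hg3, zero_mul, add_zero] at this
    exact this)
  intro r
  fin_cases r
  · exact h2 0
  · exact h2 1
  · exact h2 2
  · exact hg3

theorem GoodAt.gen_second [IsAlgClosed k] [CharZero k] (hX : IsSmoothSurface X)
    (hφ : IsMorphismOn X φ) (hnd : Nondegenerate (φ '' X)) (hN : 4 ≤ N)
    (hnl : ¬ HasLineFamily k (forms (φ '' X)))
    {j : Fin (M + 1)} {v₀ : Fin (M + 1) → k} (hv₀ : v₀ ∈ patch X j)
    (h : GoodAt X φ (LinearMap.id : (Fin (N + 1) → k) →ₗ[k] _) v₀) :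
    ∃ (c : Chart (patchIdeal X j)) (F : Fin (N + 1) → MvPolynomial (Fin (M + 1)) k),
      IsRep X φ F ∧ Gen X fun x =>
      ∃ v, ∃ hv : v ∈ patch X j, x = Projectivization.mk k v hv.1.1 ∧ eval v c.det ≠ 0 ∧
        ∃ i i', LinearIndependent k fun r => evalV (c.rows₂ F i i' r) v := by
  set I := patchIdeal X j with hIdef
  have hI : IsSurf I := hX.isSurf ⟨v₀, hv₀⟩
  have hprime : I.IsPrime := hI.1
  have hp₁ := eval_patchIdeal hv₀
  obtain ⟨c, hdet⟩ := exists_chart (hI.2 v₀ hp₁)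
  obtain ⟨F, d, hF, hd, hd0, hrows⟩ := h.exists_rows hv₀ c hI hdet
  have hFv₀ : evalV F v₀ ≠ 0 := fun h => hrows.ne_zero 0 h
  obtain ⟨P, hP, hPi⟩ := exists_det_poly (c.rows F) v₀ hrows
  let K := FractionRing (MvPolynomial (Fin (M + 1)) k ⧸ I)
  have : CharZero K := charZero_of_injective_algebraMap (algebraMap k K).injective
  have notMem : ∀ f, eval v₀ f ≠ 0 → f ∉ I := fun f hf hfI => hf (hp₁ f hfI)
  have hη : ConstIndep k fun l => aeval (genPt I K) (F l) := by
    intro μ hμ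
    refine constIndep_of_nondegenerate hX.1 hφ hnd hF hv₀ hFv₀ (j := j) ?_
    rw [← hIdef, ← aeval_genPt_eq_zero I K, map_sum, ← hμ]
    exact Finset.sum_congr rfl fun l _ => by rw [map_mul, aeval_C]
  have h1 := hPi K (genPt I K) fun h => notMem P hP ((aeval_genPt_eq_zero I K P).mp h)
  have hS : ∀ f ∈ forms (φ '' X), (∃ d, f.IsHomogeneous d) ∧
      aeval (fun l => aeval (genPt I K) (F l)) f = 0 := fun f hf => by
    refine ⟨hf.1, ?_⟩
    have h2 : aeval F f ∈ I :=
      forms_subset_patchIdeal j ((hF.mem_forms_iff subset_rfl hX.1 hφ hv₀.1 hFv₀ hf.1).mp hf)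
    rw [← aeval_genPt_eq_zero I K, ← AlgHom.comp_apply, comp_aeval] at h2
    exact h2
  obtain ⟨B, hB, hBF⟩ := c.exists_diffBasis_genPt (m := N + 1) hI hp₁ hdet K
  have hind := hBF F (by convert h1 using 1; funext i; fin_cases i <;> rfl)
  obtain ⟨i, i', hii⟩ := exists_second_notMem B (by omega) hη hind _ hS hnl
  have hd1 : aeval (genPt I K) c.det ≠ 0 := fun h =>
    notMem _ hdet ((aeval_genPt_eq_zero I K _).mp h)
  have hli := c.linearIndependent_rows₂_genPt K B hB hd1 h1 hii
  obtain ⟨P', hP', hPi'⟩ := exists_det_poly_genPt I K (c.rows₂ F i i') hli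
  refine ⟨c, F, hF, (Gen.of_notMem (Z := X) (j := j) (g := c.det * P') fun h =>
    (hprime.mem_or_mem h).elim (notMem _ hdet) hP').mono ?_⟩
  rintro x hx ⟨v, hv, hgv, hv0, hxv⟩
  rw [map_mul] at hgv
  exact ⟨v, hv, hxv, left_ne_zero_of_mul hgv, i, i', hPi' v (right_ne_zero_of_mul hgv)⟩

theorem gen_second [IsAlgClosed k] [CharZero k]
    (hX : IsSmoothSurface X) (hφ : Uncrumpled X φ) (hN : 4 ≤ N)
    (hnl : ¬ HasLineFamily k (forms (φ '' X))) :
    ∃ (j : Fin (M + 1)) (c : Chart (patchIdeal X j))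
      (F : Fin (N + 1) → MvPolynomial (Fin (M + 1)) k), IsRep X φ F ∧ Gen X fun x =>
      ∃ v, ∃ hv : v ∈ patch X j, x = Projectivization.mk k v hv.1.1 ∧ eval v c.det ≠ 0 ∧
        ∃ i i', LinearIndependent k fun r => evalV (c.rows₂ F i i' r) v := by
  obtain ⟨hφm, hnd, -, hram⟩ := hφ
  obtain ⟨p₀, hp₀, hnr⟩ := (infinite_of_hasDim (n := 1) hX.2.1).exists_notMem_finite hram
  have hgood : GoodAt X φ (LinearMap.id : (Fin (N + 1) → k) →ₗ[k] _) p₀.rep :=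
    (not_ramifiedAt_iff hX hp₀).mp fun h' => hnr ⟨hp₀, h'⟩
  have hu := rep_mem_cone hp₀
  obtain ⟨j, hj⟩ := Function.ne_iff.mp hu.1
  have hj : p₀.rep j ≠ 0 := hj
  exact ⟨j, (hgood.smul (inv_ne_zero hj)).gen_second hX hφm hnd hN hnl (exists_patch hu hj)⟩

end

end

section

section
variable {k : Type} [Field k] [IsAlgClosed k] [CharZero k] {M M' N N' : ℕ}
  {X : Set (Pr k M)} {φ : Pr k M → Pr k N} {Xt : Set (Pr k M')} {β : Pr k M' → Pr k M}
  {φt : Pr k M' → Pr k N'} {x : Pr k M} {L : (Fin (N + 1) → k) →ₗ[k] (Fin (N' + 1) → k)}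

/-- Away from the exceptional fibre, the ramification of a resolved inner projection lies over
the bad locus of the projection. -/
theorem finite_ramLocus_diff_excFiber (hX : IsSmoothSurface X) (hXt : IsSmoothSurface Xt)
    (hβ : IsMorphismOn Xt β) (hβX : β '' Xt = X) (hinj : InjOn β {q | q ∈ Xt ∧ β q ≠ x})
    (hres : ResolvesInnerProj X φ x Xt β φt L)
    (hfin : {p | p ∈ X ∧ ¬ GoodAt X φ L p.rep}.Finite) :
    (RamLocus Xt φt \ ExcFiber Xt β x).Finite := by
  refine (hfin.subset ?_).of_finite_image (f := β) (hinj.mono ?_)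
  · rintro _ ⟨q, ⟨⟨hq, hram⟩, hqE⟩, rfl⟩
    have hv := rep_mem_cone hq
    have hmk : Projectivization.mk k q.rep hv.1 = q := q.mk_rep
    refine ⟨hβX ▸ mem_image_of_mem β hq, fun h => (not_ramifiedAt_iff hXt hq).mpr ?_ hram⟩
    refine GoodAt.pullback hXt.1 hβ hβX hres hv
      (goodAt_of_not_mem_excFiber hX hXt hβ hβX hinj hv ?_) ?_
    · rw [hmk]
      exact fun h => hqE ⟨hq, h⟩
    · rwa [hmk]
  · rintro q ⟨hq, hqE⟩
    exact ⟨hq.1, fun h => hqE ⟨hq.1, h⟩⟩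

theorem RamLocus.finite_of_goodAt (hX : IsSmoothSurface X) (hXt : IsSmoothSurface Xt)
    (hbl : IsBlowupAt Xt X β x)
    (hres : ResolvesInnerProj X φ x Xt β φt L)
    (hfin : {p | p ∈ X ∧ ¬ GoodAt X φ L p.rep}.Finite)
    (hgood : ∃ q ∈ ExcFiber Xt β x, GoodAt Xt φt LinearMap.id q.rep) :
    (RamLocus Xt φt).Finite := by
  obtain ⟨-, -, -, hβ, hβX, hinj, hE, hE1, -⟩ := hbl
  obtain ⟨q₀, hq₀, hg⟩ := hgood
  refine ((hg.finite_bad_curve hXt (isCurveLike_of_hasDim_one hE hE1) hq₀ hq₀.1).union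
    (finite_ramLocus_diff_excFiber hX hXt hβ hβX hinj hres hfin)).subset ?_
  intro q hq
  by_cases hqE : q ∈ ExcFiber Xt β x
  · exact .inl ⟨hq.1, hqE, fun h => (not_ramifiedAt_iff hXt hq.1).mpr h hq.2⟩
  · exact .inr ⟨hq, hqE⟩
end

end

/-- **Proposition.** In the inner projection setting, either the resolved inner
projection from a general point is finitely ramified, or `Y` is ruled by lines. -/
theorem stmt_4
    (k : Type) [Field k] [IsAlgClosed k] [CharZero k]
    (M N : ℕ) (hN : 4 ≤ N)
    (X : Set (Pr k M)) (φ : Pr k M → Pr k N)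
    (hX : IsSmoothSurface X) (hφ : Uncrumpled X φ) :
    ForGeneralPointOn X (fun x =>
      ∀ (M' : ℕ) (Xt : Set (Pr k M')) (β : Pr k M' → Pr k M)
        (φt : Pr k M' → Pr k (N - 1)) (L : (Fin (N + 1) → k) →ₗ[k] (Fin (N - 1 + 1) → k)),
        IsSmoothSurface Xt → IsBlowupAt Xt X β x →
        ResolvesInnerProj X φ x Xt β φt L →
        ((RamLocus Xt φt).Finite ∨ RuledByLines (φ '' X))) := by
  by_cases hr : RuledByLines (φ '' X)
  · exact (Gen.of_forall hX.1.2.1 fun x _ M' Xt β φt L _ _ _ => .inr hr).forGeneralPointOn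
  have hnl : ¬ HasLineFamily k (forms (φ '' X)) := fun h =>
    hr (h.ruledByLines (IsMorphismOn.isAlgSet_image hX.1 hφ.1))
  obtain ⟨j, c, F, hF, hgen⟩ := gen_second hX hφ hN hnl
  refine (((gen_finite_bad hX hφ hN hnl).and hX.1 hgen).mono ?_).forGeneralPointOn
  rintro x hx ⟨hfin, v, hv, hxv, hdet, i, i', hli⟩ M' Xt β φt L hXt hbl hres
  obtain ⟨-, -, -, hβ, hβX, hinj, -⟩ := id hbl
  exact .inl (RamLocus.finite_of_goodAt hX hXt hbl hres (hfin _ L hres.2.1)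
    (exists_goodAt_excFiber hX hXt hβ hβX hinj hres hv hxv c hdet hF
      (fun h => hli.ne_zero 0 h) hli))

end PinchPaper
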